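/- For every integer d ≥ 1 there exist constants τ, ε_1, C > 0 with the following property: for every pair a, b ∈ GL_d(ℂ) generating a subgroup which is not virtually solvable, there exists δ_0 = δ_0(a,b) > 0 such that for every δ ∈ (0, δ_0) and every integer n with 1 ≤ n ≤ C·(log δ⁻¹)^{ε_1}, the number of elements w of the free group F_2 on two generators of reduced word length exactly n such that ‖w(a,b) − 1‖ ≤ δ is at most exp(−τn) times the total number of elements of F_2 of reduced word length exactly n. -/

import Mathlib

open scoped MatrixGroups

/-- The operator norm on `d×d` complex matrices induced by the Hermitian norm on `ℂ^d`. -/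
noncomputable def matrixOpNorm {d : ℕ} (M : Matrix (Fin d) (Fin d) ℂ) : ℝ :=
  ‖LinearMap.toContinuousLinearMap (Matrix.toEuclideanLin M)‖

set_option linter.all false

namespace WE
open MvPolynomial

/-- l1 norm of coefficients -/
noncomputable def l1 {σ : Type*} (f : MvPolynomial σ ℤ) : ℝ := ∑ m ∈ f.support, |((f.coeff m : ℤ) : ℝ)|

lemma l1_eq_of_subset {σ : Type*} (f : MvPolynomial σ ℤ) (s : Finset (σ →₀ ℕ)) (h : f.support ⊆ s) :
    l1 f = ∑ m ∈ s, |((f.coeff m : ℤ) : ℝ)| := by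
  unfold l1
  apply Finset.sum_subset h
  intro m _ hm
  simp [MvPolynomial.notMem_support_iff.mp hm]

lemma l1_nonneg {σ : Type*} (f : MvPolynomial σ ℤ) : 0 ≤ l1 f :=
  Finset.sum_nonneg fun _ _ => abs_nonneg _

lemma l1_zero {σ : Type*} : l1 (0 : MvPolynomial σ ℤ) = 0 := by simp [l1]

lemma l1_add {σ : Type*} (f g : MvPolynomial σ ℤ) : l1 (f + g) ≤ l1 f + l1 g := by
  classical
  rw [l1_eq_of_subset (f + g) (f.support ∪ g.support) MvPolynomial.support_add,
    l1_eq_of_subset f (f.support ∪ g.support) Finset.subset_union_left,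
    l1_eq_of_subset g (f.support ∪ g.support) Finset.subset_union_right,
    ← Finset.sum_add_distrib]
  apply Finset.sum_le_sum
  intro m _
  rw [coeff_add]; push_cast; exact abs_add_le _ _

lemma l1_sum {σ ι : Type*} (s : Finset ι) (f : ι → MvPolynomial σ ℤ) :
    l1 (∑ i ∈ s, f i) ≤ ∑ i ∈ s, l1 (f i) := by
  classical
  induction s using Finset.induction_on with
  | empty => simp [l1_zero]
  | insert a s ha ih =>
    rw [Finset.sum_insert ha, Finset.sum_insert ha]
    exact (l1_add _ _).trans (by linarith)

lemma l1_monomial {σ : Type*} (m : σ →₀ ℕ) (a : ℤ) : l1 (monomial m a) = |(a : ℝ)| := by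
  classical
  rw [l1_eq_of_subset _ {m} support_monomial_subset]
  simp

lemma l1_mul {σ : Type*} (f g : MvPolynomial σ ℤ) : l1 (f * g) ≤ l1 f * l1 g := by
  have h : f * g = ∑ m ∈ f.support, ∑ k ∈ g.support, monomial (m + k) (f.coeff m * g.coeff k) := by
    conv_lhs => rw [f.as_sum, g.as_sum]
    rw [Finset.sum_mul_sum]
    simp [monomial_mul]
  rw [h]
  refine (l1_sum _ _).trans ?_
  unfold l1
  rw [Finset.sum_mul_sum]
  apply Finset.sum_le_sum
  intro m _
  refine (l1_sum _ _).trans ?_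
  apply Finset.sum_le_sum
  intro k _
  rw [l1_monomial]; push_cast; rw [abs_mul]

lemma l1_C {σ : Type*} (a : ℤ) : l1 (C a : MvPolynomial σ ℤ) = |(a : ℝ)| := l1_monomial _ _
lemma l1_one {σ : Type*} : l1 (1 : MvPolynomial σ ℤ) = 1 := by
  have := l1_C (σ := σ) 1
  simpa using this
lemma l1_X {σ : Type*} (i : σ) : l1 (X i : MvPolynomial σ ℤ) = 1 := by
  have := l1_monomial (σ := σ) (Finsupp.single i 1) 1
  rw [X]
  simpa using this

lemma l1_neg {σ : Type*} (f : MvPolynomial σ ℤ) : l1 (-f) = l1 f := by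
  simp [l1]

lemma l1_sub {σ : Type*} (f g : MvPolynomial σ ℤ) : l1 (f - g) ≤ l1 f + l1 g := by
  rw [sub_eq_add_neg]; exact (l1_add _ _).trans (by rw [l1_neg])

lemma l1_pow {σ : Type*} (f : MvPolynomial σ ℤ) (n : ℕ) : l1 (f ^ n) ≤ l1 f ^ n := by
  induction n with
  | zero => simp [l1_one]
  | succ n ih =>
    rw [pow_succ, pow_succ]
    exact (l1_mul _ _).trans (mul_le_mul_of_nonneg_right ih (l1_nonneg _))

lemma l1_prod {σ ι : Type*} (s : Finset ι) (f : ι → MvPolynomial σ ℤ) :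
    l1 (∏ i ∈ s, f i) ≤ ∏ i ∈ s, l1 (f i) := by
  classical
  induction s using Finset.induction_on with
  | empty => simp [l1_one]
  | insert a s ha ih =>
    rw [Finset.prod_insert ha, Finset.prod_insert ha]
    exact (l1_mul _ _).trans (mul_le_mul_of_nonneg_left ih (l1_nonneg _))

/-- evaluation bound -/
lemma norm_aeval_le {σ : Type*} (f : MvPolynomial σ ℤ) (x : σ → ℂ) (B : ℝ) (hB : 1 ≤ B)
    (hx : ∀ i, ‖x i‖ ≤ B) (D : ℕ) (hD : f.totalDegree ≤ D) :
    ‖aeval x f‖ ≤ l1 f * B ^ D := by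
  rw [aeval_def, eval₂_eq, l1, Finset.sum_mul]
  refine norm_sum_le_of_le _ fun m hm => ?_
  rw [norm_mul]
  have h1 : ‖(algebraMap ℤ ℂ) (coeff m f)‖ = |((coeff m f : ℤ) : ℝ)| := by
    simp [Complex.norm_intCast]
  rw [h1]
  refine mul_le_mul_of_nonneg_left ?_ (abs_nonneg _)
  rw [norm_prod]
  have : ∏ i ∈ m.support, ‖x i ^ m i‖ ≤ ∏ i ∈ m.support, B ^ m i := by
    apply Finset.prod_le_prod (fun _ _ => norm_nonneg _)
    intro i _
    rw [norm_pow]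
    exact pow_le_pow_left₀ (norm_nonneg _) (hx i) _
  refine this.trans ?_
  rw [Finset.prod_pow_eq_pow_sum]
  apply pow_le_pow_right₀ hB
  exact (le_totalDegree hm).trans hD

/-- substitution bound -/
lemma l1_aeval_le {σ τ : Type*} (f : MvPolynomial σ ℤ) (x : σ → MvPolynomial τ ℤ) (B : ℝ)
    (hB : 1 ≤ B) (hx : ∀ i, l1 (x i) ≤ B) (D : ℕ) (hD : f.totalDegree ≤ D) :
    l1 (aeval x f) ≤ l1 f * B ^ D := by
  rw [aeval_def, eval₂_eq]
  refine (l1_sum _ _).trans ?_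
  rw [l1, Finset.sum_mul]
  refine Finset.sum_le_sum fun m hm => ?_
  refine (l1_mul _ _).trans ?_
  have h1 : l1 ((algebraMap ℤ (MvPolynomial τ ℤ)) (coeff m f)) = |((coeff m f : ℤ) : ℝ)| := by
    rw [algebraMap_eq]; exact l1_C _
  rw [h1]
  refine mul_le_mul_of_nonneg_left ?_ (abs_nonneg _)
  refine (l1_prod _ _).trans ?_
  have : ∏ i ∈ m.support, l1 (x i ^ m i) ≤ ∏ i ∈ m.support, B ^ m i := by
    apply Finset.prod_le_prod (fun _ _ => l1_nonneg _)
    intro i _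
    exact (l1_pow _ _).trans (pow_le_pow_left₀ (l1_nonneg _) (hx i) _)
  refine this.trans ?_
  rw [Finset.prod_pow_eq_pow_sum]
  apply pow_le_pow_right₀ hB
  exact (le_totalDegree hm).trans hD

lemma totalDegree_aeval_le {σ τ : Type*} (f : MvPolynomial σ ℤ) (x : σ → MvPolynomial τ ℤ)
    (hx : ∀ i, (x i).totalDegree ≤ 1) :
    (aeval x f).totalDegree ≤ f.totalDegree := by
  rw [aeval_def, eval₂_eq]
  refine totalDegree_finsetSum_le fun m hm => ?_
  refine (totalDegree_mul _ _).trans ?_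
  rw [algebraMap_eq, totalDegree_C, zero_add]
  refine (totalDegree_finsetProd _ _).trans ?_
  refine le_trans ?_ (le_totalDegree hm)
  apply Finset.sum_le_sum
  intro i _
  refine (totalDegree_pow _ _).trans ?_
  calc m i * (x i).totalDegree ≤ m i * 1 := Nat.mul_le_mul_left _ (hx i)
    _ = m i := mul_one _

lemma l1_coeff_finSucc {N : ℕ} (F : MvPolynomial (Fin (N+1)) ℤ) (i : ℕ) :
    l1 ((finSuccEquiv ℤ N F).coeff i) ≤ l1 F := by
  unfold l1
  simp only [finSuccEquiv_coeff_coeff]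
  have h : ∀ m ∈ ((finSuccEquiv ℤ N F).coeff i).support, m.cons i ∈ F.support := by
    intro m hm
    rwa [mem_support_iff, finSuccEquiv_coeff_coeff, ← mem_support_iff] at hm
  classical
  rw [← Finset.sum_image (s := ((finSuccEquiv ℤ N F).coeff i).support) (g := fun m => m.cons i)
    (f := fun m => |((F.coeff m : ℤ) : ℝ)|)]
  · apply Finset.sum_le_sum_of_subset_of_nonneg
    · intro m hm
      obtain ⟨k, hk, rfl⟩ := Finset.mem_image.mp hm
      exact h k hk
    · intros; exact abs_nonneg _
  · intro a _ b _ hab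
    exact Finsupp.cons_right_injective i hab

lemma aeval_cons {N : ℕ} {K : Type*} [CommRing K] (F : MvPolynomial (Fin (N+1)) ℤ)
    (t : K) (y : Fin N → K) :
    aeval (Fin.cons t y : Fin (N+1) → K) F =
      Polynomial.eval t (Polynomial.map (aeval y : MvPolynomial (Fin N) ℤ →ₐ[ℤ] K).toRingHom
        (finSuccEquiv ℤ N F)) := by
  induction F using MvPolynomial.induction_on with
  | C a => simp [finSuccEquiv_apply]
  | add p q hp hq => simp [hp, hq]
  | mul_X p i hp =>
    rw [map_mul, hp, map_mul, Polynomial.map_mul, Polynomial.eval_mul]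
    congr 1
    refine Fin.cases ?_ (fun j => ?_) i
    · simp [finSuccEquiv_X_zero]
    · simp [finSuccEquiv_X_succ]

end WE

namespace WE
open MvPolynomial

lemma det_totalDegree_le {σ : Type*} {k : ℕ} (M : Matrix (Fin k) (Fin k) (MvPolynomial σ ℤ)) (D : ℕ)
    (h : ∀ i j, (M i j).totalDegree ≤ D) : M.det.totalDegree ≤ k * D := by
  rw [Matrix.det_apply]
  refine totalDegree_finsetSum_le fun s _ => ?_
  have : (Equiv.Perm.sign s • ∏ i, M (s i) i).totalDegree ≤ (∏ i, M (s i) i).totalDegree := by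
    rcases Int.units_eq_one_or (Equiv.Perm.sign s) with h | h <;> simp [h]
  refine this.trans ((totalDegree_finsetProd _ _).trans ?_)
  calc ∑ i, (M (s i) i).totalDegree ≤ ∑ i : Fin k, D := Finset.sum_le_sum fun i _ => h _ _
    _ = k * D := by simp

lemma det_l1_le {σ : Type*} {k : ℕ} (M : Matrix (Fin k) (Fin k) (MvPolynomial σ ℤ)) (H : ℝ)
    (h : ∀ i j, l1 (M i j) ≤ H) : l1 M.det ≤ k.factorial * H ^ k := by
  rw [Matrix.det_apply]
  refine (l1_sum _ _).trans ?_
  have : ∀ s ∈ (Finset.univ : Finset (Equiv.Perm (Fin k))),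
      l1 (Equiv.Perm.sign s • ∏ i, M (s i) i) ≤ H ^ k := by
    intro s _
    have : l1 (Equiv.Perm.sign s • ∏ i, M (s i) i) ≤ l1 (∏ i, M (s i) i) := by
      rcases Int.units_eq_one_or (Equiv.Perm.sign s) with h | h <;> simp [h, l1_neg]
    refine this.trans ((l1_prod _ _).trans ?_)
    calc ∏ i, l1 (M (s i) i) ≤ ∏ i : Fin k, H :=
        Finset.prod_le_prod (fun _ _ => l1_nonneg _) fun i _ => h _ _
      _ = H ^ k := by simp
  refine (Finset.sum_le_sum this).trans ?_
  simp [Finset.card_univ, Fintype.card_perm]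

lemma vecMul_aux (q : Polynomial ℂ) (t : ℂ) (n j k : ℕ) (hq : q.natDegree ≤ n) (hj : j + n < k) :
    ∑ i : Fin k, t ^ (i : ℕ) * (if (i : ℕ) ∈ Set.Icc j (j + n) then q.coeff (i - j) else 0)
      = t ^ j * q.eval t := by
  rw [Fin.sum_univ_eq_sum_range
    (fun i => t ^ i * (if i ∈ Set.Icc j (j + n) then q.coeff (i - j) else 0))]
  rw [Polynomial.eval_eq_sum_range' (Nat.lt_succ_of_le hq), Finset.mul_sum]
  symm
  apply Finset.sum_of_injOn (fun l => j + l)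
  · intro a _ b _ h; simpa using h
  · intro a ha
    simp only [Finset.coe_range, Set.mem_Iio] at ha ⊢
    omega
  · intro i _ hi
    rw [if_neg, mul_zero]
    intro h
    apply hi
    refine ⟨i - j, ?_, ?_⟩
    · simp only [Set.mem_Icc] at h
      simp only [Finset.coe_range, Set.mem_Iio]; omega
    · simp only [Set.mem_Icc] at h
      simp only; omega
  · intro l hl
    rw [Finset.mem_range] at hl
    rw [if_pos (by simp only [Set.mem_Icc]; omega), Nat.add_sub_cancel_left, pow_add]
    ring

lemma resultant_small (p q : Polynomial ℂ) (t : ℂ) (m n : ℕ) (hp : p.natDegree ≤ m)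
    (hq : q.natDegree ≤ n) (hn : 1 ≤ n) (H B ε : ℝ) (hH : 1 ≤ H) (hB : 1 ≤ B) (hε : 0 ≤ ε)
    (hpc : ∀ i, ‖p.coeff i‖ ≤ H) (hqc : ∀ i, ‖q.coeff i‖ ≤ H) (ht : ‖t‖ ≤ B)
    (hpt : ‖p.eval t‖ ≤ ε) (hqt : ‖q.eval t‖ ≤ ε) :
    ‖p.resultant q m n‖ ≤ (m + n : ℕ) * (B ^ (m + n) * ε * ((m + n).factorial * H ^ (m + n))) := by
  set S := p.sylvester q m n with hS
  let v : Fin (m + n) → ℂ := fun i => t ^ (i : ℕ)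
  have hw : ∀ j, ‖(Matrix.vecMul v S) j‖ ≤ B ^ (m + n) * ε := by
    intro j
    have key : ∀ (l : ℕ) (z : ℂ), l ≤ m + n → ‖z‖ ≤ ε → ‖t ^ l * z‖ ≤ B ^ (m + n) * ε := by
      intro l z hl hz
      rw [norm_mul, norm_pow]
      apply mul_le_mul _ hz (norm_nonneg _) (by positivity)
      exact (pow_le_pow_left₀ (norm_nonneg _) ht _).trans (pow_le_pow_right₀ hB hl)
    induction j using Fin.addCases with
    | left j =>
      have : (Matrix.vecMul v S) (Fin.castAdd n j) = t ^ (j : ℕ) * q.eval t := by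
        rw [← vecMul_aux q t n j (m + n) hq (by omega)]
        simp [Matrix.vecMul, dotProduct, hS, Polynomial.sylvester, v]
      rw [this]; exact key _ _ (by omega) hqt
    | right j =>
      have : (Matrix.vecMul v S) (Fin.natAdd m j) = t ^ (j : ℕ) * p.eval t := by
        rw [← vecMul_aux p t m j (m + n) hp (by omega)]
        simp [Matrix.vecMul, dotProduct, hS, Polynomial.sylvester, v]
      rw [this]; exact key _ _ (by omega) hpt
  have hSb : ∀ i j, ‖S i j‖ ≤ H := by
    intro i j
    have h0 : (0:ℝ) ≤ H := by linarith
    induction j using Fin.addCases with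
    | left j =>
      simp only [hS, Polynomial.sylvester, Matrix.of_apply, Fin.addCases_left]
      split_ifs
      · exact hqc _
      · simpa using h0
    | right j =>
      simp only [hS, Polynomial.sylvester, Matrix.of_apply, Fin.addCases_right]
      split_ifs
      · exact hpc _
      · simpa using h0
  have hadj : ∀ i j, ‖S.adjugate i j‖ ≤ (m + n).factorial * H ^ (m + n) := by
    intro i j
    rw [Matrix.adjugate_apply]
    have hav : ∀ z : ℂ, NormedField.toAbsoluteValue ℂ z = ‖z‖ := fun z => rfl
    have := Matrix.det_le (abv := NormedField.toAbsoluteValue ℂ) (A := S.updateRow j (Pi.single i 1)) (x := H) ?_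
    · simpa [hav] using this
    · intro a b
      rw [hav]
      rw [Matrix.updateRow_apply]
      split_ifs
      · by_cases hbi : b = i
        · subst hbi; simpa using hH
        · rw [Pi.single_eq_of_ne hbi]; simpa using (by linarith)
      · exact hSb _ _
  let z : Fin (m + n) := ⟨0, by omega⟩
  have hdet : p.resultant q m n = ∑ j, (Matrix.vecMul v S) j * S.adjugate j z := by
    have h1 : Matrix.vecMul (Matrix.vecMul v S) S.adjugate z = S.det := by
      rw [Matrix.vecMul_vecMul, Matrix.mul_adjugate]
      simp [Matrix.vecMul_smul, v, z]
    rw [Polynomial.resultant, ← hS, ← h1]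
    rfl
  rw [hdet]
  refine (norm_sum_le _ _).trans ?_
  have : ∀ j ∈ (Finset.univ : Finset (Fin (m+n))), ‖(Matrix.vecMul v S) j * S.adjugate j z‖ ≤
      B ^ (m + n) * ε * ((m + n).factorial * H ^ (m + n)) := by
    intro j _
    rw [norm_mul]
    exact mul_le_mul (hw j) (hadj _ _) (norm_nonneg _) (by positivity)
  refine (Finset.sum_le_sum this).trans ?_
  simp

/-- the coordinate change -/
noncomputable def phi {N : ℕ} (c : Fin (N+1) → ℕ) :
    MvPolynomial (Fin (N+1)) ℤ →ₐ[ℤ] MvPolynomial (Fin (N+1)) ℤ :=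
  aeval (Fin.cons (C (c 0 : ℤ) * X 0) (fun i => X i.succ + C (c i.succ : ℤ) * X 0))

lemma phi_deg {N : ℕ} (c : Fin (N+1) → ℕ) (f : MvPolynomial (Fin (N+1)) ℤ) :
    (phi c f).totalDegree ≤ f.totalDegree := by
  apply totalDegree_aeval_le
  have h : ∀ a : ℤ, (C a * X 0 : MvPolynomial (Fin (N+1)) ℤ).totalDegree ≤ 1 := fun a =>
    (totalDegree_mul _ _).trans (by rw [totalDegree_C]; simp)
  intro i
  refine Fin.cases ?_ (fun j => ?_) i
  · simpa using h (c 0)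
  · simp only [Fin.cons_succ]
    exact (totalDegree_add _ _).trans (max_le (by simp) (h _))

lemma phi_l1 {N : ℕ} (c : Fin (N+1) → ℕ) (f : MvPolynomial (Fin (N+1)) ℤ) (D : ℕ)
    (hc : ∀ i, c i ≤ D + 1) (hD : f.totalDegree ≤ D) :
    l1 (phi c f) ≤ l1 f * ((D:ℝ) + 2) ^ D := by
  apply l1_aeval_le _ _ _ (by have := Nat.cast_nonneg (α := ℝ) D; linarith) _ _ hD
  have h : ∀ i, l1 (C (c i : ℤ) * X 0 : MvPolynomial (Fin (N+1)) ℤ) ≤ D + 1 := fun i => by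
    refine (l1_mul _ _).trans ?_
    rw [l1_C, l1_X, mul_one]
    simp only [Int.cast_natCast, Nat.abs_cast]
    exact_mod_cast hc i
  intro i
  refine Fin.cases ?_ (fun j => ?_) i
  · have := h 0
    simp only [Fin.cons_zero]; linarith
  · simp only [Fin.cons_succ]
    have := h j.succ
    have h2 := l1_add (X j.succ : MvPolynomial (Fin (N+1)) ℤ) (C (c j.succ : ℤ) * X 0)
    rw [l1_X] at h2
    linarith

lemma phi_eval {N : ℕ} {K : Type*} [CommRing K] (c : Fin (N+1) → ℕ) (f : MvPolynomial (Fin (N+1)) ℤ)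
    (t : K) (y : Fin N → K) :
    aeval (Fin.cons t y : Fin (N+1) → K) (phi c f) =
      aeval (Fin.cons (c 0 * t) (fun i => y i + c i.succ * t) : Fin (N+1) → K) f := by
  rw [phi, ← AlgHom.comp_apply, comp_aeval]
  congr 2
  funext i
  refine Fin.cases ?_ (fun j => ?_) i <;> simp

lemma phi_leading {N : ℕ} (c : Fin (N+1) → ℕ) (f : MvPolynomial (Fin (N+1)) ℤ) :
    (finSuccEquiv ℤ N (phi c f)).coeff f.totalDegree =
      C (eval (fun i => (c i : ℤ)) (homogeneousComponent f.totalDegree f)) := by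
  have h1 : finSuccEquiv ℤ N (phi c f) = ∑ m ∈ f.support, Polynomial.C (C (f.coeff m)) *
      ∏ i, (finSuccEquiv ℤ N (phi c (X i))) ^ m i := by
    conv_lhs => rw [f.as_sum]
    rw [map_sum, map_sum]
    refine Finset.sum_congr rfl fun m _ => ?_
    rw [monomial_eq, map_mul, map_mul, Finsupp.prod_fintype _ _ (by simp)]
    simp only [map_prod, map_pow]
    congr 1
    simp [phi]
  have hd : ∀ i, (finSuccEquiv ℤ N (phi c (X i))).natDegree ≤ 1 := fun i => by
    rw [natDegree_finSuccEquiv]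
    exact (degreeOf_le_totalDegree _ _).trans ((phi_deg c _).trans (by simp))
  have hc : ∀ i, (finSuccEquiv ℤ N (phi c (X i))).coeff 1 = C (c i : ℤ) := fun i => by
    refine Fin.cases ?_ (fun j => ?_) i
    · simp [phi, finSuccEquiv_X_zero]
    · simp [phi, finSuccEquiv_X_zero, finSuccEquiv_X_succ, Polynomial.coeff_C]
  have hpd : ∀ m : Fin (N+1) →₀ ℕ, (∏ i, (finSuccEquiv ℤ N (phi c (X i))) ^ m i).natDegree ≤ ∑ i, m i := by
    intro m
    refine (Polynomial.natDegree_prod_le _ _).trans (Finset.sum_le_sum fun i _ => ?_)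
    exact (Polynomial.natDegree_pow_le_of_le _ (hd i)).trans (by simp)
  have hpc : ∀ m : Fin (N+1) →₀ ℕ, (∏ i, (finSuccEquiv ℤ N (phi c (X i))) ^ m i).coeff (∑ i, m i) =
      C (∏ i, (c i : ℤ) ^ m i) := by
    intro m
    have gen : ∀ s : Finset (Fin (N+1)), (∏ i ∈ s, (finSuccEquiv ℤ N (phi c (X i))) ^ m i).natDegree ≤ ∑ i ∈ s, m i ∧ (∏ i ∈ s, (finSuccEquiv ℤ N (phi c (X i))) ^ m i).coeff (∑ i ∈ s, m i) =
      C (∏ i ∈ s, (c i : ℤ) ^ m i) := by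
      intro s
      induction s using Finset.induction_on with
      | empty => simp
      | insert a s ha ih =>
        rw [Finset.prod_insert ha, Finset.sum_insert ha, Finset.prod_insert ha]
        have e1 : ((finSuccEquiv ℤ N (phi c (X a))) ^ m a).natDegree ≤ m a :=
          (Polynomial.natDegree_pow_le_of_le _ (hd a)).trans (by simp)
        refine ⟨Polynomial.natDegree_mul_le_of_le e1 ih.1, ?_⟩
        rw [Polynomial.coeff_mul_add_eq_of_natDegree_le e1 ih.1, ih.2]
        have := Polynomial.coeff_pow_of_natDegree_le (m := m a) (hd a)
        rw [mul_one] at this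
        rw [this, hc]
        simp
    exact (gen Finset.univ).2
  rw [h1, Polynomial.finsetSum_coeff, homogeneousComponent_apply, map_sum, map_sum,
    Finset.sum_filter]
  refine Finset.sum_congr rfl fun m hm => ?_
  rw [Polynomial.coeff_C_mul]
  have hdeg : m.degree = ∑ i, m i := by
    rw [Finsupp.degree_eq_sum]
  split_ifs with h
  · rw [← h, hdeg, hpc m, ← C_mul, eval_monomial, Finsupp.prod_fintype _ _ (by simp)]
  · rw [Polynomial.coeff_eq_zero_of_natDegree_lt, mul_zero]
    refine (hpd m).trans_lt ?_
    rw [← hdeg]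
    refine lt_of_le_of_ne ?_ h
    rw [hdeg]
    have := le_totalDegree hm
    rwa [Finsupp.sum_fintype _ _ (by simp)] at this

end WE

namespace WE
open MvPolynomial

/-- combination -/
noncomputable def comb {N : ℕ} (D u : ℕ) (g : ℕ → MvPolynomial (Fin N) ℤ) : MvPolynomial (Fin N) ℤ :=
  ∑ j ∈ Finset.range D, C ((u:ℤ) ^ j) * g j

lemma aeval_comb {N : ℕ} {K : Type*} [CommRing K] (D u : ℕ) (g : ℕ → MvPolynomial (Fin N) ℤ) (y : Fin N → K) :
    aeval y (comb D u g) = ∑ j ∈ Finset.range D, (u:K) ^ j * aeval y (g j) := by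
  simp [comb]

lemma exists_u {K : Type*} [Field K] [CharZero K] (Z : Finset K) (D : ℕ) (hZ : Z.card ≤ D) (a : K → ℕ → K)
    (ha : ∀ t ∈ Z, ∃ j < D, a t j ≠ 0) :
    ∃ u ≤ D * D, ∀ t ∈ Z, ∑ j ∈ Finset.range D, (u:K) ^ j * a t j ≠ 0 := by
  classical
  let P : K → Polynomial K := fun t => ∑ j ∈ Finset.range D, Polynomial.C (a t j) * Polynomial.X ^ j
  have hP : ∀ t ∈ Z, P t ≠ 0 := by
    intro t ht h
    obtain ⟨j, hj, hne⟩ := ha t ht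
    apply hne
    have := congrArg (fun p => Polynomial.coeff p j) h
    simp only [P, Polynomial.finsetSum_coeff, Polynomial.coeff_C_mul_X_pow, Polynomial.coeff_zero] at this
    simpa [hj] using this
  have hQ : ∏ t ∈ Z, P t ≠ 0 := Finset.prod_ne_zero_iff.mpr hP
  have hdeg : (∏ t ∈ Z, P t).natDegree ≤ D * D := by
    refine (Polynomial.natDegree_prod_le _ _).trans ?_
    calc ∑ t ∈ Z, (P t).natDegree ≤ ∑ t ∈ Z, D := by
          apply Finset.sum_le_sum
          intro t _
          refine Polynomial.natDegree_sum_le_of_forall_le _ _ fun j hj => ?_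
          exact (Polynomial.natDegree_C_mul_X_pow_le _ _).trans (Finset.mem_range.mp hj).le
      _ = Z.card * D := by simp
      _ ≤ D * D := Nat.mul_le_mul_right _ hZ
  by_contra hcon
  push Not at hcon
  apply hQ
  apply Polynomial.eq_zero_of_natDegree_lt_card_of_eval_eq_zero' (∏ t ∈ Z, P t)
    ((Finset.range (D * D + 1)).image (fun n : ℕ => (n : K)))
  · intro x hx
    obtain ⟨u, hu, rfl⟩ := Finset.mem_image.mp hx
    obtain ⟨t, ht, h0⟩ := hcon u (by simpa [Nat.lt_succ_iff] using hu)
    rw [Polynomial.eval_prod]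
    apply Finset.prod_eq_zero ht
    rw [← h0]
    simp only [P, Polynomial.eval_finsetSum, Polynomial.eval_mul, Polynomial.eval_C, Polynomial.eval_pow, Polynomial.eval_X]
    exact Finset.sum_congr rfl fun j _ => mul_comm _ _
  · rw [Finset.card_image_of_injective _ Nat.cast_injective, Finset.card_range]
    omega

lemma exists_c {N : ℕ} (f : MvPolynomial (Fin (N+1)) ℤ) (hf : f ≠ 0) (D : ℕ) (hD : f.totalDegree ≤ D) :
    ∃ c : Fin (N+1) → ℕ, (∀ i, c i ≤ D + 1) ∧ c 0 ≠ 0 ∧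
      eval (fun i => (c i : ℤ)) (homogeneousComponent f.totalDegree f) ≠ 0 := by
  set h := homogeneousComponent f.totalDegree f with hh
  have hne : h ≠ 0 := by
    obtain ⟨m, hm, hmd⟩ : ∃ m ∈ f.support, m.degree = f.totalDegree := by
      obtain ⟨m, hm, h⟩ := Finset.exists_mem_eq_sup f.support (support_nonempty.mpr hf) (fun m => m.degree)
      exact ⟨m, hm, h.symm⟩
    intro h0
    have := congrArg (fun p => coeff m p) h0
    simp only [hh, coeff_homogeneousComponent, coeff_zero] at this
    rw [if_pos hmd] at this
    exact (mem_support_iff.mp hm) this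
  have hP : (X 0 * h : MvPolynomial (Fin (N+1)) ℤ) ≠ 0 := mul_ne_zero (X_ne_zero _) hne
  by_contra hcon
  push Not at hcon
  apply hP
  apply eq_zero_of_eval_zero_at_prod_finset _
    (fun _ => (Finset.range (D + 2)).image (fun n : ℕ => (n : ℤ)))
  · intro i
    rw [Finset.card_image_of_injective _ Nat.cast_injective, Finset.card_range]
    have h1 : (X 0 * h : MvPolynomial (Fin (N+1)) ℤ).totalDegree ≤ 1 + D := by
      refine (totalDegree_mul _ _).trans ?_
      have h2 : h.totalDegree ≤ f.totalDegree :=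
        (homogeneousComponent_isHomogeneous f.totalDegree f).totalDegree_le
      rw [totalDegree_X]
      omega
    have := degreeOf_le_totalDegree (X 0 * h : MvPolynomial (Fin (N+1)) ℤ) i
    omega
  · intro x hx
    have : ∀ i, ∃ n : ℕ, n ≤ D + 1 ∧ (n:ℤ) = x i := by
      intro i
      obtain ⟨n, hn, hnx⟩ := Finset.mem_image.mp (hx i)
      exact ⟨n, by have := Finset.mem_range.mp hn; omega, hnx⟩
    choose c hc hcx using this
    obtain rfl : (fun i => (c i : ℤ)) = x := funext hcx
    by_cases h0 : c 0 = 0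
    · simp [h0]
    · simp only [map_mul, hcon c hc h0, mul_zero]

lemma resultant_ne_zero_of {K : Type*} [Field K] [IsAlgClosed K] (p q : Polynomial K) (n : ℕ)
    (hp : p ≠ 0) (hq : q.natDegree ≤ n) (h : ∀ t, p.IsRoot t → q.eval t ≠ 0) :
    p.resultant q p.natDegree n ≠ 0 := by
  classical
  obtain ⟨k, rfl⟩ := Nat.exists_eq_add_of_le hq
  rw [Polynomial.resultant_add_right_deg _ _ _ _ _ le_rfl]
  refine mul_ne_zero (pow_ne_zero _ (by simpa using hp)) ?_
  apply Polynomial.resultant_ne_zero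
  rw [← EuclideanDomain.gcd_isUnit_iff]
  by_contra hu
  obtain ⟨t, ht⟩ := IsAlgClosed.exists_root (EuclideanDomain.gcd p q) (by
    intro h0
    apply hu
    rw [Polynomial.isUnit_iff_degree_eq_zero]; exact h0)
  exact h t (ht.dvd (EuclideanDomain.gcd_dvd_left _ _)) (ht.dvd (EuclideanDomain.gcd_dvd_right _ _))

/-- algebraic part of elimination -/
lemma elim_alg {N : ℕ} {K : Type*} [Field K] [IsAlgClosed K] [CharZero K]
    (S : Set (MvPolynomial (Fin (N+1)) ℤ)) (D : ℕ) (hS : ∀ f ∈ S, f.totalDegree ≤ D)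
    (f : MvPolynomial (Fin (N+1)) ℤ) (hfS : f ∈ S) (c : Fin (N+1) → ℕ)
    (hc : eval (fun i => (c i : ℤ)) (homogeneousComponent f.totalDegree f) ≠ 0)
    (y : Fin N → K)
    (hy : ∀ (g : ℕ → MvPolynomial (Fin (N+1)) ℤ), (∀ j, g j ∈ S) → ∀ u ≤ D * D,
      aeval y ((finSuccEquiv ℤ N (phi c f)).resultant (finSuccEquiv ℤ N (phi c (comb D u g)))
        f.totalDegree D) = 0) :
    ∃ z : Fin (N+1) → K, ∀ g ∈ S, aeval z g = 0 := by
  classical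
  by_contra hcon
  push Not at hcon
  set r := (aeval y : MvPolynomial (Fin N) ℤ →ₐ[ℤ] K).toRingHom with hr
  set p := (finSuccEquiv ℤ N (phi c f)).map r with hp
  have hnd : (finSuccEquiv ℤ N (phi c f)).natDegree ≤ f.totalDegree := by
    rw [natDegree_finSuccEquiv]
    exact (degreeOf_le_totalDegree _ _).trans (phi_deg c f)
  have hcoef : p.coeff f.totalDegree ≠ 0 := by
    rw [hp, Polynomial.coeff_map, phi_leading]
    simp only [hr]
    simpa using hc
  have hpd : p.natDegree = f.totalDegree :=
    Polynomial.natDegree_eq_of_le_of_coeff_ne_zero ((Polynomial.natDegree_map_le).trans hnd) hcoef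
  have hp0 : p ≠ 0 := by rintro h; rw [h] at hcoef; simp at hcoef
  have hZ : p.roots.toFinset.card ≤ D :=
    (Multiset.toFinset_card_le _).trans ((p.card_roots').trans (hpd.le.trans (hS f hfS)))
  let pt : K → Fin (N+1) → K := fun t => Fin.cons (c 0 * t) (fun i => y i + c i.succ * t)
  have hbad : ∀ t : K, ∃ g ∈ S, aeval (pt t) g ≠ 0 := fun t => hcon (pt t)
  choose G hGS hG using hbad
  let e := p.roots.toFinset.equivFin
  let g : ℕ → MvPolynomial (Fin (N+1)) ℤ := fun j =>
    if h : j < p.roots.toFinset.card then G (e.symm ⟨j, h⟩) else f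
  have hg : ∀ j, g j ∈ S := by
    intro j; simp only [g]; split_ifs
    · exact hGS _
    · exact hfS
  obtain ⟨u, hu, hu2⟩ := exists_u p.roots.toFinset D hZ (fun t j => aeval (pt t) (g j)) (by
    intro t ht
    refine ⟨e ⟨t, ht⟩, (e ⟨t, ht⟩).2.trans_le hZ, ?_⟩
    simp only [g, Fin.is_lt, dif_pos, Fin.eta, Equiv.symm_apply_apply]
    exact hG t)
  have h0 := hy g hg u hu
  have h1 : r ((finSuccEquiv ℤ N (phi c f)).resultant (finSuccEquiv ℤ N (phi c (comb D u g)))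
        f.totalDegree D) = 0 := h0
  rw [← Polynomial.resultant_map_map, ← hp, ← hpd] at h1
  refine resultant_ne_zero_of p _ D hp0 ?_ ?_ h1
  · refine Polynomial.natDegree_map_le.trans ?_
    rw [natDegree_finSuccEquiv]
    refine (degreeOf_le_totalDegree _ _).trans ((phi_deg c _).trans ?_)
    refine totalDegree_finsetSum_le fun j _ => ?_
    refine (totalDegree_mul _ _).trans ?_
    rw [totalDegree_C, zero_add]
    exact hS _ (hg j)
  · intro t ht
    rw [hr, ← aeval_cons, phi_eval, aeval_comb]
    exact hu2 t (by simp [hp0]; exact ht)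

end WE

namespace WE
open MvPolynomial

lemma self_le_exp (D : ℕ) : (D:ℝ) ≤ Real.exp D := by
  have := Real.add_one_le_exp (D:ℝ); linarith

lemma pow_le_exp (x y : ℝ) (hx : 0 ≤ x) (n : ℕ) (h : x ≤ Real.exp y) : x ^ n ≤ Real.exp (n * y) := by
  rw [Real.exp_nat_mul]; exact pow_le_pow_left₀ hx h n

set_option maxHeartbeats 2000000 in
/-- the numerical step -/
lemma elim_num {N : ℕ} (D : ℕ) (hD : 2 ≤ D) (x : Fin (N+1) → ℂ) (hx : ∀ i, ‖x i‖ ≤ D)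
    (S : Set (MvPolynomial (Fin (N+1)) ℤ)) (ε : ℝ) (hε : 0 ≤ ε)
    (hS : ∀ f ∈ S, f.totalDegree ≤ D ∧ l1 f ≤ Real.exp D ∧ ‖aeval x f‖ ≤ ε)
    (f : MvPolynomial (Fin (N+1)) ℤ) (hf : f ∈ S) (c : Fin (N+1) → ℕ) (hc : ∀ i, c i ≤ D + 1)
    (hc0 : c 0 ≠ 0) (x' : Fin N → ℂ) (hx' : ∀ i, x' i = x i.succ - c i.succ * (x 0 / c 0))
    (g : ℕ → MvPolynomial (Fin (N+1)) ℤ) (hg : ∀ j, g j ∈ S) (u : ℕ) (hu : u ≤ D * D)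
    (R : MvPolynomial (Fin N) ℤ)
    (hR : R = (finSuccEquiv ℤ N (phi c f)).resultant (finSuccEquiv ℤ N (phi c (comb D u g)))
        f.totalDegree D) :
    (∀ i, ‖x' i‖ ≤ (D:ℝ) ^ 3) ∧ R.totalDegree ≤ D ^ 3 ∧ l1 R ≤ Real.exp ((D:ℝ) ^ 8) ∧
      ‖aeval x' R‖ ≤ Real.exp ((D:ℝ) ^ 9) * ε := by
  have hD2 : (2:ℝ) ≤ D := by exact_mod_cast hD
  have hD0 : (0:ℝ) ≤ D := by linarith
  set d : ℝ := (D:ℝ) with hd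
  have e1 : d ≤ Real.exp d := self_le_exp D
  have ht0 : ‖x 0 / c 0‖ ≤ d := by
    rw [norm_div, Complex.norm_natCast]
    have : (1:ℝ) ≤ c 0 := by exact_mod_cast Nat.one_le_iff_ne_zero.mpr hc0
    exact (div_le_self (norm_nonneg _) this).trans (hx 0)
  have hcR : ∀ i, (c i : ℝ) ≤ d + 1 := fun i => by rw [hd]; exact_mod_cast hc i
  have hx'b : ∀ i, ‖x' i‖ ≤ d ^ 3 := by
    intro i
    rw [hx']
    refine (norm_sub_le _ _).trans ?_
    rw [norm_mul, Complex.norm_natCast]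
    have h1 := mul_le_mul (hcR i.succ) ht0 (norm_nonneg _) (by linarith)
    have h2 := hx i.succ
    have h3 : d ^ 3 = d * d * d := by ring
    nlinarith [mul_nonneg hD0 hD0, mul_nonneg hD0 (sub_nonneg.mpr hD2)]
  -- comb bounds
  set q := comb D u g with hq
  have huR : (u:ℝ) ≤ Real.exp (2 * d) := by
    have : (u:ℝ) ≤ d * d := by rw [hd]; exact_mod_cast hu
    refine this.trans ?_
    rw [two_mul, Real.exp_add]
    exact mul_le_mul e1 e1 hD0 (Real.exp_nonneg _)
  have hupow : ∀ j ∈ Finset.range D, (u:ℝ) ^ j ≤ Real.exp (2 * d ^ 2) := by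
    intro j hj
    refine (pow_le_exp _ _ (Nat.cast_nonneg _) j huR).trans (Real.exp_le_exp.mpr ?_)
    have : (j:ℝ) ≤ d := by rw [hd]; exact_mod_cast (Finset.mem_range.mp hj).le
    nlinarith
  have hqd : q.totalDegree ≤ D := by
    refine totalDegree_finsetSum_le fun j _ => ?_
    refine (totalDegree_mul _ _).trans ?_
    rw [totalDegree_C, zero_add]
    exact (hS _ (hg j)).1
  have hql : l1 q ≤ Real.exp (2 * d ^ 2 + 2 * d) := by
    refine (l1_sum _ _).trans ?_
    have : ∀ j ∈ Finset.range D, l1 (C ((u:ℤ) ^ j) * g j) ≤ Real.exp (2 * d ^ 2) * Real.exp d := by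
      intro j hj
      refine (l1_mul _ _).trans ?_
      refine mul_le_mul ?_ (hS _ (hg j)).2.1 (l1_nonneg _) (Real.exp_nonneg _)
      rw [l1_C]
      simpa using hupow j hj
    refine (Finset.sum_le_sum this).trans ?_
    rw [Finset.sum_const, Finset.card_range, nsmul_eq_mul]
    calc d * (Real.exp (2 * d ^ 2) * Real.exp d)
        ≤ Real.exp d * (Real.exp (2 * d ^ 2) * Real.exp d) := by gcongr
      _ = Real.exp (2 * d ^ 2 + 2 * d) := by rw [← Real.exp_add, ← Real.exp_add]; ring_nf
  have hqx : ‖aeval x q‖ ≤ Real.exp (2 * d ^ 2 + d) * ε := by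
    rw [hq, aeval_comb]
    refine (norm_sum_le _ _).trans ?_
    have : ∀ j ∈ Finset.range D, ‖(u:ℂ) ^ j * aeval x (g j)‖ ≤ Real.exp (2 * d ^ 2) * ε := by
      intro j hj
      rw [norm_mul, norm_pow, Complex.norm_natCast]
      exact mul_le_mul (hupow j hj) (hS _ (hg j)).2.2 (norm_nonneg _) (Real.exp_nonneg _)
    refine (Finset.sum_le_sum this).trans ?_
    rw [Finset.sum_const, Finset.card_range, nsmul_eq_mul]
    calc d * (Real.exp (2 * d ^ 2) * ε)
        ≤ Real.exp d * (Real.exp (2 * d ^ 2) * ε) := by gcongr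
      _ = Real.exp (2 * d ^ 2 + d) * ε := by rw [← mul_assoc, ← Real.exp_add]; ring_nf
  -- phi bounds
  have hphi : ∀ F : MvPolynomial (Fin (N+1)) ℤ, F.totalDegree ≤ D → l1 F ≤ Real.exp (2 * d ^ 2 + 2 * d) →
      l1 (phi c F) ≤ Real.exp (d ^ 5) := by
    intro F h1 h2
    refine (phi_l1 c F D hc h1).trans ?_
    have h3 : (d + 2) ^ D ≤ Real.exp (d * (2 * d)) := by
      apply pow_le_exp _ _ (by linarith)
      have := Real.add_one_le_exp (2 * d)
      linarith
    calc l1 F * (d + 2) ^ D ≤ Real.exp (2 * d ^ 2 + 2 * d) * Real.exp (d * (2 * d)) := by gcongr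
      _ = Real.exp (2 * d ^ 2 + 2 * d + d * (2 * d)) := by rw [← Real.exp_add]
      _ ≤ Real.exp (d ^ 5) := by
        apply Real.exp_le_exp.mpr
        have h4 : 8 ≤ d ^ 3 := by nlinarith [mul_self_nonneg d, mul_nonneg hD0 hD0]
        have h5 : d ^ 5 = d ^ 3 * d ^ 2 := by ring
        nlinarith [mul_nonneg hD0 hD0]
  have hfd := (hS f hf).1
  have hfl : l1 f ≤ Real.exp (2 * d ^ 2 + 2 * d) :=
    (hS f hf).2.1.trans (Real.exp_le_exp.mpr (by nlinarith))
  have hpf := hphi f hfd hfl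
  have hpq := hphi q hqd hql
  set P := finSuccEquiv ℤ N (phi c f) with hP
  set Q := finSuccEquiv ℤ N (phi c q) with hQ
  have hcoefdeg : ∀ F : MvPolynomial (Fin (N+1)) ℤ, F.totalDegree ≤ D → ∀ i,
      ((finSuccEquiv ℤ N (phi c F)).coeff i).totalDegree ≤ D := by
    intro F h i
    by_cases h0 : (finSuccEquiv ℤ N (phi c F)).coeff i = 0
    · rw [h0]; simp
    · have := totalDegree_coeff_finSuccEquiv_add_le (phi c F) i h0
      have := phi_deg c F
      omega
  have hPn : P.natDegree ≤ f.totalDegree := by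
    rw [hP, natDegree_finSuccEquiv]
    exact (degreeOf_le_totalDegree _ _).trans (phi_deg c f)
  have hQn : Q.natDegree ≤ D := by
    rw [hQ, natDegree_finSuccEquiv]
    exact (degreeOf_le_totalDegree _ _).trans ((phi_deg c q).trans hqd)
  have hsyl : ∀ i j, (P.sylvester Q f.totalDegree D i j).totalDegree ≤ D ∧
      l1 (P.sylvester Q f.totalDegree D i j) ≤ Real.exp (d ^ 5) := by
    intro i j
    induction j using Fin.addCases with
    | left j =>
      simp only [Polynomial.sylvester, Matrix.of_apply, Fin.addCases_left]
      split_ifs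
      · exact ⟨hcoefdeg q hqd _, (l1_coeff_finSucc _ _).trans hpq⟩
      · exact ⟨by simp, by rw [l1_zero]; positivity⟩
    | right j =>
      simp only [Polynomial.sylvester, Matrix.of_apply, Fin.addCases_right]
      split_ifs
      · exact ⟨hcoefdeg f hfd _, (l1_coeff_finSucc _ _).trans hpf⟩
      · exact ⟨by simp, by rw [l1_zero]; positivity⟩
  set k := f.totalDegree + D with hk
  have hk2 : k ≤ 2 * D := by omega
  have hkR : (k:ℝ) ≤ 2 * d := by rw [hd]; exact_mod_cast hk2
  have hfact : (k.factorial : ℝ) ≤ Real.exp (4 * d ^ 2) := by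
    have h1 : (k.factorial : ℝ) ≤ (k:ℝ) ^ k := by exact_mod_cast Nat.factorial_le_pow k
    refine h1.trans ((pow_le_exp _ _ (Nat.cast_nonneg _) k (self_le_exp k)).trans ?_)
    apply Real.exp_le_exp.mpr
    have : (0:ℝ) ≤ k := Nat.cast_nonneg _
    nlinarith
  have hp : 2 ^ 2 ≤ d ^ 2 := by nlinarith
  have p3 : 8 ≤ d ^ 3 := by nlinarith [mul_self_nonneg d, mul_nonneg hD0 hD0]
  have p6 : 64 ≤ d ^ 6 := by nlinarith [show d ^ 6 = d ^ 3 * d ^ 3 by ring]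
  have p7 : 2 * d ^ 7 ≤ d ^ 8 := by nlinarith [pow_nonneg hD0 7, show d ^ 8 = d ^ 7 * d by ring]
  have p67 : 2 * d ^ 6 ≤ d ^ 7 := by nlinarith [pow_nonneg hD0 6, show d ^ 7 = d ^ 6 * d by ring]
  have p8 : 2 * d ^ 8 ≤ d ^ 9 := by nlinarith [pow_nonneg hD0 8, show d ^ 9 = d ^ 8 * d by ring]
  have p28 : 64 * d ^ 2 ≤ d ^ 8 := by nlinarith [pow_nonneg hD0 2, show d ^ 8 = d ^ 6 * d ^ 2 by ring]
  refine ⟨hx'b, ?_, ?_, ?_⟩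
  · rw [hR]
    refine (det_totalDegree_le _ D fun i j => (hsyl i j).1).trans ?_
    calc k * D ≤ 2 * D * D := Nat.mul_le_mul_right _ hk2
      _ ≤ D * D * D := by gcongr
      _ = D ^ 3 := by ring
  · rw [hR]
    refine (det_l1_le _ (Real.exp (d ^ 5)) fun i j => (hsyl i j).2).trans ?_
    have h1 : Real.exp (d ^ 5) ^ k ≤ Real.exp (2 * d ^ 6) := by
      rw [← Real.exp_nat_mul]
      apply Real.exp_le_exp.mpr
      nlinarith [pow_nonneg hD0 5, show d ^ 6 = d ^ 5 * d by ring]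
    calc (k.factorial : ℝ) * Real.exp (d ^ 5) ^ k ≤ Real.exp (4 * d ^ 2) * Real.exp (2 * d ^ 6) := by gcongr
      _ = Real.exp (4 * d ^ 2 + 2 * d ^ 6) := by rw [← Real.exp_add]
      _ ≤ Real.exp (d ^ 8) := by
        apply Real.exp_le_exp.mpr
        nlinarith
  · set r := (aeval x' : MvPolynomial (Fin N) ℤ →ₐ[ℤ] ℂ).toRingHom with hr
    have hRr : aeval x' R = (P.map r).resultant (Q.map r) f.totalDegree D := by
      rw [Polynomial.resultant_map_map, hR]; rfl
    have hpoint : (Fin.cons ((c 0 : ℂ) * (x 0 / c 0)) (fun i => x' i + c i.succ * (x 0 / c 0)) : Fin (N+1) → ℂ) = x := by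
      funext i
      refine Fin.cases ?_ (fun j => ?_) i
      · have : (c 0 : ℂ) ≠ 0 := by exact_mod_cast hc0
        simp only [Fin.cons_zero]; field_simp
      · simp [hx']
    have hev : ∀ F, ((finSuccEquiv ℤ N (phi c F)).map r).eval (x 0 / c 0) = aeval x F := by
      intro F
      rw [hr, ← aeval_cons, phi_eval, hpoint]
    have hcoef : ∀ F : MvPolynomial (Fin (N+1)) ℤ, F.totalDegree ≤ D → l1 (phi c F) ≤ Real.exp (d ^ 5) →
        ∀ i, ‖((finSuccEquiv ℤ N (phi c F)).map r).coeff i‖ ≤ Real.exp (d ^ 6) := by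
      intro F h1 h2 i
      rw [Polynomial.coeff_map]
      refine (norm_aeval_le _ x' (d ^ 3) (by linarith) hx'b D (hcoefdeg F h1 i)).trans ?_
      have h3 : (d ^ 3) ^ D ≤ Real.exp (d * (3 * d)) := by
        apply pow_le_exp _ _ (by positivity)
        have := pow_le_exp d d hD0 3 e1
        simpa using this
      calc l1 ((finSuccEquiv ℤ N (phi c F)).coeff i) * (d ^ 3) ^ D
          ≤ Real.exp (d ^ 5) * Real.exp (d * (3 * d)) := by
            gcongr
            exact (l1_coeff_finSucc _ _).trans h2
        _ = Real.exp (d ^ 5 + d * (3 * d)) := by rw [← Real.exp_add]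
        _ ≤ Real.exp (d ^ 6) := by
          apply Real.exp_le_exp.mpr
          have a1 : d ^ 6 = d ^ 5 * d := by ring
          have a2 : 8 * d ^ 2 ≤ d ^ 5 := by nlinarith [show d ^ 5 = d ^ 3 * d ^ 2 by ring]
          nlinarith
    have hε' : ε ≤ Real.exp (2 * d ^ 2 + d) * ε := by
      have : 1 ≤ Real.exp (2 * d ^ 2 + d) := Real.one_le_exp (by positivity)
      nlinarith
    have := resultant_small (P.map r) (Q.map r) (x 0 / c 0) f.totalDegree D
      (Polynomial.natDegree_map_le.trans hPn) (Polynomial.natDegree_map_le.trans hQn) (by omega)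
      (Real.exp (d ^ 6)) d (Real.exp (2 * d ^ 2 + d) * ε) (Real.one_le_exp (by positivity)) (by linarith)
      (by positivity) (hcoef f hfd hpf) (hcoef q hqd hpq) ht0 (by rw [hev]; exact (hS f hf).2.2.trans hε')
      (by rw [hev]; exact hqx)
    rw [hRr]
    refine this.trans ?_
    rw [← hk]
    have b1 : (k:ℝ) ≤ Real.exp (2 * d) := (self_le_exp k).trans (Real.exp_le_exp.mpr hkR)
    have b2 : d ^ k ≤ Real.exp (2 * d * d) := by
      refine (pow_le_exp d d hD0 k e1).trans (Real.exp_le_exp.mpr ?_)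
      nlinarith
    have b3 : Real.exp (d ^ 6) ^ k ≤ Real.exp (2 * d ^ 7) := by
      rw [← Real.exp_nat_mul]
      apply Real.exp_le_exp.mpr
      nlinarith [pow_nonneg hD0 6, show d ^ 7 = d ^ 6 * d by ring]
    calc (k:ℝ) * (d ^ k * (Real.exp (2 * d ^ 2 + d) * ε) * (k.factorial * Real.exp (d ^ 6) ^ k))
        ≤ Real.exp (2 * d) * (Real.exp (2 * d * d) * (Real.exp (2 * d ^ 2 + d) * ε) *
          (Real.exp (4 * d ^ 2) * Real.exp (2 * d ^ 7))) := by gcongr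
      _ = Real.exp (2 * d + 2 * d * d + (2 * d ^ 2 + d) + 4 * d ^ 2 + 2 * d ^ 7) * ε := by
        simp only [Real.exp_add]; ring
      _ ≤ Real.exp (d ^ 9) * ε := by
        gcongr
        nlinarith

theorem approxNull (K : Type*) [Field K] [IsAlgClosed K] [CharZero K] (N : ℕ) :
    ∃ c : ℕ, ∀ D : ℕ, 2 ≤ D → ∀ x : Fin N → ℂ, (∀ i, ‖x i‖ ≤ D) →
      ∀ S : Set (MvPolynomial (Fin N) ℤ),
      (∀ f ∈ S, f.totalDegree ≤ D ∧ l1 f ≤ Real.exp D ∧ ‖aeval x f‖ ≤ Real.exp (-(D:ℝ) ^ c)) →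
      ∃ y : Fin N → K, ∀ f ∈ S, aeval y f = 0 := by
  induction N with
  | zero =>
    refine ⟨1, fun D hD x _ S hS => ⟨Fin.elim0, fun f hf => ?_⟩⟩
    obtain ⟨a, rfl⟩ := C_surjective (Fin 0) f
    have h := (hS _ hf).2.2
    have : ‖(a:ℂ)‖ < 1 := by
      have h2 : Real.exp (-(D:ℝ) ^ 1) < 1 := by
        rw [Real.exp_lt_one_iff]
        have : (2:ℝ) ≤ D := by exact_mod_cast hD
        simp; linarith
      simpa using h.trans_lt h2
    rw [Complex.norm_intCast] at this
    have ha : a = 0 := by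
      have : |a| < 1 := by exact_mod_cast this
      exact Int.abs_lt_one_iff.mp this
    simp [ha]
  | succ N ih =>
    obtain ⟨c₀, ih⟩ := ih
    refine ⟨8 * c₀ + 10, fun D hD x hx S hS => ?_⟩
    by_cases h0 : ∀ f ∈ S, f = 0
    · exact ⟨0, fun f hf => by rw [h0 f hf]; simp⟩
    push Not at h0
    obtain ⟨f, hf, hf0⟩ := h0
    obtain ⟨c, hc, hc0, hcl⟩ := exists_c f hf0 D (hS f hf).1
    have hD2 : (2:ℝ) ≤ D := by exact_mod_cast hD
    have hD1 : (1:ℝ) ≤ D := by linarith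
    let x' : Fin N → ℂ := fun i => x i.succ - c i.succ * (x 0 / c 0)
    let T : Set (MvPolynomial (Fin N) ℤ) := {R | ∃ g : ℕ → MvPolynomial (Fin (N+1)) ℤ, (∀ j, g j ∈ S) ∧
      ∃ u ≤ D * D, R = (finSuccEquiv ℤ N (phi c f)).resultant (finSuccEquiv ℤ N (phi c (comb D u g)))
        f.totalDegree D}
    have key := fun g hg u hu R hR => elim_num D hD x hx S _ (Real.exp_nonneg _) hS f hf c hc hc0 x' (fun i => rfl) g hg u hu R hR
    obtain ⟨y, hy⟩ := ih (D ^ 8) (by calc 2 ≤ D := hD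
                                      _ ≤ D ^ 8 := Nat.le_self_pow (by norm_num) D) x' (by
      intro i
      refine ((key (fun _ => f) (fun _ => hf) 0 (by omega) _ rfl).1 i).trans ?_
      push_cast
      exact pow_le_pow_right₀ hD1 (by norm_num)) T (by
      rintro R ⟨g, hg, u, hu, hR⟩
      obtain ⟨_, h2, h3, h4⟩ := key g hg u hu R hR
      refine ⟨h2.trans (Nat.pow_le_pow_right (by omega) (by norm_num)), by push_cast; exact h3, h4.trans ?_⟩
      rw [← Real.exp_add]
      apply Real.exp_le_exp.mpr
      push_cast
      rw [← pow_mul]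
      have e1 : (D:ℝ) ^ 9 ≤ (D:ℝ) ^ (8 * c₀ + 9) := pow_le_pow_right₀ hD1 (by omega)
      have e2 : (D:ℝ) ^ (8 * c₀) ≤ (D:ℝ) ^ (8 * c₀ + 9) := pow_le_pow_right₀ hD1 (by omega)
      have e3 : (D:ℝ) ^ (8 * c₀ + 10) = (D:ℝ) ^ (8 * c₀ + 9) * D := by ring
      have e4 : 0 ≤ (D:ℝ) ^ (8 * c₀ + 9) := by positivity
      nlinarith)
    exact elim_alg S D (fun f hf => (hS f hf).1) f hf c hcl y (fun g hg u hu => hy _ ⟨g, hg, u, hu, rfl⟩)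

end WE

namespace WE
open Function

abbrev F2 := FreeGroup (Fin 2)

/-- letters -/
def lt (p : Fin 2 × Bool) : F2 := FreeGroup.mk [p]

lemma lt_inv (p : Fin 2 × Bool) : lt (p.1, !p.2) = (lt p)⁻¹ := by
  simp [lt, FreeGroup.inv_mk, FreeGroup.invRev]

def flipE : (Fin 2 × Bool) ≃ (Fin 2 × Bool) where
  toFun p := (p.1, !p.2)
  invFun p := (p.1, !p.2)
  left_inv p := by simp
  right_inv p := by simp

section
variable {X : Type*} [MulAction F2 X]

/-- the adjacency operator -/
def TT (f : X → ℝ) : X → ℝ := fun x => ∑ p, f (lt p • x)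

def FS (f : X → ℝ) : Prop := f.support.Finite

noncomputable def ip (f g : X → ℝ) : ℝ := ∑' x, f x * g x

noncomputable def defect (f : X → ℝ) : ℝ := ∑ p, ∑' x, |f (lt p • x) - f x|

def Gap (X : Type*) [MulAction F2 X] (κ : ℝ) : Prop := ∀ f : X → ℝ, FS f → (∀ x, 0 ≤ f x) → ∑' x, f x = 1 → κ ≤ defect f

lemma FS.smul {f : X → ℝ} (hf : FS f) (g : F2) : FS (fun x => f (g • x)) := by
  have : (fun x => f (g • x)).support = (MulAction.toPerm g) ⁻¹' f.support := rfl
  unfold FS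
  rw [this]
  exact hf.preimage (MulAction.injective g).injOn

lemma FS.summable {f : X → ℝ} (hf : FS f) : Summable f := summable_of_hasFiniteSupport hf

lemma FS.mul_right {f : X → ℝ} (hf : FS f) (g : X → ℝ) : FS (fun x => f x * g x) :=
  Set.Finite.subset hf (by intro x hx; simp at hx ⊢; exact hx.1)

lemma FS.mul_left {f : X → ℝ} (hf : FS f) (g : X → ℝ) : FS (fun x => g x * f x) :=
  Set.Finite.subset hf (by intro x hx; simp at hx ⊢; exact hx.2)

lemma FS.add {f g : X → ℝ} (hf : FS f) (hg : FS g) : FS (fun x => f x + g x) :=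
  Set.Finite.subset (hf.union hg) (by intro x hx; simp at hx ⊢; by_contra h; push Not at h; simp [h] at hx)

lemma FS.sub {f g : X → ℝ} (hf : FS f) (hg : FS g) : FS (fun x => f x - g x) :=
  Set.Finite.subset (hf.union hg) (by intro x hx; simp at hx ⊢; by_contra h; push Not at h; simp [h] at hx)

lemma FS.comp {f : X → ℝ} (hf : FS f) (a : ℝ → ℝ) (ha : a 0 = 0) : FS (fun x => a (f x)) :=
  Set.Finite.subset hf (by intro x hx; simp at hx ⊢; rintro h; simp [h, ha] at hx)

lemma FS.TT {f : X → ℝ} (hf : FS f) : FS (TT f) := by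
  have : (WE.TT f).support ⊆ ⋃ p, (fun x => f (lt p • x)).support := by
    intro x hx
    by_contra h
    simp only [Set.mem_iUnion, not_exists, Function.mem_support, not_not] at h
    apply hx
    exact Finset.sum_eq_zero fun p _ => h p
  exact (Set.finite_iUnion fun p => hf.smul (lt p)).subset this

lemma tsum_smul (f : X → ℝ) (g : F2) : ∑' x, f (g • x) = ∑' x, f x :=
  (MulAction.toPerm g : Equiv.Perm X).tsum_eq f

lemma ip_TT (f g : X → ℝ) (hf : FS f) : ip (TT f) g = ∑ p, ∑' x, f (lt p • x) * g x := by
  unfold ip TT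
  simp_rw [Finset.sum_mul]
  rw [Summable.tsum_finsetSum]
  intro p _
  exact ((hf.smul (lt p)).mul_right g).summable

lemma ip_TT_symm (f g : X → ℝ) (hf : FS f) (hg : FS g) : ip (TT f) g = ip f (TT g) := by
  have h1 : ip f (TT g) = ip (TT g) f := by unfold ip; simp_rw [mul_comm]
  rw [h1, ip_TT _ _ hf, ip_TT _ _ hg]
  rw [← flipE.sum_comp]
  refine Finset.sum_congr rfl fun p _ => ?_
  rw [← tsum_smul _ (lt p)]
  refine tsum_congr fun x => ?_
  have : lt (flipE p) = (lt p)⁻¹ := lt_inv p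
  rw [this, inv_smul_smul, mul_comm]

lemma ip_self_nonneg (f : X → ℝ) : 0 ≤ ip f f := tsum_nonneg fun x => mul_self_nonneg _

lemma quad_nonneg (κ : ℝ) (hκ : 0 < κ) (hG : Gap X κ) (f : X → ℝ) (hf : FS f)
    (hf0 : ∀ x, 0 ≤ f x) : ip (TT f) f ≤ (4 - κ ^ 2 / 32) * ip f f := by
  by_cases hz : ip f f = 0
  · have : ∀ x, f x = 0 := by
      intro x
      have h1 := (hf.mul_right f).summable
      have := (hasSum_zero_iff_of_nonneg (fun x => mul_self_nonneg (f x))).mp (by have := h1.hasSum; rwa [show ∑' x, f x * f x = 0 from hz] at this)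
      have := congrFun this x
      simpa using this
    have : f = 0 := funext this
    subst this
    simp [ip, TT]
  have hpos : 0 < ip f f := lt_of_le_of_ne (ip_self_nonneg f) (Ne.symm hz)
  set A := ip f f with hA
  have hff : FS (fun x => f x * f x) := hf.mul_right f
  have h1 := hG (fun x => f x * f x / A) (by simpa [div_eq_mul_inv] using hff.mul_right (fun _ => A⁻¹))
    (fun x => div_nonneg (mul_self_nonneg _) hpos.le) (by rw [tsum_div_const]; exact div_self hz)
  have h2 : ∀ p, ∑' x, |f (lt p • x) * f (lt p • x) / A - f x * f x / A| ≤
      (8 / κ * (2 * A - 2 * ∑' x, f (lt p • x) * f x) + κ / 8 * A) / A := by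
    intro p
    have hs := hf.smul (lt p)
    set fs := fun x => f (lt p • x) with hfs
    have e0 : ∀ x, |fs x * fs x / A - f x * f x / A| ≤
        (8 / κ * (fs x * fs x - 2 * (fs x * f x) + f x * f x) + κ / 16 * (fs x * fs x + f x * f x)) / A := by
      intro x
      rw [← sub_div, abs_div, abs_of_pos hpos]
      apply div_le_div_of_nonneg_right _ hpos.le
      have hk : fs x * fs x - f x * f x = (fs x - f x) * (fs x + f x) := by ring
      rw [hk, abs_mul]
      set a := |fs x - f x|
      set b := |fs x + f x|
      have ha : a ^ 2 = (fs x - f x) ^ 2 := sq_abs _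
      have hb : b ^ 2 = (fs x + f x) ^ 2 := sq_abs _
      have hb2 : b ^ 2 ≤ 2 * (fs x * fs x + f x * f x) := by nlinarith [sq_nonneg (fs x - f x)]
      have h3 : a * b ≤ 8 / κ * a ^ 2 + κ / 32 * b ^ 2 := by
        have : 8 / κ * a ^ 2 + κ / 32 * b ^ 2 - a * b = (8 / κ) * (a - κ / 16 * b) ^ 2 := by
          field_simp; ring
        have h4 : 0 ≤ (8 / κ) * (a - κ / 16 * b) ^ 2 := by positivity
        linarith
      have h5 : κ / 32 * b ^ 2 ≤ κ / 32 * (2 * (fs x * fs x + f x * f x)) := by gcongr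
      have h6 : 8 / κ * a ^ 2 = 8 / κ * (fs x * fs x - 2 * (fs x * f x) + f x * f x) := by
        rw [ha]; ring
      linarith
    have hab : FS (fun x => |fs x * fs x / A - f x * f x / A|) := by
      have := (hs.mul_right fs).sub hff
      have := this.comp (fun y => |y / A|) (by simp)
      simpa [sub_div] using this
    have s1 := (hs.mul_right fs).summable
    have s2 := (hs.mul_right f).summable
    have s3 := hff.summable
    have t1 : ∑' x, fs x * fs x = A := tsum_smul (fun x => f x * f x) (lt p)
    have hsum : HasSum (fun x => (8 / κ * (fs x * fs x - 2 * (fs x * f x) + f x * f x) + κ / 16 * (fs x * fs x + f x * f x)) / A)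
      ((8 / κ * (A - 2 * ∑' x, fs x * f x + A) + κ / 16 * (A + A)) / A) := by
      have u1 : HasSum (fun x => fs x * fs x) A := t1 ▸ s1.hasSum
      have u3 : HasSum (fun x => f x * f x) A := s3.hasSum
      exact (((((u1.sub (s2.hasSum.mul_left 2)).add u3).mul_left _)).add ((u1.add u3).mul_left _)).div_const A
    have := hasSum_le e0 hab.summable.hasSum hsum
    refine this.trans (le_of_eq ?_)
    ring
  have h3 : defect (fun x => f x * f x / A) ≤ ∑ p, (8 / κ * (2 * A - 2 * ∑' x, f (lt p • x) * f x) + κ / 8 * A) / A :=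
    Finset.sum_le_sum fun p _ => h2 p
  have h4 : ∑ p : Fin 2 × Bool, (8 / κ * (2 * A - 2 * ∑' x, f (lt p • x) * f x) + κ / 8 * A) / A
      = (8 / κ * (8 * A - 2 * ip (TT f) f) + κ / 2 * A) / A := by
    rw [ip_TT _ _ hf, ← Finset.sum_div]
    congr 1
    rw [Finset.sum_add_distrib, ← Finset.mul_sum, Finset.sum_sub_distrib, ← Finset.mul_sum Finset.univ (fun p : Fin 2 × Bool => ∑' x, f (lt p • x) * f x) 2]
    rw [Finset.sum_const, Finset.sum_const, Finset.card_univ]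
    simp only [Fintype.card_prod, Fintype.card_fin, Fintype.card_bool, nsmul_eq_mul]
    push_cast
    ring
  have h5 := h1.trans (h3.trans h4.le)
  rw [le_div_iff₀ hpos] at h5
  have h6 : κ / 2 * A ≤ 8 / κ * (8 * A - 2 * ip (TT f) f) := by linarith
  have h7 : κ / 2 * A * (κ / 8) ≤ 8 / κ * (8 * A - 2 * ip (TT f) f) * (κ / 8) := by gcongr
  have h8 : 8 / κ * (8 * A - 2 * ip (TT f) f) * (κ / 8) = 8 * A - 2 * ip (TT f) f := by field_simp
  rw [h8] at h7
  nlinarith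

lemma quad_abs (κ : ℝ) (hκ : 0 < κ) (hG : Gap X κ) (f : X → ℝ) (hf : FS f) :
    |ip (TT f) f| ≤ (4 - κ ^ 2 / 32) * ip f f := by
  have ha : FS (fun x => |f x|) := hf.comp (fun y => |y|) (by simp)
  have h := quad_nonneg κ hκ hG (fun x => |f x|) ha (fun x => abs_nonneg _)
  have h2 : ip (fun x => |f x|) (fun x => |f x|) = ip f f := by
    unfold ip; simp
  rw [h2] at h
  refine le_trans ?_ h
  rw [ip_TT _ _ hf, ip_TT _ _ ha]
  refine (Finset.abs_sum_le_sum_abs _ _).trans (Finset.sum_le_sum fun p _ => ?_)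
  have hs := ((hf.smul (lt p)).mul_right f)
  have := norm_tsum_le_tsum_norm (f := fun x => f (lt p • x) * f x) (hs.comp (fun y => ‖y‖) (by simp)).summable
  simpa [abs_mul] using this

lemma norm_TT (κ : ℝ) (hκ : 0 < κ) (hκ1 : κ ≤ 1) (hG : Gap X κ) (f : X → ℝ) (hf : FS f) :
    ip (TT f) (TT f) ≤ (4 - κ ^ 2 / 32) ^ 2 * ip f f := by
  set t := 4 - κ ^ 2 / 32 with ht
  have htp : 0 < t := by nlinarith
  -- g = TT f / t
  set g : X → ℝ := fun x => TT f x * t⁻¹ with hg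
  have hgF : FS g := hf.TT.mul_right _
  have hTTlin : ∀ c : ℝ, ∀ x, TT (fun x => f x + c * g x) x = TT f x + c * TT g x := by
    intro c x; simp [TT, Finset.sum_add_distrib, Finset.mul_sum]
  have hcF : ∀ c : ℝ, FS (fun x => f x + c * g x) := fun c => hf.add (hgF.mul_left _)
  have expand : ∀ c : ℝ, ip (TT (fun x => f x + c * g x)) (fun x => f x + c * g x) =
      ip (TT f) f + 2 * c * ip (TT f) g + c ^ 2 * ip (TT g) g := by
    intro c
    have hs : ip (TT g) f = ip (TT f) g := by
      rw [ip_TT_symm g f hgF hf]; unfold ip; simp_rw [mul_comm]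
    have u1 := (hf.mul_left (TT f)).summable.hasSum
    have u2 := (hgF.mul_left (TT f)).summable.hasSum
    have u3 := (hf.mul_left (TT g)).summable.hasSum
    have u4 := (hgF.mul_left (TT g)).summable.hasSum
    have := ((u1.add (u2.mul_left c)).add (u3.mul_left c)).add (u4.mul_left (c^2))
    have e : ip (TT (fun x => f x + c * g x)) (fun x => f x + c * g x) =
        ip (TT f) f + c * ip (TT f) g + c * ip (TT g) f + c ^ 2 * ip (TT g) g := by
      refine Eq.trans ?_ this.tsum_eq
      refine tsum_congr fun x => ?_
      rw [hTTlin]; ring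
    rw [e, hs]; ring
  have expand2 : ∀ c : ℝ, ip (fun x => f x + c * g x) (fun x => f x + c * g x) =
      ip f f + 2 * c * ip f g + c ^ 2 * ip g g := by
    intro c
    have u1 := (hf.mul_left f).summable.hasSum
    have u2 := (hgF.mul_left f).summable.hasSum
    have u4 := (hgF.mul_left g).summable.hasSum
    have := ((u1.add (u2.mul_left (2*c)))).add (u4.mul_left (c^2))
    refine Eq.trans ?_ this.tsum_eq
    refine tsum_congr fun x => ?_
    ring
  have q1 := quad_abs κ hκ hG _ (hcF 1)
  have q2 := quad_abs κ hκ hG _ (hcF (-1))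
  rw [expand, expand2] at q1 q2
  rw [← ht] at q1 q2
  have q1' := (abs_le.mp q1).2
  have q2' := (abs_le.mp q2).1
  have e1 : ip (TT f) g = ip (TT f) (TT f) * t⁻¹ := by
    unfold ip; rw [← tsum_mul_right]; simp [hg, mul_assoc]
  have e2 : ip g g = ip (TT f) (TT f) * t⁻¹ ^ 2 := by
    unfold ip; rw [← tsum_mul_right]; refine tsum_congr fun x => ?_; simp only [hg]; ring
  rw [e1, e2] at q1' q2'
  set N := ip (TT f) (TT f)
  have h4 : 4 * (N * t⁻¹) ≤ 2 * t * (ip f f + N * t⁻¹ ^ 2) := by nlinarith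
  have h5 : t * (N * t⁻¹ ^ 2) = N * t⁻¹ := by field_simp
  have h6 : N * t⁻¹ ≤ t * ip f f := by nlinarith
  rw [← div_eq_mul_inv, div_le_iff₀ htp] at h6
  nlinarith

open Classical in
/-- delta function -/
noncomputable def dl {Y : Type*} (o : Y) : Y → ℝ := fun x => if x = o then 1 else 0

lemma dl_FS (o : X) : FS (dl o) := (Set.finite_singleton o).subset (by intro x hx; simpa [dl] using hx)

lemma iter_bound (κ : ℝ) (hκ : 0 < κ) (hκ1 : κ ≤ 1) (hG : Gap X κ) (o : X) (m : ℕ) :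
    (TT^[m] (dl o)) o ≤ (4 - κ ^ 2 / 32) ^ m := by
  set t := 4 - κ ^ 2 / 32 with ht
  have htp : 0 < t := by nlinarith
  have h : ∀ m, FS (TT^[m] (dl o)) ∧ ip (TT^[m] (dl o)) (TT^[m] (dl o)) ≤ (t ^ m) ^ 2 := by
    intro m
    induction m with
    | zero =>
      refine ⟨dl_FS o, ?_⟩
      simp only [iterate_zero, id, ip, pow_zero, one_pow]
      rw [tsum_eq_single o]
      · simp [dl]
      · intro x hx; simp [dl, hx]
    | succ m ih =>
      rw [iterate_succ_apply']
      refine ⟨ih.1.TT, (norm_TT κ hκ hκ1 hG _ ih.1).trans ?_⟩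
      rw [← ht]
      calc t ^ 2 * _ ≤ t ^ 2 * (t ^ m) ^ 2 := by gcongr; exact ih.2
        _ = _ := by ring
  obtain ⟨h1, h2⟩ := h m
  have h3 : (TT^[m] (dl o)) o * (TT^[m] (dl o)) o ≤ ip (TT^[m] (dl o)) (TT^[m] (dl o)) :=
    (h1.mul_right _).summable.le_tsum o (fun x _ => mul_self_nonneg _)
  exact abs_le_of_sq_le_sq' (by nlinarith) (by positivity) |>.2

lemma push (o : X) (m : ℕ) : ∀ (x : X) (W : Finset F2), (∀ w ∈ W, w • o = x) →
    ∑ w ∈ W, (TT^[m] (dl (1 : F2))) w ≤ (TT^[m] (dl o)) x := by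
  classical
  induction m with
  | zero =>
    intro x W hW
    simp only [iterate_zero, id]
    by_cases h1 : (1:F2) ∈ W
    · have : o = x := by simpa using hW 1 h1
      subst this
      rw [Finset.sum_eq_single (1:F2)]
      · simp [dl]
      · intro b _ hb; simp [dl, hb]
      · intro h; exact absurd h1 h
    · have : ∑ w ∈ W, dl (1:F2) w = 0 := by
        apply Finset.sum_eq_zero
        intro w hw
        have : w ≠ 1 := by rintro rfl; exact h1 hw
        simp [dl, this]
      rw [this]
      unfold dl; split_ifs <;> norm_num
  | succ m ih =>
    intro x W hW
    simp only [iterate_succ_apply']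
    have : ∑ w ∈ W, TT (TT^[m] (dl (1:F2))) w = ∑ p, ∑ w ∈ W, (TT^[m] (dl (1:F2))) (lt p • w) := by
      unfold TT; rw [Finset.sum_comm]
    rw [this]
    change _ ≤ ∑ p, (TT^[m] (dl o)) (lt p • x)
    refine Finset.sum_le_sum fun p _ => ?_
    have h := ih (lt p • x) (W.image (fun w => lt p • w)) (by
      intro w' hw'
      obtain ⟨w, hw, rfl⟩ := Finset.mem_image.mp hw'
      rw [smul_assoc, hW w hw])
    rwa [Finset.sum_image (by intro a _ b _ h; exact MulAction.injective (lt p) h)] at h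

end
end WE

namespace WE
open Function

/-- word length -/
def wl (w : F2) : ℕ := w.toWord.length

lemma wl_one : wl 1 = 0 := by simp [wl]

lemma toWord_lt_mul (p : Fin 2 × Bool) (w : F2) : (lt p * w).toWord =
    List.casesOn w.toWord [p] fun hd tl => if p.1 = hd.1 ∧ p.2 = !hd.2 then tl else p :: hd :: tl := by
  have h1 : lt p * w = FreeGroup.mk (p :: w.toWord) := by
    conv_lhs => rw [← FreeGroup.mk_toWord (x := w)]
    simp [lt, FreeGroup.mul_mk]
  rw [h1, FreeGroup.toWord_mk, FreeGroup.reduce.cons, FreeGroup.reduce_toWord]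

lemma toWord_lt_one (p : Fin 2 × Bool) : (lt p * 1).toWord = [p] := by
  rw [toWord_lt_mul]; simp

lemma toWord_lt_cons (p hd : Fin 2 × Bool) (tl) (w : F2) (hw : w.toWord = hd :: tl) :
    (lt p * w).toWord = if p = (hd.1, !hd.2) then tl else p :: hd :: tl := by
  rw [toWord_lt_mul, hw]
  simp [Prod.ext_iff]

lemma wl_smul_cases (p : Fin 2 × Bool) (w : F2) : wl (lt p • w) = wl w + 1 ∨ wl (lt p • w) + 1 = wl w := by
  unfold wl
  rw [smul_eq_mul]
  rcases hw : w.toWord with _ | ⟨hd, tl⟩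
  · left; rw [toWord_lt_mul, hw]; simp
  · rw [toWord_lt_cons p hd tl w hw]; split_ifs <;> simp

/-- tree function -/
noncomputable def hz (z : ℝ) : F2 → ℝ := fun w => z ^ wl w

lemma TT_hz_one (z : ℝ) : TT (hz z) 1 = 4 * z := by
  unfold TT hz wl
  simp_rw [smul_eq_mul, toWord_lt_one]
  simp

lemma TT_hz_cons (z : ℝ) (w : F2) (n : ℕ) (hw : wl w = n + 1) :
    TT (hz z) w = z ^ n + 3 * z ^ (n + 2) := by
  rcases hw' : w.toWord with _ | ⟨hd, tl⟩
  · simp [wl, hw'] at hw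
  have htl : tl.length = n := by simpa [wl, hw'] using hw
  unfold TT hz wl
  simp_rw [smul_eq_mul, toWord_lt_cons _ hd tl w hw']
  rw [Fintype.sum_eq_add_sum_compl (hd.1, !hd.2)]
  rw [if_pos rfl, htl]
  congr 1
  rw [Finset.sum_congr rfl (g := fun _ => z ^ (n + 2))]
  · rw [Finset.sum_const, Finset.card_compl]
    simp
  · intro p hp
    rw [if_neg (by simpa using hp)]
    simp [htl]

lemma hz_eq (z : ℝ) (w : F2) : hz z w = z / (1 + 3 * z ^ 2) * TT (hz z) w +
    (1 - z ^ 2) / (1 + 3 * z ^ 2) * dl 1 w := by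
  have hp : (1 + 3 * z ^ 2) ≠ 0 := by positivity
  by_cases h : w = 1
  · subst h
    rw [TT_hz_one]
    simp [hz, wl, dl]
    field_simp
    ring
  · have : wl w ≠ 0 := by
      intro h0; apply h
      exact FreeGroup.toWord_eq_nil_iff.mp (List.length_eq_zero_iff.mp h0)
    obtain ⟨n, hn⟩ := Nat.exists_eq_succ_of_ne_zero this
    rw [TT_hz_cons z w n hn]
    simp [hz, dl, h, hn]
    field_simp
    ring

section
variable {X : Type*} [MulAction F2 X]

lemma TT_mono {f g : X → ℝ} (h : ∀ x, f x ≤ g x) (x : X) : TT f x ≤ TT g x :=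
  Finset.sum_le_sum fun _ _ => h _

lemma TT_iter_mono {f g : X → ℝ} (h : ∀ x, f x ≤ g x) (m : ℕ) : ∀ x, (TT^[m] f) x ≤ (TT^[m] g) x := by
  induction m with
  | zero => simpa using h
  | succ m ih => simp only [iterate_succ_apply']; exact TT_mono ih

lemma TT_smul_add (a b : ℝ) (f g : X → ℝ) : TT (fun x => a * f x + b * g x) = fun x => a * TT f x + b * TT g x := by
  funext x; simp [TT, Finset.sum_add_distrib, Finset.mul_sum]

lemma TT_iter_smul_add (a b : ℝ) (f g : X → ℝ) (m : ℕ) :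
    TT^[m] (fun x => a * f x + b * g x) = fun x => a * (TT^[m] f) x + b * (TT^[m] g) x := by
  induction m with
  | zero => rfl
  | succ m ih => simp only [iterate_succ_apply', ih, TT_smul_add]
end

lemma hz_iter (z : ℝ) (M : ℕ) (w : F2) : hz z w =
    (1 - z ^ 2) / (1 + 3 * z ^ 2) * ∑ m ∈ Finset.range M, (z / (1 + 3 * z ^ 2)) ^ m * (TT^[m] (dl 1)) w +
      (z / (1 + 3 * z ^ 2)) ^ M * (TT^[M] (hz z)) w := by
  induction M with
  | zero => simp
  | succ M ih =>
    rw [ih, Finset.sum_range_succ]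
    have : (TT^[M] (hz z)) w = z / (1 + 3 * z ^ 2) * (TT^[M+1] (hz z)) w +
        (1 - z ^ 2) / (1 + 3 * z ^ 2) * (TT^[M] (dl 1)) w := by
      have h := funext (hz_eq z)
      conv_lhs => rw [h]
      rw [TT_iter_smul_add, iterate_succ_apply]
    rw [this]; ring

lemma TT_iter_hz_le (z : ℝ) (hz0 : 0 < z) (hz1 : z < 1) (M : ℕ) :
    ∀ w, (z / (1 + 3 * z ^ 2)) ^ M * (TT^[M] (hz z)) w ≤ hz z w := by
  intro w
  have h := hz_iter z M w
  have h0 : ∀ m, 0 ≤ (TT^[m] (dl (1:F2))) w := by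
    intro m
    have : (TT^[m] (fun _ : F2 => (0:ℝ))) w ≤ (TT^[m] (dl (1:F2))) w :=
      TT_iter_mono (fun x => by unfold dl; split_ifs <;> norm_num) m w
    have h2 : TT^[m] (fun _ : F2 => (0:ℝ)) = fun _ => 0 := by
      induction m with
      | zero => rfl
      | succ m ih => 
        rw [iterate_succ_apply]
        have : TT (fun _ : F2 => (0:ℝ)) = fun _ => 0 := by funext x; simp [TT]
        rw [this]
        apply ih
        exact TT_iter_mono (fun x => by unfold dl; split_ifs <;> norm_num) m w
    rw [h2] at this; exact this
  have h1 : 0 ≤ (1 - z ^ 2) / (1 + 3 * z ^ 2) * ∑ m ∈ Finset.range M, (z / (1 + 3 * z ^ 2)) ^ m * (TT^[m] (dl (1:F2))) w := by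
    apply mul_nonneg
    · apply div_nonneg <;> nlinarith
    · exact Finset.sum_nonneg fun m _ => mul_nonneg (by positivity) (h0 m)
  linarith

lemma wl_finite (n : ℕ) : {w : F2 | wl w = n}.Finite := by
  have : {w : F2 | wl w = n} = FreeGroup.toWord ⁻¹' {l | l.length = n} := rfl
  rw [this]
  exact (List.finite_length_eq _ n).preimage FreeGroup.toWord_injective.injOn

lemma sphere_ge (n : ℕ) : 3 ^ n ≤ {w : F2 | wl w = n}.ncard := by
  induction n with
  | zero =>
    simp only [pow_zero]
    exact (Set.ncard_pos (wl_finite 0)).mpr ⟨1, wl_one⟩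
  | succ n ih =>
    classical
    set S := (wl_finite n).toFinset with hS
    set S' := (wl_finite (n+1)).toFinset with hS'
    rw [Set.ncard_eq_toFinset_card _ (wl_finite _)] at ih ⊢
    have hsig : (S.sigma fun w => Finset.univ.filter fun p => wl (lt p • w) = n + 1).card ≤ S'.card := by
      apply Finset.card_le_card_of_injOn (fun x => lt x.2 • x.1)
      · rintro ⟨w, p⟩ h
        simp [hS, hS'] at h ⊢
        exact h.2
      · rintro ⟨w, p⟩ h ⟨w', p'⟩ h' e
        simp [hS] at h h' e
        have key : ∀ (p) (w : F2), wl w = n → wl (lt p * w) = n + 1 → (lt p * w).toWord = p :: w.toWord := by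
          intro p w h1 h2
          rcases hw' : w.toWord with _ | ⟨hd, tl⟩
          · rw [toWord_lt_mul, hw']
          · have := toWord_lt_cons p hd tl w hw'
            rw [this]
            unfold wl at h1 h2
            rw [this] at h2
            split_ifs at h2 ⊢ with h3
            · rw [hw'] at h1; simp at h1; omega
            · rfl
        have k1 := key p w h.1 h.2
        have k2 := key p' w' h'.1 h'.2
        rw [e, k2] at k1
        simp at k1
        have : w = w' := k1.2.symm
        rw [this, ← k1.1]
    rw [Finset.card_sigma] at hsig
    have h3 : ∀ w ∈ S, 3 ≤ (Finset.univ.filter fun p => wl (lt p • w) = n + 1).card := by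
      intro w hw
      have hw : wl w = n := by simpa [hS] using hw
      rcases hw' : w.toWord with _ | ⟨hd, tl⟩
      · have : (Finset.univ.filter fun p => wl (lt p • w) = n + 1) = Finset.univ := by
          ext p; simp
          unfold wl at *; rw [toWord_lt_mul, hw']; rw [hw'] at hw; simp at hw ⊢; exact hw.symm
        rw [this]; simp
      · have : Finset.univ.erase (hd.1, !hd.2) ⊆ (Finset.univ.filter fun p => wl (lt p • w) = n + 1) := by
          intro p hp
          simp at hp ⊢
          unfold wl at *; rw [toWord_lt_cons p hd tl w hw', if_neg hp]
          rw [hw'] at hw; simp at hw ⊢; exact hw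
        have := Finset.card_le_card this
        rw [Finset.card_erase_of_mem (Finset.mem_univ _)] at this
        simpa using this
    have := Finset.sum_le_sum h3
    rw [Finset.sum_const, smul_eq_mul] at this
    calc 3 ^ (n+1) = 3 ^ n * 3 := pow_succ _ _
      _ ≤ S.card * 3 := by gcongr
      _ ≤ _ := this.trans hsig

theorem cogrowth (κ : ℝ) (hκ : 0 < κ) (hκ1 : κ ≤ 1) : ∃ C τ : ℝ, 0 < C ∧ 0 < τ ∧
    ∀ (X : Type) [MulAction F2 X] (o : X), Gap X κ → ∀ n : ℕ,
      ({w : F2 | wl w = n ∧ w • o = o}.ncard : ℝ) ≤ C * Real.exp (-τ * n) * {w : F2 | wl w = n}.ncard := by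
  set η : ℝ := κ ^ 2 / 128 with hη
  have hη0 : 0 < η := by positivity
  have hη1 : η ≤ 1 / 128 := by rw [hη]; nlinarith
  refine ⟨η⁻¹ ^ 2, Real.log (1 + η), by positivity, Real.log_pos (by linarith), ?_⟩
  intro X _ o hG n
  set z : ℝ := (1 + η) / 3 with hzd
  have hz0 : 0 < z := by positivity
  have hz1 : z ≤ 1 / 2 := by rw [hzd]; linarith
  set s : ℝ := z / (1 + 3 * z ^ 2) with hs
  have hs0 : 0 < s := by positivity
  have hs1 : 4 * s ≤ 1 + η := by
    rw [hs, ← mul_div_assoc, div_le_iff₀ (by positivity), hzd]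
    nlinarith [mul_pos hη0 hη0, pow_pos hη0 3]
  set W := ((wl_finite n).subset (show {w : F2 | wl w = n ∧ w • o = o} ⊆ _ from fun w h => h.1)).toFinset with hW
  have hWm : ∀ w ∈ W, wl w = n ∧ w • o = o := fun w hw => by simpa [hW] using hw
  have hcard : {w : F2 | wl w = n ∧ w • o = o}.ncard = W.card := Set.ncard_eq_toFinset_card _ _
  have ht : 4 - κ ^ 2 / 32 = 4 * (1 - η) := by rw [hη]; ring
  set q : ℝ := s * (4 * (1 - η)) with hq
  have hq0 : 0 < q := by rw [hq]; apply mul_pos hs0; linarith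
  have hq1 : q ≤ 1 - η ^ 2 := by rw [hq]; nlinarith
  have hmain : ∀ M : ℕ, (W.card : ℝ) * z ^ n ≤ η⁻¹ ^ 2 + (s / (2 / 7)) ^ M * W.card := by
    intro M
    have h1 : (W.card : ℝ) * z ^ n = ∑ w ∈ W, hz z w := by
      rw [Finset.sum_congr rfl (g := fun _ => z ^ n)]
      · simp
      · intro w hw; simp [hz, (hWm w hw).1]
    rw [h1]
    have h2 : ∀ w ∈ W, hz z w ≤ ∑ m ∈ Finset.range M, s ^ m * (TT^[m] (dl 1)) w + (s / (2 / 7)) ^ M := by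
      intro w hw
      rw [hz_iter z M w]
      have hc0 : 0 ≤ (1 - z ^ 2) / (1 + 3 * z ^ 2) := by apply div_nonneg <;> nlinarith
      have hc1 : (1 - z ^ 2) / (1 + 3 * z ^ 2) ≤ 1 := by
        rw [div_le_one (by positivity)]; nlinarith
      have hnn : 0 ≤ ∑ m ∈ Finset.range M, s ^ m * (TT^[m] (dl 1)) w := by
        refine Finset.sum_nonneg fun m _ => mul_nonneg (by positivity) ?_
        have : ∀ m, ∀ w, 0 ≤ (TT^[m] (dl (1:F2))) w := by
          intro m
          induction m with
          | zero => intro w; simp only [iterate_zero, id]; unfold dl; split_ifs <;> norm_num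
          | succ m ih => intro w; rw [iterate_succ_apply']; exact Finset.sum_nonneg fun p _ => ih _
        exact this m w
      rw [← hs]
      have h3 : s ^ M * (TT^[M] (hz z)) w ≤ (s / (2 / 7)) ^ M := by
        have e1 := TT_iter_hz_le (1/2) (by norm_num) (by norm_num) M w
        have e2 : (TT^[M] (hz z)) w ≤ (TT^[M] (hz (1/2))) w :=
          TT_iter_mono (fun x => pow_le_pow_left₀ hz0.le hz1 _) M w
        have e3 : hz (1/2) w ≤ 1 := pow_le_one₀ (by norm_num) (by norm_num)
        have e4 : ((1:ℝ)/2 / (1 + 3 * (1/2) ^ 2)) = 2 / 7 := by norm_num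
        rw [e4] at e1
        rw [div_pow s, le_div_iff₀ (by positivity)]
        calc s ^ M * (TT^[M] (hz z)) w * (2/7) ^ M ≤ s ^ M * (TT^[M] (hz (1/2))) w * (2/7) ^ M := by gcongr
          _ = s ^ M * ((2/7) ^ M * (TT^[M] (hz (1/2))) w) := by ring
          _ ≤ s ^ M * 1 := by gcongr; exact e1.trans e3
          _ = _ := by ring
      have := mul_le_of_le_one_left hnn hc1
      linarith
    refine (Finset.sum_le_sum h2).trans ?_
    rw [Finset.sum_add_distrib, Finset.sum_const, nsmul_eq_mul, mul_comm (W.card : ℝ)]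
    gcongr
    rw [Finset.sum_comm]
    have h4 : ∀ m ∈ Finset.range M, ∑ w ∈ W, s ^ m * (TT^[m] (dl 1)) w ≤ q ^ m := by
      intro m _
      rw [← Finset.mul_sum, hq, mul_pow]
      gcongr
      refine (push o m o W fun w hw => (hWm w hw).2).trans ?_
      rw [← ht]
      exact iter_bound κ hκ hκ1 hG o m
    refine (Finset.sum_le_sum h4).trans ?_
    have h5 : ∑ m ∈ Finset.range M, q ^ m ≤ (1 - q)⁻¹ := by
      have hq1' : q < 1 := by nlinarith
      rw [← tsum_geometric_of_lt_one hq0.le hq1']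
      exact (summable_geometric_of_lt_one hq0.le hq1').sum_le_tsum _ (fun _ _ => by positivity)
    refine h5.trans ?_
    rw [inv_pow]
    apply inv_anti₀ (by positivity) (by linarith)
  have hlim : (W.card : ℝ) * z ^ n ≤ η⁻¹ ^ 2 := by
    have hr : s / (2/7) < 1 := by rw [div_lt_one (by norm_num)]; linarith
    have t := ((tendsto_pow_atTop_nhds_zero_of_lt_one (by positivity) hr).mul_const (W.card : ℝ)).const_add (η⁻¹ ^ 2)
    simp only [zero_mul, add_zero] at t
    exact ge_of_tendsto' t hmain
  rw [hcard]
  have h3 : (3:ℝ) ^ n ≤ ({w : F2 | wl w = n}.ncard : ℝ) := by exact_mod_cast sphere_ge n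
  have he : Real.exp (-Real.log (1 + η) * n) = ((1 + η) ^ n)⁻¹ := by
    rw [neg_mul, Real.exp_neg, mul_comm, Real.exp_nat_mul, Real.exp_log (by linarith)]
  rw [he]
  calc (W.card : ℝ) = (W.card * z ^ n) * (((1 + η) ^ n)⁻¹ * 3 ^ n) := by
        rw [hzd, div_pow]; field_simp
    _ ≤ η⁻¹ ^ 2 * (((1 + η) ^ n)⁻¹ * 3 ^ n) := by gcongr
    _ = η⁻¹ ^ 2 * ((1 + η) ^ n)⁻¹ * 3 ^ n := by ring
    _ ≤ _ := by gcongr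

end WE

namespace WE
open Function Filter Topology

/-- the ultrafilter -/
noncomputable abbrev UU : Ultrafilter ℕ := hyperfilter ℕ

lemma exists_ulim {E : Type*} [NormedAddCommGroup E] [ProperSpace E] (x : ℕ → E) (B : ℝ)
    (h : ∀ᶠ k in UU, ‖x k‖ ≤ B) : ∃ y, Tendsto x UU (𝓝 y) := by
  have hc : IsCompact (Metric.closedBall (0:E) B) := isCompact_closedBall 0 B
  have := hc.ultrafilter_le_nhds (UU.map x) (by
    rw [le_principal_iff]
    refine Ultrafilter.mem_map.mpr ?_
    filter_upwards [h] with k hk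
    simpa using hk)
  obtain ⟨y, _, hy⟩ := this
  exact ⟨y, hy⟩

/-- limit along the ultrafilter -/
noncomputable def ulim {E : Type*} [NormedAddCommGroup E] (x : ℕ → E) : E := 
  haveI : Nonempty E := ⟨0⟩
  lim (map x UU)

lemma ulim_eq {E : Type*} [NormedAddCommGroup E] {x : ℕ → E} {y : E} (h : Tendsto x UU (𝓝 y)) : ulim x = y := by
  haveI : Nonempty E := ⟨0⟩
  exact h.limUnder_eq

lemma tendsto_ulim {E : Type*} [NormedAddCommGroup E] [ProperSpace E] (x : ℕ → E) (B : ℝ)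
    (h : ∀ᶠ k in UU, ‖x k‖ ≤ B) : Tendsto x UU (𝓝 (ulim x)) := by
  obtain ⟨y, hy⟩ := exists_ulim x B h
  rwa [ulim_eq hy]

/-- invariant mean on a sequence of G-sets -/
structure InvMean (G : Type*) [Group G] (X : ℕ → Type) [∀ k, MulAction G (X k)] where
  μ : (∀ k, Set (X k)) → ℝ
  nonneg : ∀ E, 0 ≤ μ E
  add : ∀ E F, (∀ k, Disjoint (E k) (F k)) → μ (fun k => E k ∪ F k) = μ E + μ F
  univ : μ (fun _ => Set.univ) = 1
  inv : ∀ (g : G) E, μ (fun k => {x | g • x ∈ E k}) = μ E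
  null : ∀ E, (∀ᶠ k in UU, E k = ∅) → μ E = 0

open Classical in
theorem exists_invMean (X : ℕ → Type) [∀ k, MulAction F2 (X k)]
    (h : ∀ κ : ℝ, 0 < κ → ∀ᶠ k in UU, ¬ Gap (X k) κ) : Nonempty (InvMean F2 X) := by
  have hch : ∀ k, ∃ f : X k → ℝ, FS f ∧ (∀ x, 0 ≤ f x) ∧ ∑' x, f x ≤ 1 ∧
      ((∃ κ, ¬ Gap (X k) κ) → ∑' x, f x = 1 ∧ ∀ κ, ¬ Gap (X k) κ → defect f < κ + 1 / (k + 1)) := by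
    intro k
    by_cases hk : ∃ κ, ¬ Gap (X k) κ
    · set A := {r : ℝ | ∃ f : X k → ℝ, FS f ∧ (∀ x, 0 ≤ f x) ∧ ∑' x, f x = 1 ∧ defect f = r} with hA
      have hne : A.Nonempty := by
        obtain ⟨κ, hκ⟩ := hk
        unfold Gap at hκ
        push Not at hκ
        obtain ⟨f, h1, h2, h3, h4⟩ := hκ
        exact ⟨_, f, h1, h2, h3, rfl⟩
      obtain ⟨r, ⟨f, h1, h2, h3, h4⟩, hr⟩ := exists_lt_of_csInf_lt hne (show sInf A < sInf A + 1 / (k + 1) by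
        have : (0:ℝ) < 1 / (k + 1) := by positivity
        linarith)
      have hbdd : BddBelow A := ⟨0, by
        rintro r ⟨f, _, _, _, rfl⟩
        exact Finset.sum_nonneg fun p _ => tsum_nonneg fun x => abs_nonneg _⟩
      refine ⟨f, h1, h2, h3.le, fun _ => ⟨h3, ?_⟩⟩
      intro κ hκ
      rw [h4]
      unfold Gap at hκ
      push Not at hκ
      obtain ⟨f', h1', h2', h3', h4'⟩ := hκ
      have := csInf_le hbdd (show defect f' ∈ A from ⟨f', h1', h2', h3', rfl⟩)
      linarith
    · refine ⟨fun _ => 0, by simp [FS], by simp, by simp, fun h => absurd h hk⟩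
  choose ν hFS hnn hle hν using hch
  have hsum : ∀ k, Summable (ν k) := fun k => (hFS k).summable
  have hsumI : ∀ k (E : Set (X k)), Summable (E.indicator (ν k)) := fun k E => (hsum k).indicator E
  let m : (∀ k, Set (X k)) → ℕ → ℝ := fun E k => ∑' x, (E k).indicator (ν k) x
  have hm0 : ∀ E k, 0 ≤ m E k := fun E k => tsum_nonneg fun x => Set.indicator_nonneg (fun _ _ => hnn k _) x
  have hm1 : ∀ E k, m E k ≤ 1 := fun E k => 
    ((hsumI k (E k)).tsum_le_tsum (fun x => Set.indicator_le_self' (fun _ _ => hnn k _) x) (hsum k)).trans (hle k)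
  have ht : ∀ E, Tendsto (m E) UU (𝓝 (ulim (m E))) := fun E => tendsto_ulim _ 1
    (Eventually.of_forall fun k => by rw [Real.norm_eq_abs, abs_of_nonneg (hm0 E k)]; exact hm1 E k)
  have hlet : ∀ p E, ulim (m (fun k => {x | lt p • x ∈ E k})) = ulim (m E) := by
    intro p E
    have hd : Tendsto (fun k => m (fun k => {x | lt p • x ∈ E k}) k - m E k) UU (𝓝 0) := by
      rw [Metric.tendsto_nhds]
      intro ε hε
      have h1 := h (ε / 2) (by positivity)
      have h2 : ∀ᶠ k : ℕ in UU, (1:ℝ) / (k + 1) < ε / 2 := by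
        have := tendsto_one_div_add_atTop_nhds_zero_nat (𝕜 := ℝ)
        have h3 := (tendsto_order.mp this).2 (ε / 2) (by positivity)
        exact (Nat.hyperfilter_le_atTop) h3
      filter_upwards [h1, h2] with k hk1 hk2
      have hk3 := (hν k ⟨_, hk1⟩).2 _ hk1
      rw [dist_zero_right]
      refine lt_of_le_of_lt ?_ (show defect (ν k) < ε by linarith)
      let q : Fin 2 × Bool := (p.1, !p.2)
      have hq : lt q = (lt p)⁻¹ := lt_inv p
      have e1 : m (fun k => {x | lt p • x ∈ E k}) k = ∑' x, (E k).indicator (fun x => ν k (lt q • x)) x := by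
        change ∑' x, _ = _
        rw [← tsum_smul ((E k).indicator (fun x => ν k (lt q • x))) (lt p)]
        refine tsum_congr fun x => ?_
        simp only [Set.indicator, Set.mem_ofPred_eq, hq, inv_smul_smul]
      have s2 : Summable ((E k).indicator (fun x => ν k (lt q • x))) := ((hFS k).smul (lt q)).summable.indicator _
      have e2 : m (fun k => {x | lt p • x ∈ E k}) k - m E k =
          ∑' x, (E k).indicator (fun x => ν k (lt q • x) - ν k x) x := by
        rw [e1]
        change _ - ∑' x, _ = _
        rw [← s2.tsum_sub (hsumI k _)]
        refine tsum_congr fun x => ?_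
        simp only [Set.indicator]; split_ifs <;> simp
      rw [e2]
      have hF : FS (fun x => ν k (lt q • x) - ν k x) := ((hFS k).smul (lt q)).sub (hFS k)
      have hF2 : Summable (fun x => ‖(E k).indicator (fun x => ν k (lt q • x) - ν k x) x‖) := 
        (hF.summable.indicator (E k)).norm
      have hF3 : FS (fun x => |ν k (lt q • x) - ν k x|) := hF.comp (fun y => |y|) (by simp)
      refine (norm_tsum_le_tsum_norm hF2).trans ?_
      refine le_trans (hF2.tsum_le_tsum (g := fun x => |ν k (lt q • x) - ν k x|) ?_ hF3.summable) ?_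
      · intro x; simp only [Set.indicator]; split_ifs <;> simp
      · exact Finset.single_le_sum (f := fun p => ∑' x, |ν k (lt p • x) - ν k x|)
          (fun p _ => tsum_nonneg fun x => abs_nonneg _) (Finset.mem_univ q)
    have := hd.add (ht E)
    simp only [sub_add_cancel, zero_add] at this
    exact ulim_eq this
  refine ⟨{ μ := fun E => ulim (m E), nonneg := ?_, add := ?_, univ := ?_, inv := ?_, null := ?_ }⟩
  · intro E; exact ge_of_tendsto' (ht E) (hm0 E)
  · intro E F hd
    apply ulim_eq
    have := (ht E).add (ht F)
    refine this.congr fun k => ?_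
    change (∑' x, _) + (∑' x, _) = ∑' x, _
    rw [← (hsumI k _).tsum_add (hsumI k _)]
    refine tsum_congr fun x => ?_
    rw [Set.indicator_union_of_disjoint (hd k)]
  · apply ulim_eq
    refine tendsto_const_nhds.congr' ?_
    filter_upwards [h 1 one_pos] with k hk
    have := (hν k ⟨_, hk⟩).1
    change 1 = ∑' x, _
    simp [this]
  · intro g
    induction g using FreeGroup.induction_on with
    | C1 => intro E; simp
    | of i => exact hlet (i, true)
    | inv_of i _ =>
      have : (FreeGroup.of i)⁻¹ = lt (i, false) := by simp [FreeGroup.of, lt, FreeGroup.invRev]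
      intro E; exact hlet (i, false) E
    | mul x y hx hy =>
      intro E
      rw [← hx E, ← hy (fun k => {z | x • z ∈ E k})]
      simp only [Set.mem_ofPred_eq, smul_smul]
  · intro E hE
    apply ulim_eq
    refine tendsto_const_nhds.congr' ?_
    filter_upwards [hE] with k hk
    change 0 = ∑' x, _
    simp [hk]
end WE

namespace WE
open Matrix Polynomial
open scoped Pointwise

section
variable {ι : Type*} [Fintype ι] [DecidableEq ι] {K : Type*} [Field K]

/-- eigenvalue list -/
def HasEig (A : Matrix ι ι K) (l : ι → K) : Prop := A.charpoly = ∏ j, (X - C (l j))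

lemma exists_hasEig [IsAlgClosed K] (A : Matrix ι ι K) : ∃ l, HasEig A l := by
  have hs := IsAlgClosed.splits A.charpoly
  have h1 : A.charpoly = (A.charpoly.roots.map (fun a => X - C a)).prod := by
    have := hs.eq_prod_roots
    rw [A.charpoly_monic.leadingCoeff] at this
    simpa using this
  have hc : A.charpoly.roots.card = Fintype.card ι := by
    rw [← hs.natDegree_eq_card_roots, A.charpoly_natDegree_eq_dim]
  obtain ⟨L, hL⟩ : ∃ L : List K, (L : Multiset K) = A.charpoly.roots := ⟨_, Multiset.coe_toList _⟩
  have hlen : L.length = Fintype.card ι := by rw [← hc, ← hL]; rfl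
  let e : ι ≃ Fin L.length := (Fintype.equivFin ι).trans (finCongr hlen.symm)
  refine ⟨fun j => L.get (e j), ?_⟩
  unfold HasEig
  rw [h1, ← hL]
  rw [e.prod_comp (fun i => X - C (L.get i))]
  rw [Multiset.map_coe, Multiset.prod_coe]
  conv_lhs => rw [← List.ofFn_get L, List.map_ofFn, List.prod_ofFn]
  rfl

lemma HasEig.det_sub {A : Matrix ι ι K} {l : ι → K} (h : HasEig A l) (r : K) :
    (A - algebraMap K _ r).det = ∏ j, (l j - r) := by
  have h1 := congrArg (eval r) h
  rw [Matrix.eval_charpoly, eval_prod] at h1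
  simp only [eval_sub, eval_X, eval_C] at h1
  have : A - algebraMap K _ r = -(Matrix.scalar ι r - A) := by
    rw [neg_sub]; rfl
  rw [this, det_neg, h1, ← Finset.card_univ, ← Finset.prod_const, ← Finset.prod_mul_distrib]
  simp

lemma HasEig.det_aeval [IsAlgClosed K] {A : Matrix ι ι K} {l : ι → K} (h : HasEig A l) (p : K[X]) :
    (aeval A p).det = ∏ j, p.eval (l j) := by
  have hs := (IsAlgClosed.splits p).eq_prod_roots
  generalize p.roots = s at hs
  rw [hs]
  clear hs
  have key : ∀ s : Multiset K, (aeval A (s.map (fun a => X - C a)).prod).det = ∏ j, eval (l j) (s.map (fun a => X - C a)).prod := by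
    intro s
    induction s using Multiset.induction_on with
    | empty => simp
    | cons a s ih =>
      simp only [Multiset.map_cons, Multiset.prod_cons, map_mul, det_mul, ih, eval_mul, Finset.prod_mul_distrib]
      congr 1
      simp [h.det_sub a]
  rw [map_mul, det_mul, key]
  simp only [eval_mul, Finset.prod_mul_distrib]
  congr 1
  simp [algebraMap_eq_diagonal]

lemma HasEig.aeval [IsAlgClosed K] {A : Matrix ι ι K} {l : ι → K} (h : HasEig A l) (p : K[X]) :
    HasEig (Polynomial.aeval A p) (fun j => p.eval (l j)) := by
  unfold HasEig
  apply Polynomial.funext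
  intro t
  rw [Matrix.eval_charpoly, eval_prod]
  have : Matrix.scalar ι t - Polynomial.aeval A p = Polynomial.aeval A (C t - p) := by
    simp; rfl
  rw [this, h.det_aeval]
  simp

lemma HasEig.pow [IsAlgClosed K] {A : Matrix ι ι K} {l : ι → K} (h : HasEig A l) (n : ℕ) :
    HasEig (A ^ n) (fun j => l j ^ n) := by
  have := h.aeval (X ^ n)
  simpa using this

lemma HasEig.det {A : Matrix ι ι K} {l : ι → K} (h : HasEig A l) : A.det = ∏ j, l j := by
  have := h.det_sub 0
  simpa using this

lemma HasEig.trace [IsAlgClosed K] {A : Matrix ι ι K} {l : ι → K} (h : HasEig A l) : A.trace = ∑ j, l j := by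
  rw [Matrix.trace_eq_sum_roots_charpoly, h]
  rw [roots_prod _ _ (Finset.prod_ne_zero_iff.mpr fun j _ => X_sub_C_ne_zero _)]
  simp [Multiset.bind_singleton]

lemma HasEig.prod_eq_zero {A : Matrix ι ι K} {l : ι → K} (h : HasEig A l) :
    Polynomial.aeval A (∏ j, (X - C (l j))) = 0 := by
  rw [← show A.charpoly = _ from h]; exact A.aeval_self_charpoly

/-- irreducibility -/
def Irr (S : Set (Matrix ι ι K)) : Prop :=
  ∀ W : Submodule K (ι → K), (∀ A ∈ S, ∀ v ∈ W, A *ᵥ v ∈ W) → W = ⊥ ∨ W = ⊤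

theorem burnside [IsAlgClosed K] [Nonempty ι] (M : Submonoid (Matrix ι ι K)) (hM : Irr (M : Set (Matrix ι ι K))) :
    Submodule.span K (M : Set (Matrix ι ι K)) = ⊤ := by
  set S := Submodule.span K (M : Set (Matrix ι ι K)) with hS
  have h1 : (1 : Matrix ι ι K) ∈ S := Submodule.subset_span M.one_mem
  have hmul : ∀ A ∈ S, ∀ B ∈ S, A * B ∈ S := by
    intro A hA B hB
    have := Submodule.mul_mem_mul hA hB
    rw [hS, Submodule.span_mul_span] at this
    have h2 : (M : Set (Matrix ι ι K)) * (M : Set (Matrix ι ι K)) = M := by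
      exact Submonoid.coe_mul_self_eq M
    rwa [h2] at this
  have hMS : ∀ A ∈ M, A ∈ S := fun A hA => Submodule.subset_span hA
  -- transitivity
  have htr : ∀ v : ι → K, v ≠ 0 → ∀ w, ∃ A ∈ S, A *ᵥ v = w := by
    intro v hv w
    let W : Submodule K (ι → K) := S.map (LinearMap.applyₗ v ∘ₗ (Matrix.toLin' : Matrix ι ι K ≃ₗ[K] _).toLinearMap)
    have hW : ∀ x, x ∈ W ↔ ∃ A ∈ S, A *ᵥ v = x := by
      intro x; simp [W, Submodule.mem_map]
    rcases hM W (by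
      intro A hA x hx
      obtain ⟨B, hB, rfl⟩ := (hW x).mp hx
      exact (hW _).mpr ⟨A * B, hmul _ (hMS A hA) _ hB, by simp⟩) with h | h
    · exfalso; apply hv
      have : v ∈ W := (hW v).mpr ⟨1, h1, by simp⟩
      rwa [h, Submodule.mem_bot] at this
    · exact (hW w).mp (h ▸ Submodule.mem_top)
  -- minimal rank
  obtain ⟨T, ⟨hTS, hT0⟩, hmin⟩ : ∃ T : Matrix ι ι K, (T ∈ S ∧ T ≠ 0) ∧ ∀ T', T' ∈ S → T' ≠ 0 → T.rank ≤ T'.rank := by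
    have hne : {T : Matrix ι ι K | T ∈ S ∧ T ≠ 0}.Nonempty := ⟨1, h1, one_ne_zero⟩
    obtain ⟨T, hT, hm⟩ := exists_minimalFor_of_wellFoundedLT (fun T : Matrix ι ι K => T ∈ S ∧ T ≠ 0) Matrix.rank hne
    refine ⟨T, hT, fun T' h1 h2 => ?_⟩
    by_contra h
    push Not at h
    exact absurd (hm ⟨h1, h2⟩ h.le) (not_le.mpr h)
  have hcol : ∃ x1, T *ᵥ x1 ≠ 0 := by
    by_contra h
    push Not at h
    apply hT0
    apply Matrix.toLin'.injective
    ext1 i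
    simp [LinearMap.ext_iff, h] 
  obtain ⟨x1, hx1⟩ := hcol
  have hrank1 : ∀ x2, ∃ c : K, T *ᵥ x2 = c • (T *ᵥ x1) := by
    by_contra hcon
    push Not at hcon
    obtain ⟨x2, hx2⟩ := hcon
    obtain ⟨A, hA, hAx⟩ := htr (T *ᵥ x1) hx1 x2
    -- eigenvalue of T*A on range T
    let R := LinearMap.range (Matrix.toLin' T)
    let f : R →ₗ[K] R := (Matrix.toLin' (T * A)).restrict (p := R) (q := R) (by
      rintro x _
      exact ⟨A *ᵥ x, by simp⟩)
    haveI : Nontrivial R := ⟨⟨⟨T *ᵥ x1, x1, rfl⟩, 0, by intro h; exact hx1 (congrArg Subtype.val h)⟩⟩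
    obtain ⟨c, hc⟩ := Module.End.exists_eigenvalue f
    obtain ⟨⟨y, x3, hy⟩, hyc⟩ := hc.exists_hasEigenvector
    have hyc1 := hyc.apply_eq_smul
    have hy0 := hyc.2
    have hyc2 : (T * A) *ᵥ y = c • y := by
      have := congrArg Subtype.val hyc1
      simpa [f] using this
    have hy00 : y ≠ 0 := by intro h; apply hy0; exact Subtype.ext h
    set T' := T * A * T - c • T with hT'
    have hT'S : T' ∈ S := S.sub_mem (hmul _ (hmul _ hTS _ hA) _ hTS) (S.smul_mem _ hTS)
    have hT'0 : T' ≠ 0 := by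
      intro h
      have : T' *ᵥ x1 = 0 := by rw [h]; simp
      rw [hT', sub_mulVec, ← mulVec_mulVec, ← mulVec_mulVec, hAx, smul_mulVec, sub_eq_zero] at this
      exact hx2 c this
    have := hmin T' hT'S hT'0
    have hlt : T'.rank < T.rank := by
      -- range T' = (TA - c) R, smaller
      rw [Matrix.rank, Matrix.rank]
      let g : R →ₗ[K] (ι → K) := (Matrix.toLin' (T * A - c • 1)).domRestrict R
      have hr : LinearMap.range T'.mulVecLin ≤ LinearMap.range g := by
        rintro _ ⟨x, rfl⟩
        refine ⟨⟨T *ᵥ x, x, rfl⟩, ?_⟩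
        simp [g, hT', sub_mulVec, smul_mulVec]
      have hk : 0 < Module.finrank K (LinearMap.ker g) := by
        haveI : Nontrivial (LinearMap.ker g) := by
         refine ⟨⟨⟨⟨y, x3, hy⟩, ?_⟩, 0, ?_⟩⟩
         · simp [g, sub_mulVec, smul_mulVec, hyc2]
         · intro h; exact hy0 (congrArg Subtype.val h)
        exact Module.finrank_pos (R := K) (M := LinearMap.ker g)
      have h5 := LinearMap.finrank_range_add_finrank_ker g
      have h6 := Submodule.finrank_mono hr
      have h7 : Module.finrank K R = Module.finrank K (LinearMap.range T.mulVecLin) := rfl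
      omega
    omega
  choose φ hφ using hrank1
  -- φ as linear functional (row vector)
  set u := T *ᵥ x1 with hu
  obtain ⟨i0, hi0⟩ : ∃ i, u i ≠ 0 := by
    by_contra h; push Not at h; exact hx1 (funext h)
  let r : ι → K := fun j => T i0 j / u i0
  have hTr : T = vecMulVec u r := by
    ext i j
    have h2 := hφ (Pi.single j 1)
    rw [mulVec_single_one] at h2
    have h3 := congrFun h2 i
    have h4 := congrFun h2 i0
    simp [Matrix.col] at h3 h4
    simp only [vecMulVec_apply, r, h3, h4]
    field_simp
  have hr0 : r ≠ 0 := by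
    intro h; apply hT0; rw [hTr, h]; simp
  -- every row
  have hrows : ∀ s : ι → K, ∃ B ∈ S, r ᵥ* B = s := by
    let D : Submodule K (ι → K) := 
      S.map ({ toFun := fun B => r ᵥ* B, map_add' := fun a b => by simp [vecMul_add], map_smul' := fun c a => by simp [vecMul_smul] } : Matrix ι ι K →ₗ[K] (ι → K))
    have hD : ∀ x, x ∈ D ↔ ∃ B ∈ S, r ᵥ* B = x := by intro x; simp [D, Submodule.mem_map]
    suffices D = ⊤ by intro s; exact (hD s).mp (this ▸ Submodule.mem_top)
    by_contra hne
    obtain ⟨f, hf0, hf⟩ := Submodule.exists_le_ker_of_lt_top D (lt_top_iff_ne_top.mpr hne)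
    let v : ι → K := fun i => f (Pi.single i 1)
    have hfv : ∀ x, f x = x ⬝ᵥ v := by
      intro x
      conv_lhs => rw [pi_eq_sum_univ' x]
      simp [dotProduct, v]
    have hv0 : v ≠ 0 := by
      intro h; apply hf0; ext1 i; ext; simp [hfv, h]
    obtain ⟨A, hA, hAv⟩ := htr v hv0 (Pi.single (Classical.choose (Function.ne_iff.mp hr0)) 1)
    have h8 := hf ((hD (r ᵥ* A)).mpr ⟨A, hA, rfl⟩)
    rw [LinearMap.mem_ker, hfv, ← dotProduct_mulVec, hAv] at h8
    have := Classical.choose_spec (Function.ne_iff.mp hr0)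
    simp at h8
    exact this h8
  rw [eq_top_iff]
  intro A _
  rw [Matrix.matrix_eq_sum_single A]
  refine S.sum_mem fun i _ => S.sum_mem fun j _ => ?_
  obtain ⟨B, hB, hBr⟩ := hrows (Pi.single j 1)
  obtain ⟨A', hA', hA'u⟩ := htr u hx1 (Pi.single i (A i j))
  have : Matrix.single i j (A i j) = A' * T * B := by
    rw [hTr, mul_vecMulVec, vecMulVec_mul, hBr, hA'u]
    ext a b
    simp [Matrix.single, vecMulVec_apply, Pi.single_apply]
    grind
  rw [this]
  exact hmul _ (hmul _ hA' _ hTS) _ hB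

lemma gram_ne_zero {κ : Type*} [Fintype κ] [DecidableEq κ] (w : κ → Matrix ι ι K) (hli : LinearIndependent K w)
    (hsp : Submodule.span K (Set.range w) = ⊤) : (Matrix.of fun p q => (w p * w q).trace).det ≠ 0 := by
  intro h0
  obtain ⟨c, hc, hc2⟩ := Matrix.exists_mulVec_eq_zero_iff.mpr h0
  set Y := ∑ q, c q • w q with hY
  have h1 : ∀ p, (w p * Y).trace = 0 := by
    intro p
    have := congrFun hc2 p
    simp [mulVec, dotProduct] at this
    rw [hY, Finset.mul_sum, trace_sum, ← this]
    refine Finset.sum_congr rfl fun q _ => ?_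
    simp [mul_comm]
  have h2 : ∀ A : Matrix ι ι K, (A * Y).trace = 0 := by
    intro A
    have hA : A ∈ Submodule.span K (Set.range w) := hsp ▸ Submodule.mem_top
    induction hA using Submodule.span_induction with
    | mem x hx => obtain ⟨p, rfl⟩ := hx; exact h1 p
    | zero => simp
    | add x y _ _ hx hy => simp [add_mul, hx, hy]
    | smul a x _ hx => simp [hx]
  have hY0 : Y = 0 := by
    ext i j
    have := h2 (Matrix.single j i 1)
    rw [Matrix.trace_single_mul] at this
    simpa using this
  apply hc
  funext q
  exact Fintype.linearIndependent_iff.mp hli c hY0 q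

lemma span_of_gram [Nonempty ι] {κ : Type*} [Fintype κ] [DecidableEq κ] (w : κ → Matrix ι ι K)
    (hcard : Fintype.card κ = Fintype.card ι * Fintype.card ι)
    (h0 : (Matrix.of fun p q => (w p * w q).trace).det ≠ 0) : Submodule.span K (Set.range w) = ⊤ := by
  have hli : LinearIndependent K w := by
    rw [Fintype.linearIndependent_iff]
    intro c hc
    by_contra hne
    push Not at hne
    apply h0
    apply Matrix.exists_mulVec_eq_zero_iff.mp
    refine ⟨c, fun h => ?_, ?_⟩
    · obtain ⟨i, hi⟩ := hne; exact hi (congrFun h i)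
    · funext p
      have : (w p * ∑ q, c q • w q).trace = 0 := by rw [hc]; simp
      rw [Finset.mul_sum, trace_sum] at this
      simp only [mulVec, dotProduct, of_apply, Pi.zero_apply]
      rw [← this]
      refine Finset.sum_congr rfl fun q _ => ?_
      simp [mul_comm]
  haveI : Nonempty κ := by
    rw [← Fintype.card_pos_iff, hcard]; have := Fintype.card_pos (α := ι); positivity
  apply LinearIndependent.span_eq_top_of_card_eq_finrank hli
  rw [hcard, Module.finrank_matrix]; simp

/-- a spanning set leaves no proper subspace invariant -/
lemma irr_of_span (S : Set (Matrix ι ι K)) (h : Submodule.span K S = ⊤) : Irr S := by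
  intro W hW
  have h2 : ∀ A : Matrix ι ι K, ∀ v ∈ W, A *ᵥ v ∈ W := by
    intro A
    have hA : A ∈ Submodule.span K S := h ▸ Submodule.mem_top
    induction hA using Submodule.span_induction with
    | mem x hx => exact hW x hx
    | zero => simp
    | add x y _ _ hx hy => intro v hv; rw [add_mulVec]; exact W.add_mem (hx v hv) (hy v hv)
    | smul a x _ hx => intro v hv; rw [smul_mulVec]; exact W.smul_mem _ (hx v hv)
  by_cases hb : W = ⊥
  · left; exact hb
  right
  obtain ⟨v, hv, hv0⟩ := W.exists_mem_ne_zero_of_ne_bot hb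
  obtain ⟨i, hi⟩ := Function.ne_iff.mp hv0
  rw [eq_top_iff]
  intro x _
  have : x = (vecMulVec x (Pi.single i (v i)⁻¹)) *ᵥ v := by
    rw [vecMulVec_mulVec]
    have : (Pi.single i (v i)⁻¹ : ι → K) ⬝ᵥ v = 1 := by
      simp [inv_mul_cancel₀ (show v i ≠ 0 from hi)]
    rw [this]; simp
  rw [this]; exact h2 _ v hv
end
end WE

namespace WE
open Matrix

/-- intersection of kernels of all homomorphisms to the symmetric group on M letters -/
def Kd (G : Type*) [Group G] (M : ℕ) : Subgroup G := ⨅ f : G →* Equiv.Perm (Fin M), f.ker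

lemma Kd_perm {G : Type*} [Group G] {M : ℕ} {Ω : Type*} [Finite Ω] (h : Nat.card Ω ≤ M)
    (f : G →* Equiv.Perm Ω) : Kd G M ≤ f.ker := by
  classical
  haveI := Fintype.ofFinite Ω
  obtain ⟨e⟩ : Nonempty (Ω ↪ Fin M) := by
    apply Function.Embedding.nonempty_of_card_le
    rw [← Nat.card_eq_fintype_card]; simpa using h
  intro g hg
  have h1 := (Subgroup.mem_iInf.mp hg) ((Equiv.Perm.viaEmbeddingHom e).comp f)
  rw [MonoidHom.mem_ker] at h1 ⊢
  apply Equiv.Perm.viaEmbeddingHom_injective e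
  simpa using h1

lemma Kd_le {G : Type*} [Group G] {M : ℕ} (H : Subgroup G) (hH : H.index ≠ 0) (h : H.index ≤ M) : Kd G M ≤ H := by
  haveI : H.FiniteIndex := ⟨hH⟩
  have h1 := Kd_perm (G := G) (Ω := G ⧸ H) (M := M) (by simpa [Subgroup.index] using h) (MulAction.toPermHom G (G ⧸ H))
  intro g hg
  have h2 := h1 hg
  rw [MonoidHom.mem_ker] at h2
  have h3 := Equiv.ext_iff.mp h2 ((1 : G) : G ⧸ H)
  simp at h3
  have : ((g : G) : G ⧸ H) = ((1 : G) : G ⧸ H) := by simpa [MulAction.Quotient.smul_coe] using h3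
  rw [QuotientGroup.eq] at this
  simpa using this

lemma finite_hom {G : Type*} [Group G] [Group.FG G] (P : Type*) [Group P] [Finite P] : Finite (G →* P) := by
  obtain ⟨S, hS⟩ := (Group.fg_def (G := G)).mp inferInstance
  apply Finite.of_injective (fun (f : G →* P) (s : S) => f s)
  intro f g h
  refine MonoidHom.eq_of_eqOn_dense hS ?_
  intro s hs
  exact congrFun h ⟨s, hs⟩

lemma Kd_finiteIndex (G : Type*) [Group G] [Group.FG G] (M : ℕ) : (Kd G M).FiniteIndex := by
  haveI := finite_hom (G := G) (Equiv.Perm (Fin M))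
  unfold Kd
  haveI : ∀ f : G →* Equiv.Perm (Fin M), f.ker.FiniteIndex := fun f => inferInstance
  exact Subgroup.finiteIndex_iInf inferInstance

lemma Kd_anti {G : Type*} [Group G] {M M' : ℕ} (h : M ≤ M') : Kd G M' ≤ Kd G M := by
  apply le_iInf
  intro f
  exact Kd_perm (by simpa using h) f

section
variable {ι : Type*} [Fintype ι] [DecidableEq ι] {F : Type*} [Field F] {G : Type*} [Group G]

/-- image of a subspace by a matrix -/
def sm (A : Matrix ι ι F) (W : Submodule F (ι → F)) : Submodule F (ι → F) := W.map (toLin' A)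

lemma sm_mul (A B : Matrix ι ι F) (W) : sm (A * B) W = sm A (sm B W) := by
  unfold sm; rw [toLin'_mul, Submodule.map_comp]
lemma sm_one (W : Submodule F (ι → F)) : sm 1 W = W := by
  unfold sm; rw [toLin'_one]; simp
lemma sm_mono (A : Matrix ι ι F) {W W'} (h : W ≤ W') : sm A W ≤ sm A W' := Submodule.map_mono h

lemma submodule_le_or {V : Type*} [AddCommGroup V] [Module F V] (W U1 U2 : Submodule F V)
    (h : ∀ v ∈ W, v ∈ U1 ∨ v ∈ U2) : W ≤ U1 ∨ W ≤ U2 := by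
  by_contra hcon
  push Not at hcon
  obtain ⟨a, ha, ha1⟩ := SetLike.not_le_iff_exists.mp hcon.1
  obtain ⟨b, hb, hb1⟩ := SetLike.not_le_iff_exists.mp hcon.2
  have ha2 := (h a ha).resolve_left ha1
  have hb2 := (h b hb).resolve_right hb1
  rcases h (a + b) (W.add_mem ha hb) with h' | h'
  · exact ha1 ((U1.add_mem_iff_left hb2).mp h')
  · exact hb1 ((U2.add_mem_iff_right ha2).mp h')

theorem tree_lemma (τ : G →* Matrix ι ι F) (U1 U2 : Submodule F (ι → F)) (h1 : U1 ≠ ⊤) (h2 : U2 ≠ ⊤)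
    (v : ι → F) (hv : v ≠ 0) (hvU : ∀ h : G, τ h *ᵥ v ∈ U1 ∨ τ h *ᵥ v ∈ U2) :
    ∃ W : Submodule F (ι → F), W ≠ ⊥ ∧ W ≠ ⊤ ∧
      ∀ g ∈ Kd G (2 ^ Fintype.card ι), ∀ x ∈ W, τ g *ᵥ x ∈ W := by
  classical
  let good : Submodule F (ι → F) → Prop := fun W => ∀ x ∈ W, ∀ h : G, τ h *ᵥ x ∈ U1 ∨ τ h *ᵥ x ∈ U2
  have hcover : ∀ n : ℕ, ∀ W : Submodule F (ι → F), Module.finrank F W ≤ n →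
      ∃ T : Finset (Submodule F (ι → F)), T.card ≤ 2 ^ n ∧ (∀ W' ∈ T, good W') ∧
        ∀ W' ≤ W, good W' → ∃ W'' ∈ T, W' ≤ W'' := by
    intro n
    induction n with
    | zero =>
      intro W hW
      have : W = ⊥ := Submodule.finrank_eq_zero.mp (by omega)
      subst this
      refine ⟨{⊥}, by simp, ?_, ?_⟩
      · intro W' hW'; simp at hW'; subst hW'; intro x hx h; simp at hx; subst hx; left; simp
      · intro W' hW' _; exact ⟨⊥, by simp, hW'⟩
    | succ n ih =>
      intro W hW
      by_cases hg : good W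
      · refine ⟨{W}, by simpa using Nat.one_le_two_pow, by simpa using hg, ?_⟩
        intro W' hW' _; exact ⟨W, by simp, hW'⟩
      · simp only [good] at hg
        push Not at hg
        obtain ⟨x, hx, h, hh1, hh2⟩ := hg
        have hlt : ∀ U : Submodule F (ι → F), τ h *ᵥ x ∉ U → Module.finrank F ↥(W ⊓ U.comap (toLin' (τ h))) ≤ n := by
          intro U hU
          have : W ⊓ U.comap (toLin' (τ h)) < W := by
            refine lt_of_le_of_ne inf_le_left ?_
            intro he
            have : x ∈ W ⊓ U.comap (toLin' (τ h)) := by rw [he]; exact hx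
            exact hU (by simpa using this.2)
          have := Submodule.finrank_lt_finrank_of_lt this
          omega
        obtain ⟨T1, c1, g1, k1⟩ := ih _ (hlt U1 hh1)
        obtain ⟨T2, c2, g2, k2⟩ := ih _ (hlt U2 hh2)
        refine ⟨T1 ∪ T2, ?_, ?_, ?_⟩
        · have := Finset.card_union_le T1 T2
          rw [pow_succ]; omega
        · intro W' hW'
          rcases Finset.mem_union.mp hW' with h | h
          · exact g1 _ h
          · exact g2 _ h
        · intro W' hW' hgW'
          rcases submodule_le_or W' (U1.comap (toLin' (τ h))) (U2.comap (toLin' (τ h))) (by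
            intro y hy; simpa using hgW' y hy h) with hh | hh
          · obtain ⟨W'', m1, m2⟩ := k1 W' (le_inf hW' hh) hgW'
            exact ⟨W'', Finset.mem_union_left _ m1, m2⟩
          · obtain ⟨W'', m1, m2⟩ := k2 W' (le_inf hW' hh) hgW'
            exact ⟨W'', Finset.mem_union_right _ m1, m2⟩
  obtain ⟨T, hTc, hTg, hT⟩ := hcover (Fintype.card ι) ⊤ (by simp)
  let mx : Set (Submodule F (ι → F)) := {W | Maximal good W}
  have hmxT : mx ⊆ (T : Set (Submodule F (ι → F))) := by
    intro W hW
    obtain ⟨W'', m1, m2⟩ := hT W le_top hW.1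
    have := hW.2 (hTg _ m1) m2
    rw [le_antisymm m2 this]; exact m1
  have hgood_sm : ∀ (g : G) W, good W → good (sm (τ g) W) := by
    intro g W hW x hx h
    obtain ⟨y, hy, rfl⟩ := Submodule.mem_map.mp hx
    have := hW y hy (h * g)
    simpa [map_mul, mulVec_mulVec] using this
  have hinv : ∀ (g : G) W, sm (τ g⁻¹) (sm (τ g) W) = W := by
    intro g W; rw [← sm_mul, ← map_mul]; simp [sm_one]
  have hinv' : ∀ (g : G) W, sm (τ g) (sm (τ g⁻¹) W) = W := by
    intro g W; rw [← sm_mul, ← map_mul]; simp [sm_one]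
  have hmx_sm : ∀ (g : G) W, W ∈ mx → sm (τ g) W ∈ mx := by
    intro g W hW
    refine ⟨hgood_sm g W hW.1, ?_⟩
    intro W' hW' hle
    have h3 := hW.2 (hgood_sm g⁻¹ W' hW') (by
      have := sm_mono (τ g⁻¹) hle
      rwa [hinv] at this)
    have := sm_mono (τ g) h3
    rwa [hinv'] at this
  letI act : MulAction G mx :=
    { smul := fun g W => ⟨sm (τ g) W.1, hmx_sm g W.1 W.2⟩
      one_smul := fun W => Subtype.ext (by change sm (τ 1) W.1 = W.1; simp [sm_one])
      mul_smul := fun g h W => Subtype.ext (by change sm (τ (g * h)) W.1 = sm (τ g) (sm (τ h) W.1); rw [map_mul, sm_mul]) }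
  have hfin : mx.Finite := T.finite_toSet.subset hmxT
  haveI : Finite mx := hfin
  have hcard : Nat.card mx ≤ 2 ^ Fintype.card ι := by
    have := Set.ncard_le_ncard hmxT T.finite_toSet
    rw [Set.ncard_coe_finset] at this
    exact this.trans hTc
  have hK := Kd_perm hcard (MulAction.toPermHom G mx)
  -- maximal element above span v
  have hspan : good (Submodule.span F {v}) := by
    intro x hx h
    obtain ⟨c, rfl⟩ := Submodule.mem_span_singleton.mp hx
    rw [mulVec_smul]
    rcases hvU h with h' | h'
    · left; exact U1.smul_mem _ h'
    · right; exact U2.smul_mem _ h'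
  obtain ⟨W0, hW0T, hW0⟩ := hT _ le_top hspan
  obtain ⟨W, hle, hW⟩ : ∃ W, Submodule.span F {v} ≤ W ∧ Maximal good W := by
    obtain ⟨W, hW1, hW2⟩ := exists_maximal_ge_of_wellFoundedGT good _ hspan
    exact ⟨W, hW1, hW2⟩
  refine ⟨W, ?_, ?_, ?_⟩
  · rintro rfl
    have : v ∈ (⊥ : Submodule F (ι → F)) := hle (Submodule.mem_span_singleton_self v)
    exact hv (by simpa using this)
  · rintro rfl
    rcases submodule_le_or ⊤ U1 U2 (by intro x hx; simpa using hW.1 x hx 1) with h | h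
    · exact h1 (top_le_iff.mp h)
    · exact h2 (top_le_iff.mp h)
  · intro g hg x hx
    have h3 := hK hg
    rw [MonoidHom.mem_ker] at h3
    have h4 := Equiv.ext_iff.mp h3 ⟨W, hW⟩
    have h5 : sm (τ g) W = W := congrArg Subtype.val h4
    have : τ g *ᵥ x ∈ sm (τ g) W := Submodule.mem_map.mpr ⟨x, hx, by simp⟩
    rwa [h5] at this
end
end WE

namespace WE
open Polynomial

abbrev LL := AlgebraicClosure ℚ

instance instIntLL : Algebra.IsIntegral ℚ LL := by
  have h : @Algebra.IsAlgebraic ℚ LL _ _ (AlgebraicClosure.instAlgebra (k := ℚ)) := AlgebraicClosure.isAlgebraic ℚ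
  have e : (DivisionRing.toRatAlgebra : Algebra ℚ LL) = AlgebraicClosure.instAlgebra (k := ℚ) := Subsingleton.elim _ _
  have h2 : @Algebra.IsAlgebraic ℚ LL _ _ DivisionRing.toRatAlgebra := by rw [e]; exact h
  exact h2.isIntegral

lemma embed_root {E : Type*} [Field E] [CharZero E] [IsAlgClosed E] (x : LL) (r : E)
    (hr : r ∈ ((minpoly ℚ x).map (Rat.castHom E)).roots) : ∃ τ : LL →+* E, τ x = r := by
  letI : Algebra ℚ E := (Rat.castHom E).toAlgebra
  have h : aeval r (minpoly ℚ x) = 0 := by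
    rw [aeval_def, ← eval_map]
    exact (mem_roots'.mp hr).2
  obtain ⟨φ, hφ⟩ := IntermediateField.exists_algHom_of_splits_of_aeval (F := ℚ) (E := LL) (K := E)
    (fun s => ⟨Algebra.IsIntegral.isIntegral s, IsAlgClosed.splits _⟩) h
  exact ⟨φ.toRingHom, hφ⟩

lemma map_eq_prod {E : Type*} [Field E] [CharZero E] [IsAlgClosed E] (x : LL) :
    (minpoly ℚ x).map (Rat.castHom E) =
      ((((minpoly ℚ x).map (Rat.castHom E)).roots).map (fun a => X - C a)).prod := by
  have hm : ((minpoly ℚ x).map (Rat.castHom E)).Monic := (minpoly.monic (Algebra.IsIntegral.isIntegral x)).map _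
  have := (IsAlgClosed.splits ((minpoly ℚ x).map (Rat.castHom E))).eq_prod_roots
  rw [hm.leadingCoeff] at this
  simpa using this

lemma mprod_lt_one (s : Multiset ℂ) (hs : s ≠ 0) (h : ∀ a ∈ s, ‖a‖ < 1) : ‖s.prod‖ < 1 := by
  induction s using Multiset.induction_on with
  | empty => exact absurd rfl hs
  | cons a s ih =>
    rw [Multiset.prod_cons, norm_mul]
    by_cases hs0 : s = 0
    · subst hs0; simpa using h a (by simp)
    · have h1 := ih hs0 (fun b hb => h b (by simp [hb]))
      have h2 := h a (by simp)
      nlinarith [norm_nonneg a, norm_nonneg s.prod]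

theorem place_lemma (x : LL) (hx : x ≠ 0) : (∃ τ : LL →+* ℂ, 1 ≤ ‖τ x‖) ∨
    ∃ v : AbsoluteValue LL ℝ, IsNonarchimedean v ∧ 1 < v x := by
  have hmon := minpoly.monic (Algebra.IsIntegral.isIntegral (R := ℚ) x)
  by_cases hint : ∀ i, ((minpoly ℚ x).coeff i).den = 1
  · left
    have hc0 : (minpoly ℚ x).coeff 0 ≠ 0 := minpoly.coeff_zero_ne_zero (Algebra.IsIntegral.isIntegral x) hx
    by_contra hcon
    push Not at hcon
    have h1 : ∀ r ∈ ((minpoly ℚ x).map (Rat.castHom ℂ)).roots, ‖r‖ < 1 := by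
      intro r hr
      obtain ⟨τ, hτ⟩ := embed_root x r hr
      rw [← hτ]; exact hcon τ
    have hdeg := minpoly.natDegree_pos (Algebra.IsIntegral.isIntegral (R := ℚ) x)
    have hr0 : ((minpoly ℚ x).map (Rat.castHom ℂ)).roots ≠ 0 := by
      intro h
      have := (IsAlgClosed.splits ((minpoly ℚ x).map (Rat.castHom ℂ))).natDegree_eq_card_roots
      rw [h, natDegree_map] at this
      simp at this; omega
    have h2 := mprod_lt_one _ hr0 h1
    have h3 := congrArg (fun p => ‖p.coeff 0‖) (map_eq_prod (E := ℂ) x)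
    simp only [coeff_map] at h3
    rw [coeff_zero_eq_eval_zero (Multiset.prod _), eval_multiset_prod, Multiset.map_map] at h3
    have h4 : ∀ s : Multiset ℂ, ‖(s.map (eval 0 ∘ fun a => X - C a)).prod‖ = ‖s.prod‖ := by
      intro s
      induction s using Multiset.induction_on with
      | empty => simp
      | cons a s ih => simp only [Multiset.map_cons, Multiset.prod_cons, norm_mul, ih]; simp
    rw [h4] at h3
    have h5 : (1:ℝ) ≤ ‖(Rat.castHom ℂ) ((minpoly ℚ x).coeff 0)‖ := by
      have e := hint 0
      set q := (minpoly ℚ x).coeff 0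
      have : q = (q.num : ℚ) := (Rat.den_eq_one_iff q).mp e |>.symm
      rw [this]
      have hn : q.num ≠ 0 := Rat.num_ne_zero.mpr hc0
      simp only [eq_ratCast, Rat.cast_intCast, Complex.norm_intCast]
      exact_mod_cast Int.one_le_abs hn
    linarith
  · right
    push Not at hint
    obtain ⟨i, hi⟩ := hint
    obtain ⟨p, hp, hpd⟩ := Nat.exists_prime_and_dvd hi
    haveI : Fact p.Prime := ⟨hp⟩
    set q := (minpoly ℚ x).coeff i with hq
    have hqn : 1 < ‖(q : ℚ_[p])‖ := by
      by_contra h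
      push Not at h
      have h2 : ‖((q.den : ℤ) : ℚ_[p])‖ < 1 := by
        rw [Padic.norm_intCast_lt_one_iff]; exact_mod_cast hpd
      have hden : (q.den : ℚ_[p]) ≠ 0 := by exact_mod_cast q.den_ne_zero
      have h3 : ((q.num : ℤ) : ℚ_[p]) = (q : ℚ_[p]) * ((q.den : ℤ) : ℚ_[p]) := by
        have := Rat.mul_den_eq_num q
        have h := congrArg (Rat.cast : ℚ → ℚ_[p]) this
        push_cast at h ⊢
        exact h.symm
      have h4 : ‖((q.num : ℤ) : ℚ_[p])‖ < 1 := by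
        rw [h3, norm_mul]
        nlinarith [norm_nonneg (q : ℚ_[p]), norm_nonneg ((q.den : ℤ) : ℚ_[p])]
      rw [Padic.norm_intCast_lt_one_iff] at h4
      have hcop := q.reduced
      have : p ∣ q.num.natAbs := Int.natCast_dvd.mp h4
      have := Nat.dvd_gcd this hpd
      rw [hcop] at this
      exact hp.one_lt.ne' (Nat.dvd_one.mp this)
    have hroot : ∃ r ∈ ((minpoly ℚ x).map (Rat.castHom (PadicAlgCl p))).roots, 1 < ‖r‖ := by
      by_contra hcon
      push Not at hcon
      let O : Subring (PadicAlgCl p) :=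
        { carrier := {a | ‖a‖ ≤ 1}
          mul_mem' := by
            intro a b ha hb
            simp only [Set.mem_ofPred_eq, norm_mul] at *
            exact mul_le_one₀ ha (norm_nonneg _) hb
          one_mem' := by simp
          add_mem' := by
            intro a b ha hb
            exact (PadicAlgCl.isNonarchimedean p a b).trans (max_le ha hb)
          zero_mem' := by simp
          neg_mem' := by intro a ha; simpa using ha }
      have hl : (((minpoly ℚ x).map (Rat.castHom (PadicAlgCl p)))) ∈ lifts O.subtype := by
        rw [map_eq_prod]
        apply multiset_prod_mem
        intro f hf
        obtain ⟨a, ha, rfl⟩ := Multiset.mem_map.mp hf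
        refine (mem_lifts _).mpr ⟨X - C ⟨a, hcon a ha⟩, by simp⟩
      rw [lifts_iff_coeff_lifts] at hl
      obtain ⟨b, hb⟩ := hl i
      rw [coeff_map, ← hq] at hb
      have h6 : ‖(Rat.castHom (PadicAlgCl p)) q‖ ≤ 1 := by rw [← hb]; exact b.2
      have h7 : (Rat.castHom (PadicAlgCl p)) q = algebraMap ℚ_[p] (PadicAlgCl p) (q : ℚ_[p]) := by simp
      rw [h7] at h6
      have := PadicAlgCl.norm_extends p (q : ℚ_[p])
      rw [this] at h6
      linarith
    obtain ⟨r, hr, hr1⟩ := hroot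
    obtain ⟨τ, hτ⟩ := embed_root x r hr
    refine ⟨(NormedField.toAbsoluteValue (PadicAlgCl p)).comp τ.injective, ?_, ?_⟩
    · intro a b
      change ‖τ (a + b)‖ ≤ max ‖τ a‖ ‖τ b‖
      rw [map_add]
      exact PadicAlgCl.isNonarchimedean p _ _
    · change 1 < ‖τ x‖; rw [hτ]; exact hr1
end WE

namespace WE
open Matrix Polynomial
section
variable {ι : Type*} [Fintype ι] [DecidableEq ι] {K : Type*} [CommRing K] {K' : Type*} [CommRing K']

/-- product of `A^i - (l j)^i` over `S` -/
noncomputable def XX (A : Matrix ι ι K) (l : ι → K) (S : Finset ι) (i : ℕ) : Matrix ι ι K :=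
  aeval A (∏ j ∈ S, (X ^ i - C (l j ^ i)))

/-- signed elementary symmetric function of eigenvalues -/
noncomputable def em (Z : Matrix ι ι K) (m : ℕ) : K := Z.charpoly.coeff (Fintype.card ι - m)

noncomputable def Qf (A b c : Matrix ι ι K) (l : ι → K) (I : Finset ι) (M i : ℕ) : K :=
  (I.card.factorial : K) * em ((XX A l Iᶜ i * b) ^ M) I.card *
    (XX A l Iᶜ i * b * (XX A l I i * c)).trace

noncomputable def gramD (w : ι × ι → Matrix ι ι K) : K :=
  (Matrix.of fun p q => (w p * w q).trace).det

noncomputable def Pf (A b : Matrix ι ι K) (c : ℕ → Matrix ι ι K) (l : ι → K) (I : Finset ι)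
    (w : ι × ι → Matrix ι ι K) (M N M3 : ℕ) : K :=
  (∏ i : Fin N, ∏ j ∈ Finset.Ioi i, Qf A b (c ((j : ℕ) - i)) l I M ((j : ℕ) - i)) ^ M3 * gramD w

lemma XX_map (f : K →+* K') (A : Matrix ι ι K) (l : ι → K) (S : Finset ι) (i : ℕ) :
    f.mapMatrix (XX A l S i) = XX (f.mapMatrix A) (fun j => f (l j)) S i := by
  unfold XX
  have h : ∀ p : K[X], f.mapMatrix (aeval A p) = aeval (f.mapMatrix A) (p.map f) := by
    intro p
    induction p using Polynomial.induction_on' with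
    | add p q hp hq => rw [map_add, map_add, hp, hq, Polynomial.map_add, map_add]
    | monomial n a =>
      simp only [aeval_monomial, Polynomial.map_monomial, map_mul, map_pow]
      congr 1
      ext i j
      by_cases hij : i = j <;> simp [Matrix.algebraMap_matrix_apply, hij]
  rw [h]
  congr 1
  simp [Polynomial.map_prod]

lemma em_map (f : K →+* K') (Z : Matrix ι ι K) (m : ℕ) : f (em Z m) = em (f.mapMatrix Z) m := by
  unfold em
  rw [RingHom.mapMatrix_apply, Matrix.charpoly_map, coeff_map]

lemma trace_map' (f : K →+* K') (Z : Matrix ι ι K) : f Z.trace = (f.mapMatrix Z).trace := by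
  simp [Matrix.trace]

lemma Qf_map (f : K →+* K') (A b c : Matrix ι ι K) (l : ι → K) (I : Finset ι) (M i : ℕ) :
    f (Qf A b c l I M i) = Qf (f.mapMatrix A) (f.mapMatrix b) (f.mapMatrix c) (fun j => f (l j)) I M i := by
  unfold Qf
  simp only [map_mul, em_map, trace_map', map_pow, XX_map, map_natCast]

lemma gramD_map (f : K →+* K') (w : ι × ι → Matrix ι ι K) :
    f (gramD w) = gramD (fun p => f.mapMatrix (w p)) := by
  unfold gramD
  rw [RingHom.map_det]
  congr 1
  ext p q
  simp only [RingHom.mapMatrix_apply, Matrix.map_apply, Matrix.of_apply]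
  rw [trace_map', map_mul]; rfl

lemma Pf_map (f : K →+* K') (A b : Matrix ι ι K) (c : ℕ → Matrix ι ι K) (l : ι → K) (I : Finset ι)
    (w : ι × ι → Matrix ι ι K) (M N M3 : ℕ) :
    f (Pf A b c l I w M N M3) = Pf (f.mapMatrix A) (f.mapMatrix b) (fun i => f.mapMatrix (c i))
      (fun j => f (l j)) I (fun p => f.mapMatrix (w p)) M N M3 := by
  unfold Pf
  simp only [map_mul, map_pow, map_prod, Qf_map, gramD_map]

/-- conjugation -/
noncomputable def cj (u : (Matrix ι ι K)ˣ) (A : Matrix ι ι K) : Matrix ι ι K := u * A * (u⁻¹ : (Matrix ι ι K)ˣ)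

lemma cj_mul (u : (Matrix ι ι K)ˣ) (A B) : cj u (A * B) = cj u A * cj u B := by
  unfold cj; simp [mul_assoc]
lemma cj_one (u : (Matrix ι ι K)ˣ) : cj u 1 = 1 := by unfold cj; simp
lemma cj_pow (u : (Matrix ι ι K)ˣ) (A) (n : ℕ) : cj u (A ^ n) = cj u A ^ n := by
  induction n with
  | zero => simp [cj_one]
  | succ n ih => simp [pow_succ, cj_mul, ih]

lemma cj_trace (u : (Matrix ι ι K)ˣ) (A) : (cj u A).trace = A.trace := by
  unfold cj; rw [Matrix.trace_mul_comm]; simp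
lemma cj_charpoly (u : (Matrix ι ι K)ˣ) (A) : (cj u A).charpoly = A.charpoly := by
  unfold cj; rw [Matrix.charpoly_mul_comm]; simp
lemma cj_XX (u : (Matrix ι ι K)ˣ) (A : Matrix ι ι K) (l : ι → K) (S : Finset ι) (i : ℕ) :
    cj u (XX A l S i) = XX (cj u A) l S i := by
  unfold XX
  generalize (∏ j ∈ S, (X ^ i - C (l j ^ i)) : K[X]) = p
  induction p using Polynomial.induction_on' with
  | add p q hp hq =>
    rw [map_add, map_add, ← hp, ← hq]; unfold cj; rw [mul_add, add_mul]
  | monomial n a =>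
    simp only [aeval_monomial]
    rw [cj_mul, cj_pow]
    congr 1
    unfold cj
    rw [← Algebra.commutes]
    rw [mul_assoc]; simp

lemma Qf_cj (u : (Matrix ι ι K)ˣ) (A b c : Matrix ι ι K) (l : ι → K) (I : Finset ι) (M i : ℕ) :
    Qf (cj u A) (cj u b) (cj u c) l I M i = Qf A b c l I M i := by
  unfold Qf em
  simp only [← cj_XX, ← cj_mul, ← cj_pow, cj_charpoly, cj_trace]

lemma gramD_cj (u : (Matrix ι ι K)ˣ) (w : ι × ι → Matrix ι ι K) :
    gramD (fun p => cj u (w p)) = gramD w := by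
  unfold gramD
  simp only [← cj_mul, cj_trace]

lemma Pf_cj (u : (Matrix ι ι K)ˣ) (A b : Matrix ι ι K) (c : ℕ → Matrix ι ι K) (l : ι → K) (I : Finset ι)
    (w : ι × ι → Matrix ι ι K) (M N M3 : ℕ) :
    Pf (cj u A) (cj u b) (fun i => cj u (c i)) l I (fun p => cj u (w p)) M N M3
      = Pf A b c l I w M N M3 := by
  unfold Pf
  simp only [Qf_cj, gramD_cj]

end
end WE

namespace WE
open Matrix Polynomial
section
variable {ι : Type*} [Fintype ι] [DecidableEq ι]

lemma exists_unimod_not_root (p : ℂ[X]) (hp : p ≠ 0) : ∃ z : ℂ, ‖z‖ = 1 ∧ p.eval z ≠ 0 := by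
  by_contra hcon
  push Not at hcon
  have hinf : (Metric.sphere (0:ℂ) 1).Infinite := by
    have : (Set.range (fun n : ℕ => Complex.exp (n * Complex.I))).Infinite := by
      apply Set.infinite_range_of_injective
      intro m n hmn
      simp only at hmn
      rw [Complex.exp_eq_exp_iff_exists_int] at hmn
      obtain ⟨k, hk⟩ := hmn
      have h2 : (m : ℝ) = n + k * (2 * Real.pi) := by
        have := congrArg Complex.im hk
        simpa using this
      by_cases hk0 : k = 0
      · subst hk0; simpa using h2
      · exfalso
        have hpi := irrational_pi
        apply hpi
        refine ⟨((m:ℚ) - n) / (2 * k), ?_⟩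
        have : (k:ℝ) ≠ 0 := by exact_mod_cast hk0
        push_cast
        rw [h2]; field_simp; ring
    refine this.mono ?_
    rintro _ ⟨n, rfl⟩
    simp [Complex.norm_exp]
  apply hinf
  refine (p.roots.toFinset.finite_toSet).subset ?_
  intro z hz
  simp only [Finset.mem_coe, Multiset.mem_toFinset, mem_roots hp]
  exact hcon z (by simpa using hz)

lemma unitary_diag0 (A : Matrix ι ι ℂ) (hA : A ∈ unitaryGroup ι ℂ) :
    ∃ V ∈ unitaryGroup ι ℂ, ∃ m : ι → ℂ, A = V * diagonal m * star V := by
  obtain ⟨z, hz, hz2⟩ := exists_unimod_not_root A.charpoly A.charpoly_monic.ne_zero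
  have hAA : A * star A = 1 := (Matrix.mem_unitaryGroup_iff).1 hA
  have hAA' : star A * A = 1 := (Matrix.mem_unitaryGroup_iff').1 hA
  have hzz : z * star z = 1 := by
    have := Complex.mul_conj z
    rw [Complex.normSq_eq_norm_sq, hz] at this
    simpa using this
  set T : Matrix ι ι ℂ := z • 1 - A with hT
  have hTu : IsUnit T := by
    rw [Matrix.isUnit_iff_isUnit_det, isUnit_iff_ne_zero]
    rw [Matrix.eval_charpoly] at hz2
    convert hz2 using 2
    rw [hT, Matrix.smul_one_eq_diagonal]; rfl
  obtain ⟨u, hu⟩ := hTu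
  set Ti : Matrix ι ι ℂ := ((u⁻¹ : (Matrix ι ι ℂ)ˣ) : Matrix ι ι ℂ) with hTi
  have h1 : T * Ti = 1 := by rw [← hu]; simp [hTi]
  have h2 : Ti * T = 1 := by rw [← hu]; simp [hTi]
  set H : Matrix ι ι ℂ := Complex.I • ((z • 1 + A) * Ti) with hH
  have hHT : H * T = Complex.I • (z • 1 + A) := by
    rw [hH, Matrix.smul_mul, mul_assoc, h2, mul_one]
  have hstarT : star T = star z • 1 - star A := by simp [hT, star_sub]
  -- H hermitian
  have hHerm : star H = H := by
    -- star T * star H = star (H T)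
    have e1 : star T * star H = star (Complex.I • (z • 1 + A)) := by rw [← star_mul, hHT]
    have e2 : star (Complex.I • (z • 1 + A)) = -(Complex.I) • (star z • 1 + star A) := by
      simp [star_smul, star_add]
    have e3 : star T * H * T = star T * star H * T := by
      have q : star z * z = 1 := by rw [mul_comm]; exact hzz
      have q1 : (star z • (1 : Matrix ι ι ℂ) - star A) * (z • 1 + A) = star z • A - z • star A := by
        rw [sub_mul, mul_add, mul_add, hAA']
        simp only [Matrix.mul_smul, Matrix.smul_mul, mul_one, one_mul, smul_smul, hzz, one_smul]
        abel
      have q2 : (star z • (1 : Matrix ι ι ℂ) + star A) * (z • 1 - A) = -(star z • A - z • star A) := by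
        rw [add_mul, mul_sub, mul_sub, hAA']
        simp only [Matrix.mul_smul, Matrix.smul_mul, mul_one, one_mul, smul_smul, hzz, one_smul]
        abel
      rw [mul_assoc, hHT, e1, e2, hstarT, hT, Matrix.mul_smul, Matrix.smul_mul, q1, q2, smul_neg, neg_smul, neg_neg]
    have hTsU : star Ti * star T = 1 := by rw [← star_mul, h1, star_one]
    have e4 : star T * H = star T * star H := by
      have := congrArg (· * Ti) e3
      simpa [mul_assoc, h1] using this
    have := congrArg (star Ti * ·) e4
    simp only [← mul_assoc, hTsU, one_mul] at this
    exact this.symm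
  have hHe : H.IsHermitian := hHerm
  set V := hHe.eigenvectorUnitary
  have hsp := hHe.conjStarAlgAut_star_eigenvectorUnitary
  rw [Unitary.conjStarAlgAut_star_apply] at hsp
  set e := hHe.eigenvalues
  have hVV : (star (V : Matrix ι ι ℂ)) * V = 1 := Unitary.coe_star_mul_self V
  have hVV' : (V : Matrix ι ι ℂ) * star (V : Matrix ι ι ℂ) = 1 := Unitary.coe_mul_star_self V
  -- A (H + i)... : H*(z - A) = i (z + A)  so (H + i) A = z (H - i)
  have key : (H + Complex.I • 1) * A = z • (H - Complex.I • 1) := by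
    have : H * T = z • H - H * A := by rw [hT, mul_sub]; simp
    rw [this] at hHT
    rw [add_mul]
    have h3 : H * A = z • H - Complex.I • (z • 1 + A) := by rw [← hHT]; abel
    rw [h3]; simp only [smul_add, smul_sub, smul_smul, Matrix.smul_mul, one_mul, mul_comm z]; abel
  have hne : ∀ j, ((e j : ℝ) : ℂ) + Complex.I ≠ 0 := by
    intro j h
    have := congrArg Complex.im h
    simp at this
  set m : ι → ℂ := fun j => z * ((e j : ℂ) - Complex.I) / ((e j : ℂ) + Complex.I) with hm
  have hB : star (V : Matrix ι ι ℂ) * A * V = diagonal m := by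
    have k2 : star (V : Matrix ι ι ℂ) * ((H + Complex.I • 1) * A) * V = star (V : Matrix ι ι ℂ) * (z • (H - Complex.I • 1)) * V := by rw [key]
    have k3 : star (V : Matrix ι ι ℂ) * ((H + Complex.I • 1) * A) * V = (star (V : Matrix ι ι ℂ) * H * V + Complex.I • 1) * (star (V : Matrix ι ι ℂ) * A * V) := by
      have : star (V : Matrix ι ι ℂ) * H * V + Complex.I • 1 = star (V : Matrix ι ι ℂ) * (H + Complex.I • 1) * V := by
        rw [mul_add, add_mul]; simp [hVV]
      rw [this]
      calc _ = star (V : Matrix ι ι ℂ) * (H + Complex.I • 1) * 1 * A * V := by simp only [mul_one, mul_assoc]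
        _ = _ := by rw [← hVV']; simp only [mul_assoc]
    have k4 : star (V : Matrix ι ι ℂ) * (z • (H - Complex.I • 1)) * V = z • (star (V : Matrix ι ι ℂ) * H * V - Complex.I • 1) := by
      rw [Matrix.mul_smul, Matrix.smul_mul, mul_sub, sub_mul]; simp [hVV]
    rw [k3, k4, hsp] at k2
    ext i j
    have := congrFun (congrFun k2 i) j
    have d1 : (diagonal (RCLike.ofReal ∘ e) : Matrix ι ι ℂ) + Complex.I • 1 = diagonal (fun j => (e j : ℂ) + Complex.I) := by
      ext i j; by_cases hij : i = j <;> simp [hij, diagonal]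
    have d2 : z • ((diagonal (RCLike.ofReal ∘ e) : Matrix ι ι ℂ) - Complex.I • 1) = diagonal (fun j => z * ((e j : ℂ) - Complex.I)) := by
      ext i j; by_cases hij : i = j <;> simp [hij, diagonal]
    rw [d1, d2, Matrix.diagonal_mul] at this
    by_cases hij : i = j
    · subst hij
      simp only [diagonal_apply_eq] at this ⊢
      rw [hm]; simp only
      rw [eq_div_iff (hne i), mul_comm, this]
    · rw [diagonal_apply_ne _ hij] at this ⊢
      exact (mul_eq_zero.1 this).resolve_left (hne i)
  refine ⟨V, V.2, m, ?_⟩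
  rw [← hB]
  calc A = (V * star (V : Matrix ι ι ℂ)) * A * (V * star (V : Matrix ι ι ℂ)) := by rw [hVV']; simp
    _ = _ := by simp only [mul_assoc]

lemma eig_perm {K : Type*} [Field K] (l m : ι → K) (h : ∏ j, (X - C (l j)) = ∏ j, (X - C (m j))) :
    ∃ s : Equiv.Perm ι, l = m ∘ s := by
  have h1 : Multiset.map l Finset.univ.val = Multiset.map m Finset.univ.val := by
    have := congrArg Polynomial.roots h
    rw [Polynomial.roots_prod _ _ (Finset.prod_ne_zero_iff.2 fun j _ => X_sub_C_ne_zero _),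
      Polynomial.roots_prod _ _ (Finset.prod_ne_zero_iff.2 fun j _ => X_sub_C_ne_zero _)] at this
    simp only [roots_X_sub_C, Multiset.bind_singleton] at this
    exact this
  classical
  have hc : ∀ x, Fintype.card {j // l j = x} = Fintype.card {j // m j = x} := by
    intro x
    have := congrArg (Multiset.count x) h1
    rw [Multiset.count_map, Multiset.count_map] at this
    rw [Fintype.card_subtype, Fintype.card_subtype]
    simpa [Finset.card_def, Finset.filter_val, eq_comm] using this
  have e : ∀ x, {j // l j = x} ≃ {j // m j = x} := fun x => Fintype.equivOfCardEq (hc x)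
  let s : ι ≃ ι := (Equiv.sigmaFiberEquiv l).symm.trans ((Equiv.sigmaCongrRight e).trans (Equiv.sigmaFiberEquiv m))
  refine ⟨s, funext fun j => ?_⟩
  simp only [Function.comp_apply, s, Equiv.trans_apply]
  exact ((e (l j)) ⟨j, rfl⟩).2.symm

lemma unitary_diag (A : Matrix ι ι ℂ) (hA : A ∈ unitaryGroup ι ℂ) (l : ι → ℂ) (hl : HasEig A l) :
    ∃ V ∈ unitaryGroup ι ℂ, A = V * diagonal l * star V := by
  obtain ⟨V, hV, m, hm⟩ := unitary_diag0 A hA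
  have hVV : star V * V = 1 := (Matrix.mem_unitaryGroup_iff').1 hV
  have hVV' : V * star V = 1 := (Matrix.mem_unitaryGroup_iff).1 hV
  have : A.charpoly = ∏ j, (X - C (m j)) := by
    rw [hm, Matrix.charpoly_mul_comm, ← mul_assoc, hVV, one_mul, charpoly_diagonal]
  obtain ⟨s, hs⟩ := eig_perm l m (hl.symm.trans this)
  -- permutation matrix
  set P : Matrix ι ι ℂ := (1 : Matrix ι ι ℂ).submatrix id s with hP
  have hPP : P * star P = 1 := by
    rw [hP, star_eq_conjTranspose, conjTranspose_submatrix, Matrix.submatrix_mul_equiv]; simp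
  have hPd : P * diagonal l * star P = diagonal m := by
    have e1 : diagonal l = (diagonal m).submatrix s s := by
      rw [Matrix.submatrix_diagonal_equiv, hs]
    rw [e1, hP, star_eq_conjTranspose, conjTranspose_submatrix, Matrix.submatrix_mul_equiv, Matrix.submatrix_mul_equiv]; simp
  refine ⟨V * P, mul_mem hV (Matrix.mem_unitaryGroup_iff.2 hPP), ?_⟩
  rw [hm, ← hPd, star_mul]; simp only [mul_assoc]

end
end WE

namespace WE
open Matrix Polynomial
section
variable {ι : Type*} [Fintype ι] [DecidableEq ι]

lemma aeval_diagonal' {K : Type*} [CommRing K] (l : ι → K) (p : K[X]) :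
    aeval (diagonal l) p = diagonal (fun t => p.eval (l t)) := by
  induction p using Polynomial.induction_on' with
  | add p q hp hq => rw [map_add, hp, hq]; simp [diagonal_add]
  | monomial n a =>
    rw [aeval_monomial, Matrix.algebraMap_eq_diagonal, Matrix.diagonal_pow, Matrix.diagonal_mul_diagonal]
    simp

lemma XX_diagonal {K : Type*} [CommRing K] (l : ι → K) (S : Finset ι) (i : ℕ) :
    XX (diagonal l) l S i = diagonal (fun t => ∏ j ∈ S, (l t ^ i - l j ^ i)) := by
  unfold XX
  rw [aeval_diagonal']
  simp [Polynomial.eval_prod]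

open scoped ComplexOrder in
lemma det_sq_le {κ : Type*} [Fintype κ] [DecidableEq κ] [Nonempty κ] (B : Matrix κ κ ℂ) (y : ℝ) (hy : 0 ≤ y)
    (h : ∑ t, ∑ s, ‖B t s‖ ^ 2 ≤ Fintype.card κ * (1 - y)) : ‖B.det‖ ^ 2 ≤ 1 - y := by
  have hpsd : (B * Bᴴ).PosSemidef := Matrix.posSemidef_self_mul_conjTranspose B
  have hH := hpsd.isHermitian
  have hm : (0:ℝ) < Fintype.card κ := by exact_mod_cast Fintype.card_pos
  have h1 : ‖B.det‖ ^ 2 = ∏ t, hH.eigenvalues t := by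
    have e := hH.det_eq_prod_eigenvalues
    rw [Matrix.det_mul, Matrix.det_conjTranspose] at e
    have : ((‖B.det‖ ^ 2 : ℝ) : ℂ) = B.det * star B.det := by
      rw [← Complex.normSq_eq_norm_sq, ← Complex.mul_conj]; rfl
    rw [← this] at e
    apply Complex.ofReal_injective
    rw [e]; simp
  have h2 : ∑ t, hH.eigenvalues t = ∑ t, ∑ s, ‖B t s‖ ^ 2 := by
    have e := hH.trace_eq_sum_eigenvalues
    have : (B * Bᴴ).trace = ((∑ t, ∑ s, ‖B t s‖ ^ 2 : ℝ) : ℂ) := by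
      rw [Matrix.trace]
      push_cast
      refine Finset.sum_congr rfl fun t _ => ?_
      rw [Matrix.diag_apply, Matrix.mul_apply]
      refine Finset.sum_congr rfl fun s _ => ?_
      rw [Matrix.conjTranspose_apply, ← Complex.ofReal_pow, ← Complex.normSq_eq_norm_sq, ← Complex.mul_conj]; rfl
    rw [this] at e
    apply Complex.ofReal_injective
    rw [e]; simp
  have hnn : ∀ t, 0 ≤ hH.eigenvalues t := hpsd.eigenvalues_nonneg
  have amgm := Real.geom_mean_le_arith_mean_weighted Finset.univ (fun _ => (1:ℝ) / Fintype.card κ) hH.eigenvalues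
    (fun _ _ => by positivity) (by simp [hm.ne']) (fun t _ => hnn t)
  rw [← Finset.mul_sum, h2] at amgm
  have h3 : (1:ℝ) / Fintype.card κ * ∑ t, ∑ s, ‖B t s‖ ^ 2 ≤ 1 - y := by
    rw [div_mul_eq_mul_div, one_mul, div_le_iff₀ hm, mul_comm]; exact h
  have h4 := amgm.trans h3
  rw [Real.finsetProd_rpow _ _ (fun t _ => hnn t), ← h1] at h4
  have hy1 : 0 ≤ 1 - y := le_trans (by positivity) h4
  have h5 : ‖B.det‖ ^ 2 ≤ (1 - y) ^ Fintype.card κ := by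
    have := pow_le_pow_left₀ (by positivity) h4 (Fintype.card κ)
    rwa [one_div, Real.rpow_inv_natCast_pow (by positivity) (Fintype.card_ne_zero)] at this
  refine h5.trans ?_
  exact pow_le_of_le_one hy1 (by linarith) Fintype.card_ne_zero

lemma y_bound (y : ℝ) (h0 : 0 ≤ y) (h1 : y ≤ 1) (M : ℕ) : y * (1 - y) ^ M ≤ 1 / (M + 1) := by
  have hb : 1 + (M:ℝ) * y ≤ (1 + y) ^ M := one_add_mul_le_pow (by linarith) M
  have hp : (1 - y) ^ M * (1 + y) ^ M ≤ 1 := by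
    rw [← mul_pow]; apply pow_le_one₀ <;> nlinarith
  have h2 : (1 - y) ^ M * (1 + M * y) ≤ 1 := le_trans (mul_le_mul_of_nonneg_left hb (pow_nonneg (by linarith) M)) hp
  have hM : (0:ℝ) ≤ M := Nat.cast_nonneg M
  rw [le_div_iff₀ (by positivity)]
  have h3 : (0:ℝ) ≤ (1 - y) ^ M := pow_nonneg (by linarith) M
  nlinarith

lemma unitary_row (b : Matrix ι ι ℂ) (hb : b ∈ unitaryGroup ι ℂ) (t : ι) : ∑ s, ‖b t s‖ ^ 2 = 1 := by
  have := congrFun (congrFun ((Matrix.mem_unitaryGroup_iff).1 hb) t) t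
  rw [Matrix.mul_apply, Matrix.one_apply_eq] at this
  have e : ((∑ s, ‖b t s‖ ^ 2 : ℝ) : ℂ) = 1 := by
    rw [← this]; push_cast
    refine Finset.sum_congr rfl fun s _ => ?_
    rw [Matrix.star_apply, ← Complex.ofReal_pow, ← Complex.normSq_eq_norm_sq, ← Complex.mul_conj]; rfl
  exact_mod_cast e

lemma unitary_entry (b : Matrix ι ι ℂ) (hb : b ∈ unitaryGroup ι ℂ) (t s : ι) : ‖b t s‖ ≤ 1 := by
  have h := unitary_row b hb t
  have h2 : ‖b t s‖ ^ 2 ≤ 1 := by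
    rw [← h]; exact Finset.single_le_sum (f := fun s => ‖b t s‖ ^ 2) (fun _ _ => by positivity) (Finset.mem_univ s)
  nlinarith [norm_nonneg (b t s)]

/-- rows outside `I` vanish -/
lemma pow_submatrix {K : Type*} [CommRing K] (Z : Matrix ι ι K) (I : Finset ι) (hZ : ∀ t, t ∉ I → ∀ s, Z t s = 0) (M : ℕ) :
    (Z ^ M).submatrix (Subtype.val : I → ι) (Subtype.val : I → ι) =
      (Z.submatrix (Subtype.val : I → ι) (Subtype.val : I → ι)) ^ M := by
  induction M with
  | zero =>
    rw [pow_zero, pow_zero, Matrix.submatrix_one _ Subtype.val_injective]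
  | succ n ih =>
    rw [pow_succ (Z.submatrix _ _), ← ih]
    ext a b
    rw [pow_succ, Matrix.submatrix_apply, Matrix.mul_apply, Matrix.mul_apply]
    rw [← Finset.sum_subset (Finset.subset_univ I), ← Finset.sum_coe_sort I]
    · rfl
    · intro x _ hx
      rw [hZ x hx]; simp

lemma em_of_rows {K : Type*} [CommRing K] (Z : Matrix ι ι K) (I : Finset ι) (hZ : ∀ t, t ∉ I → ∀ s, Z t s = 0) (M : ℕ)
    (hM : 1 ≤ M) :
    em (Z ^ M) I.card = (-1) ^ I.card * (Z.submatrix (Subtype.val : I → ι) (Subtype.val : I → ι)).det ^ M := by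
  unfold em
  rw [Matrix.charpoly_coeff_eq_sum_minors _ _ (Finset.card_le_univ I)]
  congr 1
  rw [Finset.sum_eq_single I]
  · rw [pow_submatrix Z I hZ, Matrix.det_pow]
  · intro s hs hsI
    obtain ⟨t, hts, htI⟩ : ∃ t ∈ s, t ∉ I := by
      by_contra hcon
      push Not at hcon
      exact hsI (Finset.eq_of_subset_of_card_le hcon (by rw [(Finset.mem_powersetCard.1 hs).2]))
    apply Matrix.det_eq_zero_of_row_eq_zero ⟨t, hts⟩
    intro j
    obtain ⟨n, rfl⟩ : ∃ n, M = n + 1 := ⟨M - 1, by omega⟩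
    rw [Matrix.submatrix_apply, pow_succ', Matrix.mul_apply]
    exact Finset.sum_eq_zero fun x _ => by rw [hZ t htI, zero_mul]
  · intro h; exact absurd (Finset.mem_powersetCard.2 ⟨Finset.subset_univ _, rfl⟩) h

lemma Qf_bound_diag (b c : Matrix ι ι ℂ) (hb : b ∈ unitaryGroup ι ℂ) (hc : c ∈ unitaryGroup ι ℂ)
    (l : ι → ℂ) (hl : ∀ j, ‖l j‖ = 1) (I : Finset ι) (z0 : ℂ) (hI : ∀ j ∈ I, l j = z0) (hne : I.Nonempty) (M i : ℕ) (hM : 1 ≤ M) :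
    ‖Qf (diagonal l) b c l I M i‖ ^ 2 ≤ ((Fintype.card ι).factorial ^ 2 * 4 ^ Fintype.card ι * (Fintype.card ι) ^ 3 : ℝ) / (M + 1) *
      (‖∏ j ∈ Iᶜ, (z0 ^ i - l j ^ i)‖ ^ (I.card * M + 1)) ^ 2 := by
  set d := Fintype.card ι
  set m := I.card with hm
  have hmpos : 0 < m := Finset.card_pos.2 hne
  have hmd : m ≤ d := Finset.card_le_univ I
  set δ := ∏ j ∈ Iᶜ, (z0 ^ i - l j ^ i) with hδ
  set x : ι → ℂ := fun t => ∏ j ∈ Iᶜ, (l t ^ i - l j ^ i) with hx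
  set y : ι → ℂ := fun t => ∏ j ∈ I, (l t ^ i - l j ^ i) with hy
  have hx1 : ∀ t ∈ I, x t = δ := by intro t ht; simp only [hx, hδ, hI t ht]
  have hx0 : ∀ t, t ∉ I → x t = 0 := by
    intro t ht
    exact Finset.prod_eq_zero (Finset.mem_compl.2 ht) (sub_self _)
  have hy0 : ∀ t ∈ I, y t = 0 := fun t ht => Finset.prod_eq_zero ht (sub_self _)
  have hy1 : ∀ t, ‖y t‖ ≤ 2 ^ m := by
    intro t
    simp only [hy, norm_prod]
    calc _ ≤ ∏ j ∈ I, (2:ℝ) := Finset.prod_le_prod (fun _ _ => norm_nonneg _) (fun j _ => by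
            refine (norm_sub_le _ _).trans ?_
            simp [norm_pow, hl]; norm_num)
      _ = 2 ^ m := by simp [hm]
  set Z := diagonal x * b with hZ
  have hZe : ∀ t s, Z t s = x t * b t s := fun t s => by rw [hZ, Matrix.diagonal_mul]
  set B := b.submatrix (Subtype.val : I → ι) (Subtype.val : I → ι) with hB
  have hZB : Z.submatrix (Subtype.val : I → ι) (Subtype.val : I → ι) = δ • B := by
    ext t s
    simp only [Matrix.submatrix_apply, hZe, Matrix.smul_apply, hB, smul_eq_mul]
    rw [hx1 t t.2]
  have hem : em (Z ^ M) m = (-1) ^ m * (δ ^ m * B.det) ^ M := by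
    rw [hm, em_of_rows Z I (fun t ht s => by rw [hZe, hx0 t ht, zero_mul]) M hM, hZB, Matrix.det_smul, Fintype.card_coe]
  set c2 : ℝ := ∑ t ∈ I, ∑ s ∈ Iᶜ, ‖b t s‖ ^ 2 with hc2
  have hc2n : 0 ≤ c2 := by positivity
  have hsum : ∑ t : I, ∑ s : I, ‖B t s‖ ^ 2 = m - c2 := by
    have : ∑ t : I, ∑ s : I, ‖B t s‖ ^ 2 = ∑ t ∈ I, ∑ s ∈ I, ‖b t s‖ ^ 2 := by
      rw [← Finset.sum_coe_sort I]
      refine Finset.sum_congr rfl fun t _ => ?_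
      rw [← Finset.sum_coe_sort I]; rfl
    rw [this, eq_sub_iff_add_eq, hc2, ← Finset.sum_add_distrib]
    calc _ = ∑ t ∈ I, (1:ℝ) := Finset.sum_congr rfl fun t _ => by
            rw [Finset.sum_add_sum_compl, unitary_row b hb]
      _ = m := by simp [hm]
  have hmR : (0:ℝ) < m := by exact_mod_cast hmpos
  set yy : ℝ := c2 / m with hyy
  have hyy0 : 0 ≤ yy := by positivity
  have hdet : ‖B.det‖ ^ 2 ≤ 1 - yy := by
    haveI : Nonempty I := hne.to_subtype
    apply det_sq_le _ _ hyy0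
    rw [hsum, Fintype.card_coe, ← hm, hyy]
    field_simp; rfl
  have hyy1 : yy ≤ 1 := by nlinarith [sq_nonneg ‖B.det‖]
  have htr : ‖(diagonal x * b * (diagonal y * c)).trace‖ ^ 2 ≤ ‖δ‖ ^ 2 * (4 ^ m * d ^ 2 * c2) := by
    have e1 : (diagonal x * b * (diagonal y * c)).trace = δ * ∑ t ∈ I, ∑ s ∈ Iᶜ, b t s * (y s * c s t) := by
      rw [← hZ, Matrix.trace, ← Finset.sum_subset (Finset.subset_univ I)]
      · rw [Finset.mul_sum]
        refine Finset.sum_congr rfl fun t ht => ?_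
        rw [Matrix.diag_apply, Matrix.mul_apply, ← Finset.sum_subset (Finset.subset_univ Iᶜ), Finset.mul_sum]
        · refine Finset.sum_congr rfl fun s _ => ?_
          rw [hZe, Matrix.diagonal_mul, hx1 t ht]; ring
        · intro s _ hs
          rw [Matrix.diagonal_mul, hy0 s (by simpa using hs)]; simp
      · intro t _ ht
        rw [Matrix.diag_apply, Matrix.mul_apply]
        exact Finset.sum_eq_zero fun s _ => by rw [hZe, hx0 t ht]; simp
    rw [e1, norm_mul, mul_pow]
    refine mul_le_mul_of_nonneg_left ?_ (by positivity)
    have e2 : ‖∑ t ∈ I, ∑ s ∈ Iᶜ, b t s * (y s * c s t)‖ ≤ 2 ^ m * ∑ p ∈ I ×ˢ Iᶜ, ‖b p.1 p.2‖ := by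
      rw [Finset.sum_product, Finset.mul_sum]
      refine (norm_sum_le _ _).trans (Finset.sum_le_sum fun t _ => ?_)
      rw [Finset.mul_sum]
      refine (norm_sum_le _ _).trans (Finset.sum_le_sum fun s _ => ?_)
      rw [norm_mul, norm_mul]
      have := mul_le_mul (hy1 s) (unitary_entry c hc s t) (norm_nonneg _) (by positivity)
      nlinarith [norm_nonneg (b t s)]
    have e3 : (∑ p ∈ I ×ˢ Iᶜ, ‖b p.1 p.2‖) ^ 2 ≤ d ^ 2 * c2 := by
      have := sq_sum_le_card_mul_sum_sq (s := I ×ˢ Iᶜ) (f := fun p => ‖b p.1 p.2‖)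
      rw [Finset.sum_product (f := fun p => ‖b p.1 p.2‖ ^ 2), ← hc2] at this
      refine this.trans (mul_le_mul_of_nonneg_right ?_ hc2n)
      rw [Finset.card_product, sq]
      push_cast
      exact mul_le_mul (by exact_mod_cast hmd) (by exact_mod_cast Finset.card_le_univ _) (by positivity) (by positivity)
    calc _ ≤ (2 ^ m * ∑ p ∈ I ×ˢ Iᶜ, ‖b p.1 p.2‖) ^ 2 := pow_le_pow_left₀ (norm_nonneg _) e2 2
      _ = 4 ^ m * (∑ p ∈ I ×ˢ Iᶜ, ‖b p.1 p.2‖) ^ 2 := by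
          rw [mul_pow, ← pow_mul, mul_comm m 2, pow_mul]; norm_num
      _ ≤ 4 ^ m * (d ^ 2 * c2) := mul_le_mul_of_nonneg_left e3 (by positivity)
      _ = _ := by ring
  have hQ : Qf (diagonal l) b c l I M i = (m.factorial : ℂ) * em (Z ^ M) m * (diagonal x * b * (diagonal y * c)).trace := by
    unfold Qf; rw [XX_diagonal, XX_diagonal]
  rw [hQ, norm_mul, norm_mul, mul_pow, mul_pow, hem]
  have hne2 : ‖((-1 : ℂ) ^ m * (δ ^ m * B.det) ^ M)‖ ^ 2 = (‖δ‖ ^ (m * M)) ^ 2 * (‖B.det‖ ^ 2) ^ M := by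
    rw [norm_mul, norm_pow, norm_neg, norm_one, one_pow, one_mul, norm_pow, norm_mul, norm_pow]
    ring
  rw [hne2, Complex.norm_natCast]
  have hdM : (‖B.det‖ ^ 2) ^ M ≤ (1 - yy) ^ M := pow_le_pow_left₀ (by positivity) hdet M
  have hc2y : c2 = m * yy := by rw [hyy]; field_simp
  have hyb := y_bound yy hyy0 hyy1 M
  have hf : (m.factorial : ℝ) ^ 2 ≤ (d.factorial : ℝ) ^ 2 := pow_le_pow_left₀ (by positivity) (by exact_mod_cast Nat.factorial_le hmd) 2
  have h4 : (4:ℝ) ^ m ≤ 4 ^ d := pow_le_pow_right₀ (by norm_num) hmd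
  have hmdR : (m:ℝ) ≤ d := by exact_mod_cast hmd
  calc (m.factorial:ℝ) ^ 2 * ((‖δ‖ ^ (m * M)) ^ 2 * (‖B.det‖ ^ 2) ^ M) * ‖(diagonal x * b * (diagonal y * c)).trace‖ ^ 2
      ≤ (m.factorial:ℝ) ^ 2 * ((‖δ‖ ^ (m * M)) ^ 2 * (1 - yy) ^ M) * (‖δ‖ ^ 2 * (4 ^ m * d ^ 2 * c2)) := by gcongr
    _ = ((m.factorial:ℝ) ^ 2 * 4 ^ m * (m * d ^ 2)) * (yy * (1 - yy) ^ M) * (‖δ‖ ^ (m * M + 1)) ^ 2 := by rw [hc2y]; ring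
    _ ≤ ((d.factorial:ℝ) ^ 2 * 4 ^ d * (d * d ^ 2)) * (1 / (M + 1)) * (‖δ‖ ^ (m * M + 1)) ^ 2 := by
        have : 0 ≤ yy * (1 - yy) ^ M := mul_nonneg hyy0 (pow_nonneg (by linarith) M)
        have a1 : (m.factorial:ℝ) ^ 2 * 4 ^ m * (m * d ^ 2) ≤ (d.factorial:ℝ) ^ 2 * 4 ^ d * (d * d ^ 2) :=
          mul_le_mul (mul_le_mul hf h4 (pow_nonneg (by norm_num) _) (sq_nonneg _))
            (mul_le_mul_of_nonneg_right hmdR (sq_nonneg _)) (mul_nonneg (Nat.cast_nonneg _) (sq_nonneg _))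
            (mul_nonneg (sq_nonneg _) (pow_nonneg (by norm_num) _))
        exact mul_le_mul_of_nonneg_right (mul_le_mul a1 hyb this (mul_nonneg (mul_nonneg (sq_nonneg _) (pow_nonneg (by norm_num) _)) (mul_nonneg (Nat.cast_nonneg _) (sq_nonneg _)))) (sq_nonneg _)
    _ = _ := by ring

lemma Qf_bound (A b c : Matrix ι ι ℂ) (hA : A ∈ unitaryGroup ι ℂ) (hb : b ∈ unitaryGroup ι ℂ) (hc : c ∈ unitaryGroup ι ℂ)
    (l : ι → ℂ) (hAl : HasEig A l) (hl : ∀ j, ‖l j‖ = 1) (I : Finset ι) (z0 : ℂ) (hI : ∀ j ∈ I, l j = z0) (hne : I.Nonempty) (M i : ℕ) (hM : 1 ≤ M) :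
    ‖Qf A b c l I M i‖ ^ 2 ≤ ((Fintype.card ι).factorial ^ 2 * 4 ^ Fintype.card ι * (Fintype.card ι) ^ 3 : ℝ) / (M + 1) *
      (‖∏ j ∈ Iᶜ, (z0 ^ i - l j ^ i)‖ ^ (I.card * M + 1)) ^ 2 := by
  obtain ⟨V, hV, hAV⟩ := unitary_diag A hA l hAl
  have hVV : star V * V = 1 := (Matrix.mem_unitaryGroup_iff').1 hV
  have hVV' : V * star V = 1 := (Matrix.mem_unitaryGroup_iff).1 hV
  let u : (Matrix ι ι ℂ)ˣ := ⟨star V, V, hVV, hVV'⟩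
  have hu : ∀ B, cj u B = star V * B * V := fun B => rfl
  have h1 : cj u A = diagonal l := by
    rw [hu, hAV]
    calc _ = (star V * V) * diagonal l * (star V * V) := by simp only [mul_assoc]
      _ = _ := by rw [hVV]; simp
  rw [← Qf_cj u, h1]
  have hV' : star V ∈ unitaryGroup ι ℂ := Unitary.star_mem hV
  exact Qf_bound_diag _ _ (by rw [hu]; exact mul_mem (mul_mem hV' hb) hV) (by rw [hu]; exact mul_mem (mul_mem hV' hc) hV) l hl I z0 hI hne M i hM

end
end WE

namespace WE
open Matrix Polynomial

lemma vander_bound (N : ℕ) (u : ℂ) (hu : ‖u‖ = 1) :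
    ∏ i : Fin N, ∏ j ∈ Finset.Ioi i, ‖u ^ (j:ℕ) - u ^ (i:ℕ)‖ ≤ (N.factorial : ℝ) := by
  have h := Matrix.det_vandermonde (fun i : Fin N => u ^ (i:ℕ))
  have h2 : ∏ i : Fin N, ∏ j ∈ Finset.Ioi i, ‖u ^ (j:ℕ) - u ^ (i:ℕ)‖ = ‖(Matrix.vandermonde (fun i : Fin N => u ^ (i:ℕ))).det‖ := by
    rw [h]; simp only [norm_prod]
  rw [h2]
  have := Matrix.det_le (A := Matrix.vandermonde (fun i : Fin N => u ^ (i:ℕ))) (abv := NormedField.toAbsoluteValue ℂ) (x := 1)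
    (fun i j => by
      show ‖Matrix.vandermonde (fun i : Fin N => u ^ (i:ℕ)) i j‖ ≤ 1
      simp [Matrix.vandermonde, hu])
  refine le_trans (le_of_eq rfl) (this.trans ?_)
  simp

lemma vander_bound2 (N : ℕ) (z w : ℂ) (hz : ‖z‖ = 1) (hw : ‖w‖ = 1) :
    ∏ i : Fin N, ∏ j ∈ Finset.Ioi i, ‖z ^ ((j:ℕ) - i) - w ^ ((j:ℕ) - i)‖ ≤ (N.factorial : ℝ) := by
  have hw0 : w ≠ 0 := by intro h; simp [h] at hw
  refine le_trans (le_of_eq ?_) (vander_bound N (z / w) (by simp [hz, hw]))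
  refine Finset.prod_congr rfl fun i _ => Finset.prod_congr rfl fun j hj => ?_
  have hij : (i:ℕ) ≤ j := by
    have := Finset.mem_Ioi.1 hj
    exact (Fin.lt_def.1 this).le
  have e1 : (z / w) ^ (j:ℕ) - (z / w) ^ (i:ℕ) = (z / w) ^ (i:ℕ) * ((z / w) ^ ((j:ℕ) - i) - 1) := by
    rw [mul_sub, ← pow_add, mul_one]; congr 2; omega
  have e2 : z ^ ((j:ℕ) - i) - w ^ ((j:ℕ) - i) = w ^ ((j:ℕ) - i) * ((z / w) ^ ((j:ℕ) - i) - 1) := by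
    rw [mul_sub, mul_one, div_pow, mul_div_cancel₀]
    exact pow_ne_zero _ hw0
  rw [e1, e2, norm_mul, norm_mul, norm_pow, norm_pow, norm_div, hz, hw]; simp

lemma pairs_count (K : ℕ) (x : ℝ) :
    ∏ i : Fin (2 * K + 1), ∏ _j ∈ Finset.Ioi i, x = (x ^ K) ^ (2 * K + 1) := by
  simp only [Finset.prod_const, Fin.card_Ioi]
  rw [Finset.prod_pow_eq_pow_sum, ← pow_mul]
  congr 1
  rw [Fin.sum_univ_eq_sum_range (fun i => 2 * K + 1 - 1 - i) (2 * K + 1), Finset.sum_range_reflect (fun i => i)]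
  have := Finset.sum_range_id_mul_two (2 * K + 1)
  have h3 : (2 * K + 1) * (2 * K + 1 - 1) = (K * (2 * K + 1)) * 2 := by
    rw [Nat.add_sub_cancel]; ring
  omega

lemma exists_K (E : ℕ) : ∃ K : ℕ, 1 ≤ K ∧ (2:ℝ) * (2 * K + 1) ^ E ≤ 2 ^ K := by
  have h := tendsto_pow_const_div_const_pow_of_one_lt E (r := (2:ℝ)) (by norm_num)
  have h2 := h.eventually (gt_mem_nhds (show (0:ℝ) < 1 / (2 * 3 ^ E) by positivity))
  obtain ⟨K, hK, hK1⟩ := (h2.and (Filter.eventually_ge_atTop 1)).exists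
  refine ⟨K, hK1, ?_⟩
  rw [div_lt_div_iff₀ (by positivity) (by positivity)] at hK
  have hKR : (1:ℝ) ≤ K := by exact_mod_cast hK1
  have : (2 * (K:ℝ) + 1) ^ E ≤ (3 * K) ^ E := pow_le_pow_left₀ (by positivity) (by linarith) E
  rw [mul_pow] at this
  nlinarith

section
variable {ι : Type*} [Fintype ι] [DecidableEq ι]

lemma gramD_bound (w : ι × ι → Matrix ι ι ℂ) (hw : ∀ p, w p ∈ unitaryGroup ι ℂ) :
    ‖gramD w‖ ≤ ((Fintype.card ι * Fintype.card ι).factorial : ℝ) * (Fintype.card ι) ^ (Fintype.card ι * Fintype.card ι) := by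
  have := Matrix.det_le (A := (Matrix.of fun p q => (w p * w q).trace)) (abv := NormedField.toAbsoluteValue ℂ) (x := (Fintype.card ι : ℝ))
    (fun p q => by
      show ‖(w p * w q).trace‖ ≤ _
      refine (norm_sum_le _ _).trans ?_
      calc _ ≤ ∑ t : ι, (1:ℝ) := Finset.sum_le_sum fun t _ => unitary_entry _ (mul_mem (hw p) (hw q)) t t
        _ = _ := by simp)
  refine le_trans (le_of_eq rfl) (this.trans ?_)
  simp

theorem uni_unitary (d : ℕ) : ∃ M N M3 : ℕ, 1 ≤ M ∧ ∀ (ι : Type) [Fintype ι] [DecidableEq ι], Fintype.card ι = d →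
    ∀ (A b : Matrix ι ι ℂ) (c : ℕ → Matrix ι ι ℂ) (l : ι → ℂ) (I : Finset ι) (w : ι × ι → Matrix ι ι ℂ) (z0 : ℂ),
    A ∈ unitaryGroup ι ℂ → b ∈ unitaryGroup ι ℂ → (∀ i, c i ∈ unitaryGroup ι ℂ) → (∀ p, w p ∈ unitaryGroup ι ℂ) →
    HasEig A l → (∀ j, ‖l j‖ = 1) → (∀ j ∈ I, l j = z0) → I.Nonempty →
    ‖Pf A b c l I w M N M3‖ < 1 := by
  obtain ⟨M, hM⟩ := exists_nat_gt ((4:ℝ) * (d.factorial ^ 2 * 4 ^ d * d ^ 3))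
  have hMpos : 1 ≤ M + 1 := by omega
  set E := d * (d * (M + 1) + 1) with hE
  obtain ⟨K, hK1, hK⟩ := exists_K E
  set N := 2 * K + 1 with hN
  obtain ⟨M3, hM3⟩ := pow_unbounded_of_one_lt (((d * d).factorial : ℝ) * (d:ℝ) ^ (d * d)) (show (1:ℝ) < 2 by norm_num)
  refine ⟨M + 1, N, M3, hMpos, ?_⟩
  intro ι _ _ hcard A b c l I w z0 hA hb hc hw hAl hl hI hne
  have hz0 : ‖z0‖ = 1 := by
    obtain ⟨j, hj⟩ := hne
    rw [← hI j hj]; exact hl j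
  set e := I.card * (M + 1) + 1 with he
  set δ : ℕ → ℂ := fun i => ∏ j ∈ Iᶜ, (z0 ^ i - l j ^ i) with hδ
  have hQ : ∀ i, ‖Qf A b (c i) l I (M + 1) i‖ ≤ 1 / 2 * ‖δ i‖ ^ e := by
    intro i
    have h := Qf_bound A b (c i) hA hb (hc i) l hAl hl I z0 hI hne (M + 1) i hMpos
    rw [hcard] at h
    have hk : ((d.factorial : ℝ) ^ 2 * 4 ^ d * d ^ 3) / ((M + 1 : ℕ) + 1) ≤ 1 / 4 := by
      rw [div_le_div_iff₀ (by positivity) (by norm_num)]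
      push_cast; linarith
    have h2 : ‖Qf A b (c i) l I (M + 1) i‖ ^ 2 ≤ (1 / 2 * ‖δ i‖ ^ e) ^ 2 := by
      refine h.trans ?_
      rw [mul_pow]
      refine mul_le_mul_of_nonneg_right (hk.trans (by norm_num)) (sq_nonneg _)
    exact le_of_sq_le_sq h2 (mul_nonneg (by norm_num) (pow_nonneg (norm_nonneg _) _))
  have hprod : ‖∏ i : Fin N, ∏ j ∈ Finset.Ioi i, Qf A b (c ((j : ℕ) - i)) l I (M + 1) ((j : ℕ) - i)‖ ≤ 1 / 2 := by
    simp only [norm_prod]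
    have hfac1 : (1:ℝ) ≤ N.factorial := by exact_mod_cast Nat.factorial_pos N
    calc ∏ i : Fin N, ∏ j ∈ Finset.Ioi i, ‖Qf A b (c ((j : ℕ) - i)) l I (M + 1) ((j : ℕ) - i)‖
        ≤ ∏ i : Fin N, ∏ j ∈ Finset.Ioi i, (1 / 2 * ‖δ ((j:ℕ) - i)‖ ^ e) :=
          Finset.prod_le_prod (fun _ _ => Finset.prod_nonneg fun _ _ => norm_nonneg _) fun i _ =>
            Finset.prod_le_prod (fun _ _ => norm_nonneg _) fun j _ => hQ _
      _ = ((1/2) ^ K) ^ N * (∏ j ∈ Iᶜ, ∏ i : Fin N, ∏ j' ∈ Finset.Ioi i, ‖z0 ^ ((j':ℕ) - i) - l j ^ ((j':ℕ) - i)‖) ^ e := by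
          rw [← pairs_count]
          simp only [Finset.prod_mul_distrib, Finset.prod_pow]
          congr 2
          rw [Finset.prod_comm]
          refine Finset.prod_congr rfl fun i _ => ?_
          rw [Finset.prod_comm]
          refine Finset.prod_congr rfl fun j _ => ?_
          simp only [hδ, norm_prod]
      _ ≤ ((1/2) ^ K) ^ N * ((N.factorial : ℝ) ^ d) ^ e := by
          have : ∏ j ∈ Iᶜ, ∏ i : Fin N, ∏ j' ∈ Finset.Ioi i, ‖z0 ^ ((j':ℕ) - i) - l j ^ ((j':ℕ) - i)‖ ≤ (N.factorial : ℝ) ^ d := by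
            calc _ ≤ ∏ j ∈ Iᶜ, (N.factorial : ℝ) := Finset.prod_le_prod (fun _ _ => Finset.prod_nonneg fun _ _ => Finset.prod_nonneg fun _ _ => norm_nonneg _)
                    (fun j _ => vander_bound2 N z0 (l j) hz0 (hl j))
              _ = (N.factorial : ℝ) ^ (Iᶜ.card) := by simp
              _ ≤ _ := pow_le_pow_right₀ hfac1 (by rw [← hcard]; exact Finset.card_le_univ _)
          refine mul_le_mul_of_nonneg_left (pow_le_pow_left₀ ?_ this e) (by positivity)
          exact Finset.prod_nonneg fun _ _ => Finset.prod_nonneg fun _ _ => Finset.prod_nonneg fun _ _ => norm_nonneg _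
      _ ≤ ((1/2) ^ K) ^ N * ((N:ℝ) ^ E) ^ N := by
          refine mul_le_mul_of_nonneg_left ?_ (by positivity)
          rw [← pow_mul]
          calc (N.factorial : ℝ) ^ (d * e) ≤ (N.factorial : ℝ) ^ E := by
                apply pow_le_pow_right₀ hfac1
                rw [hE, he]
                have : I.card ≤ d := by rw [← hcard]; exact Finset.card_le_univ _
                gcongr
            _ ≤ ((N:ℝ) ^ N) ^ E := pow_le_pow_left₀ (by positivity) (by exact_mod_cast Nat.factorial_le_pow N) E
            _ = _ := by rw [← pow_mul, ← pow_mul, mul_comm]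
      _ = ((1/2) ^ K * (N:ℝ) ^ E) ^ N := by rw [mul_pow]
      _ ≤ (1/2) ^ N := by
          refine pow_le_pow_left₀ (by positivity) ?_ N
          have : (N:ℝ) = 2 * K + 1 := by rw [hN]; push_cast; ring
          rw [this, one_div, inv_pow, inv_mul_le_iff₀ (by positivity)]
          linarith
      _ ≤ 1 / 2 := pow_le_of_le_one (by norm_num) (by norm_num) (by omega)
  unfold Pf
  rw [norm_mul, norm_pow]
  have hg := gramD_bound w hw
  rw [hcard] at hg
  calc _ ≤ (1/2 : ℝ) ^ M3 * (((d * d).factorial : ℝ) * (d:ℝ) ^ (d * d)) :=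
        mul_le_mul (pow_le_pow_left₀ (norm_nonneg _) hprod M3) hg (norm_nonneg _) (by positivity)
    _ < 1 := by
        rw [one_div, inv_pow, inv_mul_lt_iff₀ (by positivity)]
        simpa using hM3

end
end WE

namespace WE
open Matrix Polynomial
section
variable {ι : Type*} [Fintype ι] [DecidableEq ι]

/-- squared Hilbert-Schmidt norm -/
noncomputable def hs (p : Matrix ι ι ℂ) : ℝ := ∑ i, ∑ j, ‖p i j‖ ^ 2

lemma hs_nonneg (p : Matrix ι ι ℂ) : 0 ≤ hs p := by unfold hs; positivity

lemma hs_eq_zero (p : Matrix ι ι ℂ) (h : hs p ≤ 0) : p = 0 := by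
  ext i j
  have h1 : ‖p i j‖ ^ 2 ≤ hs p := by
    refine le_trans ?_ (Finset.single_le_sum (f := fun i => ∑ j, ‖p i j‖ ^ 2) (fun _ _ => by positivity) (Finset.mem_univ i))
    exact Finset.single_le_sum (f := fun j => ‖p i j‖ ^ 2) (fun _ _ => by positivity) (Finset.mem_univ j)
  have : ‖p i j‖ ^ 2 = 0 := le_antisymm (h1.trans h) (by positivity)
  simpa using this

lemma norm_sum_mul_sq_le {κ : Type*} [Fintype κ] (x y : κ → ℂ) : ‖∑ k, x k * y k‖ ^ 2 ≤ (∑ k, ‖x k‖ ^ 2) * ∑ k, ‖y k‖ ^ 2 := by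
  have h1 : ‖∑ k, x k * y k‖ ≤ ∑ k, ‖x k‖ * ‖y k‖ := (norm_sum_le _ _).trans (by simp)
  calc _ ≤ (∑ k, ‖x k‖ * ‖y k‖) ^ 2 := pow_le_pow_left₀ (norm_nonneg _) h1 2
    _ ≤ _ := Finset.sum_mul_sq_le_sq_mul_sq _ _ _

lemma hs_mul (p q : Matrix ι ι ℂ) : hs (p * q) ≤ hs p * hs q := by
  unfold hs
  have : (∑ i, ∑ j, ‖p i j‖ ^ 2) * (∑ i, ∑ j, ‖q i j‖ ^ 2) = ∑ i, ∑ j, (∑ k, ‖p i k‖ ^ 2) * (∑ k, ‖q k j‖ ^ 2) := by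
    rw [Finset.sum_mul]
    refine Finset.sum_congr rfl fun i _ => ?_
    rw [← Finset.mul_sum, Finset.sum_comm]
  rw [this]
  refine Finset.sum_le_sum fun i _ => Finset.sum_le_sum fun j _ => ?_
  rw [Matrix.mul_apply]
  exact norm_sum_mul_sq_le _ _

lemma hs_star (p : Matrix ι ι ℂ) : hs pᴴ = hs p := by
  unfold hs
  rw [Finset.sum_comm]
  simp

lemma hs_mid (p q : Matrix ι ι ℂ) : hs ((1/2 : ℂ) • (p + q)) = 1/2 * hs p + 1/2 * hs q - 1/4 * hs (p - q) := by
  unfold hs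
  simp only [Finset.mul_sum, ← Finset.sum_add_distrib, ← Finset.sum_sub_distrib]
  refine Finset.sum_congr rfl fun i _ => Finset.sum_congr rfl fun j _ => ?_
  have := parallelogram_law_with_norm ℝ (p i j) (q i j)
  simp only [Matrix.smul_apply, Matrix.add_apply, Matrix.sub_apply, smul_eq_mul, norm_mul]
  have h2 : ‖(1/2 : ℂ)‖ = 1/2 := by simp
  rw [h2]; nlinarith

lemma hs_continuous : Continuous (hs : Matrix ι ι ℂ → ℝ) := by
  unfold hs
  refine continuous_finsetSum _ fun i _ => continuous_finsetSum _ fun j _ => ?_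
  exact ((continuous_id.matrix_elem i j).norm).pow 2

lemma hs_bdd (p : Matrix ι ι ℂ) (K : ℝ) (h : ∀ i j, ‖p i j‖ ≤ K) : hs p ≤ (Fintype.card ι) ^ 2 * K ^ 2 := by
  unfold hs
  calc _ ≤ ∑ i : ι, ∑ j : ι, K ^ 2 := Finset.sum_le_sum fun i _ => Finset.sum_le_sum fun j _ => pow_le_pow_left₀ (norm_nonneg _) (h i j) 2
    _ = _ := by simp; ring

/-- squared norm of vectors -/
noncomputable def vs (x : ι → ℂ) : ℝ := ∑ i, ‖x i‖ ^ 2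

lemma vs_mulVec (p : Matrix ι ι ℂ) (x : ι → ℂ) : vs (p *ᵥ x) ≤ hs p * vs x := by
  unfold vs hs
  rw [Finset.sum_mul]
  exact Finset.sum_le_sum fun i _ => norm_sum_mul_sq_le _ _

lemma star_dot (x : ι → ℂ) : star x ⬝ᵥ x = ((vs x : ℝ) : ℂ) := by
  unfold vs dotProduct
  push_cast
  refine Finset.sum_congr rfl fun i _ => ?_
  rw [← Complex.ofReal_pow, ← Complex.normSq_eq_norm_sq, ← Complex.mul_conj, mul_comm]; rfl

open scoped ComplexOrder in
lemma posdef_factor (p : Matrix ι ι ℂ) (hp : p.PosDef) : ∃ u : (Matrix ι ι ℂ)ˣ, p = (u : Matrix ι ι ℂ)ᴴ * u := by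
  have hH := hp.isHermitian
  have hsp := hH.spectral_theorem
  rw [Unitary.conjStarAlgAut_apply] at hsp
  set V := hH.eigenvectorUnitary
  set e := hH.eigenvalues
  have he : ∀ i, 0 < e i := hp.eigenvalues_pos
  set S : Matrix ι ι ℂ := diagonal (fun i => ((Real.sqrt (e i) : ℝ) : ℂ)) * star (V : Matrix ι ι ℂ) with hS
  have hSS : p = Sᴴ * S := by
    rw [hS, conjTranspose_mul, ← star_eq_conjTranspose (star _), star_star, diagonal_conjTranspose]
    calc p = _ := hsp
      _ = _ := by
        simp only [mul_assoc]
        congr 1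
        simp only [← mul_assoc]
        rw [diagonal_mul_diagonal]
        congr 2
        ext i
        simp only [Function.comp_apply, Pi.star_apply]
        have h2 : (star ((Real.sqrt (e i) : ℝ) : ℂ)) = ((Real.sqrt (e i) : ℝ) : ℂ) := Complex.conj_ofReal _
        rw [h2, ← Complex.ofReal_mul, Real.mul_self_sqrt (he i).le]; rfl
  have hu : IsUnit S := by
    rw [Matrix.isUnit_iff_isUnit_det, isUnit_iff_ne_zero]
    intro h0
    have : p.det = 0 := by rw [hSS, Matrix.det_mul, h0, mul_zero]
    exact hp.det_pos.ne' this
  obtain ⟨u, hu⟩ := hu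
  exact ⟨u, by rw [hu]; exact hSS⟩

open scoped ComplexOrder in
theorem unitarize {G : Type*} [Group G] (s : G →* Matrix ι ι ℂ) (K : ℝ) (hK : ∀ g i j, ‖s g i j‖ ≤ K) :
    ∃ u : (Matrix ι ι ℂ)ˣ, ∀ g, cj u (s g) ∈ unitaryGroup ι ℂ := by
  set B : ℝ := (Fintype.card ι) ^ 2 * K ^ 2 + 1 with hB
  have hB0 : 0 < B := by positivity
  have hsB : ∀ g, hs (s g) ≤ B := fun g => (hs_bdd _ K (hK g)).trans (by linarith)
  let act : G → Matrix ι ι ℂ → Matrix ι ι ℂ := fun g p => (s g)ᴴ * p * s g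
  have act_act : ∀ g h p, act g (act h p) = act (h * g) p := by
    intro g h p
    simp only [act, map_mul, conjTranspose_mul, mul_assoc]
  have act_one : ∀ p, act 1 p = p := by intro p; simp [act]
  have act_sub : ∀ g p q, act g (p - q) = act g p - act g q := by intro g p q; simp [act, mul_sub, sub_mul]
  have act_mid : ∀ g p q, act g ((1/2 : ℂ) • (p + q)) = (1/2 : ℂ) • (act g p + act g q) := by
    intro g p q; simp [act, mul_add, add_mul]
  have act_hs : ∀ g p, hs (act g p) ≤ B ^ 2 * hs p := by
    intro g p
    calc _ ≤ hs ((s g)ᴴ * p) * hs (s g) := hs_mul _ _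
      _ ≤ (hs (s g)ᴴ * hs p) * hs (s g) := mul_le_mul_of_nonneg_right (hs_mul _ _) (hs_nonneg _)
      _ = (hs (s g) * hs (s g)) * hs p := by rw [hs_star]; ring
      _ ≤ (B * B) * hs p := mul_le_mul_of_nonneg_right (mul_le_mul (hsB g) (hsB g) (hs_nonneg _) hB0.le) (hs_nonneg _)
      _ = _ := by ring
  have act_cont : ∀ g, Continuous (act g) := by
    intro g
    exact (continuous_const.matrix_mul continuous_id).matrix_mul continuous_const
  let f : Matrix ι ι ℂ → ℝ := fun p => ⨆ g, hs (act g p)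
  have bdd : ∀ p, BddAbove (Set.range fun g => hs (act g p)) := fun p => ⟨B ^ 2 * hs p, by rintro _ ⟨g, rfl⟩; exact act_hs g p⟩
  have le_f : ∀ p g, hs (act g p) ≤ f p := fun p g => le_ciSup (bdd p) g
  have f_act : ∀ p h, f (act h p) ≤ f p := by
    intro p h
    refine ciSup_le fun g => ?_
    rw [act_act]; exact le_f _ _
  have f_lsc : LowerSemicontinuous f := lowerSemicontinuous_ciSup bdd fun g => (hs_continuous.comp (act_cont g)).lowerSemicontinuous
  let qf : Matrix ι ι ℂ → (ι → ℂ) → ℝ := fun p x => (star x ⬝ᵥ (p *ᵥ x)).re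
  let C : Set (Matrix ι ι ℂ) := {p | pᴴ = p ∧ ∀ g x, vs x ≤ B * qf (act g p) x}
  have hC1 : (1 : Matrix ι ι ℂ) ∈ C := by
    refine ⟨conjTranspose_one, fun g x => ?_⟩
    have e1 : qf (act g 1) x = vs (s g *ᵥ x) := by
      simp only [qf, act, mul_one]
      rw [← Matrix.mulVec_mulVec, Matrix.dotProduct_mulVec, ← Matrix.star_mulVec, star_dot, Complex.ofReal_re]
    rw [e1]
    have e2 : x = s g⁻¹ *ᵥ (s g *ᵥ x) := by
      rw [Matrix.mulVec_mulVec, ← map_mul]; simp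
    calc vs x = vs (s g⁻¹ *ᵥ (s g *ᵥ x)) := by rw [← e2]
      _ ≤ hs (s g⁻¹) * vs (s g *ᵥ x) := vs_mulVec _ _
      _ ≤ _ := mul_le_mul_of_nonneg_right (hsB _) (by unfold vs; positivity)
  have hCact : ∀ h p, p ∈ C → act h p ∈ C := by
    rintro h p ⟨h1, h2⟩
    refine ⟨?_, fun g x => ?_⟩
    · simp [act, conjTranspose_mul, h1, mul_assoc]
    · rw [act_act]; exact h2 _ _
  have hCmid : ∀ p q, p ∈ C → q ∈ C → (1/2 : ℂ) • (p + q) ∈ C := by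
    rintro p q ⟨h1, h2⟩ ⟨h3, h4⟩
    refine ⟨by simp [conjTranspose_add, h1, h3], fun g x => ?_⟩
    rw [act_mid]
    have : qf ((1/2 : ℂ) • (act g p + act g q)) x = 1/2 * (qf (act g p) x + qf (act g q) x) := by
      simp only [qf]
      rw [Matrix.smul_mulVec, Matrix.add_mulVec, dotProduct_smul, dotProduct_add]
      have : (1/2 : ℂ) = ((1/2 : ℝ) : ℂ) := by norm_num
      rw [this, smul_eq_mul, Complex.re_ofReal_mul, Complex.add_re]
    rw [this]
    nlinarith [h2 g x, h4 g x]
  have hCcl : IsClosed C := by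
    have hcl1 : IsClosed {p : Matrix ι ι ℂ | pᴴ = p} := isClosed_eq (continuous_id.matrix_conjTranspose) continuous_id
    have hcl2 : IsClosed {p : Matrix ι ι ℂ | ∀ g x, vs x ≤ B * qf (act g p) x} := by
      simp only [Set.ofPred_forall]
      refine isClosed_iInter fun g => isClosed_iInter fun x => ?_
      refine isClosed_le continuous_const (continuous_const.mul ?_)
      refine Complex.continuous_re.comp ?_
      exact continuous_const.dotProduct ((act_cont g).matrix_mulVec continuous_const)
    exact hcl1.inter hcl2
  let D : Set (Matrix ι ι ℂ) := C ∩ {p | hs p ≤ f 1}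
  have hDc : IsCompact D := by
    have hbig : IsCompact (Set.pi Set.univ fun _ : ι => Set.pi Set.univ fun _ : ι => Metric.closedBall (0:ℂ) (f 1 + 1)) :=
      isCompact_univ_pi fun _ => isCompact_univ_pi fun _ => isCompact_closedBall _ _
    refine IsCompact.of_isClosed_subset hbig (hCcl.inter (isClosed_le hs_continuous continuous_const)) ?_
    rintro p ⟨_, hp⟩
    intro i _ j _
    have h1 : ‖p i j‖ ^ 2 ≤ hs p := by
      refine le_trans ?_ (Finset.single_le_sum (f := fun i => ∑ j, ‖p i j‖ ^ 2) (fun _ _ => by positivity) (Finset.mem_univ i))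
      exact Finset.single_le_sum (f := fun j => ‖p i j‖ ^ 2) (fun _ _ => by positivity) (Finset.mem_univ j)
    have h2 : hs p ≤ f 1 := hp
    rw [mem_closedBall_zero_iff]
    nlinarith [norm_nonneg (p i j), sq_nonneg (‖p i j‖ - 1)]
  have h1f : hs (1 : Matrix ι ι ℂ) ≤ f 1 := by have := le_f 1 1; rwa [act_one] at this
  obtain ⟨p, hpD, hpmin⟩ := LowerSemicontinuousOn.exists_isMinOn (s := D) ⟨1, hC1, h1f⟩ hDc (f_lsc.lowerSemicontinuousOn D)
  have hpC := hpD.1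
  have hmin : ∀ q ∈ C, f p ≤ f q := by
    intro q hq
    by_cases hq2 : hs q ≤ f 1
    · exact hpmin ⟨hq, hq2⟩
    · have := le_f q 1
      rw [act_one] at this
      have h3 : f p ≤ f 1 := hpmin (show (1 : Matrix ι ι ℂ) ∈ D from ⟨hC1, h1f⟩)
      linarith
  have huniq : ∀ q ∈ C, f q ≤ f p → q = p := by
    intro q hq hqp
    have hr := hmin _ (hCmid p q hpC hq)
    have hr2 : f ((1/2 : ℂ) • (p + q)) ≤ f p - hs (p - q) / (4 * B ^ 2) := by
      refine ciSup_le fun g => ?_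
      rw [act_mid, hs_mid, ← act_sub]
      have h1 : hs (p - q) ≤ B ^ 2 * hs (act g (p - q)) := by
        have := act_hs g⁻¹ (act g (p - q))
        rw [act_act, mul_inv_cancel, act_one] at this
        exact this
      have h2 : hs (p - q) / (4 * B ^ 2) ≤ 1/4 * hs (act g (p - q)) := by
        rw [div_le_iff₀ (by positivity)]; nlinarith
      have := le_f p g
      have := le_f q g
      linarith
    have h3 : hs (p - q) / (4 * B ^ 2) ≤ 0 := by linarith
    have h4 : hs (p - q) ≤ 0 := by
      by_contra hcon
      push Not at hcon
      have : 0 < hs (p - q) / (4 * B ^ 2) := by positivity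
      linarith
    exact (sub_eq_zero.1 (hs_eq_zero _ h4)).symm
  have hfix : ∀ g, act g p = p := fun g => huniq _ (hCact g p hpC) (f_act p g)
  have hpd : p.PosDef := by
    have hHp : p.IsHermitian := hpC.1
    refine Matrix.PosDef.of_dotProduct_mulVec_pos hHp fun x hx => ?_
    rw [Complex.lt_def]
    constructor
    · have h1 := hpC.2 1 x
      rw [act_one] at h1
      have h2 : 0 < vs x := by
        obtain ⟨i, hi⟩ := Function.ne_iff.1 hx
        unfold vs
        refine Finset.sum_pos' (fun _ _ => by positivity) ⟨i, Finset.mem_univ i, ?_⟩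
        have : 0 < ‖x i‖ := norm_pos_iff.2 hi
        positivity
      have h3 : 0 < B * qf p x := lt_of_lt_of_le h2 h1
      exact (pos_iff_pos_of_mul_pos h3).1 hB0
    · have := hHp.im_star_dotProduct_mulVec_self x
      exact this.symm
  obtain ⟨u, hu⟩ := posdef_factor p hpd
  refine ⟨u, fun g => ?_⟩
  rw [Matrix.mem_unitaryGroup_iff', star_eq_conjTranspose]
  unfold cj
  set ui : Matrix ι ι ℂ := ((u⁻¹ : (Matrix ι ι ℂ)ˣ) : Matrix ι ι ℂ) with hui
  have h1 : (u : Matrix ι ι ℂ) * ui = 1 := by simp [hui]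
  have h2 : uiᴴ * (u : Matrix ι ι ℂ)ᴴ = 1 := by rw [← conjTranspose_mul, h1, conjTranspose_one]
  have hf := hfix g
  calc _ = uiᴴ * ((s g)ᴴ * ((u : Matrix ι ι ℂ)ᴴ * u) * s g) * ui := by simp only [conjTranspose_mul, mul_assoc]
    _ = uiᴴ * ((u : Matrix ι ι ℂ)ᴴ * u) * ui := by rw [← hu]; rw [show (s g)ᴴ * p * s g = p from hf]
    _ = (uiᴴ * (u : Matrix ι ι ℂ)ᴴ) * (u * ui) := by simp only [mul_assoc]
    _ = 1 := by rw [h1, h2, mul_one]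

end
end WE

namespace WE
open Matrix
section
variable {ι : Type*} [Fintype ι] [DecidableEq ι] {K : Type*} [Field K] {G : Type*} [Group G]

/-- evaluation of a polynomial function at a matrix -/
noncomputable def evp (A : Matrix ι ι K) : MvPolynomial (ι × ι) K →+* K :=
  MvPolynomial.eval (fun p => A p.1 p.2)

noncomputable def gX (ι K : Type*) [Field K] : Matrix ι ι (MvPolynomial (ι × ι) K) :=
  Matrix.of fun i j => MvPolynomial.X (i, j)

lemma gX_map (A : Matrix ι ι K) : (evp A).mapMatrix (gX ι K) = A := by
  ext i j; simp [evp, gX]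

lemma C_map (A B : Matrix ι ι K) : (evp A).mapMatrix (MvPolynomial.C.mapMatrix B) = B := by
  ext i j; simp [evp]

/-- right translation -/
noncomputable def rtr (B : Matrix ι ι K) : MvPolynomial (ι × ι) K →+* MvPolynomial (ι × ι) K :=
  (MvPolynomial.aeval (fun p : ι × ι => (gX ι K * MvPolynomial.C.mapMatrix B : Matrix ι ι (MvPolynomial (ι × ι) K)) p.1 p.2)).toRingHom

lemma evp_rtr (A B : Matrix ι ι K) (F) : evp A (rtr B F) = evp (A * B) F := by
  have : (evp A).comp (rtr B) = evp (A * B) := by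
    apply MvPolynomial.ringHom_ext
    · intro r; simp [rtr, evp]
    · intro p
      simp only [RingHom.comp_apply]
      have h : (evp A).mapMatrix (gX ι K * MvPolynomial.C.mapMatrix B) = A * B := by
        rw [map_mul, gX_map, C_map]
      have h2 := congrFun (congrFun h p.1) p.2
      rw [RingHom.mapMatrix_apply, Matrix.map_apply] at h2
      have e : rtr B (MvPolynomial.X p) = (gX ι K * MvPolynomial.C.mapMatrix B : Matrix ι ι (MvPolynomial (ι × ι) K)) p.1 p.2 := by simp [rtr]
      rw [e, h2]; simp [evp]
  exact RingHom.congr_fun this F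

lemma evp_ext [Infinite K] {F F' : MvPolynomial (ι × ι) K} (h : ∀ A, evp A F = evp A F') : F = F' := by
  apply MvPolynomial.funext
  intro x
  exact h (Matrix.of fun i j => x (i, j))

lemma rtr_comp [Infinite K] (B B' : Matrix ι ι K) : (rtr B).comp (rtr B') = rtr (B * B') := by
  refine RingHom.ext fun F => ?_
  apply evp_ext
  intro A
  rw [RingHom.comp_apply, evp_rtr, evp_rtr, evp_rtr, mul_assoc]

lemma rtr_one [Infinite K] : rtr (1 : Matrix ι ι K) = RingHom.id _ := by
  refine RingHom.ext fun F => ?_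
  apply evp_ext
  intro A
  rw [evp_rtr, mul_one]; rfl

/-- vanishing ideal -/
noncomputable def vI (S : G →* Matrix ι ι K) (H : Subgroup G) : Ideal (MvPolynomial (ι × ι) K) :=
  ⨅ h : H, RingHom.ker (evp (S h))

lemma mem_vI (S : G →* Matrix ι ι K) (H : Subgroup G) (F) : F ∈ vI S H ↔ ∀ h ∈ H, evp (S h) F = 0 := by
  simp [vI, Ideal.mem_iInf, RingHom.mem_ker]

/-- Zariski connectedness -/
def Zc (S : G →* Matrix ι ι K) : Prop := ∀ F1 F2 : MvPolynomial (ι × ι) K, (∃ g, evp (S g) F1 ≠ 0) →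
  (∃ g, evp (S g) F2 ≠ 0) → ∃ g, evp (S g) (F1 * F2) ≠ 0

lemma Zc.prod {S : G →* Matrix ι ι K} (h : Zc S) {κ : Type*} (s : Finset κ) (F : κ → MvPolynomial (ι × ι) K)
    (hF : ∀ t ∈ s, ∃ g, evp (S g) (F t) ≠ 0) : ∃ g, evp (S g) (∏ t ∈ s, F t) ≠ 0 := by
  classical
  induction s using Finset.induction_on with
  | empty => exact ⟨1, by simp⟩
  | insert a s ha ih =>
    rw [Finset.prod_insert ha]
    exact h _ _ (hF a (by simp)) (ih fun t ht => hF t (by simp [ht]))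

lemma rtr_min [Infinite K] (S : G →* Matrix ι ι K) (H : Subgroup G) (𝔭 : Ideal (MvPolynomial (ι × ι) K))
    (h𝔭 : 𝔭 ∈ (vI S H).minimalPrimes) (g : G) (hg : g ∈ H) :
    𝔭.comap (rtr (S g)) ∈ (vI S H).minimalPrimes := by
  have hle : ∀ g ∈ H, ∀ q : Ideal (MvPolynomial (ι × ι) K), vI S H ≤ q → vI S H ≤ q.comap (rtr (S g)) := by
    intro g hg q hq F hF
    rw [Ideal.mem_comap]
    apply hq
    rw [mem_vI] at hF ⊢
    intro h hh
    rw [evp_rtr, ← map_mul]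
    exact hF _ (H.mul_mem hh hg)
  have hcomp : ∀ g : G, ∀ q : Ideal (MvPolynomial (ι × ι) K), (q.comap (rtr (S g))).comap (rtr (S g⁻¹)) = q := by
    intro g q
    rw [Ideal.comap_comap, rtr_comp, ← map_mul, mul_inv_cancel, map_one, rtr_one, Ideal.comap_id]
  obtain ⟨⟨hp, hI⟩, hmin⟩ := h𝔭
  refine ⟨⟨Ideal.IsPrime.comap _, hle g hg _ hI⟩, ?_⟩
  rintro q ⟨hq, hqI⟩ hqle
  have h1 : q.comap (rtr (S g⁻¹)) ≤ 𝔭 := by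
    rw [← hcomp g 𝔭]; exact Ideal.comap_mono hqle
  have h2 := hmin ⟨Ideal.IsPrime.comap _, hle _ (H.inv_mem hg) _ hqI⟩ h1
  have h3 := Ideal.comap_mono (f := rtr (S g)) h2
  have h4 := hcomp g⁻¹ q
  rw [inv_inv] at h4
  rwa [h4] at h3

theorem exists_Zc [IsAlgClosed K] (S : G →* Matrix ι ι K) :
    ∃ H : Subgroup G, H.FiniteIndex ∧ Zc (S.comp H.subtype) := by
  haveI : Infinite K := inferInstance
  have hwf : WellFounded ((· > ·) : Ideal (MvPolynomial (ι × ι) K) → _ → Prop) := wellFounded_gt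
  obtain ⟨I, ⟨H, hH, rfl⟩, hmax⟩ := hwf.has_min {I | ∃ H : Subgroup G, H.FiniteIndex ∧ vI S H = I}
    ⟨_, ⊤, inferInstance, rfl⟩
  refine ⟨H, hH, ?_⟩
  suffices hpr : (vI S H).IsPrime by
    intro F1 F2 h1 h2
    by_contra hcon
    push Not at hcon
    have : F1 * F2 ∈ vI S H := (mem_vI _ _ _).mpr fun h hh => hcon ⟨h, hh⟩
    rcases hpr.mem_or_mem this with h | h
    · obtain ⟨g, hg⟩ := h1
      exact hg ((mem_vI _ _ _).mp h g g.2)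
    · obtain ⟨g, hg⟩ := h2
      exact hg ((mem_vI _ _ _).mp h g g.2)
  have hker : vI S H ≤ RingHom.ker (evp (1 : Matrix ι ι K)) := by
    intro F hF
    have := (mem_vI _ _ _).mp hF 1 H.one_mem
    rwa [map_one] at this
  haveI : (RingHom.ker (evp (1 : Matrix ι ι K))).IsPrime := RingHom.ker_isPrime _
  obtain ⟨𝔭, h𝔭, h𝔭1⟩ := Ideal.exists_minimalPrimes_le hker
  let Ω := {q // q ∈ (vI S H).minimalPrimes}
  haveI : Finite Ω := (Ideal.finite_minimalPrimes_of_isNoetherianRing _ (vI S H)).to_subtype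
  letI : MulAction H Ω :=
    { smul := fun h q => ⟨q.1.comap (rtr (S (h : G)⁻¹)), rtr_min S H _ q.2 _ (H.inv_mem h.2)⟩
      one_smul := fun q => Subtype.ext (by
        change q.1.comap (rtr (S ((1 : H) : G)⁻¹)) = q.1
        simp [rtr_one, Ideal.comap_id])
      mul_smul := fun g h q => Subtype.ext (by
        change q.1.comap (rtr (S ((g * h : H) : G)⁻¹)) = (q.1.comap (rtr (S (h : G)⁻¹))).comap (rtr (S (g : G)⁻¹))
        rw [Ideal.comap_comap, rtr_comp, ← map_mul]
        simp) }
  set N := (MulAction.toPermHom H Ω).ker with hN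
  have hNi : N.FiniteIndex := Subgroup.finiteIndex_ker _
  have hN' : (N.map H.subtype).FiniteIndex := ⟨by
    rw [Subgroup.index_map_subtype]; exact mul_ne_zero hNi.index_ne_zero hH.index_ne_zero⟩
  have hle : 𝔭 ≤ vI S (N.map H.subtype) := by
    intro F hF
    rw [mem_vI]
    rintro _ ⟨h, hh, rfl⟩
    have h1 : h⁻¹ • (⟨𝔭, h𝔭⟩ : Ω) = ⟨𝔭, h𝔭⟩ := by
      have := MonoidHom.mem_ker.mp (N.inv_mem hh)
      exact Equiv.ext_iff.mp this ⟨𝔭, h𝔭⟩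
    have h2 : 𝔭.comap (rtr (S ((h⁻¹ : H) : G)⁻¹)) = 𝔭 := congrArg Subtype.val h1
    rw [← h2, Ideal.mem_comap] at hF
    have h3 := h𝔭1 hF
    rw [RingHom.mem_ker, evp_rtr] at h3
    simpa using h3
  have hmon : vI S H ≤ vI S (N.map H.subtype) := by
    intro F hF
    rw [mem_vI] at hF ⊢
    rintro _ ⟨h, hh, rfl⟩
    exact hF _ h.2
  have heq : vI S (N.map H.subtype) = vI S H := by
    by_contra hne
    exact hmax _ ⟨_, hN', rfl⟩ (lt_of_le_of_ne hmon (Ne.symm hne))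
  have : vI S H = 𝔭 := le_antisymm h𝔭.1.2 (heq ▸ hle)
  rw [this]; exact h𝔭.1.1
end
end WE

namespace WE
open Matrix
section
variable {ι : Type*} [Fintype ι] [DecidableEq ι] {K : Type*} [Field K] {G : Type*} [Group G]

lemma span_top [IsAlgClosed K] [Nonempty ι] (S : G →* Matrix ι ι K) (H : Subgroup G) (h : Irr (S '' H)) :
    Submodule.span K (S '' H) = ⊤ := burnside (H.toSubmonoid.map S) h

lemma trace_nondeg (S : Set (Matrix ι ι K)) (hS : Submodule.span K S = ⊤) (Z : Matrix ι ι K)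
    (h : ∀ A ∈ S, (Z * A).trace = 0) : Z = 0 := by
  have h2 : ∀ A : Matrix ι ι K, (Z * A).trace = 0 := by
    intro A
    have hA : A ∈ Submodule.span K S := hS ▸ Submodule.mem_top
    induction hA using Submodule.span_induction with
    | mem x hx => exact h x hx
    | zero => simp
    | add x y _ _ hx hy => rw [mul_add, trace_add, hx, hy, add_zero]
    | smul a x _ hx => rw [Matrix.mul_smul, trace_smul, hx, smul_zero]
  rw [Matrix.ext_iff_trace_mul_right]
  intro x; rw [h2]; simp

lemma basis_words (S : G →* Matrix ι ι K) (H : Subgroup G) (h : Submodule.span K (S '' H) = ⊤) :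
    ∃ w : ι × ι → G, (∀ p, w p ∈ H) ∧ gramD (fun p => S (w p)) ≠ 0 := by
  obtain ⟨b, hb, hspan, hli⟩ := exists_linearIndependent K (S '' (H : Set G))
  rw [h] at hspan
  let B : Module.Basis b K (Matrix ι ι K) := Module.Basis.mk hli (by rw [Subtype.range_coe, hspan])
  haveI : Finite b := Module.Finite.finite_basis B
  haveI := Fintype.ofFinite b
  have hcard : Fintype.card (ι × ι) = Fintype.card b := by
    rw [← Module.finrank_eq_card_basis B, Module.finrank_matrix]; simp
  let e : ι × ι ≃ b := Fintype.equivOfCardEq hcard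
  have hch : ∀ p, ∃ g ∈ H, S g = e p := fun p => by
    obtain ⟨g, hg, hg2⟩ := hb (e p).2
    exact ⟨g, hg, hg2⟩
  choose w hw hw2 using hch
  refine ⟨w, hw, ?_⟩
  unfold gramD
  apply gram_ne_zero
  · have : (fun p => S (w p)) = (fun x : b => (x : Matrix ι ι K)) ∘ e := by ext p; simp [hw2]
    rw [this]; exact hli.comp _ e.injective
  · have : Set.range (fun p => S (w p)) = b := by
      ext x; constructor
      · rintro ⟨p, rfl⟩; simp only [hw2]; exact (e p).2
      · intro hx; exact ⟨e.symm ⟨x, hx⟩, by simp [hw2]⟩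
    rw [this, hspan]

lemma eig_stab (l : ι → K) (Q : ℕ) [Nonempty ι] : ∃ t < Fintype.card ι,
    ∀ j k, (l j ^ (Q ^ t)) ^ Q = (l k ^ (Q ^ t)) ^ Q → l j ^ (Q ^ t) = l k ^ (Q ^ t) := by
  classical
  by_contra hcon
  push Not at hcon
  let im : ℕ → Finset K := fun t => Finset.univ.image fun j => l j ^ (Q ^ t)
  have him : ∀ t, im (t + 1) = (im t).image (fun x => x ^ Q) := by
    intro t
    simp only [im, Finset.image_image]
    congr 1
    ext j; simp [pow_succ, pow_mul]
  have hlt : ∀ t < Fintype.card ι, (im (t+1)).card < (im t).card := by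
    intro t ht
    obtain ⟨j, k, h1, h2⟩ := hcon t ht
    rw [him]
    refine lt_of_le_of_ne Finset.card_image_le ?_
    intro h
    have := Finset.card_image_iff.mp h
    exact h2 (this (by simp [im]) (by simp [im]) h1)
  have hind : ∀ t ≤ Fintype.card ι, (im t).card + t ≤ Fintype.card ι := by
    intro t
    induction t with
    | zero => intro _; simpa using (Finset.card_image_le (s := Finset.univ) (f := fun j => l j ^ (Q ^ 0)))
    | succ t ih =>
      intro ht
      have := ih (by omega)
      have := hlt t (by omega)
      omega
  have h1 := hind _ le_rfl
  have h2 : 0 < (im (Fintype.card ι)).card := Finset.card_pos.mpr (Finset.univ_nonempty.image _)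
  omega

lemma not_irr_one (h2 : 2 ≤ Fintype.card ι) (S : G →* Matrix ι ι K) (hirr : Irr (Set.range S))
    (h : ∀ g, S g = 1) : False := by
  haveI : Nonempty ι := Fintype.card_pos_iff.mp (by omega)
  let j : ι := Classical.arbitrary ι
  have := hirr (Submodule.span K {Pi.single j 1}) (by
    rintro _ ⟨g, rfl⟩ v hv
    rw [h, one_mulVec]; exact hv)
  rcases this with h0 | h0
  · rw [Submodule.span_singleton_eq_bot] at h0
    have := congrFun h0 j
    simp at this
  · have h3 := finrank_span_singleton (K := K) (v := (Pi.single j 1 : ι → K)) (by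
      intro h0
      have := congrFun h0 j
      simp at this)
    rw [h0, finrank_top] at h3
    simp at h3
    omega

theorem exists_good_elt [IsAlgClosed K] [CharZero K] (S : G →* Matrix ι ι K) (hZ : Zc S) (hirr : Irr (Set.range S))
    (hdet : ∀ g, (S g).det = 1) (h2 : 2 ≤ Fintype.card ι) (N : ℕ) :
    ∃ g l, HasEig (S g) l ∧ (∃ j k, l j ≠ l k) ∧ ∀ j k, l j ≠ l k → ∀ i, 1 ≤ i → i < N → l j ^ i ≠ l k ^ i := by
  classical
  haveI : Nonempty ι := Fintype.card_pos_iff.mp (by omega)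
  by_contra hcon
  push Not at hcon
  set d := Fintype.card ι with hd
  set Q := N.factorial with hQ
  have hQ0 : 0 < Q := Nat.factorial_pos N
  set E := Q ^ d * d with hE
  have hE0 : 0 < E := by positivity
  let R : Finset K := (Fintype.piFinset fun _ : ι => Polynomial.nthRootsFinset E (1:K)).image (fun l => ∑ j, l j)
  have htr : ∀ g, (S g).trace ∈ R := by
    intro g
    obtain ⟨l, hl⟩ := exists_hasEig (S g)
    rw [hl.trace]
    refine Finset.mem_image.mpr ⟨l, ?_, rfl⟩
    rw [Fintype.mem_piFinset]
    intro j
    rw [Polynomial.mem_nthRootsFinset hE0]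
    obtain ⟨t, ht, hinj⟩ := eig_stab l Q
    have hp := hl.pow (Q ^ t)
    rw [← map_pow] at hp
    have heq : ∀ a b, l a ^ Q ^ t = l b ^ Q ^ t := by
      by_contra hne
      push Not at hne
      obtain ⟨a, b, hab, i, h1, hN, hi⟩ := hcon _ _ hp hne
      apply hab
      apply hinj
      obtain ⟨c, hc⟩ := Nat.dvd_factorial h1 hN.le
      rw [← hQ] at hc
      rw [hc, pow_mul _ i c, pow_mul _ i c, ← hc, hi]
    have hdt := hp.det
    rw [hdet, Finset.prod_congr rfl (fun a _ => heq a j)] at hdt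
    simp only [Finset.prod_const, Finset.card_univ, ← hd] at hdt
    have : E = (Q ^ t * d) * Q ^ (d - t) := by
      rw [hE, mul_right_comm, ← pow_add]; congr 2; omega
    rw [this, pow_mul, pow_mul, ← hdt, one_pow]
  obtain ⟨r, hr⟩ : ∃ r, ∀ g, (S g).trace = r := by
    by_contra hno
    push Not at hno
    have hev : ∀ g r, evp (S g) ((gX ι K).trace - MvPolynomial.C r) = (S g).trace - r := by
      intro g r
      rw [map_sub, trace_map', gX_map]; simp [evp]
    obtain ⟨g, hg⟩ := hZ.prod R (fun r => (gX ι K).trace - MvPolynomial.C r) (fun r _ => by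
      obtain ⟨g, hg⟩ := hno r
      exact ⟨g, by rw [hev]; exact sub_ne_zero.mpr hg⟩)
    rw [map_prod] at hg
    exact Finset.prod_ne_zero_iff.mp hg _ (htr g) (by rw [hev, sub_self])
  have hspan := span_top S ⊤ (by simpa using hirr)
  refine not_irr_one h2 S hirr fun g => ?_
  rw [← sub_eq_zero]
  refine trace_nondeg _ hspan _ ?_
  rintro _ ⟨h, _, rfl⟩
  rw [sub_mul, one_mul, trace_sub, ← map_mul, hr, hr, sub_self]

lemma em_ne_zero (Z : Matrix ι ι K) (z : ι → K) (hz : HasEig Z z) (I : Finset ι) (h0 : ∀ k ∉ I, z k = 0)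
    (h1 : ∀ k ∈ I, z k ≠ 0) : em Z I.card ≠ 0 := by
  unfold em
  rw [hz, ← Finset.prod_compl_mul_prod I]
  have : ∏ j ∈ Iᶜ, (Polynomial.X - Polynomial.C (z j)) = Polynomial.X ^ (Fintype.card ι - I.card) := by
    rw [Finset.prod_congr rfl (fun j hj => by rw [h0 j (by simpa using hj), Polynomial.C_0, sub_zero]),
      Finset.prod_const, Finset.card_compl]
  rw [this, Polynomial.coeff_X_pow_mul', if_pos le_rfl, Nat.sub_self, Polynomial.coeff_zero_eq_eval_zero,
    Polynomial.eval_prod]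
  refine Finset.prod_ne_zero_iff.mpr fun k hk => ?_
  simpa using h1 k hk

lemma XX_eig [IsAlgClosed K] (A : Matrix ι ι K) (l : ι → K) (h : HasEig A l) (S : Finset ι) (i : ℕ) :
    HasEig (XX A l S i) (fun k => ∏ j ∈ S, (l k ^ i - l j ^ i)) := by
  unfold XX
  have := h.aeval (∏ j ∈ S, (Polynomial.X ^ i - Polynomial.C (l j ^ i)))
  convert this using 2
  rw [Polynomial.eval_prod]; simp

lemma ne_zero_of_eig (A : Matrix ι ι K) (l : ι → K) (h : HasEig A l) (k : ι) (hk : l k ≠ 0) : A ≠ 0 := by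
  rintro rfl
  have := h.det_sub (l k)
  rw [Finset.prod_eq_zero (Finset.mem_univ k) (sub_self _), zero_sub, ← map_neg, Matrix.algebraMap_eq_diagonal, det_diagonal] at this
  rw [Finset.prod_eq_zero_iff] at this
  obtain ⟨_, _, h⟩ := this
  simp at h
  exact hk h

theorem exists_data [IsAlgClosed K] [CharZero K] (S : G →* Matrix ι ι K) (hZ : Zc S) (hirr : Irr (Set.range S))
    (hdet : ∀ g, (S g).det = 1) (h2 : 2 ≤ Fintype.card ι) (M N : ℕ) :
    ∃ (g0 b : G) (c : ℕ → G) (l : ι → K) (I : Finset ι) (z0 : K), HasEig (S g0) l ∧ I.Nonempty ∧ (∀ j ∈ I, l j = z0) ∧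
      ∀ i, 1 ≤ i → i < N → Qf (S g0) (S b) (S (c i)) l I M i ≠ 0 := by
  classical
  haveI : Nonempty ι := Fintype.card_pos_iff.mp (by omega)
  obtain ⟨g0, l, hl, ⟨j0, k0, hjk⟩, hdist⟩ := exists_good_elt S hZ hirr hdet h2 N
  have hspan := span_top S ⊤ (by simpa using hirr)
  set A := S g0
  set I : Finset ι := Finset.univ.filter fun j => l j = l j0 with hI
  have hmem : ∀ j, j ∈ I ↔ l j = l j0 := by simp [hI]
  have hch : ∀ i, ∃ bc : G × G, 1 ≤ i → i < N → (XX A l Iᶜ i * S bc.1 * (XX A l I i * S bc.2)).trace ≠ 0 := by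
    intro i
    by_cases hi : 1 ≤ i ∧ i < N
    swap
    · exact ⟨1, fun h1 h2 => absurd ⟨h1, h2⟩ hi⟩
    by_contra hno
    push Not at hno
    have hX : XX A l Iᶜ i ≠ 0 := ne_zero_of_eig _ _ (XX_eig A l hl _ i) j0 (by
      refine Finset.prod_ne_zero_iff.mpr fun j hj => sub_ne_zero.mpr (hdist _ _ ?_ i hi.1 hi.2)
      rw [Finset.mem_compl, hmem] at hj
      exact Ne.symm hj)
    have hY : XX A l I i ≠ 0 := ne_zero_of_eig _ _ (XX_eig A l hl _ i) k0 (by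
      refine Finset.prod_ne_zero_iff.mpr fun j hj => sub_ne_zero.mpr (hdist _ _ ?_ i hi.1 hi.2)
      rw [hmem] at hj
      rw [hj]; exact hjk.symm)
    have h3 : ∀ b : G, XX A l Iᶜ i * S b * XX A l I i = 0 := by
      intro b
      refine trace_nondeg _ hspan _ ?_
      rintro _ ⟨c, _, rfl⟩
      have := (hno (b, c)).2.2
      rwa [← mul_assoc] at this
    have h4 : ∀ B : Matrix ι ι K, XX A l Iᶜ i * B * XX A l I i = 0 := by
      intro B
      have hB : B ∈ Submodule.span K (S '' ((⊤ : Subgroup G) : Set G)) := hspan ▸ Submodule.mem_top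
      induction hB using Submodule.span_induction with
      | mem x hx => obtain ⟨b, _, rfl⟩ := hx; exact h3 b
      | zero => simp
      | add x y _ _ hx hy => rw [mul_add, add_mul, hx, hy, add_zero]
      | smul a x _ hx => rw [Matrix.mul_smul, Matrix.smul_mul, hx, smul_zero]
    obtain ⟨p, q, hpq⟩ : ∃ p q, XX A l Iᶜ i p q ≠ 0 := by
      by_contra hz; push Not at hz; exact hX (by ext p q; exact hz p q)
    obtain ⟨r, s, hrs⟩ : ∃ p q, XX A l I i p q ≠ 0 := by
      by_contra hz; push Not at hz; exact hY (by ext p q; exact hz p q)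
    have h5 := congrFun (congrFun (h4 (Matrix.single q r 1)) p) s
    rw [Matrix.mul_apply, Finset.sum_eq_single r] at h5
    · rw [Matrix.mul_single_apply_same, mul_one, Matrix.zero_apply] at h5
      exact mul_ne_zero hpq hrs h5
    · intro t _ ht
      rw [Matrix.mul_single_apply_of_ne (hbj := ht), zero_mul]
    · simp
  choose bc hbc using hch
  let gC : Matrix ι ι K → Matrix ι ι (MvPolynomial (ι × ι) K) := fun B => MvPolynomial.C.mapMatrix B
  let l' : ι → MvPolynomial (ι × ι) K := fun j => MvPolynomial.C (l j)
  have hXev : ∀ B T i, (evp B).mapMatrix (XX (gC A) l' T i) = XX A l T i := by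
    intro B T i
    rw [XX_map, C_map]; simp [l', evp]
  let F1 : ℕ → MvPolynomial (ι × ι) K := fun i => em ((XX (gC A) l' Iᶜ i * gX ι K) ^ M) I.card
  let F2 : ℕ → MvPolynomial (ι × ι) K := fun i =>
    (XX (gC A) l' Iᶜ i * gX ι K * (XX (gC A) l' I i * gC (S (bc i).2))).trace
  have hF1 : ∀ B i, evp B (F1 i) = em ((XX A l Iᶜ i * B) ^ M) I.card := by
    intro B i
    simp only [F1]
    rw [em_map, map_pow, map_mul, hXev, gX_map]
  have hF2 : ∀ B i, evp B (F2 i) = (XX A l Iᶜ i * B * (XX A l I i * S (bc i).2)).trace := by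
    intro B i
    simp only [F2]
    rw [trace_map', map_mul, map_mul, map_mul, hXev, hXev, gX_map, C_map]
  obtain ⟨b, hb⟩ := hZ.prod (Finset.Ico 1 N) (fun i => F1 i * F2 i) (fun i hi => by
    rw [Finset.mem_Ico] at hi
    apply hZ
    · refine ⟨1, ?_⟩
      rw [hF1, map_one, mul_one]
      have hz := (XX_eig A l hl Iᶜ i).pow M
      by_cases hM : M = 0
      · subst hM
        simp only [pow_zero] at hz ⊢
        unfold em
        rw [Matrix.charpoly_one, sub_eq_add_neg, ← Polynomial.C_1, ← Polynomial.C_neg, Polynomial.coeff_X_add_C_pow]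
        refine mul_ne_zero (pow_ne_zero _ (by simp)) ?_
        exact_mod_cast (Nat.choose_pos (Nat.sub_le _ _)).ne'
      refine em_ne_zero _ _ hz I ?_ ?_
      · intro k hk
        rw [Finset.prod_eq_zero (Finset.mem_compl.mpr hk) (sub_self _), zero_pow hM]
      · intro k hk
        refine pow_ne_zero _ (Finset.prod_ne_zero_iff.mpr fun j hj => sub_ne_zero.mpr (hdist _ _ ?_ i hi.1 hi.2))
        rw [Finset.mem_compl, hmem] at hj
        rw [(hmem k).mp hk]; exact Ne.symm hj
    · exact ⟨(bc i).1, by rw [hF2]; exact hbc i hi.1 hi.2⟩)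
  refine ⟨g0, b, fun i => (bc i).2, l, I, l j0, hl, ⟨j0, (hmem _).mpr rfl⟩, fun j hj => (hmem j).mp hj, ?_⟩
  intro i h1 hN
  rw [map_prod] at hb
  have := Finset.prod_ne_zero_iff.mp hb i (Finset.mem_Ico.mpr ⟨h1, hN⟩)
  rw [map_mul, hF1, hF2] at this
  unfold Qf
  rw [mul_assoc]
  exact mul_ne_zero (by exact_mod_cast (Nat.factorial_pos _).ne') this
end
end WE

namespace WE
open Matrix
section
variable {ι : Type*} [Fintype ι] [DecidableEq ι] {K : Type*} [Field K] {G : Type*} [Group G]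

lemma newton_int [IsAlgClosed K] (R : Subring K) (Z : Matrix ι ι K) (h : ∀ n : ℕ, (Z ^ n).trace ∈ R) (m : ℕ)
    (hm : m ≤ Fintype.card ι) : (m.factorial : K) * em Z m ∈ R := by
  classical
  obtain ⟨z, hz⟩ := exists_hasEig Z
  have hp : ∀ n, MvPolynomial.aeval z (MvPolynomial.psum ι ℤ n) ∈ R := by
    intro n
    have : MvPolynomial.aeval z (MvPolynomial.psum ι ℤ n) = (Z ^ n).trace := by
      rw [(hz.pow n).trace]; simp [MvPolynomial.psum]
    rw [this]; exact h n
  have he : ∀ n : ℕ, (n.factorial : K) * MvPolynomial.aeval z (MvPolynomial.esymm ι ℤ n) ∈ R := by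
    intro n
    induction n using Nat.strong_induction_on with
    | _ n ih =>
      rcases n with _ | n
      · simp [R.one_mem]
      have h1 := congrArg (MvPolynomial.aeval z) (MvPolynomial.mul_esymm_eq_sum ι ℤ (n+1))
      rw [map_mul, map_mul, map_sum, map_natCast] at h1
      rw [Nat.factorial_succ, Nat.cast_mul, mul_comm ((n+1 : ℕ) : K), mul_assoc, h1, map_pow, map_neg, map_one,
        mul_left_comm, Finset.mul_sum]
      refine R.mul_mem (R.pow_mem (R.neg_mem R.one_mem) _) (R.sum_mem fun a ha => ?_)
      rw [Finset.mem_filter] at ha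
      rw [map_mul, map_mul, map_pow, map_neg, map_one]
      obtain ⟨c, hc⟩ := Nat.factorial_dvd_factorial (show a.1 ≤ n by omega)
      rw [hc, Nat.cast_mul]
      have h2 := R.mul_mem (R.mul_mem (natCast_mem R c) (R.pow_mem (R.neg_mem R.one_mem) a.1)) (R.mul_mem (ih a.1 ha.2) (hp a.2))
      convert h2 using 1
      ring
  have hem : em Z m = (-1) ^ m * MvPolynomial.aeval z (MvPolynomial.esymm ι ℤ m) := by
    unfold em
    rw [hz]
    have h1 : ∏ j, (Polynomial.X - Polynomial.C (z j)) =
        ((Finset.univ.val.map z).map fun a => Polynomial.X - Polynomial.C a).prod := by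
      rw [Multiset.map_map]; rfl
    rw [h1, Multiset.prod_X_sub_C_coeff _ (by simp)]
    have h2 : (Finset.univ.val.map z).card - (Fintype.card ι - m) = m := by simp; omega
    rw [h2, MvPolynomial.aeval_esymm_eq_multiset_esymm]
  rw [hem, mul_left_comm]
  exact R.mul_mem (R.pow_mem (R.neg_mem R.one_mem) _) (he m)

section
variable (R : Subring K) (S : G →* Matrix ι ι K)

/-- integral combinations -/
def ZR : Subalgebra R (Matrix ι ι K) := Algebra.adjoin R (Set.range S)

lemma ZR_mem (g : G) : S g ∈ ZR R S := Algebra.subset_adjoin ⟨g, rfl⟩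

lemma ZR_trace (h : ∀ g, (S g).trace ∈ R) (Z : Matrix ι ι K) (hZ : Z ∈ ZR R S) : Z.trace ∈ R := by
  have h1 : Z ∈ Submodule.span R (Set.range S) := by
    have := Algebra.adjoin_eq_span R (Set.range S)
    have h2 : Z ∈ Subalgebra.toSubmodule (ZR R S) := hZ
    unfold ZR at h2
    rw [this] at h2
    have h3 : (Submonoid.closure (Set.range S) : Set (Matrix ι ι K)) = Set.range S := by
      have : Set.range S = ((MonoidHom.mrange S : Submonoid _) : Set _) := rfl
      rw [this, Submonoid.closure_eq]
    rwa [h3] at h2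
  induction h1 using Submodule.span_induction with
  | mem x hx => obtain ⟨g, rfl⟩ := hx; exact h g
  | zero => simpa using R.zero_mem
  | add x y h1 h2 hx hy =>
    have e : ∀ {x}, x ∈ Submodule.span R (Set.range S) → x ∈ ZR R S := fun {x} hx =>
      (Submodule.span_le.mpr (fun y hy => Algebra.subset_adjoin hy) :
        Submodule.span R (Set.range S) ≤ Subalgebra.toSubmodule (ZR R S)) hx
    rw [trace_add]; exact R.add_mem (hx (e h1)) (hy (e h2))
  | smul a x h1 hx =>
    have e : ∀ {x}, x ∈ Submodule.span R (Set.range S) → x ∈ ZR R S := fun {x} hx =>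
      (Submodule.span_le.mpr (fun y hy => Algebra.subset_adjoin hy) :
        Submodule.span R (Set.range S) ≤ Subalgebra.toSubmodule (ZR R S)) hx
    rw [trace_smul]; exact R.mul_mem a.2 (hx (e h1))

lemma ZR_XX (A : Matrix ι ι K) (hA : A ∈ ZR R S) (l : ι → K) (hl : ∀ j, l j ∈ R) (T : Finset ι) (i : ℕ) :
    XX A l T i ∈ ZR R S := by
  unfold XX
  induction T using Finset.induction_on with
  | empty => simpa using Subalgebra.one_mem _
  | insert j T hj ih =>
  rw [Finset.prod_insert hj, map_mul]
  refine Subalgebra.mul_mem _ ?_ ih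
  rw [map_sub, map_pow, Polynomial.aeval_X, Polynomial.aeval_C]
  refine Subalgebra.sub_mem _ (Subalgebra.pow_mem _ hA _) ?_
  have := (ZR R S).algebraMap_mem ⟨l j ^ i, R.pow_mem (hl j) i⟩
  exact this

lemma Qf_int [IsAlgClosed K] (h : ∀ g, (S g).trace ∈ R) (l : ι → K) (hl : ∀ j, l j ∈ R) (g b c : G) (I : Finset ι) (M i : ℕ) :
    Qf (S g) (S b) (S c) l I M i ∈ R := by
  unfold Qf
  have hX := fun T => ZR_XX R S (S g) (ZR_mem R S g) l hl T i
  refine R.mul_mem (newton_int R _ ?_ _ (Finset.card_le_univ I)) ?_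
  · intro n
    apply ZR_trace R S h
    exact Subalgebra.pow_mem _ (Subalgebra.pow_mem _ (Subalgebra.mul_mem _ (hX _) (ZR_mem R S b)) _) _
  · apply ZR_trace R S h
    exact Subalgebra.mul_mem _ (Subalgebra.mul_mem _ (hX _) (ZR_mem R S b)) (Subalgebra.mul_mem _ (hX _) (ZR_mem R S c))
end

lemma closure_finite (s : Set K) (x : K) (hx : x ∈ Subring.closure s) :
    ∃ t : Finset K, (t : Set K) ⊆ s ∧ x ∈ Subring.closure (t : Set K) := by
  classical
  induction hx using Subring.closure_induction with
  | mem x hx => exact ⟨{x}, by simpa using hx, Subring.subset_closure (by simp)⟩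
  | zero => exact ⟨∅, by simp, Subring.zero_mem _⟩
  | one => exact ⟨∅, by simp, Subring.one_mem _⟩
  | add x y _ _ hx hy =>
    obtain ⟨t, ht, hx⟩ := hx
    obtain ⟨u, hu, hy⟩ := hy
    exact ⟨t ∪ u, by simp [ht, hu], Subring.add_mem _ (Subring.closure_mono (by simp) hx) (Subring.closure_mono (by simp) hy)⟩
  | neg x _ hx =>
    obtain ⟨t, ht, hx⟩ := hx
    exact ⟨t, ht, Subring.neg_mem _ hx⟩
  | mul x y _ _ hx hy =>
    obtain ⟨t, ht, hx⟩ := hx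
    obtain ⟨u, hu, hy⟩ := hy
    exact ⟨t ∪ u, by simp [ht, hu], Subring.mul_mem _ (Subring.closure_mono (by simp) hx) (Subring.closure_mono (by simp) hy)⟩

lemma closure_finite' {κ : Type*} (s : Set K) (F : Finset κ) (x : κ → K) (hx : ∀ k ∈ F, x k ∈ Subring.closure s) :
    ∃ t : Finset K, (t : Set K) ⊆ s ∧ ∀ k ∈ F, x k ∈ Subring.closure (t : Set K) := by
  classical
  have : ∀ k, ∃ t : Finset K, (t : Set K) ⊆ s ∧ (k ∈ F → x k ∈ Subring.closure (t : Set K)) := by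
    intro k
    by_cases hk : k ∈ F
    · obtain ⟨t, h1, h2⟩ := closure_finite s (x k) (hx k hk)
      exact ⟨t, h1, fun _ => h2⟩
    · exact ⟨∅, by simp, fun h => absurd h hk⟩
  choose t h1 h2 using this
  refine ⟨F.biUnion t, by simpa using fun k _ => h1 k, fun k hk => Subring.closure_mono ?_ (h2 k hk)⟩
  exact_mod_cast Finset.subset_biUnion_of_mem t hk

theorem exists_alg [IsAlgClosed K] [CharZero K] [Group.FG G] (S : G →* Matrix ι ι K) (hZ : Zc S)
    (hirr : ∀ H : Subgroup G, H.FiniteIndex → Irr (S '' H))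
    (hdet : ∀ g, (S g).det = 1) (h2 : 2 ≤ Fintype.card ι) (M N M3 : ℕ) (Sg : Finset G) :
    ∃ (g0 b : G) (c : ℕ → G) (l : ι → K) (I : Finset ι) (z0 : K) (w : ι × ι → G) (T : Finset K),
      HasEig (S g0) l ∧ I.Nonempty ∧ (∀ j ∈ I, l j = z0) ∧ (∀ p, w p ∈ Kd G (2 ^ Fintype.card ι)) ∧
      (∀ t ∈ T, (∃ j, t = l j) ∨ ∃ g, t = (S g).trace) ∧
      Pf (S g0) (S b) (fun i => S (c i)) l I (fun p => S (w p)) M N M3 ≠ 0 ∧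
      ∀ V : Subring K, (∀ t ∈ T, t ∈ V) → (∀ j, l j ∈ V) ∧
        (∀ i, 1 ≤ i → i < N → Qf (S g0) (S b) (S (c i)) l I M i ∈ V) ∧ (∀ p q, (S (w p) * S (w q)).trace ∈ V) ∧
        (∀ s ∈ Sg, ∀ p q, (S s * S (w p) * S (w q)).trace ∈ V) := by
  classical
  haveI : Nonempty ι := Fintype.card_pos_iff.mp (by omega)
  have hirr0 : Irr (Set.range S) := by simpa using hirr ⊤ inferInstance
  obtain ⟨g0, b, c, l, I, z0, hl, hI, hIz, hQ⟩ := exists_data S hZ hirr0 hdet h2 M N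
  obtain ⟨w, hw, hgram⟩ := basis_words S (Kd G (2 ^ Fintype.card ι))
    (span_top S _ (hirr _ (Kd_finiteIndex G _)))
  set s : Set K := Set.range l ∪ Set.range fun g => (S g).trace with hs
  have hQc : ∀ i ∈ Finset.Ico 1 N, Qf (S g0) (S b) (S (c i)) l I M i ∈ Subring.closure s := by
    intro i _
    exact Qf_int _ S (fun g => Subring.subset_closure (Or.inr ⟨g, rfl⟩)) l (fun j => Subring.subset_closure (Or.inl ⟨j, rfl⟩)) _ _ _ _ _ _
  obtain ⟨t, ht, htQ⟩ := closure_finite' s _ _ hQc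
  let T1 : Finset K := Finset.univ.image l
  let T2 : Finset K := Finset.univ.image fun pq : (ι × ι) × (ι × ι) => (S (w pq.1) * S (w pq.2)).trace
  let T3 : Finset K := (Sg ×ˢ (Finset.univ : Finset ((ι × ι) × (ι × ι)))).image fun x => (S x.1 * S (w x.2.1) * S (w x.2.2)).trace
  refine ⟨g0, b, c, l, I, z0, w, t ∪ T1 ∪ T2 ∪ T3, hl, hI, hIz, hw, ?_, ?_, ?_⟩
  · intro x hx
    simp only [Finset.mem_union, T1, T2, T3, Finset.mem_image] at hx
    rcases hx with ((hx | ⟨j, _, rfl⟩) | ⟨pq, _, rfl⟩) | ⟨a, _, rfl⟩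
    · rcases ht hx with ⟨j, rfl⟩ | ⟨g, rfl⟩
      · exact Or.inl ⟨j, rfl⟩
      · exact Or.inr ⟨g, rfl⟩
    · exact Or.inl ⟨j, rfl⟩
    · exact Or.inr ⟨_, by rw [← map_mul]⟩
    · exact Or.inr ⟨_, by rw [← map_mul, ← map_mul]⟩
  · unfold Pf
    refine mul_ne_zero (pow_ne_zero _ (Finset.prod_ne_zero_iff.mpr fun i _ => Finset.prod_ne_zero_iff.mpr fun j hj => ?_)) hgram
    have hj := Finset.mem_Ioi.mp hj
    have hj : (i : ℕ) < j := hj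
    exact hQ _ (by omega) (by omega)
  · intro V hV
    refine ⟨fun j => hV _ (by simp [T1]), fun i h1 hN => ?_, fun p q => hV _ ?_, fun g hg p q => hV _ ?_⟩
    · have := htQ i (Finset.mem_Ico.mpr ⟨h1, hN⟩)
      refine (Subring.closure_le.mpr ?_) this
      intro x hx
      exact hV x (by simp only [Finset.mem_union]; exact Or.inl (Or.inl (Or.inl hx)))
    · simp only [Finset.mem_union, T2, Finset.mem_image]
      exact Or.inl (Or.inr ⟨(p, q), by simp, rfl⟩)
    · simp only [Finset.mem_union, T3, Finset.mem_image]
      exact Or.inr ⟨(g, (p, q)), by simp [hg], rfl⟩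
end
end WE

namespace WE
open Filter Topology Matrix

/-- an ultrapower of a field -/
structure UP (L 𝕃 : Type) [Field L] [Field 𝕃] where
  make ::
  mk : (ℕ → L) →+* 𝕃
  surj : Function.Surjective mk
  zero : ∀ f, mk f = 0 ↔ ∀ᶠ k in UU, f k = 0

theorem exists_UP (L : Type) [Field L] : ∃ (𝕃 : Type) (_ : Field 𝕃), Nonempty (UP L 𝕃) := by
  refine ⟨Germ (UU : Filter ℕ) L, inferInstance, ⟨⟨Germ.coeRingHom _, ?_, ?_⟩⟩⟩
  · intro x
    induction x using Germ.inductionOn with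
    | _ f => exact ⟨f, rfl⟩
  · intro f
    exact Germ.coe_eq

namespace UP
variable {L 𝕃 : Type} [Field L] [Field 𝕃] (u : UP L 𝕃)

noncomputable def rep (x : 𝕃) : ℕ → L := Function.surjInv u.surj x

@[simp] lemma mk_rep (x : 𝕃) : u.mk (u.rep x) = x := Function.surjInv_eq u.surj x

lemma mk_eq {f g : ℕ → L} : u.mk f = u.mk g ↔ ∀ᶠ k in UU, f k = g k := by
  rw [← sub_eq_zero, ← map_sub, u.zero]
  simp [sub_eq_zero]

lemma rep_mk (f : ℕ → L) : ∀ᶠ k in UU, u.rep (u.mk f) k = f k := by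
  rw [← u.mk_eq, mk_rep]

lemma ne_zero {f : ℕ → L} : u.mk f ≠ 0 ↔ ∀ᶠ k in UU, f k ≠ 0 := by
  rw [ne_eq, u.zero, ← Ultrafilter.eventually_not]

lemma mk_inv (f : ℕ → L) : u.mk (fun k => (f k)⁻¹) = (u.mk f)⁻¹ := by
  by_cases h : u.mk f = 0
  · rw [h, _root_.inv_zero, u.zero]
    filter_upwards [(u.zero f).mp h] with k hk
    rw [hk, _root_.inv_zero]
  · apply eq_inv_of_mul_eq_one_left
    rw [← map_mul, ← map_one u.mk, u.mk_eq]
    filter_upwards [u.ne_zero.mp h] with k hk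
    simp [hk]


lemma charZero (u : UP L 𝕃) [CharZero L] : CharZero 𝕃 := by
  refine charZero_of_inj_zero fun n hn => ?_
  rw [← map_natCast u.mk, u.zero] at hn
  obtain ⟨k, hk⟩ := hn.exists
  simpa using hk

open Polynomial in
lemma isAlgClosed (u : UP L 𝕃) [IsAlgClosed L] : IsAlgClosed 𝕃 := by
  refine IsAlgClosed.of_exists_root _ fun p hp hirr => ?_
  let P : (ℕ → L)[X] := X ^ p.natDegree + ∑ i ∈ Finset.range p.natDegree, C (u.rep (p.coeff i)) * X ^ i
  have hP : P.map u.mk = p := by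
    simp only [P, Polynomial.map_add, Polynomial.map_pow, Polynomial.map_X, Polynomial.map_sum, Polynomial.map_mul, Polynomial.map_C, mk_rep]
    exact hp.as_sum.symm
  have hd : 0 < p.natDegree := hirr.natDegree_pos
  have hr : ∀ k, ∃ r : L, (P.map (Pi.evalRingHom (fun _ => L) k)).eval r = 0 := by
    intro k
    have hdeg : (P.map (Pi.evalRingHom (fun _ => L) k)).degree = p.natDegree := by
      simp only [P, Polynomial.map_add, Polynomial.map_pow, Polynomial.map_X, Polynomial.map_sum, Polynomial.map_mul, Polynomial.map_C]
      rw [degree_add_eq_left_of_degree_lt]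
      · simp
      · rw [degree_X_pow]
        refine (degree_sum_le _ _).trans_lt ?_
        rw [Finset.sup_lt_iff (by exact WithBot.bot_lt_coe _)]
        intro i hi
        exact (degree_C_mul_X_pow_le _ _).trans_lt (by exact_mod_cast Finset.mem_range.mp hi)
    exact IsAlgClosed.exists_root _ (by rw [hdeg]; exact_mod_cast hd.ne')
  choose r hr using hr
  refine ⟨u.mk r, ?_⟩
  have h1 : P.eval r = 0 := by
    funext k
    have := Polynomial.eval_map_apply (Pi.evalRingHom (fun _ => L) k) (p := P) r
    have h2 := hr k
    rw [show r k = Pi.evalRingHom (fun _ => L) k r from rfl, this] at h2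
    exact h2
  rw [← hP, Polynomial.eval_map_apply, h1, map_zero]

section mat
variable {ι κ : Type*} [Fintype ι] [DecidableEq ι]

/-- sequence of matrices to a matrix of sequences -/
def tw (A : ℕ → Matrix ι ι L) : Matrix ι ι (ℕ → L) := Matrix.of fun i j k => A k i j

lemma tw_eval (A : ℕ → Matrix ι ι L) (k) : (Pi.evalRingHom (fun _ => L) k).mapMatrix (tw A) = A k := by
  ext i j; rfl

lemma tw_ext {M N : Matrix ι ι (ℕ → L)} (h : ∀ k, (Pi.evalRingHom (fun _ => L) k).mapMatrix M = (Pi.evalRingHom (fun _ => L) k).mapMatrix N) : M = N := by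
  ext i j k
  exact congrFun (congrFun (h k) i) j

/-- limit matrix -/
def mkM (A : ℕ → Matrix ι ι L) : Matrix ι ι 𝕃 := u.mk.mapMatrix (tw A)

lemma mkM_apply (A : ℕ → Matrix ι ι L) (i j) : u.mkM A i j = u.mk (fun k => A k i j) := rfl

lemma mkM_mul (A B : ℕ → Matrix ι ι L) : u.mkM (fun k => A k * B k) = u.mkM A * u.mkM B := by
  unfold mkM
  rw [← map_mul]
  congr 1
  apply tw_ext; intro k
  rw [map_mul, tw_eval, tw_eval, tw_eval]

lemma mkM_one : u.mkM (fun _ => (1 : Matrix ι ι L)) = 1 := by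
  unfold mkM
  rw [← map_one u.mk.mapMatrix]
  congr 1
  apply tw_ext; intro k
  rw [map_one, tw_eval]

lemma mkM_det (A : ℕ → Matrix ι ι L) : (u.mkM A).det = u.mk (fun k => (A k).det) := by
  unfold mkM
  rw [← RingHom.map_det]
  congr 1
  funext k
  have := RingHom.map_det (Pi.evalRingHom (fun _ => L) k) (tw A)
  rw [tw_eval] at this
  exact this

lemma mkM_eq {A B : ℕ → Matrix ι ι L} : u.mkM A = u.mkM B ↔ ∀ᶠ k in UU, A k = B k := by
  constructor
  · intro h
    have : ∀ i j, ∀ᶠ k in UU, A k i j = B k i j := fun i j => u.mk_eq.mp (congrFun (congrFun h i) j)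
    have h2 : ∀ᶠ k in UU, ∀ i j, A k i j = B k i j := by
      rw [eventually_all]; intro i; rw [eventually_all]; exact this i
    filter_upwards [h2] with k hk
    ext i j; exact hk i j
  · intro h
    ext i j
    rw [mkM_apply, mkM_apply, u.mk_eq]
    filter_upwards [h] with k hk; rw [hk]

/-- lifts -/
noncomputable def repM (A : Matrix ι ι 𝕃) (k : ℕ) : Matrix ι ι L := Matrix.of fun i j => u.rep (A i j) k

@[simp] lemma mkM_repM (A : Matrix ι ι 𝕃) : u.mkM (u.repM A) = A := by
  ext i j; exact u.mk_rep _

lemma mkM_mulVec (A : ℕ → Matrix ι ι L) (x : ℕ → ι → L) :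
    u.mkM A *ᵥ (fun i => u.mk fun k => x k i) = fun i => u.mk fun k => (A k *ᵥ x k) i := by
  funext i
  simp only [Matrix.mulVec, dotProduct, mkM_apply, ← map_mul, ← map_sum]
  congr 1
  funext k
  simp [Finset.sum_apply]

variable {G : Type*} [Group G]
/-- limit representation -/
def hom (σ : ℕ → G →* Matrix ι ι L) : G →* Matrix ι ι 𝕃 where
  toFun g := u.mkM fun k => σ k g
  map_one' := by simp only [map_one]; exact u.mkM_one
  map_mul' g h := by simp only [map_mul]; exact u.mkM_mul _ _

lemma hom_apply (σ : ℕ → G →* Matrix ι ι L) (g) : u.hom σ g = u.mkM fun k => σ k g := rfl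
end mat
end UP
end WE

namespace WE
open Filter Topology

section
variable {L 𝕃 : Type} [Field L] [Field 𝕃] (u : UP L 𝕃) (v : ℕ → AbsoluteValue L ℝ)

lemma bd_congr {f g : ℕ → L} (h : ∀ᶠ k in UU, f k = g k) (hf : ∃ B : ℝ, ∀ᶠ k in UU, v k (f k) ≤ B) :
    ∃ B : ℝ, ∀ᶠ k in UU, v k (g k) ≤ B := by
  obtain ⟨B, hB⟩ := hf
  exact ⟨B, by filter_upwards [h, hB] with k h1 h2; rwa [← h1]⟩

/-- bounded elements -/
noncomputable def bO : ValuationSubring 𝕃 where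
  carrier := {x | ∃ B : ℝ, ∀ᶠ k in UU, v k (u.rep x k) ≤ B}
  mul_mem' := by
    rintro x y ⟨A, hA⟩ ⟨B, hB⟩
    refine bd_congr v (f := u.rep x * u.rep y) (by rw [← u.mk_eq]; simp) ⟨A * B, ?_⟩
    filter_upwards [hA, hB] with k h1 h2
    rw [Pi.mul_apply, map_mul]
    exact mul_le_mul h1 h2 ((v k).nonneg _) (((v k).nonneg _).trans h1)
  one_mem' := bd_congr v (f := 1) (by rw [← u.mk_eq]; simp) ⟨1, by simp⟩
  add_mem' := by
    rintro x y ⟨A, hA⟩ ⟨B, hB⟩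
    refine bd_congr v (f := u.rep x + u.rep y) (by rw [← u.mk_eq]; simp) ⟨A + B, ?_⟩
    filter_upwards [hA, hB] with k h1 h2
    exact ((v k).add_le _ _).trans (add_le_add h1 h2)
  zero_mem' := bd_congr v (f := 0) (by rw [← u.mk_eq]; simp) ⟨1, by simp⟩
  neg_mem' := by
    rintro x ⟨A, hA⟩
    refine bd_congr v (f := - u.rep x) (by rw [← u.mk_eq]; simp) ⟨A, ?_⟩
    filter_upwards [hA] with k h1
    rwa [Pi.neg_apply, (v k).map_neg]
  mem_or_inv_mem' := by
    intro x
    have h : ∀ᶠ k in UU, v k (u.rep x k) ≤ 1 ∨ v k ((u.rep x k)⁻¹) ≤ 1 := by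
      refine Eventually.of_forall fun k => ?_
      rcases le_total (v k (u.rep x k)) 1 with h | h
      · exact Or.inl h
      · right
        rw [map_inv₀]
        exact inv_le_one_of_one_le₀ h
    rcases Ultrafilter.eventually_or.mp h with h | h
    · exact Or.inl ⟨1, h⟩
    · right
      exact bd_congr v (f := fun k => (u.rep x k)⁻¹) (by rw [← u.mk_eq, u.mk_inv]; simp) ⟨1, h⟩

lemma mem_bO_mk (f : ℕ → L) : u.mk f ∈ bO u v ↔ ∃ B : ℝ, ∀ᶠ k in UU, v k (f k) ≤ B :=
  ⟨fun h => bd_congr v (u.rep_mk f) h, fun h => bd_congr v (by filter_upwards [u.rep_mk f] with k hk; exact hk.symm) h⟩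

lemma mem_bO (x : 𝕃) : x ∈ bO u v ↔ ∃ B : ℝ, ∀ᶠ k in UU, v k (u.rep x k) ≤ B := Iff.rfl

/-- a limit place -/
structure Plc (F : Type) [NormedField F] where
  st : bO u v →+* F
  norm_st : ∀ x : bO u v, Tendsto (fun k => v k (u.rep x k)) UU (𝓝 ‖st x‖)

variable {u v}
lemma Plc.norm_mk {F : Type} [NormedField F] (p : Plc u v F) (f : ℕ → L) (h : u.mk f ∈ bO u v) :
    Tendsto (fun k => v k (f k)) UU (𝓝 ‖p.st ⟨u.mk f, h⟩‖) :=
  (p.norm_st ⟨u.mk f, h⟩).congr' (by filter_upwards [u.rep_mk f] with k hk; rw [hk])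

lemma Plc.inv_mem {F : Type} [NormedField F] (p : Plc u v F) (x : bO u v) (h : p.st x ≠ 0) : (x : 𝕃)⁻¹ ∈ bO u v := by
  have h1 := p.norm_st x
  have h0 : 0 < ‖p.st x‖ := norm_pos_iff.mpr h
  have h2 : ∀ᶠ k in UU, ‖p.st x‖ / 2 < v k (u.rep x k) := h1.eventually (lt_mem_nhds (by linarith))
  have h3 : u.mk (fun k => (u.rep x k)⁻¹) = (x : 𝕃)⁻¹ := by rw [u.mk_inv, u.mk_rep]
  rw [← h3, mem_bO_mk]
  refine ⟨(‖p.st x‖ / 2)⁻¹, ?_⟩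
  filter_upwards [h2] with k hk
  rw [map_inv₀]
  exact inv_anti₀ (by linarith) hk.le

lemma Plc.ultra {F : Type} [NormedField F] (p : Plc u v F) (c : ℕ → ℝ) (hc : Tendsto c UU (𝓝 1))
    (h : ∀ k x y, v k (x + y) ≤ c k * max (v k x) (v k y)) (x y : bO u v) : ‖p.st (x + y)‖ ≤ max ‖p.st x‖ ‖p.st y‖ := by
  have h1 := p.norm_st (x + y)
  have h2 := hc.mul ((p.norm_st x).max (p.norm_st y))
  rw [one_mul] at h2
  refine le_of_tendsto_of_tendsto h1 h2 ?_
  have h3 : u.mk (u.rep ((x + y : bO u v) : 𝕃)) = u.mk (u.rep x + u.rep y) := by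
    rw [map_add, u.mk_rep, u.mk_rep, u.mk_rep]; rfl
  filter_upwards [u.mk_eq.mp h3] with k hk
  rw [hk]; exact h k _ _

variable (u v)
theorem exists_plc : ∃ (F : Type) (_ : NormedField F), Nonempty (Plc u v F) := by
  let O := bO u v
  let nm : O → ℝ := fun x => ulim fun k => v k (u.rep x k)
  have hnm : ∀ x : O, Tendsto (fun k => v k (u.rep x k)) UU (𝓝 (nm x)) := by
    intro x
    obtain ⟨B, hB⟩ := x.2
    refine tendsto_ulim _ B ?_
    filter_upwards [hB] with k hk
    rwa [Real.norm_eq_abs, abs_of_nonneg ((v k).nonneg _)]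
  have hmk : ∀ (x : O) (f : ℕ → L), u.mk f = x → Tendsto (fun k => v k (f k)) UU (𝓝 (nm x)) := by
    intro x f hf
    refine (hnm x).congr' ?_
    have : ∀ᶠ k in UU, u.rep x k = f k := by rw [← u.mk_eq, hf]; simp
    filter_upwards [this] with k hk; rw [hk]
  have h0 : ∀ x, 0 ≤ nm x := fun x => ge_of_tendsto' (hnm x) fun k => (v k).nonneg _
  have hmul : ∀ x y, nm (x * y) = nm x * nm y := by
    intro x y
    refine tendsto_nhds_unique (hmk (x * y) (u.rep x * u.rep y) (by simp)) ?_
    simp only [Pi.mul_apply, map_mul]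
    exact (hnm x).mul (hnm y)
  have hadd : ∀ x y, nm (x + y) ≤ nm x + nm y := by
    intro x y
    refine le_of_tendsto_of_tendsto' (hmk (x + y) (u.rep x + u.rep y) (by simp)) ((hnm x).add (hnm y)) ?_
    intro k
    exact (v k).add_le _ _
  have hone : nm 1 = 1 := by
    refine tendsto_nhds_unique (hmk 1 1 (by simp)) ?_
    simp
  have hzero : ∀ x, nm x = 0 ↔ IsLocalRing.residue O x = 0 := by
    intro x
    rw [IsLocalRing.residue_eq_zero_iff, IsLocalRing.mem_maximalIdeal, mem_nonunits_iff]
    constructor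
    · rintro hx ⟨y, rfl⟩
      have := hmul y ↑y⁻¹
      rw [Units.mul_inv, hone, hx, zero_mul] at this
      exact one_ne_zero this
    · intro hx
      by_contra hne
      apply hx
      have hpos : 0 < nm x := lt_of_le_of_ne (h0 x) (Ne.symm hne)
      have h2 : ∀ᶠ k in UU, nm x / 2 < v k (u.rep x k) := (hnm x).eventually (lt_mem_nhds (by linarith))
      have h3 : u.mk (fun k => (u.rep x k)⁻¹) = (x : 𝕃)⁻¹ := by rw [u.mk_inv, u.mk_rep]
      have h4 : (x : 𝕃)⁻¹ ∈ O := by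
        rw [← h3, mem_bO_mk]
        refine ⟨(nm x / 2)⁻¹, ?_⟩
        filter_upwards [h2] with k hk
        rw [map_inv₀]
        exact inv_anti₀ (by linarith) hk.le
      have hx0 : (x : 𝕃) ≠ 0 := by
        intro h
        obtain ⟨k, hk, hk2⟩ := (h2.and ((u.zero _).mp ((u.mk_rep x).trans h))).exists
        rw [hk2, map_zero] at hk
        linarith
      exact IsUnit.of_mul_eq_one ⟨_, h4⟩ (Subtype.ext (mul_inv_cancel₀ hx0))
  have hneg : ∀ x, nm (-x) = nm x := by
    intro x
    refine tendsto_nhds_unique (hmk (-x) (-u.rep x) (by simp)) ?_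
    simp only [Pi.neg_apply, AbsoluteValue.map_neg]
    exact hnm x
  have hcong : ∀ x y, IsLocalRing.residue O x = IsLocalRing.residue O y → nm x = nm y := by
    have : ∀ x y, IsLocalRing.residue O x = IsLocalRing.residue O y → nm x ≤ nm y := by
      intro x y h
      have h1 : nm (x - y) = 0 := by rw [hzero, map_sub, h, sub_self]
      have h2 := hadd (x - y) y
      rw [sub_add_cancel, h1, zero_add] at h2
      exact h2
    exact fun x y h => le_antisymm (this x y h) (this y x h.symm)
  let F := IsLocalRing.ResidueField O
  let sec : F → O := Function.surjInv IsLocalRing.residue_surjective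
  have hsec : ∀ a : F, IsLocalRing.residue O (sec a) = a := fun a => Function.surjInv_eq _ a
  let av : AbsoluteValue F ℝ :=
    { toFun := fun a => nm (sec a)
      map_mul' := fun a b => by rw [← hmul]; apply hcong; rw [map_mul, hsec, hsec, hsec]
      nonneg' := fun a => h0 _
      eq_zero' := fun a => by rw [hzero, hsec]
      add_le' := fun a b => by
        refine le_trans (le_of_eq ?_) (hadd _ _)
        apply hcong; rw [map_add, hsec, hsec, hsec] }
  refine ⟨F, av.toNormedField, ?_⟩
  letI := av.toNormedField
  refine ⟨⟨IsLocalRing.residue O, ?_⟩⟩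
  intro x
  have : av (IsLocalRing.residue O x) = nm x := hcong _ _ (hsec _)
  have h2 := hnm x
  rw [← this] at h2
  exact h2

theorem complex_plc (τ : ℕ → L →+* ℂ) (h : ∀ k x, v k x = ‖τ k x‖) : Nonempty (Plc u v ℂ) := by
  have hl : ∀ x : bO u v, Tendsto (fun k => τ k (u.rep x k)) UU (𝓝 (ulim fun k => τ k (u.rep x k))) := by
    intro x
    obtain ⟨B, hB⟩ := x.2
    refine tendsto_ulim _ B ?_
    filter_upwards [hB] with k hk
    rwa [← h]
  have hmk : ∀ (x : bO u v) (f : ℕ → L), u.mk f = x → Tendsto (fun k => τ k (f k)) UU (𝓝 (ulim fun k => τ k (u.rep x k))) := by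
    intro x f hf
    refine (hl x).congr' ?_
    have : ∀ᶠ k in UU, u.rep x k = f k := by rw [← u.mk_eq, hf]; simp
    filter_upwards [this] with k hk; rw [hk]
  refine ⟨⟨{ toFun := fun x => ulim fun k => τ k (u.rep x k), map_one' := ?_, map_mul' := ?_, map_zero' := ?_, map_add' := ?_}, ?_⟩⟩
  · exact tendsto_nhds_unique (hmk 1 1 (by simp)) (by simp)
  · intro x y
    refine tendsto_nhds_unique (hmk (x * y) (u.rep x * u.rep y) (by simp)) ?_
    simp only [Pi.mul_apply, map_mul]
    exact (hl x).mul (hl y)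
  · exact tendsto_nhds_unique (hmk 0 0 (by simp)) (by simp)
  · intro x y
    refine tendsto_nhds_unique (hmk (x + y) (u.rep x + u.rep y) (by simp)) ?_
    simp only [Pi.add_apply, map_add]
    exact (hl x).add (hl y)
  · intro x
    simp only [h]
    exact (hl x).norm
end
end WE

namespace WE
open Filter Topology

/-- powers of absolute values -/
noncomputable def pw {L : Type} [Field L] (v : AbsoluteValue L ℝ) (s : ℝ) (hs : 0 < s)
    (h : ∀ x y, v (x + y) ^ s ≤ v x ^ s + v y ^ s) : AbsoluteValue L ℝ where
  toFun x := v x ^ s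
  map_mul' x y := by rw [map_mul, Real.mul_rpow (v.nonneg _) (v.nonneg _)]
  nonneg' x := Real.rpow_nonneg (v.nonneg _) _
  eq_zero' x := by rw [Real.rpow_eq_zero (v.nonneg _) hs.ne', AbsoluteValue.eq_zero]
  add_le' := h

lemma pw_apply {L : Type} [Field L] (v : AbsoluteValue L ℝ) (s : ℝ) (hs : 0 < s) (h) (x : L) : pw v s hs h x = v x ^ s := rfl

lemma pw_na {L : Type} [Field L] (v : AbsoluteValue L ℝ) (s : ℝ) (hs : 0 < s) (h : IsNonarchimedean v) (x y) :
    v (x + y) ^ s ≤ max (v x ^ s) (v y ^ s) := by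
  have h1 := Real.rpow_le_rpow (v.nonneg _) (h x y) hs.le
  rcases le_total (v x) (v y) with h2 | h2
  · rw [max_eq_right h2] at h1; exact le_max_of_le_right h1
  · rw [max_eq_left h2] at h1; exact le_max_of_le_left h1

lemma rpow_inv_log {b : ℝ} (hb : 1 < b) : b ^ (1 / Real.log b) = Real.exp 1 := by
  rw [Real.rpow_def_of_pos (by linarith)]
  congr 1
  have := Real.log_pos hb
  field_simp

section
variable {𝕃 : Type} [Field 𝕃] (u : UP LL 𝕃)

lemma exists_max_a {T : Finset 𝕃} (hT : T.Nonempty) (w : ℕ → AbsoluteValue LL ℝ) :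
    ∃ t0 ∈ T, ∀ᶠ k in UU, ∀ t ∈ T, w k (u.rep t k) ≤ w k (u.rep t0 k) := by
  have h : ∀ᶠ k in UU, ∃ t0 ∈ (T : Set 𝕃), ∀ t ∈ T, w k (u.rep t k) ≤ w k (u.rep t0 k) :=
    Eventually.of_forall fun k => T.exists_max_image (fun t => w k (u.rep t k)) hT
  exact (Ultrafilter.eventually_exists_mem_iff T.finite_toSet).mp h

theorem places (T : Finset 𝕃) (P : 𝕃) (hP : P ≠ 0) (hV : ∀ V : Subring 𝕃, (∀ t ∈ T, t ∈ V) → P ∈ V) :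
    ∃ v : ℕ → AbsoluteValue LL ℝ, (∀ t ∈ T, t ∈ bO u v) ∧ (∀ᶠ k in UU, 1 ≤ v k (u.rep P k)) ∧
    ((∃ c : ℕ → ℝ, Tendsto c UU (𝓝 1) ∧ (∀ k x y, v k (x + y) ≤ c k * max (v k x) (v k y)) ∧
      ∃ t ∈ T, ∃ a : ℝ, 1 < a ∧ ∀ᶠ k in UU, a ≤ v k (u.rep t k)) ∨
     ∃ τ : ℕ → LL →+* ℂ, ∀ k x, v k x = ‖τ k x‖) := by
  have hP' : ∀ᶠ k in UU, u.rep P k ≠ 0 := by rw [← u.ne_zero]; simpa using hP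
  have hpl : ∀ᶠ k in UU, (∃ τ : LL →+* ℂ, 1 ≤ ‖τ (u.rep P k)‖) ∨
      ∃ v : AbsoluteValue LL ℝ, IsNonarchimedean v ∧ 1 < v (u.rep P k) := by
    filter_upwards [hP'] with k hk using place_lemma _ hk
  rcases Ultrafilter.eventually_or.mp hpl with harch | hna
  · have τ0 : LL →+* ℂ := (IsAlgClosed.lift : LL →ₐ[ℚ] ℂ).toRingHom
    have : ∀ k, ∃ τ : LL →+* ℂ, (∃ τ : LL →+* ℂ, 1 ≤ ‖τ (u.rep P k)‖) → 1 ≤ ‖τ (u.rep P k)‖ := by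
      intro k
      by_cases h : ∃ τ : LL →+* ℂ, 1 ≤ ‖τ (u.rep P k)‖
      · obtain ⟨τ, hτ⟩ := h; exact ⟨τ, fun _ => hτ⟩
      · exact ⟨τ0, fun h' => (h h').elim⟩
    choose τ hτ using this
    have hτ1 : ∀ᶠ k in UU, 1 ≤ ‖τ k (u.rep P k)‖ := by
      filter_upwards [harch] with k hk using hτ k hk
    let w : ℕ → AbsoluteValue LL ℝ := fun k => (NormedField.toAbsoluteValue ℂ).comp (τ k).injective
    have hw : ∀ k x, w k x = ‖τ k x‖ := fun k x => rfl
    rcases T.eq_empty_or_nonempty with rfl | hT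
    · exact ⟨w, by simp, hτ1, Or.inr ⟨τ, hw⟩⟩
    obtain ⟨t0, ht0, hmax⟩ := exists_max_a u hT w
    by_cases hB : ∃ B : ℝ, ∀ᶠ k in UU, w k (u.rep t0 k) ≤ B
    · obtain ⟨B, hB⟩ := hB
      refine ⟨w, fun t ht => ⟨B, ?_⟩, hτ1, Or.inr ⟨τ, hw⟩⟩
      filter_upwards [hB, hmax] with k h1 h2 using (h2 t ht).trans h1
    · have hB' : ∀ B : ℝ, ∀ᶠ k in UU, B < w k (u.rep t0 k) := by
        intro B
        have h1 : ¬ ∀ᶠ k in UU, w k (u.rep t0 k) ≤ B := fun h => hB ⟨B, h⟩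
        rw [← Ultrafilter.eventually_not] at h1
        filter_upwards [h1] with k hk using not_le.mp hk
      let s : ℕ → ℝ := fun k => if Real.exp 1 < w k (u.rep t0 k) then 1 / Real.log (w k (u.rep t0 k)) else 1
      have hlog : ∀ k, Real.exp 1 < w k (u.rep t0 k) → 1 < Real.log (w k (u.rep t0 k)) := fun k hk =>
        (Real.lt_log_iff_exp_lt ((Real.exp_pos 1).trans hk)).mpr hk
      have hs0 : ∀ k, 0 < s k := by
        intro k
        simp only [s]; split_ifs with h
        · have := hlog k h; positivity
        · exact one_pos
      have hs1 : ∀ k, s k ≤ 1 := by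
        intro k
        simp only [s]; split_ifs with h
        · have := hlog k h
          rw [div_le_one (by linarith)]; exact this.le
        · exact le_rfl
      have hst : Tendsto s UU (𝓝 0) := by
        have h1 : Tendsto (fun k => w k (u.rep t0 k)) UU atTop := by
          rw [tendsto_atTop]; intro b
          filter_upwards [hB' b] with k hk using hk.le
        have h2 := (Real.tendsto_log_atTop.comp h1).inv_tendsto_atTop
        refine h2.congr' ?_
        filter_upwards [hB' (Real.exp 1)] with k hk
        simp [s, hk]
      refine ⟨fun k => pw (w k) (s k) (hs0 k) fun x y => ?_, fun t ht => ?_, ?_, Or.inl ⟨fun k => 2 ^ s k, ?_, ?_, t0, ht0, Real.exp 1, ?_, ?_⟩⟩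
      · exact (Real.rpow_le_rpow ((w k).nonneg _) ((w k).add_le x y) (hs0 k).le).trans
          (Real.rpow_add_le_add_rpow ((w k).nonneg _) ((w k).nonneg _) (hs0 k).le (hs1 k))
      · refine ⟨Real.exp 1, ?_⟩
        filter_upwards [hmax, hB' (Real.exp 1)] with k h1 h2
        rw [pw_apply]
        refine (Real.rpow_le_rpow ((w k).nonneg _) (h1 t ht) (hs0 k).le).trans ?_
        simp only [s, h2, if_true]
        rw [rpow_inv_log]
        have := Real.add_one_le_exp 1
        linarith
      · filter_upwards [hτ1] with k h1
        rw [pw_apply]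
        exact Real.one_le_rpow h1 (hs0 k).le
      · have := (tendsto_const_nhds (x := (2:ℝ))).rpow hst (Or.inl two_ne_zero)
        rwa [Real.rpow_zero] at this
      · intro k x y
        simp only [pw_apply]
        have h2 : max (w k x ^ s k) (w k y ^ s k) = (max (w k x) (w k y)) ^ s k := by
          rcases le_total (w k x) (w k y) with h | h
          · rw [max_eq_right h, max_eq_right (Real.rpow_le_rpow ((w k).nonneg _) h (hs0 k).le)]
          · rw [max_eq_left h, max_eq_left (Real.rpow_le_rpow ((w k).nonneg _) h (hs0 k).le)]
        rw [h2, ← Real.mul_rpow (by norm_num) (le_max_of_le_left ((w k).nonneg _))]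
        refine Real.rpow_le_rpow ((w k).nonneg _) (((w k).add_le x y).trans ?_) (hs0 k).le
        linarith [le_max_left (w k x) (w k y), le_max_right (w k x) (w k y)]
      · have := Real.add_one_le_exp 1
        linarith
      · filter_upwards [hB' (Real.exp 1)] with k h2
        rw [pw_apply]
        simp only [s, h2, if_true]
        rw [rpow_inv_log]
        have := Real.add_one_le_exp 1
        linarith
  · have hv0 : ∃ v : AbsoluteValue LL ℝ, IsNonarchimedean v := by
      obtain ⟨k, v, hv, -⟩ := hna.exists
      exact ⟨v, hv⟩
    obtain ⟨v0, hv0⟩ := hv0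
    have : ∀ k, ∃ v : AbsoluteValue LL ℝ, IsNonarchimedean v ∧ ((∃ v : AbsoluteValue LL ℝ, IsNonarchimedean v ∧ 1 < v (u.rep P k)) → 1 < v (u.rep P k)) := by
      intro k
      by_cases h : ∃ v : AbsoluteValue LL ℝ, IsNonarchimedean v ∧ 1 < v (u.rep P k)
      · obtain ⟨v, hv, hv1⟩ := h; exact ⟨v, hv, fun _ => hv1⟩
      · exact ⟨v0, hv0, fun h' => (h h').elim⟩
    choose w hw hw1 using this
    have hwP : ∀ᶠ k in UU, 1 < w k (u.rep P k) := by
      filter_upwards [hna] with k hk using hw1 k hk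
    have hex : ∃ t ∈ T, ∀ᶠ k in UU, 1 < w k (u.rep t k) := by
      by_contra hcon
      push Not at hcon
      have key : ∀ {f g : ℕ → LL}, (∀ᶠ k in UU, f k = g k) → (∀ᶠ k in UU, w k (f k) ≤ 1) → ∀ᶠ k in UU, w k (g k) ≤ 1 := by
        intro f g h1 h2
        filter_upwards [h1, h2] with k h1 h2
        rwa [← h1]
      let V : Subring 𝕃 :=
        { carrier := {x | ∀ᶠ k in UU, w k (u.rep x k) ≤ 1}
          mul_mem' := by
            intro x y hx hy
            refine key (f := u.rep x * u.rep y) (by rw [← u.mk_eq]; simp) ?_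
            filter_upwards [hx, hy] with k h1 h2
            rw [Pi.mul_apply, map_mul]
            exact mul_le_one₀ h1 ((w k).nonneg _) h2
          one_mem' := key (f := 1) (by rw [← u.mk_eq]; simp) (by simp)
          add_mem' := by
            intro x y hx hy
            refine key (f := u.rep x + u.rep y) (by rw [← u.mk_eq]; simp) ?_
            filter_upwards [hx, hy] with k h1 h2
            exact (hw k _ _).trans (max_le h1 h2)
          zero_mem' := key (f := 0) (by rw [← u.mk_eq]; simp) (by simp)
          neg_mem' := by
            intro x hx
            refine key (f := - u.rep x) (by rw [← u.mk_eq]; simp) ?_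
            filter_upwards [hx] with k h1
            rwa [Pi.neg_apply, (w k).map_neg] }
      have h1 : P ∈ V := by
        exact hV V fun t ht => hcon t ht
      obtain ⟨k, hk1, hk2⟩ := (hwP.and h1).exists
      linarith
    obtain ⟨t1, ht1, ht1'⟩ := hex
    obtain ⟨t0, ht0, hmax⟩ := exists_max_a u ⟨t1, ht1⟩ w
    have hgt : ∀ᶠ k in UU, 1 < w k (u.rep t0 k) := by
      filter_upwards [ht1', hmax] with k h1 h2 using h1.trans_le (h2 _ ht1)
    let s : ℕ → ℝ := fun k => if 1 < w k (u.rep t0 k) then 1 / Real.log (w k (u.rep t0 k)) else 1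
    have hs0 : ∀ k, 0 < s k := by
      intro k
      simp only [s]; split_ifs with h
      · have := Real.log_pos h; positivity
      · exact one_pos
    refine ⟨fun k => pw (w k) (s k) (hs0 k) fun x y => ?_, fun t ht => ?_, ?_, Or.inl ⟨fun k => 1, tendsto_const_nhds, ?_, t0, ht0, Real.exp 1, ?_, ?_⟩⟩
    · refine (pw_na _ _ (hs0 k) (hw k) x y).trans (max_le_add_of_nonneg ?_ ?_) <;> exact Real.rpow_nonneg ((w k).nonneg _) _
    · refine ⟨Real.exp 1, ?_⟩
      filter_upwards [hmax, hgt] with k h1 h2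
      rw [pw_apply]
      refine (Real.rpow_le_rpow ((w k).nonneg _) (h1 t ht) (hs0 k).le).trans ?_
      simp only [s, h2, if_true]
      rw [rpow_inv_log h2]
    · filter_upwards [hwP] with k h1
      rw [pw_apply]
      exact Real.one_le_rpow h1.le (hs0 k).le
    · intro k x y
      rw [one_mul]
      exact pw_na _ _ (hs0 k) (hw k) x y
    · have := Real.add_one_le_exp 1
      linarith
    · filter_upwards [hgt] with k h2
      rw [pw_apply]
      simp only [s, h2, if_true]
      rw [rpow_inv_log h2]
end
end WE

namespace WE
open Matrix
section
variable {ι : Type} [Fintype ι] [DecidableEq ι] {K : Type} [Field K]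

/-- the Gram matrix -/
def gram (W : ι × ι → Matrix ι ι K) : Matrix (ι × ι) (ι × ι) K := Matrix.of fun p q => (W p * W q).trace

lemma gramD_eq (W : ι × ι → Matrix ι ι K) : gramD W = (gram W).det := rfl

lemma gram_span [Nonempty ι] (W : ι × ι → Matrix ι ι K) (h : gramD W ≠ 0) : Submodule.span K (Set.range W) = ⊤ :=
  span_of_gram W (by simp) h

lemma gram_expand [Nonempty ι] (W : ι × ι → Matrix ι ι K) (h : gramD W ≠ 0) (A : Matrix ι ι K) (c : ι × ι → K)
    (hc : gram W *ᵥ c = fun q => (W q * A).trace) : A = ∑ p, c p • W p := by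
  have h1 : ∀ q, (W q * (A - ∑ p, c p • W p)).trace = 0 := by
    intro q
    have := congrFun hc q
    simp only [mulVec, dotProduct, gram, Matrix.of_apply] at this
    rw [mul_sub, trace_sub, ← this, Finset.mul_sum, trace_sum, sub_eq_zero]
    refine Finset.sum_congr rfl fun p _ => ?_
    rw [mul_smul_comm, trace_smul, smul_eq_mul, mul_comm]
  rw [← sub_eq_zero]
  have h2 : ∀ B : Matrix ι ι K, (B * (A - ∑ p, c p • W p)).trace = 0 := by
    intro B
    have hB : B ∈ Submodule.span K (Set.range W) := by rw [gram_span W h]; trivial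
    induction hB using Submodule.span_induction with
    | mem x hx => obtain ⟨q, rfl⟩ := hx; exact h1 q
    | zero => simp
    | add x y _ _ hx hy => rw [add_mul, trace_add, hx, hy, add_zero]
    | smul a x _ hx => rw [smul_mul_assoc, trace_smul, hx, smul_zero]
  apply Matrix.ext_iff_trace_mul_left.mpr
  intro B
  rw [h2, mul_zero, trace_zero]

lemma gram_coef (V : Subring K) [Nonempty ι] (W : ι × ι → Matrix ι ι K) (h : gramD W ≠ 0) (hW : ∀ p q, (W p * W q).trace ∈ V)
    (hd : (gramD W)⁻¹ ∈ V) (A : Matrix ι ι K) (hA : ∀ q, (W q * A).trace ∈ V) :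
    ∃ c : ι × ι → K, (∀ p, c p ∈ V) ∧ A = ∑ p, c p • W p := by
  let G : Matrix (ι × ι) (ι × ι) V := Matrix.of fun p q => ⟨_, hW p q⟩
  have hG : V.subtype.mapMatrix G = gram W := rfl
  have hdG : (G.det : K) = gramD W := by
    rw [gramD_eq, ← hG, ← RingHom.map_det]; rfl
  have hu : IsUnit G.det := IsUnit.of_mul_eq_one ⟨_, hd⟩ (Subtype.ext (by
    rw [Subring.coe_mul, hdG]; exact mul_inv_cancel₀ h))
  let t : ι × ι → V := fun q => ⟨_, hA q⟩
  let c := G⁻¹ *ᵥ t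
  have h1 : G *ᵥ c = t := by
    simp only [c, Matrix.mulVec_mulVec]
    rw [Matrix.mul_nonsing_inv _ hu, one_mulVec]
  refine ⟨fun p => c p, fun p => (c p).2, gram_expand W h A _ ?_⟩
  funext q
  have := congrArg (fun z => (z q : K)) h1
  rw [← hG]
  refine Eq.trans ?_ this
  exact (RingHom.map_mulVec V.subtype G c q).symm

theorem lattice {G : Type} [Group G] [Nonempty ι] (O : ValuationSubring K) (S : G →* Matrix ι ι K) (w : ι × ι → G) (Sg : Set G)
    (hgen : Submonoid.closure Sg = ⊤) (h1 : ∀ p q, (S (w p) * S (w q)).trace ∈ O)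
    (h2 : ∀ s ∈ Sg, ∀ p q, (S s * S (w p) * S (w q)).trace ∈ O) (hD0 : gramD (fun p => S (w p)) ≠ 0)
    (hD : (gramD (fun p => S (w p)))⁻¹ ∈ O) : ∃ Q : (Matrix ι ι K)ˣ, ∀ g i j, cj Q (S g) i j ∈ O := by
  obtain ⟨i0⟩ := (inferInstance : Nonempty ι)
  let x0 : ι → K := Pi.single i0 1
  let y : ι × ι → ι → K := fun p => S (w p) *ᵥ x0
  have hspan : Submodule.span K (Set.range y) = ⊤ := by
    rw [eq_top_iff]
    intro v _
    let A : Matrix ι ι K := Matrix.of fun i j => if j = i0 then v i else 0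
    have hA : A *ᵥ x0 = v := by
      funext i
      simp [A, x0]
    rw [← hA]
    have hmem : A ∈ Submodule.span K (Set.range fun p => S (w p)) := by rw [gram_span _ hD0]; trivial
    generalize A = B at hmem
    induction hmem using Submodule.span_induction with
    | mem x hx => obtain ⟨q, rfl⟩ := hx; exact Submodule.subset_span ⟨q, rfl⟩
    | zero => simp
    | add x y _ _ hx hy => rw [add_mulVec]; exact Submodule.add_mem _ hx hy
    | smul a x _ hx => rw [smul_mulVec]; exact Submodule.smul_mem _ _ hx
  let Mf : (ι → ι × ι) → Matrix ι ι K := fun f => Matrix.of fun i j => y (f j) i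
  have hex : ∃ f, (Mf f).det ≠ 0 := by
    obtain ⟨f, hf1, hf2, hf3⟩ := Submodule.exists_fun_fin_finrank_span_eq K (Set.range y)
    choose f' hf' using hf1
    have hc : Fintype.card ι = Module.finrank K (Submodule.span K (Set.range y)) := by
      rw [hspan]; simp
    let e : ι ≃ Fin (Module.finrank K (Submodule.span K (Set.range y))) := Fintype.equivFinOfCardEq hc
    refine ⟨fun j => f' (e j), ?_⟩
    have hli : LinearIndependent K (fun j => y (f' (e j))) := by
      simp only [hf']
      exact hf3.comp e e.injective
    have h3 : IsUnit (Mf fun j => f' (e j)) := Matrix.linearIndependent_cols_iff_isUnit.mp hli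
    exact ((Matrix.isUnit_iff_isUnit_det _).mp h3).ne_zero
  obtain ⟨f, -, hf⟩ := Finset.exists_max_image (Finset.univ : Finset (ι → ι × ι)) (fun f => O.valuation (Mf f).det)
    ⟨fun _ => (i0, i0), Finset.mem_univ _⟩
  have hf0 : (Mf f).det ≠ 0 := by
    obtain ⟨f1, hf1⟩ := hex
    have := hf f1 (Finset.mem_univ _)
    intro h0
    rw [h0, map_zero] at this
    exact hf1 ((map_eq_zero _).mp (le_antisymm this zero_le'))
  have hu : IsUnit (Mf f).det := hf0.isUnit
  let Q : (Matrix ι ι K)ˣ := ⟨(Mf f)⁻¹, Mf f, Matrix.nonsing_inv_mul _ hu, Matrix.mul_nonsing_inv _ hu⟩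
  have hQ : ∀ p i, ((Mf f)⁻¹ *ᵥ y p) i ∈ O := by
    intro p i
    have h3 : (Mf f).det * ((Mf f)⁻¹ *ᵥ y p) i = (Mf (Function.update f i p)).det := by
      have := congrFun (Matrix.det_smul_inv_mulVec_eq_cramer (Mf f) (y p) hu) i
      rw [Pi.smul_apply, smul_eq_mul, Matrix.cramer_apply] at this
      rw [this]
      congr 1
      ext a b
      by_cases hb : b = i
      · subst hb; simp [Mf]
      · simp [Mf, hb]
    rw [← O.valuation_le_one_iff]
    have h4 := hf (Function.update f i p) (Finset.mem_univ _)
    rw [← h3, map_mul] at h4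
    have h5 : O.valuation (Mf f).det ≠ 0 := (map_ne_zero _).mpr hf0
    exact (mul_le_iff_le_one_right (zero_lt_iff.mpr h5)).mp h4
  refine ⟨Q, ?_⟩
  let N : Submonoid G :=
    { carrier := {g | ∀ i j, cj Q (S g) i j ∈ O}
      one_mem' := by
        intro i j
        rw [map_one, cj_one, Matrix.one_apply]
        split_ifs
        · exact O.one_mem
        · exact O.zero_mem
      mul_mem' := by
        intro a b ha hb i j
        rw [map_mul, cj_mul, Matrix.mul_apply]
        exact sum_mem fun k _ => mul_mem (ha i k) (hb k j) }
  have hN : Submonoid.closure Sg ≤ N := by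
    rw [Submonoid.closure_le]
    intro s hs i j
    obtain ⟨c, hc1, hc2⟩ := gram_coef O.toSubring (fun p => S (w p)) hD0 h1 hD (S s * S (w (f j))) (fun q => by
      rw [trace_mul_comm]; exact h2 s hs _ _)
    have h3 : cj Q (S s) i j = ((Mf f)⁻¹ *ᵥ ((S s * S (w (f j))) *ᵥ x0)) i := by
      change ((Mf f)⁻¹ * S s * Mf f) i j = _
      rw [← mulVec_mulVec, mulVec_mulVec]
      rfl
    rw [h3, hc2, sum_mulVec, mulVec_sum, Finset.sum_apply]
    refine sum_mem fun p _ => ?_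
    rw [smul_mulVec, mulVec_smul, Pi.smul_apply, smul_eq_mul]
    exact mul_mem (hc1 p) (hQ p i)
  intro g
  have : g ∈ N := hN (by rw [hgen]; trivial)
  exact this
end
end WE

namespace WE
open Filter Topology
namespace InvMean
variable {G : Type} [Group G] {X : ℕ → Type} [∀ k, MulAction G (X k)] (m : InvMean G X)

lemma congr {E F : ∀ k, Set (X k)} (h : ∀ᶠ k in UU, E k = F k) : m.μ E = m.μ F := by
  have key : ∀ E F : ∀ k, Set (X k), (∀ᶠ k in UU, E k = F k) → m.μ E = m.μ (fun k => E k ∩ F k) := by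
    intro E F h
    have h1 := m.add (fun k => E k ∩ F k) (fun k => E k \ F k) (fun k => Set.disjoint_sdiff_inter.symm)
    have h2 : m.μ (fun k => E k \ F k) = 0 := m.null _ (by filter_upwards [h] with k hk; rw [hk, Set.sdiff_self])
    rw [h2, add_zero] at h1
    rw [← h1]
    congr 1
    funext k
    exact (Set.inter_union_sdiff _ _).symm
  rw [key E F h, key F E (by filter_upwards [h] with k hk using hk.symm)]
  congr 1
  funext k
  exact Set.inter_comm _ _

lemma mono {E F : ∀ k, Set (X k)} (h : ∀ k, E k ⊆ F k) : m.μ E ≤ m.μ F := by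
  have h1 := m.add E (fun k => F k \ E k) (fun k => Set.disjoint_sdiff_right)
  have h2 := m.nonneg (fun k => F k \ E k)
  have h3 : (fun k => E k ∪ F k \ E k) = F := by
    funext k; exact Set.union_sdiff_cancel (h k)
  rw [h3] at h1
  linarith

lemma le_one (E : ∀ k, Set (X k)) : m.μ E ≤ 1 := by
  rw [← m.univ]; exact m.mono fun k => Set.subset_univ _

lemma union_null {E F : ∀ k, Set (X k)} (hE : m.μ E = 0) (hF : m.μ F = 0) : m.μ (fun k => E k ∪ F k) = 0 := by
  have h1 := m.add E (fun k => F k \ E k) (fun k => Set.disjoint_sdiff_right)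
  have h2 : m.μ (fun k => F k \ E k) = 0 :=
    le_antisymm (hF ▸ m.mono fun k => Set.sdiff_subset) (m.nonneg _)
  rw [h2, hE, add_zero] at h1
  rw [← h1]
  congr 1
  funext k
  exact Set.union_sdiff_self.symm

lemma null_of_disjoint (E : ∀ k, Set (X k)) (γ : G)
    (h : ∀ l : ℕ, 1 ≤ l → ∀ᶠ k in UU, ∀ x ∈ E k, γ ^ l • x ∉ E k) : m.μ E = 0 := by
  have key : ∀ n : ℕ, m.μ (fun k => ⋃ l ∈ Finset.range n, {x | γ ^ l • x ∈ E k}) = n * m.μ E := by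
    intro n
    induction n with
    | zero => simp [m.null]
    | succ n ih =>
      let D : ∀ k, Set (X k) := fun k => {x | γ ^ n • x ∈ E k} \ ⋃ l ∈ Finset.range n, {x | γ ^ l • x ∈ E k}
      have h1 := m.add (fun k => ⋃ l ∈ Finset.range n, {x | γ ^ l • x ∈ E k}) D (fun k => Set.disjoint_sdiff_right)
      have h2 : m.μ D = m.μ E := by
        rw [← m.inv (γ ^ n) E]
        apply m.congr
        have h3 : ∀ᶠ k in UU, ∀ l ∈ Finset.range n, ∀ x ∈ E k, γ ^ (n - l) • x ∉ E k := by
          rw [eventually_all_finset]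
          intro l hl
          have := Finset.mem_range.mp hl
          exact h _ (by omega)
        filter_upwards [h3] with k hk
        ext x
        constructor
        · exact fun hx => hx.1
        · intro hx
          refine ⟨hx, fun hx2 => ?_⟩
          simp only [Set.mem_iUnion] at hx2
          obtain ⟨l, hl, hx2⟩ := hx2
          apply hk l hl _ hx2
          rw [smul_smul, ← pow_add]
          have := Finset.mem_range.mp hl
          rw [show n - l + l = n by omega]
          exact hx
      rw [h2, ih] at h1
      push_cast
      rw [add_mul, one_mul, ← h1]
      congr 1
      funext k
      rw [Finset.range_add_one]
      simp only [D, Set.union_sdiff_self, Finset.set_biUnion_insert]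
      rw [Set.union_comm]
  by_contra hne
  have hpos : 0 < m.μ E := lt_of_le_of_ne (m.nonneg _) (Ne.symm hne)
  obtain ⟨n, hn⟩ := exists_nat_gt (1 / m.μ E)
  have h1 := m.le_one (fun k => ⋃ l ∈ Finset.range n, {x | γ ^ l • x ∈ E k})
  rw [key n] at h1
  rw [div_lt_iff₀ hpos] at hn
  linarith

theorem saturation [∀ k, Nonempty (X k)] (B : ℕ → ∀ k, Set (X k)) (hB : ∀ i, m.μ (B i) = 0) :
    ∃ x : ∀ k, X k, ∀ i, ∀ᶠ k in UU, x k ∉ B i k := by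
  classical
  have hU : ∀ n : ℕ, m.μ (fun k => ⋃ i ∈ Finset.range n, B i k) = 0 := by
    intro n
    induction n with
    | zero => simp [m.null]
    | succ n ih =>
      rw [← m.union_null ih (hB n)]
      congr 1
      funext k
      rw [Finset.range_add_one, Finset.set_biUnion_insert, Set.union_comm]
  have hne : ∀ n : ℕ, ∀ᶠ k in UU, ∃ x : X k, ∀ i < n, x ∉ B i k := by
    intro n
    by_contra hcon
    rw [← Ultrafilter.eventually_not] at hcon
    have h1 : m.μ (fun k => ⋃ i ∈ Finset.range n, B i k) = m.μ (fun k => Set.univ) := by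
      apply m.congr
      filter_upwards [hcon] with k hk
      rw [Set.eq_univ_iff_forall]
      intro x
      push Not at hk
      obtain ⟨i, hi, hx⟩ := hk x
      simp only [Set.mem_iUnion]
      exact ⟨i, Finset.mem_range.mpr hi, hx⟩
    rw [hU n, m.univ] at h1
    exact zero_ne_one h1
  have : ∀ k, ∃ x : X k, ∀ i < Nat.findGreatest (fun n => ∃ x : X k, ∀ i < n, x ∉ B i k) k, x ∉ B i k := by
    intro k
    exact Nat.findGreatest_spec (P := fun n => ∃ x : X k, ∀ i < n, x ∉ B i k) (Nat.zero_le k)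
      ⟨Classical.arbitrary _, fun i hi => absurd hi (Nat.not_lt_zero _)⟩
  choose x hx using this
  refine ⟨x, fun i => ?_⟩
  have hk : ∀ᶠ k in UU, i + 1 ≤ k := Nat.hyperfilter_le_atTop (eventually_ge_atTop (i + 1))
  filter_upwards [hk, hne (i + 1)] with k h1 h2
  exact hx k i (Nat.le_findGreatest (P := fun n => ∃ x : X k, ∀ i < n, x ∉ B i k) h1 h2)

theorem saturation' [∀ k, Nonempty (X k)] {J : Type} [Countable J] (B : J → ∀ k, Set (X k)) (hB : ∀ i, m.μ (B i) = 0) :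
    ∃ x : ∀ k, X k, ∀ i, ∀ᶠ k in UU, x k ∉ B i k := by
  rcases isEmpty_or_nonempty J with h | h
  · exact ⟨fun k => Classical.arbitrary _, fun i => h.elim i⟩
  · obtain ⟨f, hf⟩ := exists_surjective_nat J
    obtain ⟨x, hx⟩ := m.saturation (fun n => B (f n)) fun n => hB _
    refine ⟨x, fun i => ?_⟩
    obtain ⟨n, rfl⟩ := hf i
    exact hx n

/-- restriction to a subgroup -/
def restrict (H : Subgroup G) : InvMean H X where
  μ := m.μ
  nonneg := m.nonneg
  add := m.add
  univ := m.univ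
  inv := fun g E => m.inv (g : G) E
  null := m.null
end InvMean
end WE

namespace WE
open Matrix
section
variable {ι : Type} [Fintype ι] [DecidableEq ι]

lemma XX1_empty {K : Type*} [CommRing K] (A : Matrix ι ι K) (l : ι → K) : XX A l ∅ 1 = 1 := by
  simp [XX]

lemma XX1_insert {K : Type*} [CommRing K] (A : Matrix ι ι K) (l : ι → K) (a : ι) (J : Finset ι) (ha : a ∉ J) :
    XX A l (insert a J) 1 = (A - l a • 1) * XX A l J 1 := by
  unfold XX
  rw [Finset.prod_insert ha, map_mul]
  congr 1
  simp [Algebra.algebraMap_eq_smul_one]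

lemma XX1_insert' {K : Type*} [CommRing K] (A : Matrix ι ι K) (l : ι → K) (a : ι) (J : Finset ι) (ha : a ∉ J) :
    XX A l (insert a J) 1 = XX A l J 1 * (A - l a • 1) := by
  unfold XX
  rw [Finset.prod_insert ha, mul_comm, map_mul]
  congr 1
  simp [Algebra.algebraMap_eq_smul_one]

lemma XX1_comm {K : Type*} [CommRing K] (A : Matrix ι ι K) (l : ι → K) (J : Finset ι) (m : ℕ) :
    A ^ m * XX A l J 1 = XX A l J 1 * A ^ m := by
  unfold XX
  have : A ^ m = Polynomial.aeval A (Polynomial.X ^ m : Polynomial K) := by simp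
  rw [this, ← map_mul, mul_comm, map_mul]

lemma XX1_compl {K : Type*} [Field K] (A : Matrix ι ι K) (l : ι → K) (h : HasEig A l) (J : Finset ι) :
    XX A l J 1 * XX A l Jᶜ 1 = 0 := by
  unfold XX
  rw [← map_mul, Finset.prod_mul_prod_compl]
  simpa using h.prod_eq_zero

lemma XX1_ne_zero {K : Type*} [Field K] (A : Matrix ι ι K) (l : ι → K) (h : HasEig A l) (J : Finset ι) (a : ι)
    (ha : ∀ j ∈ J, l j ≠ l a) : XX A l J 1 ≠ 0 := by
  have h0 : (A - algebraMap K _ (l a)).det = 0 := by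
    rw [h.det_sub, Finset.prod_eq_zero (Finset.mem_univ a) (sub_self _)]
  obtain ⟨x, hx, hx2⟩ := Matrix.exists_mulVec_eq_zero_iff.mpr h0
  have hA : A *ᵥ x = l a • x := by
    rw [sub_mulVec, sub_eq_zero] at hx2
    rw [hx2, Algebra.algebraMap_eq_smul_one, smul_mulVec, one_mulVec]
  have key : ∀ J : Finset ι, XX A l J 1 *ᵥ x = (∏ j ∈ J, (l a - l j)) • x := by
    intro J
    induction J using Finset.induction_on with
    | empty => simp [XX1_empty]
    | insert b J hb ih =>
      rw [XX1_insert' _ _ _ _ hb, ← mulVec_mulVec, sub_mulVec, hA, smul_mulVec, one_mulVec, ← sub_smul, mulVec_smul, ih,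
        Finset.prod_insert hb, smul_smul]
  intro hz
  have := key J
  rw [hz, zero_mulVec] at this
  have h3 := smul_eq_zero.mp this.symm
  rcases h3 with h3 | h3
  · rw [Finset.prod_eq_zero_iff] at h3
    obtain ⟨j, hj, h4⟩ := h3
    exact ha j hj (sub_eq_zero.mp h4).symm
  · exact hx h3

variable {F : Type} [NormedField F]

lemma growth (A : Matrix ι ι F) (l : ι → F) (r r' : ℝ) (hr : 0 ≤ r) (hr' : r < r') (J : Finset ι) :
    (∀ j ∈ J, ‖l j‖ ≤ r) → ∀ Y : Matrix ι ι F, XX A l J 1 * Y = 0 →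
    ∃ C : ℝ, 0 ≤ C ∧ ∀ (m : ℕ) i j, ‖(A ^ m * Y) i j‖ ≤ C * r' ^ m := by
  induction J using Finset.induction_on with
  | empty =>
    intro _ Y hY
    rw [XX1_empty, one_mul] at hY
    subst hY
    exact ⟨0, le_rfl, by simp⟩
  | insert a J ha ih =>
    intro hl Y hY
    rw [XX1_insert' _ _ _ _ ha, mul_assoc] at hY
    obtain ⟨C, hC, hC2⟩ := ih (fun j hj => hl j (Finset.mem_insert_of_mem hj)) _ hY
    let a0 : ℝ := ∑ i, ∑ j, ‖Y i j‖
    have ha0 : ∀ i j, ‖Y i j‖ ≤ a0 := fun i j =>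
      (Finset.single_le_sum (f := fun j => ‖Y i j‖) (fun _ _ => norm_nonneg _) (Finset.mem_univ j)).trans
      (Finset.single_le_sum (f := fun i => ∑ j, ‖Y i j‖) (fun _ _ => Finset.sum_nonneg fun _ _ => norm_nonneg _) (Finset.mem_univ i))
    have ha1 : 0 ≤ a0 := Finset.sum_nonneg fun _ _ => Finset.sum_nonneg fun _ _ => norm_nonneg _
    have hd : 0 < r' - r := by linarith
    refine ⟨a0 + C / (r' - r), by positivity, ?_⟩
    intro m
    induction m with
    | zero =>
      intro i j
      rw [pow_zero, one_mul, pow_zero, mul_one]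
      have : 0 ≤ C / (r' - r) := by positivity
      linarith [ha0 i j]
    | succ m ihm =>
      intro i j
      have h1 : A ^ (m + 1) * Y = A ^ m * ((A - l a • 1) * Y) + l a • (A ^ m * Y) := by
        rw [pow_succ, sub_mul, mul_sub, mul_assoc, smul_mul_assoc, one_mul, mul_smul_comm]
        abel
      rw [h1, Matrix.add_apply, Matrix.smul_apply, smul_eq_mul]
      refine (norm_add_le _ _).trans ?_
      rw [norm_mul]
      have h2 := hC2 m i j
      have h3 := ihm i j
      have h4 := hl a (Finset.mem_insert_self _ _)
      have h5 : ‖l a‖ * ‖(A ^ m * Y) i j‖ ≤ r * ((a0 + C / (r' - r)) * r' ^ m) :=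
        mul_le_mul h4 h3 (norm_nonneg _) hr
      have h6 : C / (r' - r) * (r' - r) = C := div_mul_cancel₀ _ hd.ne'
      have h7 : 0 < r' ^ m := pow_pos (by linarith) m
      rw [pow_succ]
      have h8 : C ≤ (a0 + C / (r' - r)) * (r' - r) := by
        rw [add_mul, h6]; nlinarith
      nlinarith [mul_le_mul_of_nonneg_right h8 h7.le]

lemma XX1_inv (A Ai : Matrix ι ι F) (h : A * Ai = 1) (l : ι → F) (J : Finset ι) (hl : ∀ j ∈ J, l j ≠ 0) :
    ∃ (c : F) (n : ℕ), XX Ai (fun j => (l j)⁻¹) J 1 = c • Ai ^ n * XX A l J 1 := by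
  have h' : Ai * A = 1 := mul_eq_one_comm.mp h
  induction J using Finset.induction_on with
  | empty => exact ⟨1, 0, by simp [XX1_empty]⟩
  | insert a J ha ih =>
    obtain ⟨c, n, hc⟩ := ih fun j hj => hl j (Finset.mem_insert_of_mem hj)
    refine ⟨- (l a)⁻¹ * c, n + 1, ?_⟩
    have h0 := hl a (Finset.mem_insert_self _ _)
    rw [XX1_insert _ _ _ _ ha, XX1_insert _ _ _ _ ha, hc]
    have e1 : Ai - (l a)⁻¹ • 1 = (-(l a)⁻¹) • (Ai * (A - l a • 1)) := by
      rw [mul_sub, h', mul_smul_comm, mul_one, smul_sub, smul_smul, neg_mul, inv_mul_cancel₀ h0]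
      simp [sub_eq_add_neg, add_comm]
    have e2 : (A - l a • 1) * Ai ^ n = Ai ^ n * (A - l a • 1) := by
      have : Commute A (Ai ^ n) := (show Commute A Ai from h.trans h'.symm).pow_right n
      rw [sub_mul, mul_sub, this.eq]; simp
    rw [e1]
    simp only [smul_mul_assoc, mul_smul_comm, smul_smul]
    rw [mul_comm c]
    congr 1
    rw [pow_succ', mul_assoc, ← mul_assoc (A - l a • 1), e2]
    simp only [mul_assoc]

lemma mulVec_bound (Z : Matrix ι ι F) (C : ℝ) (hZ : ∀ i j, ‖Z i j‖ ≤ C) (x : ι → F) (hx : ∀ i, ‖x i‖ ≤ 1) (i : ι) :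
    ‖(Z *ᵥ x) i‖ ≤ Fintype.card ι * C := by
  simp only [mulVec, dotProduct]
  refine (norm_sum_le _ _).trans ?_
  refine (Finset.sum_le_sum (g := fun _ => C) fun j _ => ?_).trans (by simp)
  rw [norm_mul]
  calc _ ≤ C * 1 := mul_le_mul (hZ i j) (hx j) (norm_nonneg _) ((norm_nonneg _).trans (hZ i j))
    _ = C := mul_one C

theorem pingpong (A Ai : Matrix ι ι F) (h : A * Ai = 1) (l : ι → F) (hl : HasEig A l) (R : ℝ) (hR : 0 < R) (J : Finset ι)
    (hJ : ∀ j ∈ J, ‖l j‖ = R) (hJc : ∀ j ∈ Jᶜ, ‖l j‖ < R) (K : ℝ) (hK : 0 < K) :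
    ∃ m0 : ℕ, ∀ m, m0 ≤ m → ∀ (x y : ι → F) (c : F), (∀ i, ‖x i‖ ≤ 1) → (∀ i, ‖y i‖ ≤ 1) → A ^ m *ᵥ x = c • y →
      (∃ i, K ≤ ‖(XX A l Jᶜ 1 *ᵥ x) i‖) → (∃ i, K ≤ ‖(XX A l J 1 *ᵥ y) i‖) → False := by
  have h' : Ai * A = 1 := mul_eq_one_comm.mp h
  obtain ⟨r, hr0, hrR, hr⟩ : ∃ r : ℝ, 0 ≤ r ∧ r < R ∧ ∀ j ∈ Jᶜ, ‖l j‖ ≤ r := by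
    rcases (Jᶜ).eq_empty_or_nonempty with he | hne
    · exact ⟨0, le_rfl, hR, by simp [he]⟩
    · obtain ⟨j, hj, hj2⟩ := (Jᶜ).exists_max_image (fun j => ‖l j‖) hne
      exact ⟨‖l j‖, norm_nonneg _, hJc j hj, hj2⟩
  obtain ⟨r', hr1, hr2⟩ := exists_between hrR
  have hr'0 : 0 < r' := by linarith
  obtain ⟨q, hq1, hq2⟩ := exists_between (inv_strictAnti₀ hr'0 hr2)
  have hq0 : 0 < q := (inv_pos.mpr hR).trans hq1
  obtain ⟨C1, hC1, hg1⟩ := growth A l r r' hr0 hr1 Jᶜ hr (XX A l J 1) (by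
    have := XX1_compl A l hl Jᶜ; rwa [compl_compl] at this)
  obtain ⟨C2, hC2, hg2⟩ := growth Ai (fun j => (l j)⁻¹) R⁻¹ q (inv_pos.mpr hR).le hq1 J
    (fun j hj => by rw [norm_inv, hJ j hj]) (XX A l Jᶜ 1) (by
      obtain ⟨c, n, hc⟩ := XX1_inv A Ai h l J (fun j hj h0 => by
        have := hJ j hj; rw [h0, norm_zero] at this; linarith)
      rw [hc, mul_assoc, XX1_compl A l hl, mul_zero])
  set d : ℝ := (Fintype.card ι : ℝ)
  have hlt : r' * q < 1 := by
    calc r' * q < r' * r'⁻¹ := mul_lt_mul_of_pos_left hq2 hr'0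
      _ = 1 := mul_inv_cancel₀ hr'0.ne'
  have htend := (tendsto_pow_atTop_nhds_zero_of_lt_one (by positivity) hlt).const_mul (d * C1 * (d * C2))
  rw [mul_zero] at htend
  have hev := htend.eventually (gt_mem_nhds (show (0:ℝ) < K * K by positivity))
  obtain ⟨m0, hm0⟩ := Filter.eventually_atTop.mp hev
  refine ⟨m0, fun m hm x y c hx hy hxy ⟨i, hi⟩ ⟨i', hi'⟩ => ?_⟩
  have h1 : A ^ m *ᵥ (XX A l J 1 *ᵥ x) = c • (XX A l J 1 *ᵥ y) := by
    rw [mulVec_mulVec, XX1_comm, ← mulVec_mulVec, hxy, mulVec_smul]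
  have hcomm : Ai ^ m * XX A l Jᶜ 1 * A ^ m = XX A l Jᶜ 1 := by
    rw [mul_assoc, ← XX1_comm, ← mul_assoc]
    have : Ai ^ m * A ^ m = 1 := by
      rw [← (show Commute Ai A from h'.trans h.symm).mul_pow, h', one_pow]
    rw [this, one_mul]
  have h2 : XX A l Jᶜ 1 *ᵥ x = c • ((Ai ^ m * XX A l Jᶜ 1) *ᵥ y) := by
    rw [← mulVec_smul, ← hxy, mulVec_mulVec, hcomm]
  have b1 : ‖c‖ * K ≤ d * (C1 * r' ^ m) := by
    have := mulVec_bound (A ^ m * XX A l J 1) _ (fun i j => hg1 m i j) x hx i'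
    rw [← mulVec_mulVec, h1, Pi.smul_apply, norm_smul] at this
    exact (mul_le_mul_of_nonneg_left hi' (norm_nonneg _)).trans this
  have b2 : K ≤ ‖c‖ * (d * (C2 * q ^ m)) := by
    have := mulVec_bound (Ai ^ m * XX A l Jᶜ 1) _ (fun i j => hg2 m i j) y hy i
    rw [h2, Pi.smul_apply, norm_smul] at hi
    exact hi.trans (mul_le_mul_of_nonneg_left this (norm_nonneg _))
  have b3 := hm0 m hm
  have hd0 : 0 ≤ d := Nat.cast_nonneg _
  have b4 : K * K ≤ d * C1 * (d * C2) * (r' * q) ^ m := by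
    calc K * K ≤ (‖c‖ * (d * (C2 * q ^ m))) * K := mul_le_mul_of_nonneg_right b2 hK.le
      _ = (‖c‖ * K) * (d * (C2 * q ^ m)) := by ring
      _ ≤ (d * (C1 * r' ^ m)) * (d * (C2 * q ^ m)) := mul_le_mul_of_nonneg_right b1 (by positivity)
      _ = _ := by rw [mul_pow]; ring
  linarith
end
end WE

namespace WE
open Matrix Filter Topology
section
variable {ι : Type} [Fintype ι] [DecidableEq ι] {L 𝕃 F : Type} [Field L] [Field 𝕃] [NormedField F] {G : Type} [Group G]

lemma exists_vecs [Nonempty ι] (v : AbsoluteValue L ℝ) {X : Type} [MulAction G X] (σ : G →* Matrix ι ι L)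
    (hst : ∀ (g : G) (x : X), g • x = x → ∃ c : L, σ g = c • 1) :
    ∃ V : X → ι → L, (∀ x, (∃ i, V x i = 1) ∧ ∀ j, v (V x j) ≤ 1) ∧ ∀ (g : G) (x : X), ∃ c : L, σ g *ᵥ V x = c • V (g • x) := by
  obtain ⟨i0⟩ := (inferInstance : Nonempty ι)
  let e : ι → L := Pi.single i0 1
  let r : X → X := fun x => Quotient.out (Quotient.mk (MulAction.orbitRel G X) x)
  have hγ : ∀ x, ∃ γ : G, γ • r x = x := by
    intro x
    have h1 : (MulAction.orbitRel G X) (r x) x := Quotient.mk_out (s := MulAction.orbitRel G X) x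
    have h2 := (MulAction.orbitRel G X).symm h1
    exact MulAction.orbitRel_apply.mp h2
  choose γ hγ using hγ
  have hr : ∀ (g : G) x, r (g • x) = r x := by
    intro g x
    simp only [r]
    congr 1
    apply Quotient.sound
    exact MulAction.orbitRel_apply.mpr ⟨g, rfl⟩
  let pre : X → ι → L := fun x => σ (γ x) *ᵥ e
  have hpre : ∀ x, pre x ≠ 0 := by
    intro x h0
    have h1 : σ (γ x)⁻¹ *ᵥ pre x = e := by
      simp only [pre, mulVec_mulVec, ← map_mul]; simp
    rw [h0, mulVec_zero] at h1
    have := congrFun h1 i0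
    simp [e] at this
  have hmax : ∀ x, ∃ i, ∀ j, v (pre x j) ≤ v (pre x i) := by
    intro x
    obtain ⟨i, -, hi⟩ := Finset.exists_max_image Finset.univ (fun j => v (pre x j)) ⟨i0, Finset.mem_univ _⟩
    exact ⟨i, fun j => hi j (Finset.mem_univ _)⟩
  choose mi hmi using hmax
  have hne : ∀ x, pre x (mi x) ≠ 0 := by
    intro x h0
    apply hpre x
    funext j
    have := hmi x j
    rw [h0, map_zero] at this
    exact v.eq_zero.mp (le_antisymm this (v.nonneg _))
  refine ⟨fun x => (pre x (mi x))⁻¹ • pre x, fun x => ⟨⟨mi x, ?_⟩, fun j => ?_⟩, fun g x => ?_⟩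
  · simp [hne x]
  · beta_reduce
    rw [Pi.smul_apply, smul_eq_mul, map_mul, map_inv₀, inv_mul_le_iff₀ (v.pos (hne x)), mul_one]
    exact hmi x j
  · obtain ⟨c, hc⟩ := hst ((γ (g • x))⁻¹ * (g * γ x)) (r x) (by
      rw [mul_smul, mul_smul, hγ, inv_smul_eq_iff]
      conv_rhs => rw [← hr g x]
      rw [hγ])
    have h1 : σ (g * γ x) = c • σ (γ (g • x)) := by
      have : g * γ x = γ (g • x) * ((γ (g • x))⁻¹ * (g * γ x)) := by group
      rw [this, map_mul, hc, mul_smul_comm, mul_one]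
    refine ⟨(pre x (mi x))⁻¹ * c * pre (g • x) (mi (g • x)), ?_⟩
    beta_reduce
    rw [mulVec_smul, smul_smul, mul_assoc, mul_inv_cancel₀ (hne _), mul_one]
    simp only [pre]
    rw [mulVec_mulVec, ← map_mul, h1, smul_mulVec, smul_smul]

set_option maxHeartbeats 1000000 in
theorem lemmaL [Nonempty ι] [Countable G] (u : UP L 𝕃) (v : ℕ → AbsoluteValue L ℝ) (p : Plc u v F)
    (X : ℕ → Type) [∀ k, MulAction G (X k)] [∀ k, Nonempty (X k)] (m : InvMean G X)
    (σ : ℕ → G →* Matrix ι ι L) (hst : ∀ k (g : G) (x : X k), g • x = x → ∃ c : L, σ k g = c • 1)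
    (hdet : ∀ k g, (σ k g).det = 1)
    (s : G →* Matrix ι ι (bO u v)) (hs : ∀ g, (bO u v).subtype.mapMatrix (s g) = u.hom σ g)
    (hirr : Irr ((fun g => p.st.mapMatrix (s g)) '' (Kd G (2 ^ Fintype.card ι) : Set G)))
    (g : G) (l : ι → bO u v) (hl : HasEig (p.st.mapMatrix (s g)) (fun j => p.st (l j))) : ∀ j, ‖p.st (l j)‖ = 1 := by
  choose V hV1 hV2 using fun k => exists_vecs (v k) (X := X k) (σ k) (hst k)
  -- limit vectors
  have hmem : ∀ (x : ∀ k, X k) i, u.mk (fun k => V k (x k) i) ∈ bO u v := fun x i =>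
    (mem_bO_mk u v _).mpr ⟨1, Eventually.of_forall fun k => (hV1 k (x k)).2 i⟩
  let vO : (∀ k, X k) → ι → bO u v := fun x i => ⟨_, hmem x i⟩
  let β : (∀ k, X k) → ι → F := fun x i => p.st (vO x i)
  have hβ1 : ∀ x i, ‖β x i‖ ≤ 1 := fun x i =>
    le_of_tendsto' (p.norm_mk _ (hmem x i)) fun k => (hV1 k (x k)).2 i
  have hone : ∀ x, ∃ i, vO x i = 1 := by
    intro x
    have h1 : ∀ᶠ k in UU, ∃ i, V k (x k) i = 1 := Eventually.of_forall fun k => (hV1 k (x k)).1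
    obtain ⟨i, hi⟩ := Ultrafilter.eventually_exists_iff.mp h1
    refine ⟨i, Subtype.ext ?_⟩
    change u.mk _ = 1
    rw [← map_one u.mk, u.mk_eq]
    exact hi
  have hβ0 : ∀ x, β x ≠ 0 := by
    intro x h0
    obtain ⟨i, hi⟩ := hone x
    have := congrFun h0 i
    simp only [β, hi, map_one] at this
    exact one_ne_zero this
  have hact : ∀ (h : G) (x : ∀ k, X k), ∃ c : F, p.st.mapMatrix (s h) *ᵥ β x = c • β (fun k => h • x k) := by
    intro h x
    choose c hc using fun k => hV2 k h (x k)
    have h1 : u.hom σ h *ᵥ (fun i => (vO x i : 𝕃)) = u.mk c • fun i => (vO (fun k => h • x k) i : 𝕃) := by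
      rw [UP.hom_apply]
      refine (u.mkM_mulVec _ _).trans ?_
      funext i
      simp only [Pi.smul_apply, smul_eq_mul, vO, ← map_mul]
      congr 1
      funext k
      rw [hc k]; rfl
    have h2 : ∀ i, ((s h *ᵥ vO x) i : 𝕃) = u.mk c * vO (fun k => h • x k) i := by
      intro i
      have := congrFun h1 i
      rw [Pi.smul_apply, smul_eq_mul] at this
      rw [← this, ← hs h]
      exact RingHom.map_mulVec (bO u v).subtype (s h) (vO x) i
    obtain ⟨i, hi⟩ := hone (fun k => h • x k)
    have hcO : u.mk c ∈ bO u v := by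
      have := h2 i
      rw [hi] at this
      simp only [OneMemClass.coe_one, mul_one] at this
      rw [← this]; exact Subtype.property _
    have h3 : s h *ᵥ vO x = (⟨_, hcO⟩ : bO u v) • vO (fun k => h • x k) := by
      funext i
      exact Subtype.ext (h2 i)
    refine ⟨p.st ⟨_, hcO⟩, ?_⟩
    funext i
    have h4 := RingHom.map_mulVec p.st (s h) (vO x) i
    rw [h3, Pi.smul_apply, smul_eq_mul, map_mul] at h4
    exact h4.symm
  let lift : Matrix ι ι (bO u v) → ℕ → Matrix ι ι L := fun Z => u.repM ((bO u v).subtype.mapMatrix Z)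
  have hlim : ∀ (Z : Matrix ι ι (bO u v)) (x : ∀ k, X k) i,
      Tendsto (fun k => v k ((lift Z k *ᵥ V k (x k)) i)) UU (𝓝 ‖(p.st.mapMatrix Z *ᵥ β x) i‖) := by
    intro Z x i
    have h1 : u.mk (fun k => (lift Z k *ᵥ V k (x k)) i) = ((Z *ᵥ vO x) i : bO u v) := by
      have := congrFun (u.mkM_mulVec (lift Z) (fun k => V k (x k))) i
      rw [← this, u.mkM_repM]
      exact (RingHom.map_mulVec (bO u v).subtype Z (vO x) i).symm
    have h2 : u.mk (fun k => (lift Z k *ᵥ V k (x k)) i) ∈ bO u v := by rw [h1]; exact Subtype.property _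
    have h3 := p.norm_mk _ h2
    have h4 : p.st ⟨_, h2⟩ = (p.st.mapMatrix Z *ᵥ β x) i := by
      have : (⟨_, h2⟩ : bO u v) = (Z *ᵥ vO x) i := Subtype.ext h1
      rw [this]
      exact RingHom.map_mulVec p.st Z (vO x) i
    rwa [h4] at h3
  -- eigenvalues
  by_contra hcon
  push Not at hcon
  have hprod : ∏ j, ‖p.st (l j)‖ = 1 := by
    rw [← norm_prod, ← hl.det, ← RingHom.map_det]
    have h1 : (s g).det = 1 := by
      apply Subtype.ext
      change (bO u v).subtype (s g).det = 1
      rw [RingHom.map_det, hs, UP.hom_apply, u.mkM_det]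
      simp only [hdet]
      exact map_one u.mk
    rw [h1, map_one, norm_one]
  obtain ⟨i0⟩ := (inferInstance : Nonempty ι)
  obtain ⟨j0, -, hj0⟩ := Finset.exists_max_image Finset.univ (fun j => ‖p.st (l j)‖) ⟨i0, Finset.mem_univ _⟩
  set R := ‖p.st (l j0)‖ with hRdef
  have hR : 0 < R := by
    refine lt_of_le_of_ne (norm_nonneg _) fun h0 => ?_
    rw [Finset.prod_eq_zero (Finset.mem_univ j0) h0.symm] at hprod
    exact zero_ne_one hprod
  classical
  let J : Finset ι := Finset.univ.filter fun j => ‖p.st (l j)‖ = R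
  have hJ : ∀ j ∈ J, ‖p.st (l j)‖ = R := fun j hj => (Finset.mem_filter.mp hj).2
  have hJc : ∀ j ∈ Jᶜ, ‖p.st (l j)‖ < R := by
    intro j hj
    refine lt_of_le_of_ne (hj0 j (Finset.mem_univ _)) fun h => ?_
    rw [Finset.mem_compl] at hj
    exact hj (Finset.mem_filter.mpr ⟨Finset.mem_univ _, h⟩)
  have hj1 : ∃ j1, j1 ∈ Jᶜ := by
    by_contra hno
    push Not at hno
    have hall : ∀ j, ‖p.st (l j)‖ = R := fun j => by
      have := hno j
      rw [Finset.mem_compl, not_not] at this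
      exact hJ j this
    have h1 : R ^ Fintype.card ι = 1 := by
      rw [← hprod, Finset.prod_congr rfl fun j _ => hall j, Finset.prod_const, Finset.card_univ]
    have h2 : R = 1 := (pow_eq_one_iff_of_nonneg hR.le Fintype.card_ne_zero).mp h1
    obtain ⟨j, hj⟩ := hcon
    exact hj ((hall j).trans h2)
  obtain ⟨j1, hj1⟩ := hj1
  let Zp : Matrix ι ι (bO u v) := XX (s g) l Jᶜ 1
  let Zm : Matrix ι ι (bO u v) := XX (s g) l J 1
  have hZp : p.st.mapMatrix Zp = XX (p.st.mapMatrix (s g)) (fun j => p.st (l j)) Jᶜ 1 := XX_map _ _ _ _ _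
  have hZm : p.st.mapMatrix Zm = XX (p.st.mapMatrix (s g)) (fun j => p.st (l j)) J 1 := XX_map _ _ _ _ _
  have hZp0 : p.st.mapMatrix Zp ≠ 0 := by
    rw [hZp]
    refine XX1_ne_zero _ _ hl _ j0 fun j hj h => ?_
    have := hJc j hj
    rw [h] at this
    exact lt_irrefl _ this
  have hZm0 : p.st.mapMatrix Zm ≠ 0 := by
    rw [hZm]
    refine XX1_ne_zero _ _ hl _ j1 fun j hj h => ?_
    have := hJc j1 hj1
    rw [← h, hJ j hj] at this
    exact lt_irrefl _ this
  let E : ℕ → ∀ k, Set (X k) := fun n k => {x | (∃ i, 1 / ((n : ℝ) + 1) ≤ v k ((lift Zp k *ᵥ V k x) i)) ∧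
    ∃ i, 1 / ((n : ℝ) + 1) ≤ v k ((lift Zm k *ᵥ V k x) i)}
  have hge : ∀ (Z : Matrix ι ι (bO u v)) (x : ∀ k, X k) (a : ℝ), (∀ᶠ k in UU, ∃ i, a ≤ v k ((lift Z k *ᵥ V k (x k)) i)) →
      ∃ i, a ≤ ‖(p.st.mapMatrix Z *ᵥ β x) i‖ := by
    intro Z x a h
    obtain ⟨i, hi⟩ := Ultrafilter.eventually_exists_iff.mp h
    exact ⟨i, ge_of_tendsto (hlim Z x i) hi⟩
  have hE : ∀ n, m.μ (E n) = 0 := by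
    intro n
    have hAi : p.st.mapMatrix (s g) * p.st.mapMatrix (s g⁻¹) = 1 := by
      rw [← map_mul, ← map_mul, mul_inv_cancel, map_one, map_one]
    obtain ⟨m0, hm0⟩ := pingpong _ _ hAi _ hl R hR J hJ hJc (1 / ((n : ℝ) + 1)) (by positivity)
    refine m.null_of_disjoint (E n) (g ^ m0) fun e he => ?_
    by_contra hno
    rw [← Ultrafilter.eventually_not] at hno
    have hch : ∀ k, ∃ x : X k, (¬ ∀ x ∈ E n k, (g ^ m0) ^ e • x ∉ E n k) → x ∈ E n k ∧ (g ^ m0) ^ e • x ∈ E n k := by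
      intro k
      by_cases h : ∀ x ∈ E n k, (g ^ m0) ^ e • x ∉ E n k
      · exact ⟨Classical.arbitrary _, fun h' => (h' h).elim⟩
      · push Not at h
        obtain ⟨x, hx1, hx2⟩ := h
        exact ⟨x, fun _ => ⟨hx1, hx2⟩⟩
    choose x hx using hch
    have hx' : ∀ᶠ k in UU, x k ∈ E n k ∧ (g ^ m0) ^ e • x k ∈ E n k := by
      filter_upwards [hno] with k hk using hx k hk
    obtain ⟨c, hc⟩ := hact ((g ^ m0) ^ e) x
    refine hm0 (m0 * e) (Nat.le_mul_of_pos_right _ he) (β x) _ c (hβ1 _) (hβ1 _) (by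
      rw [← hc, ← map_pow, ← map_pow, pow_mul]) ?_ ?_
    · rw [← hZp]
      exact hge _ _ _ (by filter_upwards [hx'] with k hk using hk.1.1)
    · rw [← hZm]
      exact hge _ (fun k => (g ^ m0) ^ e • x k) _ (by filter_upwards [hx'] with k hk using hk.2.2)
  obtain ⟨x, hx⟩ := m.saturation' (J := ℕ × G) (fun q k => {x | q.2 • x ∈ E q.1 k}) (fun q => by
    rw [m.inv]; exact hE q.1)
  have hkill : ∀ h : G, p.st.mapMatrix Zp *ᵥ β (fun k => h • x k) = 0 ∨ p.st.mapMatrix Zm *ᵥ β (fun k => h • x k) = 0 := by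
    intro h
    by_contra hno
    push Not at hno
    obtain ⟨h1, h2⟩ := hno
    obtain ⟨i1, hi1⟩ := Function.ne_iff.mp h1
    obtain ⟨i2, hi2⟩ := Function.ne_iff.mp h2
    have a1 : 0 < ‖(p.st.mapMatrix Zp *ᵥ β (fun k => h • x k)) i1‖ := norm_pos_iff.mpr hi1
    have a2 : 0 < ‖(p.st.mapMatrix Zm *ᵥ β (fun k => h • x k)) i2‖ := norm_pos_iff.mpr hi2
    obtain ⟨n, hn⟩ := exists_nat_one_div_lt (lt_min a1 a2)
    have e1 := (hlim Zp (fun k => h • x k) i1).eventually (lt_mem_nhds (hn.trans_le (min_le_left _ _)))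
    have e2 := (hlim Zm (fun k => h • x k) i2).eventually (lt_mem_nhds (hn.trans_le (min_le_right _ _)))
    obtain ⟨k, ⟨f1, f2⟩, f3⟩ := ((e1.and e2).and (hx (n, h))).exists
    exact f3 ⟨⟨i1, f1.le⟩, ⟨i2, f2.le⟩⟩
  have hker : ∀ Z : Matrix ι ι F, Z ≠ 0 → LinearMap.ker Z.mulVecLin ≠ ⊤ := by
    intro Z hZ htop
    rw [LinearMap.ker_eq_top] at htop
    apply hZ
    ext i j
    have := congrFun (LinearMap.congr_fun htop (Pi.single j 1)) i
    simpa using this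
  obtain ⟨W, hW1, hW2, hW3⟩ := tree_lemma (p.st.mapMatrix.toMonoidHom.comp s) (LinearMap.ker (p.st.mapMatrix Zp).mulVecLin)
    (LinearMap.ker (p.st.mapMatrix Zm).mulVecLin) (hker _ hZp0) (hker _ hZm0) (β x) (hβ0 x) (by
      intro h
      obtain ⟨c, hc⟩ := hact h x
      have hc' : (p.st.mapMatrix.toMonoidHom.comp s) h *ᵥ β x = c • β (fun k => h • x k) := hc
      rw [hc']
      rcases hkill h with h1 | h1
      · left; rw [LinearMap.mem_ker, map_smul, mulVecLin_apply, h1, smul_zero]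
      · right; rw [LinearMap.mem_ker, map_smul, mulVecLin_apply, h1, smul_zero])
  rcases hirr W (by
    rintro _ ⟨h, hh, rfl⟩ w hw
    exact hW3 h hh w hw) with h | h
  · exact hW1 h
  · exact hW2 h
end
end WE

namespace WE
open Matrix Filter Topology
section
variable {ι : Type} [Fintype ι] [DecidableEq ι] {L 𝕃 F : Type} [Field L] [Field 𝕃] [NormedField F] {G : Type} [Group G]

lemma conj_lift (u : UP L 𝕃) (σ : ℕ → G →* Matrix ι ι L) (Q : (Matrix ι ι 𝕃)ˣ) :
    ∃ (q : ℕ → (Matrix ι ι L)ˣ) (σ' : ℕ → G →* Matrix ι ι L), (∀ k g, σ' k g = cj (q k) (σ k g)) ∧ ∀ g, u.hom σ' g = cj Q (u.hom σ g) := by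
  have h0 : ∀ᶠ k in UU, (u.repM (Q : Matrix ι ι 𝕃) k).det ≠ 0 := by
    rw [← u.ne_zero, ← u.mkM_det, u.mkM_repM]
    exact ((Matrix.isUnit_iff_isUnit_det _).mp Q.isUnit).ne_zero
  have : ∀ k, ∃ q : (Matrix ι ι L)ˣ, (u.repM (Q : Matrix ι ι 𝕃) k).det ≠ 0 → (q : Matrix ι ι L) = u.repM Q k := by
    intro k
    by_cases h : (u.repM (Q : Matrix ι ι 𝕃) k).det = 0
    · exact ⟨1, fun h' => (h' h).elim⟩
    · have h1 : IsUnit (u.repM (Q : Matrix ι ι 𝕃) k) := (Matrix.isUnit_iff_isUnit_det _).mpr (Ne.isUnit h)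
      exact ⟨h1.unit, fun _ => rfl⟩
  choose q hq using this
  let σ' : ℕ → G →* Matrix ι ι L := fun k =>
    { toFun := fun g => cj (q k) (σ k g)
      map_one' := by rw [map_one, cj_one]
      map_mul' := fun a b => by rw [map_mul, cj_mul] }
  refine ⟨q, σ', fun k g => rfl, fun g => ?_⟩
  have hqm : u.mkM (fun k => (q k : Matrix ι ι L)) = Q := by
    conv_rhs => rw [← u.mkM_repM (Q : Matrix ι ι 𝕃)]
    rw [u.mkM_eq]
    filter_upwards [h0] with k hk using hq k hk
  have h1 : u.hom σ' g * Q = Q * u.hom σ g := by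
    rw [← hqm, UP.hom_apply, UP.hom_apply, ← u.mkM_mul, ← u.mkM_mul]
    congr 1
    funext k
    change cj (q k) (σ k g) * q k = _
    unfold cj
    rw [mul_assoc, Units.inv_mul, mul_one]
  unfold cj
  rw [← h1, mul_assoc, Units.mul_inv, mul_one]

/-- charpoly factorization descends to the valuation ring and to the residue field -/
lemma eig_O (u : UP L 𝕃) (v : ℕ → AbsoluteValue L ℝ) (p : Plc u v F) (A : Matrix ι ι (bO u v)) (l : ι → 𝕃)
    (hl : HasEig ((bO u v).subtype.mapMatrix A) l) :
    ∃ l' : ι → bO u v, (∀ j, (l' j : 𝕃) = l j) ∧ HasEig (p.st.mapMatrix A) (fun j => p.st (l' j)) := by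
  have hmem : ∀ j, l j ∈ bO u v := by
    intro j
    have hint : IsIntegral (bO u v) (l j) := by
      refine ⟨A.charpoly, A.charpoly_monic, ?_⟩
      rw [← Polynomial.eval_map]
      have h1 : A.charpoly.map (algebraMap (bO u v) 𝕃) = ∏ j, (Polynomial.X - Polynomial.C (l j)) := by
        rw [← hl, RingHom.mapMatrix_apply, Matrix.charpoly_map]; rfl
      rw [h1, Polynomial.eval_prod]
      exact Finset.prod_eq_zero (Finset.mem_univ j) (by simp)
    obtain ⟨y, hy⟩ := IsIntegrallyClosed.isIntegral_iff.mp hint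
    rw [← hy]; exact y.2
  refine ⟨fun j => ⟨l j, hmem j⟩, fun j => rfl, ?_⟩
  have h2 : A.charpoly = ∏ j, (Polynomial.X - Polynomial.C (⟨l j, hmem j⟩ : bO u v)) := by
    apply Polynomial.map_injective (bO u v).subtype Subtype.val_injective
    rw [← Matrix.charpoly_map]
    refine Eq.trans hl ?_
    simp only [Polynomial.map_prod, Polynomial.map_sub, Polynomial.map_X, Polynomial.map_C]
    rfl
  unfold HasEig
  rw [RingHom.mapMatrix_apply, Matrix.charpoly_map, h2]
  simp [Polynomial.map_prod]

lemma pf_mem {K : Type} [CommRing K] (V : Subring K) (A b : Matrix ι ι K) (c : ℕ → Matrix ι ι K) (l : ι → K) (I : Finset ι)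
    (w : ι × ι → Matrix ι ι K) (M N M3 : ℕ) (hQ : ∀ i, 1 ≤ i → i < N → Qf A b (c i) l I M i ∈ V)
    (hw : ∀ p q, (w p * w q).trace ∈ V) :
    (∏ i : Fin N, ∏ j ∈ Finset.Ioi i, Qf A b (c ((j : ℕ) - i)) l I M ((j : ℕ) - i)) ^ M3 ∈ V ∧ gramD w ∈ V := by
  constructor
  · refine pow_mem (prod_mem fun i _ => prod_mem fun j hj => hQ _ ?_ ?_) _
    · have := Finset.mem_Ioi.mp hj
      have : (i : ℕ) < j := this
      omega
    · have := j.2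
      omega
  · unfold gramD
    rw [Matrix.det_apply]
    refine sum_mem fun π _ => ?_
    rw [Units.smul_def]
    exact zsmul_mem (prod_mem fun p _ => hw _ _) _

set_option maxHeartbeats 1000000 in
theorem core [Nonempty ι] [Countable G] [IsAlgClosed 𝕃] (u : UP L 𝕃) (v : ℕ → AbsoluteValue L ℝ) (p : Plc u v F)
    (X : ℕ → Type) [∀ k, MulAction G (X k)] [∀ k, Nonempty (X k)] (m : InvMean G X)
    (σ : ℕ → G →* Matrix ι ι L) (hst : ∀ k (g : G) (x : X k), g • x = x → ∃ c : L, σ k g = c • 1)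
    (hdet : ∀ k g, (σ k g).det = 1)
    (w : ι × ι → G) (hwK : ∀ q, w q ∈ Kd G (2 ^ Fintype.card ι)) (Sg : Set G)
    (hgen : Submonoid.closure Sg = ⊤) (h1 : ∀ p q, (u.hom σ (w p) * u.hom σ (w q)).trace ∈ bO u v)
    (h2 : ∀ s ∈ Sg, ∀ p q, (u.hom σ s * u.hom σ (w p) * u.hom σ (w q)).trace ∈ bO u v)
    (hDm : gramD (fun p => u.hom σ (w p)) ∈ bO u v) (hD : p.st ⟨_, hDm⟩ ≠ 0) :
    ∃ (Q : (Matrix ι ι 𝕃)ˣ) (s : G →* Matrix ι ι (bO u v)), (∀ g, (bO u v).subtype.mapMatrix (s g) = cj Q (u.hom σ g)) ∧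
      gramD (fun q => p.st.mapMatrix (s (w q))) ≠ 0 ∧
      ∀ g (l : ι → 𝕃), HasEig (u.hom σ g) l → ∃ l' : ι → bO u v, (∀ j, (l' j : 𝕃) = l j) ∧
        HasEig (p.st.mapMatrix (s g)) (fun j => p.st (l' j)) ∧ ∀ j, ‖p.st (l' j)‖ = 1 := by
  have hD0 : gramD (fun p => u.hom σ (w p)) ≠ 0 := by
    intro h
    apply hD
    have : (⟨_, hDm⟩ : bO u v) = 0 := Subtype.ext h
    rw [this, map_zero]
  obtain ⟨Q, hQ⟩ := lattice (bO u v) (u.hom σ) w Sg hgen h1 h2 hD0 (p.inv_mem ⟨_, hDm⟩ hD)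
  obtain ⟨q, σ', hσ', hS'⟩ := conj_lift u σ Q
  let s : G →* Matrix ι ι (bO u v) :=
    { toFun := fun g => Matrix.of fun i j => ⟨_, hQ g i j⟩
      map_one' := by
        apply Matrix.map_injective (f := (bO u v).subtype) Subtype.val_injective
        change cj Q (u.hom σ 1) = (bO u v).subtype.mapMatrix 1
        rw [map_one, map_one, cj_one]
      map_mul' := fun a b => by
        apply Matrix.map_injective (f := (bO u v).subtype) Subtype.val_injective
        change cj Q (u.hom σ (a * b)) = (bO u v).subtype.mapMatrix (_ * _)
        rw [map_mul, map_mul, cj_mul]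
        rfl }
  have hs : ∀ g, (bO u v).subtype.mapMatrix (s g) = cj Q (u.hom σ g) := fun g => rfl
  have hgr : gramD (fun q => p.st.mapMatrix (s (w q))) ≠ 0 := by
    rw [← gramD_map]
    have : gramD (fun q => s (w q)) = ⟨_, hDm⟩ := by
      apply Subtype.ext
      change (bO u v).subtype _ = _
      rw [gramD_map]
      simp only [hs]
      rw [gramD_cj]
    rw [this]; exact hD
  refine ⟨Q, s, hs, hgr, fun g l hl => ?_⟩
  have hl' : HasEig ((bO u v).subtype.mapMatrix (s g)) l := by
    unfold HasEig
    rw [hs, cj_charpoly]; exact hl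
  obtain ⟨l', hl1, hl2⟩ := eig_O u v p (s g) l hl'
  refine ⟨l', hl1, hl2, ?_⟩
  refine lemmaL u v p X m σ' ?_ ?_ s ?_ ?_ g l' hl2
  · intro k g x hx
    obtain ⟨c, hc⟩ := hst k g x hx
    refine ⟨c, ?_⟩
    rw [hσ', hc]
    unfold cj
    simp
  · intro k g
    rw [hσ']
    unfold cj
    rw [det_mul_comm, ← mul_assoc, Units.inv_mul, one_mul, hdet]
  · intro g
    rw [hs, hS']
  · apply irr_of_span
    rw [eq_top_iff, ← gram_span _ hgr]
    apply Submodule.span_mono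
    rintro _ ⟨q, rfl⟩
    exact ⟨w q, hwK q, rfl⟩
end
end WE

namespace WE
open Matrix Filter Topology
section
variable {ι : Type} [Fintype ι] [DecidableEq ι] {G : Type} [Group G]

lemma bdd_of_trace [Nonempty ι] (s : G →* Matrix ι ι ℂ) (w : ι × ι → G) (h : gramD (fun q => s (w q)) ≠ 0) (B : ℝ)
    (hB : ∀ g, ‖(s g).trace‖ ≤ B) : ∃ K : ℝ, ∀ g i j, ‖s g i j‖ ≤ K := by
  set W : ι × ι → Matrix ι ι ℂ := fun q => s (w q) with hW
  have hu : IsUnit (gram W).det := by rw [← gramD_eq]; exact Ne.isUnit h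
  have h1 : ∀ i j g, ‖s g i j‖ ≤ ∑ p, (∑ q, ‖(gram W)⁻¹ p q‖ * B) * ‖W p i j‖ := by
    intro i j g
    have he := gram_expand W h (s g) ((gram W)⁻¹ *ᵥ fun q => (W q * s g).trace) (by
      rw [mulVec_mulVec, Matrix.mul_nonsing_inv _ hu, one_mulVec])
    have he2 := congrFun (congrFun he i) j
    rw [he2, Matrix.sum_apply]
    refine (norm_sum_le _ _).trans (Finset.sum_le_sum fun p _ => ?_)
    rw [Matrix.smul_apply, smul_eq_mul, norm_mul]
    refine mul_le_mul_of_nonneg_right ?_ (norm_nonneg _)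
    refine (norm_sum_le _ _).trans (Finset.sum_le_sum fun q _ => ?_)
    rw [norm_mul]
    refine mul_le_mul_of_nonneg_left ?_ (norm_nonneg _)
    change ‖(s (w q) * s g).trace‖ ≤ B
    rw [← map_mul]; exact hB _
  have hB0 : 0 ≤ B := (norm_nonneg _).trans (hB 1)
  refine ⟨∑ i, ∑ j, ∑ p, (∑ q, ‖(gram W)⁻¹ p q‖ * B) * ‖W p i j‖, fun g i j => (h1 i j g).trans ?_⟩
  have hp : ∀ i j, 0 ≤ ∑ p, (∑ q, ‖(gram W)⁻¹ p q‖ * B) * ‖W p i j‖ := fun i j =>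
    Finset.sum_nonneg fun p _ => mul_nonneg (Finset.sum_nonneg fun q _ => mul_nonneg (norm_nonneg _) hB0) (norm_nonneg _)
  refine (Finset.single_le_sum (f := fun j => ∑ p, (∑ q, ‖(gram W)⁻¹ p q‖ * B) * ‖W p i j‖) (fun j _ => hp i j) (Finset.mem_univ j)).trans ?_
  exact Finset.single_le_sum (f := fun i => ∑ j, ∑ p, (∑ q, ‖(gram W)⁻¹ p q‖ * B) * ‖W p i j‖)
    (fun i _ => Finset.sum_nonneg fun j _ => hp i j) (Finset.mem_univ i)

lemma Plc.norm_ge {L 𝕃 F : Type} [Field L] [Field 𝕃] [NormedField F] {u : UP L 𝕃} {v : ℕ → AbsoluteValue L ℝ} (p : Plc u v F)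
    (x : bO u v) (a : ℝ) (h : ∀ᶠ k in UU, a ≤ v k (u.rep x k)) : a ≤ ‖p.st x‖ :=
  ge_of_tendsto (p.norm_st x) h

theorem MT0 [Countable G] [Group.FG G] {𝕃 : Type} [Field 𝕃] (u : UP LL 𝕃)
    (X : ℕ → Type) [∀ k, MulAction G (X k)] [∀ k, Nonempty (X k)] (m : InvMean G X)
    (σ : ℕ → G →* Matrix ι ι LL) (hst : ∀ k (g : G) (x : X k), g • x = x → ∃ c : LL, σ k g = c • 1)
    (hdet : ∀ k g, (σ k g).det = 1) (hZ : Zc (u.hom σ))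
    (hirr : ∀ H : Subgroup G, H.FiniteIndex → Irr (u.hom σ '' H)) (hc : 2 ≤ Fintype.card ι) : False := by
  haveI : Nonempty ι := Fintype.card_pos_iff.mp (by omega)
  haveI := u.charZero
  haveI := u.isAlgClosed
  obtain ⟨M, N, M3, -, huni⟩ := uni_unitary (Fintype.card ι)
  obtain ⟨Sg, hSg⟩ := (Group.fg_iff_monoid_fg.mp ‹Group.FG G›).fg_top
  have hdetS : ∀ g, (u.hom σ g).det = 1 := by
    intro g
    rw [u.hom_apply, u.mkM_det, ← map_one u.mk]
    congr 1; funext k; exact hdet k g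
  obtain ⟨g0, b, c, l, I, z0, w, T, hl, hI, hIz, hwK, hT, hP, hV⟩ := exists_alg (u.hom σ) hZ hirr hdetS hc M N M3 Sg
  set P := Pf (u.hom σ g0) (u.hom σ b) (fun i => u.hom σ (c i)) l I (fun p => u.hom σ (w p)) M N M3 with hPdef
  have hPV : ∀ V : Subring 𝕃, (∀ t ∈ T, t ∈ V) → P ∈ V := by
    intro V hTV
    obtain ⟨-, h2, h3, -⟩ := hV V hTV
    have := pf_mem V (u.hom σ g0) (u.hom σ b) (fun i => u.hom σ (c i)) l I (fun p => u.hom σ (w p)) M N M3 h2 h3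
    exact mul_mem this.1 this.2
  obtain ⟨v, hTO, hP1, hcase⟩ := places u T P hP hPV
  obtain ⟨-, hO2, hO3, hO4⟩ := hV (bO u v).toSubring hTO
  have hPO : P ∈ bO u v := hPV (bO u v).toSubring hTO
  obtain ⟨hm1, hm2⟩ := pf_mem (bO u v).toSubring (u.hom σ g0) (u.hom σ b) (fun i => u.hom σ (c i)) l I (fun p => u.hom σ (w p)) M N M3 hO2 hO3
  have hD : ∀ {F : Type} [NormedField F] (p : Plc u v F), p.st ⟨_, hm2⟩ ≠ 0 := by
    intro F _ p h0
    have h1 := p.norm_ge ⟨P, hPO⟩ 1 hP1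
    have h2 : (⟨P, hPO⟩ : bO u v) = ⟨_, hm1⟩ * ⟨_, hm2⟩ := Subtype.ext rfl
    rw [h2, map_mul, h0, mul_zero, norm_zero] at h1
    linarith
  have hcore := fun {F : Type} [NormedField F] (p : Plc u v F) =>
    core u v p X m σ hst hdet w hwK Sg hSg hO3 hO4 hm2 (hD p)
  rcases hcase with ⟨cc, hcc, hul, t, htT, a, ha, hta⟩ | ⟨τ, hτ⟩
  · obtain ⟨F, _, ⟨p⟩⟩ := exists_plc u v
    obtain ⟨Q, s, hs, -, heig⟩ := hcore p
    have h1 := p.norm_ge ⟨t, hTO t htT⟩ a hta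
    rcases hT t htT with ⟨j, hj⟩ | ⟨g, hg⟩
    · obtain ⟨l', hl', -, hn⟩ := heig g0 l hl
      have : (⟨t, hTO t htT⟩ : bO u v) = l' j := Subtype.ext (hj.trans (hl' j).symm)
      rw [this, hn] at h1
      linarith
    · obtain ⟨lg, hlg⟩ := exists_hasEig (u.hom σ g)
      obtain ⟨l', hl', -, hn⟩ := heig g lg hlg
      have : (⟨t, hTO t htT⟩ : bO u v) = ∑ j, l' j := by
        apply Subtype.ext
        change t = (bO u v).subtype _
        rw [map_sum, hg, hlg.trace]
        exact Finset.sum_congr rfl fun j _ => (hl' j).symm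
      rw [this] at h1
      have h3 : ∀ S : Finset ι, ‖p.st (∑ j ∈ S, l' j)‖ ≤ 1 := by
        intro S
        induction S using Finset.induction_on with
        | empty => simp
        | insert i S hi ih =>
          rw [Finset.sum_insert hi]
          exact (p.ultra cc hcc hul _ _).trans (max_le (hn i).le ih)
      linarith [h3 Finset.univ]
  · obtain ⟨p⟩ := complex_plc u v τ hτ
    obtain ⟨Q, s, hs, hgr, heig⟩ := hcore p
    let sb : G →* Matrix ι ι ℂ := (p.st.mapMatrix (m := ι)).toMonoidHom.comp s
    have hsb : ∀ g, sb g = p.st.mapMatrix (s g) := fun g => rfl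
    have htr : ∀ g, ‖(sb g).trace‖ ≤ Fintype.card ι := by
      intro g
      obtain ⟨lg, hlg⟩ := exists_hasEig (u.hom σ g)
      obtain ⟨l', hl', he, hn⟩ := heig g lg hlg
      rw [hsb, he.trace]
      refine (norm_sum_le _ _).trans ?_
      simp [hn]
    obtain ⟨K, hK⟩ := bdd_of_trace sb w hgr _ htr
    obtain ⟨U, hU⟩ := unitarize sb K hK
    obtain ⟨l', hl', he, hn⟩ := heig g0 l hl
    have h1 := p.norm_ge ⟨P, hPO⟩ 1 hP1
    have h2 : (⟨P, hPO⟩ : bO u v) = Pf (s g0) (s b) (fun i => s (c i)) l' I (fun p => s (w p)) M N M3 := by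
      apply Subtype.ext
      have h4 := Pf_map (bO u v).subtype (s g0) (s b) (fun i => s (c i)) l' I (fun p => s (w p)) M N M3
      simp only [hs] at h4
      rw [Pf_cj] at h4
      have h5 : (fun j => (bO u v).subtype (l' j)) = l := funext fun j => hl' j
      rw [h5] at h4
      exact h4.symm
    rw [h2, Pf_map, ← Pf_cj U] at h1
    obtain ⟨j0, hj0⟩ := hI
    have h3 := huni ι rfl (cj U (sb g0)) (cj U (sb b)) (fun i => cj U (sb (c i))) (fun j => p.st (l' j)) I
      (fun q => cj U (sb (w q))) (p.st (l' j0)) (hU _) (hU _) (fun i => hU _) (fun q => hU _)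
      (by unfold HasEig; rw [cj_charpoly]; exact he) hn
      (fun j hj => by
        congr 1
        apply Subtype.ext
        rw [hl', hl', hIz j hj, hIz j0 hj0]) ⟨j0, hj0⟩
    exact absurd h1 (not_le.mpr h3)

theorem MT [Countable G] [Group.FG G] {𝕃 : Type} [Field 𝕃] (u : UP LL 𝕃)
    (X : ℕ → Type) [∀ k, MulAction G (X k)] [∀ k, Nonempty (X k)] (m : InvMean G X)
    (σ : ℕ → G →* Matrix ι ι LL) (hst : ∀ k (g : G) (x : X k), g • x = x → ∃ c : LL, σ k g = c • 1)
    (hdet : ∀ k g, (σ k g).det = 1)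
    (hirr : ∀ H : Subgroup G, H.FiniteIndex → Irr (u.hom σ '' H)) (hc : 2 ≤ Fintype.card ι) : False := by
  haveI := u.isAlgClosed
  obtain ⟨H, hH, hZ⟩ := exists_Zc (u.hom σ)
  haveI := hH
  haveI : Group.FG H := Subgroup.fg_of_index_ne_zero H
  refine MT0 (G := H) u X (m.restrict H) (fun k => (σ k).comp H.subtype) (fun k g x hx => hst k g x hx)
    (fun k g => hdet k g) hZ ?_ hc
  intro H' hH'
  have h1 : (H'.map H.subtype).FiniteIndex := by
    constructor
    rw [Subgroup.index_map_subtype]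
    exact mul_ne_zero hH'.index_ne_zero hH.index_ne_zero
  have h2 := hirr _ h1
  convert h2 using 1
  ext A
  constructor
  · rintro ⟨g, hg, rfl⟩
    exact ⟨g, ⟨g, hg, rfl⟩, rfl⟩
  · rintro ⟨_, ⟨g, hg, rfl⟩, rfl⟩
    exact ⟨g, hg, rfl⟩
end
end WE

namespace WE
open Matrix Filter Topology
section
/-- derived series of a subgroup, inside the ambient group -/
def dS {G : Type*} [Group G] (H : Subgroup G) : ℕ → Subgroup G
  | 0 => H
  | n + 1 => ⁅dS H n, dS H n⁆

lemma dS_mono {G : Type*} [Group G] {H K : Subgroup G} (h : H ≤ K) (n : ℕ) : dS H n ≤ dS K n := by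
  induction n with
  | zero => exact h
  | succ n ih => exact Subgroup.commutator_mono ih ih

lemma dS_succ_le {G : Type*} [Group G] (H : Subgroup G) (n : ℕ) : dS H (n + 1) ≤ dS H n := by
  change ⁅dS H n, dS H n⁆ ≤ _
  rw [Subgroup.commutator_le]
  intro a ha b hb
  exact mul_mem (mul_mem (mul_mem ha hb) (inv_mem ha)) (inv_mem hb)

lemma dS_anti {G : Type*} [Group G] (H : Subgroup G) : Antitone (dS H) := antitone_nat_of_succ_le (dS_succ_le H)

lemma dS_map {G G' : Type*} [Group G] [Group G'] (f : G →* G') (H : Subgroup G) (n : ℕ) : (dS H n).map f = dS (H.map f) n := by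
  induction n with
  | zero => rfl
  | succ n ih =>
    change (⁅dS H n, dS H n⁆).map f = ⁅_, _⁆
    rw [Subgroup.map_commutator, ih]

lemma dS_derived {G : Type*} [Group G] (H : Subgroup G) (n : ℕ) : (derivedSeries H n).map H.subtype = dS H n := by
  have h : ∀ n, derivedSeries H n = dS (⊤ : Subgroup H) n := by
    intro n
    induction n with
    | zero => rfl
    | succ n ih => rw [derivedSeries_succ, ih]; rfl
  rw [h, dS_map, ← MonoidHom.range_eq_map, Subgroup.range_subtype]

lemma comm_trivial {G A : Type*} [Group G] [Monoid A] (f : G →* A) (K : Subgroup G)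
    (h : ∀ a ∈ K, ∀ b ∈ K, f a * f b = f b * f a) : ∀ u ∈ ⁅K, K⁆, f u = 1 := by
  intro u hu
  have : ⁅K, K⁆ ≤ f.ker := by
    rw [Subgroup.commutator_le]
    intro a ha b hb
    rw [MonoidHom.mem_ker, commutatorElement_def]
    have h1 : f (a * b) = f (b * a) := by rw [map_mul, map_mul, h a ha b hb]
    rw [mul_assoc, ← _root_.mul_inv_rev, map_mul, h1, ← map_mul, mul_inv_cancel, map_one]
  exact this hu

lemma block_hom {G K m n : Type} [Group G] [Field K] [Fintype m] [DecidableEq m] [Fintype n] [DecidableEq n]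
    (f : G →* Matrix (m ⊕ n) (m ⊕ n) K) (h : ∀ g, (f g).toBlocks₂₁ = 0) :
    ∃ (α : G →* Matrix m m K) (β : G →* Matrix n n K), ∀ g, f g = fromBlocks (α g) (f g).toBlocks₁₂ 0 (β g) := by
  have h0 : ∀ g, f g = fromBlocks (f g).toBlocks₁₁ (f g).toBlocks₁₂ 0 (f g).toBlocks₂₂ := fun g => by
    conv_lhs => rw [← fromBlocks_toBlocks (f g), h g]
  have h1 : ∀ a b, (f (a * b)).toBlocks₁₁ = (f a).toBlocks₁₁ * (f b).toBlocks₁₁ ∧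
      (f (a * b)).toBlocks₂₂ = (f a).toBlocks₂₂ * (f b).toBlocks₂₂ := by
    intro a b
    have := map_mul f a b
    rw [h0 a, h0 b, fromBlocks_multiply] at this
    rw [this]
    simp
  refine ⟨⟨⟨fun g => (f g).toBlocks₁₁, ?_⟩, fun a b => (h1 a b).1⟩, ⟨⟨fun g => (f g).toBlocks₂₂, ?_⟩, fun a b => (h1 a b).2⟩, h0⟩
  · rw [map_one, ← fromBlocks_one, toBlocks_fromBlocks₁₁]
  · rw [map_one, ← fromBlocks_one, toBlocks_fromBlocks₂₂]

lemma exists_flag {ι K : Type} [Fintype ι] [DecidableEq ι] [Field K] (W : Submodule K (ι → K)) (h1 : W ≠ ⊥) (h2 : W ≠ ⊤) :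
    ∃ (r s : ℕ) (_ : 1 ≤ r) (_ : 1 ≤ s) (_ : r + s = Fintype.card ι) (e : ι ≃ Fin r ⊕ Fin s) (Q : (Matrix ι ι K)ˣ),
      ∀ A : Matrix ι ι K, (∀ x ∈ W, A *ᵥ x ∈ W) → ((cj Q A).submatrix e.symm e.symm).toBlocks₂₁ = 0 := by
  obtain ⟨W', hW⟩ := W.exists_isCompl
  let bW := Module.finBasis K W
  let bW' := Module.finBasis K W'
  let eq := Submodule.prodEquivOfIsCompl W W' hW
  let B := (bW.prod bW').map eq
  have hcard : Module.finrank K W + Module.finrank K W' = Fintype.card ι := by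
    rw [Submodule.finrank_add_eq_of_isCompl hW, Module.finrank_fintype_fun_eq_card]
  have hr : 1 ≤ Module.finrank K W := by
    rw [Nat.one_le_iff_ne_zero]
    intro h; exact h1 (Submodule.finrank_eq_zero.mp h)
  have hs : 1 ≤ Module.finrank K W' := by
    rw [Nat.one_le_iff_ne_zero]
    intro h
    have := Submodule.finrank_eq_zero.mp h
    subst this
    exact h2 (by simpa using hW.sup_eq_top)
  let e : ι ≃ Fin (Module.finrank K W) ⊕ Fin (Module.finrank K W') := Fintype.equivOfCardEq (by simp [hcard])
  let B' := B.reindex e.symm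
  let std := Pi.basisFun K ι
  let Q : (Matrix ι ι K)ˣ := ⟨B'.toMatrix std, std.toMatrix B', Module.Basis.toMatrix_mul_toMatrix_flip _ _,
    Module.Basis.toMatrix_mul_toMatrix_flip _ _⟩
  refine ⟨_, _, hr, hs, hcard, e, Q, fun A hA => ?_⟩
  ext i j
  have h3 : cj Q A (e.symm (Sum.inr i)) (e.symm (Sum.inl j)) = B'.repr (A *ᵥ (B' (e.symm (Sum.inl j)))) (e.symm (Sum.inr i)) := by
    have h4 := std.toMatrix_mulVec_repr B' (A *ᵥ (B' (e.symm (Sum.inl j))))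
    rw [← h4]
    change (B'.toMatrix std * A * std.toMatrix B') _ _ = _
    rw [Matrix.mul_assoc]
    rfl
  change cj Q A (e.symm (Sum.inr i)) (e.symm (Sum.inl j)) = 0
  rw [h3]
  have h5 : B' (e.symm (Sum.inl j)) = bW j := by
    simp [B', B, eq]
  rw [h5]
  have h6 := hA _ (bW j).2
  have h7 : B'.repr (A *ᵥ (bW j : ι → K)) (e.symm (Sum.inr i)) = (bW.prod bW').repr (eq.symm (A *ᵥ (bW j : ι → K))) (Sum.inr i) := by
    simp [B', B]
  rw [h7]
  have h8 : eq.symm (A *ᵥ (bW j : ι → K)) = (⟨_, h6⟩, 0) := Submodule.prodEquivOfIsCompl_symm_apply_left _ _ hW ⟨_, h6⟩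
  rw [h8]
  simp
end
end WE

namespace WE
open Matrix Filter Topology
section
lemma strong_irr_false {ι : Type} [Fintype ι] [DecidableEq ι] {G : Type} [Group G] [IsFreeGroup G] [Countable G] [Group.FG G]
    {𝕃 : Type} [Field 𝕃] (u : UP LL 𝕃)
    (X : ℕ → Type) [∀ k, MulAction G (X k)] [∀ k, Nonempty (X k)] (m : InvMean G X)
    (ρ : ℕ → G →* Matrix ι ι LL) (hst : ∀ k (g : G) (x : X k), g • x = x → ρ k g = 1)
    (hirr : ∀ H : Subgroup G, H.FiniteIndex → Irr (u.hom ρ '' H)) (hc : 2 ≤ Fintype.card ι) : False := by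
  let D : ℕ → G →* LLˣ := fun k => ((Matrix.detMonoidHom (n := ι) (R := LL)).comp (ρ k)).toHomUnits
  have hD : ∀ k g, ((D k g : LLˣ) : LL) = (ρ k g).det := fun k g => rfl
  have hroot : ∀ y : LLˣ, ∃ z : LLˣ, z ^ Fintype.card ι = y⁻¹ := by
    intro y
    obtain ⟨z, hz⟩ := IsAlgClosed.exists_pow_nat_eq ((y⁻¹ : LLˣ) : LL) (n := Fintype.card ι) (by omega)
    have hz0 : z ≠ 0 := by
      rintro rfl
      rw [zero_pow (by omega)] at hz
      exact (y⁻¹).ne_zero hz.symm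
    exact ⟨Units.mk0 z hz0, Units.ext (by simpa using hz)⟩
  choose rt hrt using hroot
  let χ : ℕ → G →* LLˣ := fun k => IsFreeGroup.lift fun a => rt (D k (IsFreeGroup.of a))
  have hχ : ∀ k g, (χ k g) ^ Fintype.card ι = (D k g)⁻¹ := by
    intro k
    have : (powMonoidHom (Fintype.card ι)).comp (χ k) = (D k)⁻¹ := by
      apply IsFreeGroup.ext_hom
      intro a
      simp only [MonoidHom.comp_apply, powMonoidHom_apply, χ, MonoidHom.inv_apply]
      rw [IsFreeGroup.lift_of, hrt]
    intro g
    exact DFunLike.congr_fun this g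
  let σ : ℕ → G →* Matrix ι ι LL := fun k =>
    { toFun := fun g => ((χ k g : LLˣ) : LL) • ρ k g
      map_one' := by simp
      map_mul' := fun a b => by simp [smul_smul, mul_comm] }
  refine MT u X m σ ?_ ?_ ?_ hc
  · intro k g x hx
    exact ⟨((χ k g : LLˣ) : LL), by change ((χ k g : LLˣ) : LL) • ρ k g = _; rw [hst k g x hx]⟩
  · intro k g
    change (((χ k g : LLˣ) : LL) • ρ k g).det = 1
    rw [det_smul, ← hD, ← Units.val_pow_eq_pow_val, hχ, ← Units.val_mul, inv_mul_cancel, Units.val_one]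
  · intro H hH W hW
    refine hirr H hH W ?_
    rintro _ ⟨g, hg, rfl⟩ x hx
    have h1 := hW _ ⟨g, hg, rfl⟩ x hx
    have h2 : u.hom ρ g = u.mk (fun k => (((χ k g)⁻¹ : LLˣ) : LL)) • u.hom σ g := by
      ext i j
      rw [Matrix.smul_apply, u.hom_apply, u.hom_apply, u.mkM_apply, u.mkM_apply, smul_eq_mul, ← map_mul]
      congr 1
      funext k
      change _ = ((χ k g)⁻¹ : LLˣ) * (((χ k g : LLˣ) : LL) • ρ k g) i j
      rw [Matrix.smul_apply, smul_eq_mul, ← mul_assoc, Units.inv_mul, one_mul]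
    rw [h2, smul_mulVec]
    exact W.smul_mem _ h1

lemma good_k {G m n K : Type} [Group G] [Group.FG G] [Field K] [Fintype m] [DecidableEq m] [Fintype n] [DecidableEq n]
    (f : ℕ → G →* Matrix (m ⊕ n) (m ⊕ n) K) (h : ∀ g, ∀ᶠ k in UU, (f k g).toBlocks₂₁ = 0) :
    ∀ᶠ k in UU, ∀ g, (f k g).toBlocks₂₁ = 0 := by
  obtain ⟨Sg, hSg⟩ := (Group.fg_iff_monoid_fg.mp ‹Group.FG G›).fg_top
  have h1 : ∀ᶠ k in UU, ∀ g ∈ Sg, (f k g).toBlocks₂₁ = 0 := (eventually_all_finset Sg).mpr fun g _ => h g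
  filter_upwards [h1] with k hk g
  have hg : g ∈ Submonoid.closure (Sg : Set G) := by rw [hSg]; trivial
  induction hg using Submonoid.closure_induction with
  | mem x hx => exact hk x hx
  | one => rw [map_one, ← fromBlocks_one, toBlocks_fromBlocks₂₁]
  | mul a b _ _ ha hb =>
    rw [map_mul, ← fromBlocks_toBlocks (f k a), ← fromBlocks_toBlocks (f k b), fromBlocks_multiply, toBlocks_fromBlocks₂₁, ha, hb]
    simp

theorem claim : ∀ (n : ℕ) (ι : Type) [Fintype ι] [DecidableEq ι], Fintype.card ι = n →
    ∀ (G : Type) [Group G] [IsFreeGroup G] [Countable G] [Group.FG G]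
    (X : ℕ → Type) [∀ k, MulAction G (X k)] [∀ k, Nonempty (X k)] (_ : InvMean G X)
    (ρ : ℕ → G →* Matrix ι ι LL), (∀ k (g : G) (x : X k), g • x = x → ρ k g = 1) →
    ∃ H : Subgroup G, H.FiniteIndex ∧ ∀ᶠ k in UU, ∀ g ∈ dS H n, ρ k g = 1 := by
  intro n
  induction n using Nat.strong_induction_on with
  | _ n ih =>
  intro ι _ _ hn G _ _ _ _ X _ _ m ρ hst
  by_cases hn0 : n = 0
  · haveI : IsEmpty ι := Fintype.card_eq_zero_iff.mp (hn.trans hn0)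
    exact ⟨⊤, inferInstance, Eventually.of_forall fun k g _ => Subsingleton.elim _ _⟩
  by_cases hn1 : n = 1
  · subst hn1
    haveI : Subsingleton ι := Fintype.card_le_one_iff_subsingleton.mp hn.le
    refine ⟨⊤, inferInstance, Eventually.of_forall fun k => comm_trivial (ρ k) ⊤ fun a _ b _ => ?_⟩
    ext i j
    rw [Subsingleton.elim j i, mul_apply, mul_apply]
    refine Finset.sum_congr rfl fun x _ => ?_
    rw [Subsingleton.elim x i, mul_comm]
  obtain ⟨𝕃, _, ⟨u⟩⟩ := exists_UP LL
  by_cases hirr : ∀ H : Subgroup G, H.FiniteIndex → Irr (u.hom ρ '' H)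
  · exact (strong_irr_false u X m ρ hst hirr (by omega)).elim
  push Not at hirr
  obtain ⟨H, hH, hnI⟩ := hirr
  unfold Irr at hnI
  push Not at hnI
  obtain ⟨W, hW, hW1, hW2⟩ := hnI
  obtain ⟨r, s, hr, hs, hrs, e, Q, hQ⟩ := exists_flag W hW1 hW2
  obtain ⟨q, σ', hσ', hS'⟩ := conj_lift u ρ Q
  haveI : Group.FG H := Subgroup.fg_of_index_ne_zero H
  let f : ℕ → H →* Matrix (Fin r ⊕ Fin s) (Fin r ⊕ Fin s) LL := fun k =>
    ((Matrix.reindexAlgEquiv LL LL e : Matrix ι ι LL →* _).comp (σ' k)).comp H.subtype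
  have hf : ∀ k g, f k g = (σ' k g).submatrix e.symm e.symm := fun k g => rfl
  have hgood : ∀ᶠ k in UU, ∀ g, (f k g).toBlocks₂₁ = 0 := by
    refine good_k f fun g => ?_
    have h1 := hQ _ (hW _ ⟨g, g.2, rfl⟩)
    rw [← hS'] at h1
    have h2 : ∀ i j, ∀ᶠ k in UU, (f k g).toBlocks₂₁ i j = 0 := by
      intro i j
      have h3 := congrFun (congrFun h1 i) j
      change u.hom σ' g (e.symm (Sum.inr i)) (e.symm (Sum.inl j)) = 0 at h3
      rw [u.hom_apply, u.mkM_apply, u.zero] at h3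
      exact h3
    have h3 : ∀ᶠ k in UU, ∀ i j, (f k g).toBlocks₂₁ i j = 0 := by
      rw [eventually_all]; intro i; rw [eventually_all]; exact h2 i
    filter_upwards [h3] with k hk
    ext i j; exact hk i j
  have hab : ∀ k, ∃ (α : H →* Matrix (Fin r) (Fin r) LL) (β : H →* Matrix (Fin s) (Fin s) LL),
      ((∀ g, (f k g).toBlocks₂₁ = 0) → ∀ g, f k g = fromBlocks (α g) (f k g).toBlocks₁₂ 0 (β g)) ∧
      ∀ g, f k g = 1 → α g = 1 ∧ β g = 1 := by
    intro k
    by_cases hk : ∀ g, (f k g).toBlocks₂₁ = 0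
    · obtain ⟨α, β, h⟩ := block_hom (f k) hk
      refine ⟨α, β, fun _ => h, fun g hg => ?_⟩
      have := h g
      rw [hg, ← fromBlocks_one, fromBlocks_inj] at this
      exact ⟨this.1.symm, this.2.2.2.symm⟩
    · exact ⟨1, 1, fun h => (hk h).elim, fun g _ => ⟨rfl, rfl⟩⟩
  choose α β hab1 hab2 using hab
  have hstf : ∀ k (g : H) (x : X k), g • x = x → f k g = 1 := by
    intro k g x hx
    rw [hf, hσ', hst k g x hx, cj_one, submatrix_one_equiv]
  obtain ⟨H1, hH1, h1⟩ := ih r (by omega) (Fin r) (by simp) H X (m.restrict H) α fun k g x hx => (hab2 k g (hstf k g x hx)).1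
  obtain ⟨H2, hH2, h2⟩ := ih s (by omega) (Fin s) (by simp) H X (m.restrict H) β fun k g x hx => (hab2 k g (hstf k g x hx)).2
  refine ⟨(H1 ⊓ H2).map H.subtype, ?_, ?_⟩
  · constructor
    rw [Subgroup.index_map_subtype]
    haveI := hH1
    haveI := hH2
    exact mul_ne_zero (inferInstance : (H1 ⊓ H2).FiniteIndex).index_ne_zero hH.index_ne_zero
  · filter_upwards [hgood, h1, h2] with k hk h1k h2k
    rw [← dS_map]
    rintro _ ⟨g, hg, rfl⟩
    have hle : max r s + 1 ≤ n := by
      rcases le_total r s with h | h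
      · rw [max_eq_right h]; omega
      · rw [max_eq_left h]; omega
    have hg' : g ∈ ⁅dS (H1 ⊓ H2) (max r s), dS (H1 ⊓ H2) (max r s)⁆ := dS_anti _ hle hg
    have hf1 : ∀ a ∈ dS (H1 ⊓ H2) (max r s), f k a = fromBlocks 1 (f k a).toBlocks₁₂ 0 1 := by
      intro a ha
      rw [← h1k a (dS_mono inf_le_left _ (dS_anti _ (le_max_left r s) ha)),
        ← h2k a (dS_mono inf_le_right _ (dS_anti _ (le_max_right r s) ha))]
      exact hab1 k hk a
    have hfg : f k g = 1 := by
      refine comm_trivial (f k) _ (fun a ha b hb => ?_) g hg'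
      rw [hf1 a ha, hf1 b hb, fromBlocks_multiply, fromBlocks_multiply]
      simp [add_comm]
    have h3 : σ' k g = 1 := by
      have := congrArg (fun A => A.submatrix e e) (hfg.symm.trans (hf k g))
      simpa using this.symm
    rw [hσ'] at h3
    change ρ k g = 1
    unfold cj at h3
    have h4 : (q k : Matrix ι ι LL) * ρ k g = q k := by
      have := congrArg (fun A => A * (q k : Matrix ι ι LL)) h3
      simpa [Matrix.mul_assoc] using this
    have h5 := congrArg (fun A => (((q k)⁻¹ : (Matrix ι ι LL)ˣ) : Matrix ι ι LL) * A) h4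
    simpa [← Matrix.mul_assoc] using h5
end
end WE

namespace WE
open Matrix Filter Topology
section
lemma wl_b_pow (n : ℕ) : wl ((FreeGroup.of (1 : Fin 2)) ^ n) = n := by
  unfold wl; rw [FreeGroup.toWord_of_pow]; simp

lemma wl_a_b_pow (n : ℕ) : wl (FreeGroup.of (0 : Fin 2) * (FreeGroup.of (1 : Fin 2)) ^ n) = n + 1 := by
  change (lt (0, true) * _).toWord.length = _
  rw [toWord_lt_mul, FreeGroup.toWord_of_pow]
  cases n with
  | zero => simp
  | succ n => simp [List.replicate_succ]

/-- if all words of some positive length are trivial, the image is commutative -/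
lemma comm_of_sphere {A : Type*} [Monoid A] (f : F2 →* A) (n : ℕ) (hn : 1 ≤ n) (h : ∀ w, wl w = n → f w = 1) (x y : F2) :
    f x * f y = f y * f x := by
  obtain ⟨n, rfl⟩ : ∃ m, n = m + 1 := ⟨n - 1, by omega⟩
  let F := f.toHomUnits
  have hF : ∀ w, wl w = n + 1 → F w = 1 := fun w hw => Units.ext (h w hw)
  have h1 := hF _ (wl_b_pow (n + 1))
  have h2 := hF _ (wl_a_b_pow n)
  have h3 : F (FreeGroup.of 0) = F (FreeGroup.of 1) := by
    rw [pow_succ', map_mul] at h1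
    rw [map_mul] at h2
    exact mul_right_cancel (h2.trans h1.symm)
  let ψ : F2 →* Multiplicative ℤ := FreeGroup.lift fun _ => Multiplicative.ofAdd 1
  have h4 : F = (zpowersHom _ (F (FreeGroup.of 0))).comp ψ := by
    ext i
    fin_cases i
    · simp [ψ]
    · simp [ψ, h3]
  have h5 : F x * F y = F y * F x := by
    rw [← map_mul, ← map_mul, h4]
    simp only [MonoidHom.comp_apply, map_mul]
    rw [← map_mul, mul_comm, map_mul]
  exact congrArg Units.val h5

lemma Gap.mono {X : Type*} [MulAction F2 X] {κ κ' : ℝ} (h : Gap X κ) (hk : κ' ≤ κ) : Gap X κ' :=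
  fun f h1 h2 h3 => hk.trans (h f h1 h2 h3)

theorem goalA (d : ℕ) : ∃ (M : ℕ) (τ : ℝ), 0 < τ ∧ ∀ ρ : F2 →* Matrix (Fin d) (Fin d) LL,
    (∃ g ∈ dS (Kd F2 M) d, ρ g ≠ 1) → ∀ n : ℕ, 1 ≤ n →
    ({w : F2 | wl w = n ∧ ρ w = 1}.ncard : ℝ) ≤ Real.exp (-τ * n) * {w : F2 | wl w = n}.ncard := by
  by_contra hcon
  push Not at hcon
  have hc : ∀ k : ℕ, ∃ ρ : F2 →* Matrix (Fin d) (Fin d) LL, (∃ g ∈ dS (Kd F2 k) d, ρ g ≠ 1) ∧ ∃ n : ℕ, 1 ≤ n ∧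
    Real.exp (-(1 / ((k:ℝ) + 1)) * n) * {w : F2 | wl w = n}.ncard < ({w : F2 | wl w = n ∧ ρ w = 1}.ncard : ℝ) :=
    fun k => hcon k (1 / ((k:ℝ) + 1)) (by positivity)
  choose ρ hg n hn hlt using hc
  choose g hgd hg1 using hg
  let X : ℕ → Type := fun k => F2 ⧸ (ρ k).ker
  have hX : ∀ k w, w • ((1 : F2) : F2 ⧸ (ρ k).ker) = ((1 : F2) : F2 ⧸ (ρ k).ker) ↔ ρ k w = 1 := by
    intro k w
    rw [MulAction.Quotient.smul_coe, smul_eq_mul, mul_one, eq_comm, QuotientGroup.eq, _root_.inv_one, one_mul, MonoidHom.mem_ker]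
  have hd : d ≠ 0 := by
    rintro rfl
    exact hg1 0 (Subsingleton.elim _ _)
  have hgap : ∀ κ : ℝ, 0 < κ → ∀ᶠ k in UU, ¬ Gap (X k) κ := by
    intro κ0 hκ0
    rw [Ultrafilter.eventually_not]
    intro hG0
    have hκ : 0 < min κ0 1 := lt_min hκ0 one_pos
    have hG : ∀ᶠ k in UU, Gap (X k) (min κ0 1) := hG0.mono fun k hk => hk.mono (min_le_left _ _)
    obtain ⟨C, τ, hC, hτ, hco⟩ := cogrowth _ hκ (min_le_right _ _)
    have hlim : Tendsto (fun k : ℕ => 1 / ((k:ℝ) + 1)) UU (𝓝 0) :=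
      tendsto_one_div_add_atTop_nhds_zero_nat.mono_left Nat.hyperfilter_le_atTop
    have hpos : ∀ n, (0:ℝ) < {w : F2 | wl w = n}.ncard := fun n => by
      have := sphere_ge n
      have h3 : 0 < 3 ^ n := by positivity
      exact_mod_cast lt_of_lt_of_le h3 this
    set B : ℕ := ⌈C * (2 / τ)⌉₊ with hB
    have hnB : ∀ᶠ k in UU, n k ≤ B := by
      filter_upwards [hG, hlim.eventually (gt_mem_nhds (show (0:ℝ) < τ / 2 by linarith))] with k hk hk2
      have h1 := hco (X k) ((1 : F2) : F2 ⧸ (ρ k).ker) hk (n k)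
      simp only [hX] at h1
      have h2 := (hlt k).trans_le h1
      have h3 := lt_of_mul_lt_mul_right h2 (hpos _).le
      have h4 : Real.exp (-(τ / 2) * n k) < C * Real.exp (-τ * n k) :=
        lt_of_le_of_lt (Real.exp_le_exp.mpr (by
          have : (0:ℝ) ≤ n k := Nat.cast_nonneg _
          nlinarith)) h3
      have h5 : Real.exp (τ / 2 * n k) < C := by
        have h6 := mul_lt_mul_of_pos_right h4 (Real.exp_pos (τ * n k))
        rw [mul_assoc, ← Real.exp_add, ← Real.exp_add] at h6
        have e1 : -(τ / 2) * (n k : ℝ) + τ * n k = τ / 2 * n k := by ring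
        have e2 : -τ * (n k : ℝ) + τ * n k = 0 := by ring
        rwa [e1, e2, Real.exp_zero, mul_one] at h6
      have h6 := Real.add_one_le_exp (τ / 2 * n k)
      have h7 : (n k : ℝ) ≤ C * (2 / τ) := by
        rw [mul_div_assoc', le_div_iff₀ hτ]
        nlinarith
      exact Nat.cast_le.mp (h7.trans (Nat.le_ceil _))
    set R : ℝ := ∑ i ∈ Finset.range (B + 1), ({w : F2 | wl w = i}.ncard : ℝ) with hR
    have hlim2 : Tendsto (fun k : ℕ => (1 - Real.exp (-(1 / ((k:ℝ) + 1)) * B)) * R) UU (𝓝 0) := by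
      have h1 := ((Real.continuous_exp.tendsto _).comp (hlim.neg.mul_const (B:ℝ)))
      have h2 := (h1.const_sub 1).mul_const R
      simpa using h2
    obtain ⟨k, hk1, hk2⟩ := (hnB.and (hlim2.eventually (gt_mem_nhds (show (0:ℝ) < 1 by norm_num)))).exists
    have hall : ∀ w, wl w = n k → ρ k w = 1 := by
      by_contra hne
      push Not at hne
      obtain ⟨w0, hw0, hw1⟩ := hne
      have hss : {w : F2 | wl w = n k ∧ ρ k w = 1} ⊂ {w : F2 | wl w = n k} := by
        refine ⟨fun w hw => hw.1, fun h => hw1 (h hw0).2⟩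
      have h1 := Set.ncard_lt_ncard hss (wl_finite _)
      have h2 : ({w : F2 | wl w = n k ∧ ρ k w = 1}.ncard : ℝ) + 1 ≤ {w : F2 | wl w = n k}.ncard := by exact_mod_cast h1
      have h3 := hlt k
      have h4 : ({w : F2 | wl w = n k}.ncard : ℝ) ≤ R := by
        rw [hR]
        exact Finset.single_le_sum (f := fun i => ({w : F2 | wl w = i}.ncard : ℝ)) (fun i _ => Nat.cast_nonneg _)
          (Finset.mem_range.mpr (by omega))
      have h5 : Real.exp (-(1 / ((k:ℝ) + 1)) * B) ≤ Real.exp (-(1 / ((k:ℝ) + 1)) * n k) := by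
        apply Real.exp_le_exp.mpr
        have h6 : (n k : ℝ) ≤ B := by exact_mod_cast hk1
        have h7 : 0 < 1 / ((k:ℝ) + 1) := by positivity
        nlinarith
      have h8 : Real.exp (-(1 / ((k:ℝ) + 1)) * B) ≤ 1 := by
        apply Real.exp_le_one_iff.mpr
        have h7 : 0 < 1 / ((k:ℝ) + 1) := by positivity
        have : (0:ℝ) ≤ B := Nat.cast_nonneg _
        nlinarith
      have h9 := hpos (n k)
      nlinarith [mul_le_mul_of_nonneg_right h5 h9.le, mul_le_mul_of_nonneg_left h4 (sub_nonneg.mpr h8)]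
    apply hg1 k
    have h1 : g k ∈ dS (Kd F2 k) 1 := dS_anti _ (Nat.one_le_iff_ne_zero.mpr hd) (hgd k)
    exact comm_trivial (ρ k) _ (fun a _ b _ => comm_of_sphere (ρ k) (n k) (hn k) hall a b) _ h1
  obtain ⟨m⟩ := exists_invMean X hgap
  haveI : ∀ k, Nonempty (X k) := fun k => ⟨((1 : F2) : F2 ⧸ (ρ k).ker)⟩
  obtain ⟨H, hH, hev⟩ := claim d (Fin d) (by simp) F2 X m ρ (by
    intro k w x hx
    obtain ⟨y, rfl⟩ := QuotientGroup.mk_surjective x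
    rw [MulAction.Quotient.smul_coe, smul_eq_mul, eq_comm, QuotientGroup.eq, ← mul_assoc, MonoidHom.mem_ker] at hx
    have h1 : y⁻¹ * w * y ∈ (ρ k).ker := hx
    have h2 := (inferInstance : (ρ k).ker.Normal).conj_mem _ h1 y
    have h3 : y * (y⁻¹ * w * y) * y⁻¹ = w := by group
    rwa [h3] at h2)
  have hbig : ∀ᶠ k in UU, H.index ≤ k := (eventually_ge_atTop H.index).filter_mono Nat.hyperfilter_le_atTop
  obtain ⟨k, hk1, hk2⟩ := (hev.and hbig).exists
  exact hg1 k (hk1 _ (dS_mono (Kd_le H hH.index_ne_zero hk2) _ (hgd k)))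
end
end WE

namespace WE
open MvPolynomial
section

theorem approxNull' (K : Type*) [Field K] [IsAlgClosed K] [CharZero K] (V : Type) [Fintype V] :
    ∃ c : ℕ, ∀ D : ℕ, 2 ≤ D → ∀ x : V → ℂ, (∀ i, ‖x i‖ ≤ D) →
      ∀ S : Set (MvPolynomial V ℤ),
      (∀ f ∈ S, f.totalDegree ≤ D ∧ l1 f ≤ Real.exp D ∧ ‖aeval x f‖ ≤ Real.exp (-(D:ℝ) ^ c)) →
      ∃ y : V → K, ∀ f ∈ S, aeval y f = 0 := by
  obtain ⟨c, hc⟩ := approxNull K (Fintype.card V)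
  refine ⟨c, fun D hD x hx S hS => ?_⟩
  let e := Fintype.equivFin V
  obtain ⟨y, hy⟩ := hc D hD (x ∘ e.symm) (fun i => hx _) (rename e '' S) (by
    rintro _ ⟨f, hf, rfl⟩
    obtain ⟨h1, h2, h3⟩ := hS f hf
    refine ⟨(totalDegree_rename_le _ _).trans h1, le_trans ?_ h2, ?_⟩
    · have := l1_aeval_le f (fun v => (X (e v) : MvPolynomial (Fin (Fintype.card V)) ℤ)) 1 le_rfl (fun i => (l1_X _).le) _ le_rfl
      rw [one_pow, mul_one] at this
      have he : rename e f = aeval (fun v => (X (e v) : MvPolynomial (Fin (Fintype.card V)) ℤ)) f := by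
        have h5 : (rename e : MvPolynomial V ℤ →ₐ[ℤ] MvPolynomial (Fin (Fintype.card V)) ℤ) = aeval (fun v => X (e v)) := by
          apply MvPolynomial.algHom_ext
          intro i; simp
        rw [h5]
      rw [he]
      exact this
    · rw [aeval_rename]
      have : (x ∘ e.symm) ∘ e = x := by funext i; simp
      rw [this]; exact h3)
  refine ⟨y ∘ e, fun f hf => ?_⟩
  have := hy _ ⟨f, hf, rfl⟩
  rwa [aeval_rename] at this

variable (d : ℕ)
/-- variables -/
abbrev VV := Option ((Fin 2 × Bool) × Fin d × Fin d)

/-- generic letters -/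
noncomputable def gm (p : Fin 2 × Bool) : Matrix (Fin d) (Fin d) (MvPolynomial (VV d) ℤ) := Matrix.of fun i j => X (some (p, i, j))

/-- generic words -/
noncomputable def wm (L : List (Fin 2 × Bool)) : Matrix (Fin d) (Fin d) (MvPolynomial (VV d) ℤ) := (L.map (gm d)).prod

lemma wm_bound (hd : 1 ≤ d) (L : List (Fin 2 × Bool)) : ∀ i j, (wm d L i j).totalDegree ≤ L.length ∧ l1 (wm d L i j) ≤ (d:ℝ) ^ L.length := by
  induction L with
  | nil =>
    intro i j
    unfold wm
    simp only [List.map_nil, List.prod_nil, List.length_nil, pow_zero, Nat.le_zero]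
    rw [Matrix.one_apply]
    split_ifs
    · exact ⟨totalDegree_one, l1_one.le⟩
    · exact ⟨totalDegree_zero, by rw [l1_zero]; norm_num⟩
  | cons p L ih =>
    intro i j
    have h : wm d (p :: L) i j = ∑ k, X (some (p, i, k)) * wm d L k j := by
      unfold wm
      rw [List.map_cons, List.prod_cons, Matrix.mul_apply]; rfl
    rw [h]
    constructor
    · refine totalDegree_finsetSum_le fun k _ => (totalDegree_mul _ _).trans ?_
      rw [totalDegree_X, List.length_cons]
      have := (ih k j).1
      omega
    · refine (l1_sum _ _).trans ?_
      refine (Finset.sum_le_sum fun k _ => (l1_mul _ _).trans (mul_le_mul_of_nonneg_left (ih k j).2 (l1_nonneg _))).trans ?_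
      simp only [l1_X, one_mul, Finset.sum_const, Finset.card_univ, Fintype.card_fin, nsmul_eq_mul, List.length_cons]
      rw [pow_succ']

lemma wm_sub_bound (hd : 1 ≤ d) (L : List (Fin 2 × Bool)) (hL : 1 ≤ L.length) (i j) :
    ((wm d L - 1) i j).totalDegree ≤ L.length ∧ l1 ((wm d L - 1) i j) ≤ Real.exp (d * L.length) := by
  have h1 : ∀ i j, ((1 : Matrix (Fin d) (Fin d) (MvPolynomial (VV d) ℤ)) i j).totalDegree ≤ 0 ∧
      l1 ((1 : Matrix (Fin d) (Fin d) (MvPolynomial (VV d) ℤ)) i j) ≤ 1 := by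
    intro i j
    rw [Matrix.one_apply]
    split_ifs
    · exact ⟨totalDegree_one.le, l1_one.le⟩
    · exact ⟨totalDegree_zero.le, by rw [l1_zero]; norm_num⟩
  obtain ⟨h2, h3⟩ := wm_bound d hd L i j
  rw [Matrix.sub_apply]
  constructor
  · exact (totalDegree_sub _ _).trans (max_le h2 ((h1 i j).1.trans (by omega)))
  · refine (l1_sub _ _).trans ((add_le_add h3 (h1 i j).2).trans ?_)
    have h4 : (d:ℝ) ^ L.length + 1 ≤ ((d:ℝ) + 1) ^ L.length := by
      have := pow_add_pow_le (x := (d:ℝ)) (y := 1) (n := L.length) (Nat.cast_nonneg _) zero_le_one (by omega)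
      rwa [one_pow] at this
    have h5 : ((d:ℝ) + 1) ^ L.length ≤ Real.exp d ^ L.length := pow_le_pow_left₀ (by positivity) (Real.add_one_le_exp _) _
    rw [← Real.exp_nat_mul] at h5
    rw [mul_comm]
    linarith

variable {d}
/-- letters at a point -/
def lm {K : Type*} (y : VV d → K) (p : Fin 2 × Bool) : Matrix (Fin d) (Fin d) K := Matrix.of fun i j => y (some (p, i, j))

lemma wm_aeval {K : Type*} [CommRing K] (y : VV d → K) (L : List (Fin 2 × Bool)) :
    (aeval y : MvPolynomial (VV d) ℤ →ₐ[ℤ] K).toRingHom.mapMatrix (wm d L) = (L.map (lm y)).prod := by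
  unfold wm
  rw [map_list_prod, List.map_map]
  congr 2
  funext p
  ext i j
  simp [gm, lm]

/-- the representation at a point satisfying the relations -/
lemma exists_rep {K : Type*} [CommRing K] (A : Fin 2 × Bool → Matrix (Fin d) (Fin d) K) (h : ∀ p : Fin 2 × Bool, A p * A (p.1, !p.2) = 1) :
    ∃ ρ : F2 →* Matrix (Fin d) (Fin d) K, ∀ w : F2, ρ w = (w.toWord.map A).prod := by
  let f : Fin 2 → (Matrix (Fin d) (Fin d) K)ˣ := fun i => ⟨A (i, true), A (i, false), h (i, true), h (i, false)⟩
  refine ⟨(Units.coeHom _).comp (FreeGroup.lift f), fun w => ?_⟩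
  conv_lhs => rw [← FreeGroup.mk_toWord (x := w)]
  rw [MonoidHom.comp_apply, FreeGroup.lift_mk, map_list_prod, List.map_map]
  congr 2
  funext p
  rcases p with ⟨i, _ | _⟩ <;> rfl

lemma entry_le (M : Matrix (Fin d) (Fin d) ℂ) (i j) : ‖M i j‖ ≤ ‖LinearMap.toContinuousLinearMap (Matrix.toEuclideanLin M)‖ := by
  have h1 := (LinearMap.toContinuousLinearMap (Matrix.toEuclideanLin M)).le_opNorm (EuclideanSpace.single j 1)
  rw [EuclideanSpace.norm_single, norm_one, mul_one] at h1
  refine le_trans ?_ h1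
  refine le_trans ?_ (PiLp.norm_apply_le _ i)
  simp

lemma nonVS {A : Type*} [Group A] (a b : A) (φ : F2 →* A) (h0 : φ (FreeGroup.of 0) = a) (h1 : φ (FreeGroup.of 1) = b)
    (h : ¬(∃ H : Subgroup ↥(Subgroup.closure {a, b}), H.FiniteIndex ∧ IsSolvable ↥H)) (M n : ℕ) :
    ∃ g ∈ dS (Kd F2 M) n, φ g ≠ 1 := by
  by_contra hcon
  push Not at hcon
  apply h
  have hr : ∀ w, φ w ∈ Subgroup.closure {a, b} := by
    intro w
    induction w using FreeGroup.induction_on with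
    | C1 => rw [map_one]; exact one_mem _
    | of i =>
      fin_cases i
      · exact Subgroup.subset_closure (by simp [h0])
      · exact Subgroup.subset_closure (by simp [h1])
    | inv_of i hi => rw [map_inv]; exact inv_mem hi
    | mul x y hx hy => rw [map_mul]; exact mul_mem hx hy
  let φ' := φ.codRestrict _ hr
  have hsurj : Function.Surjective φ' := by
    rintro ⟨y, hy⟩
    have : Subgroup.closure {a, b} ≤ φ.range := by
      rw [Subgroup.closure_le]
      rintro z (rfl | rfl)
      · exact ⟨_, h0⟩
      · exact ⟨_, h1⟩
    obtain ⟨w, hw⟩ := this hy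
    exact ⟨w, Subtype.ext hw⟩
  haveI := Kd_finiteIndex F2 M
  refine ⟨(Kd F2 M).map φ', ⟨?_⟩, ⟨n, ?_⟩⟩
  · intro h2
    have := Subgroup.index_map_dvd (Kd F2 M) hsurj
    rw [h2, zero_dvd_iff] at this
    exact Subgroup.FiniteIndex.index_ne_zero this
  · have h2 := dS_derived ((Kd F2 M).map φ') n
    rw [← dS_map] at h2
    have h3 : (dS (Kd F2 M) n).map φ' = ⊥ := by
      rw [eq_bot_iff]
      rintro _ ⟨g, hg, rfl⟩
      exact Subtype.ext (hcon g hg)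
    rw [h3] at h2
    exact (Subgroup.map_eq_bot_iff_of_injective _ Subtype.val_injective).mp h2
end
end WE

namespace WE
open MvPolynomial Filter
section
variable {d : ℕ}

lemma hom_word {A : Type*} [Monoid A] (Φ : F2 →* A) (w : F2) : (w.toWord.map fun p => Φ (lt p)).prod = Φ w := by
  have h : ∀ L : List (Fin 2 × Bool), (L.map fun p => Φ (lt p)).prod = Φ (FreeGroup.mk L) := by
    intro L
    induction L with
    | nil => exact (map_one Φ).symm
    | cons p L ih =>
      rw [List.map_cons, List.prod_cons, ih, ← map_mul]
      congr 1
  rw [h, FreeGroup.mk_toWord]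

lemma wm_sub_aeval {K : Type*} [CommRing K] (y : VV d → K) (L : List (Fin 2 × Bool)) (i j : Fin d) :
    aeval y ((wm d L - 1) i j) = ((L.map (lm y)).prod - 1 : Matrix (Fin d) (Fin d) K) i j := by
  rw [← wm_aeval y L, ← map_one ((aeval y : MvPolynomial (VV d) ℤ →ₐ[ℤ] K).toRingHom.mapMatrix), ← map_sub]
  rfl

lemma q0_aeval {K : Type*} [Field K] (y : VV d → K) (L : List (Fin 2 × Bool)) (i j : Fin d)
    (h : aeval y (X none * (wm d L - 1) i j - 1 : MvPolynomial (VV d) ℤ) = 0) : (L.map (lm y)).prod ≠ 1 := by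
  intro h1
  rw [map_sub, map_mul, map_one, wm_sub_aeval, h1, sub_self, Matrix.zero_apply, mul_zero, zero_sub] at h
  simp at h

theorem final (d : ℕ) (hd : 1 ≤ d) : ∃ τ ε₁ C : ℝ, 0 < τ ∧ 0 < ε₁ ∧ 0 < C ∧
      ∀ a b : GL (Fin d) ℂ,
        ¬(∃ H : Subgroup ↥(Subgroup.closure {a, b}), H.FiniteIndex ∧ IsSolvable ↥H) →
        ∃ δ₀ : ℝ, 0 < δ₀ ∧ ∀ δ : ℝ, 0 < δ → δ < δ₀ →
          ∀ n : ℕ, 1 ≤ n → (n : ℝ) ≤ C * Real.log δ⁻¹ ^ ε₁ →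
            (({w : FreeGroup (Fin 2) | (FreeGroup.toWord w).length = n ∧
                matrixOpNorm
                  (((FreeGroup.lift (fun i : Fin 2 => if i = 0 then a else b) w :
                      GL (Fin d) ℂ) : Matrix (Fin d) (Fin d) ℂ) -
                    (1 : Matrix (Fin d) (Fin d) ℂ)) ≤ δ}).ncard : ℝ) ≤
              Real.exp (-τ * n) *
                (({w : FreeGroup (Fin 2) | (FreeGroup.toWord w).length = n}).ncard : ℝ) := by
  obtain ⟨M, τ, hτ, hA⟩ := goalA d
  obtain ⟨c, hc⟩ := approxNull' LL (VV d)
  have hd0 : (0:ℝ) < d := by exact_mod_cast hd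
  refine ⟨τ, 1 / ((c:ℝ) + 1), 1 / d, hτ, by positivity, by positivity, fun a b hab => ?_⟩
  set φ : F2 →* GL (Fin d) ℂ := FreeGroup.lift (fun i : Fin 2 => if i = 0 then a else b) with hφ
  obtain ⟨g, hg, hg1⟩ := nonVS a b φ (by simp [hφ]) (by simp [hφ]) hab M d
  have hij : ∃ i j, ((φ g : Matrix (Fin d) (Fin d) ℂ) - 1) i j ≠ 0 := by
    by_contra hcon
    push Not at hcon
    apply hg1
    apply Units.ext
    rw [← sub_eq_zero]
    ext i j; exact hcon i j
  obtain ⟨i0, j0, hij⟩ := hij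
  let Φ : F2 →* Matrix (Fin d) (Fin d) ℂ := (Units.coeHom _).comp φ
  have hΦ : ∀ w, Φ w = (φ w : Matrix (Fin d) (Fin d) ℂ) := fun w => rfl
  let x : VV d → ℂ := fun o => o.elim (((φ g : Matrix (Fin d) (Fin d) ℂ) - 1) i0 j0)⁻¹ fun q => Φ (lt q.1) q.2.1 q.2.2
  have hlm : lm x = fun p => Φ (lt p) := by
    funext p; ext i j; rfl
  have hxw : ∀ w : F2, (w.toWord.map (lm x)).prod = Φ w := fun w => by rw [hlm]; exact hom_word Φ w
  let S1 : Set (MvPolynomial (VV d) ℤ) := Set.range fun q : (Fin 2 × Bool) × Fin d × Fin d =>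
    (wm d [q.1, (q.1.1, !q.1.2)] - 1) q.2.1 q.2.2
  let q0 : MvPolynomial (VV d) ℤ := X none * (wm d g.toWord - 1) i0 j0 - 1
  have hS1fin : (S1 ∪ {q0}).Finite := (Set.finite_range _).union (Set.finite_singleton _)
  have hev : ∀ᶠ D : ℕ in atTop, (∀ f ∈ S1 ∪ {q0}, f.totalDegree ≤ D ∧ l1 f ≤ Real.exp D) ∧ (∀ i, ‖x i‖ ≤ D) := by
    have hr : ∀ r : ℝ, ∀ᶠ D : ℕ in atTop, r ≤ D := fun r => tendsto_natCast_atTop_atTop.eventually (eventually_ge_atTop r)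
    refine Eventually.and ?_ ?_
    · rw [eventually_all_finite hS1fin]
      intro f _
      refine (eventually_ge_atTop _).and ?_
      filter_upwards [hr (l1 f)] with D hD
      linarith [Real.add_one_le_exp (D:ℝ)]
    · rw [eventually_all]
      exact fun i => hr _
  obtain ⟨D0, hD0⟩ := eventually_atTop.mp hev
  set D1 := max D0 2 with hD1
  refine ⟨Real.exp (-(D1:ℝ) ^ c), Real.exp_pos _, fun δ hδ hδ0 n hn hnC => ?_⟩
  set D := max D1 (d * n) with hD
  have hDD : D0 ≤ D := (le_max_left _ _).trans (le_max_left _ _)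
  have hD2 : 2 ≤ D := (le_max_right _ _).trans (le_max_left _ _)
  set Λ := Real.log δ⁻¹ with hΛ
  have hδΛ : δ = Real.exp (-Λ) := by
    rw [hΛ, Real.log_inv, neg_neg, Real.exp_log hδ]
  have hΛ1 : (D1:ℝ) ^ c < Λ := by
    rw [hδΛ, Real.exp_lt_exp] at hδ0
    linarith
  have hΛ0 : 0 < Λ := lt_of_le_of_lt (by positivity) hΛ1
  have hΛ2 : ((d * n : ℕ) : ℝ) ^ c ≤ Λ := by
    have h1 : ((d * n : ℕ) : ℝ) ≤ Λ ^ (1 / ((c:ℝ) + 1)) := by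
      push_cast
      have := mul_le_mul_of_nonneg_left hnC hd0.le
      rwa [← mul_assoc, mul_one_div_cancel hd0.ne', one_mul] at this
    have h2 : (1:ℝ) ≤ ((d * n : ℕ) : ℝ) := by
      exact_mod_cast Nat.mul_pos hd hn
    calc ((d * n : ℕ) : ℝ) ^ c ≤ ((d * n : ℕ) : ℝ) ^ (c + 1) := pow_le_pow_right₀ h2 (by omega)
      _ ≤ (Λ ^ (1 / ((c:ℝ) + 1))) ^ (c + 1) := pow_le_pow_left₀ (by linarith) h1 _
      _ = Λ := by
        rw [← Real.rpow_natCast, ← Real.rpow_mul hΛ0.le]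
        push_cast
        rw [one_div_mul_cancel (by positivity), Real.rpow_one]
  have hDc : (D:ℝ) ^ c ≤ Λ := by
    rcases max_choice D1 (d * n) with h | h
    · rw [hD, h]; exact hΛ1.le
    · rw [hD, h]; exact hΛ2
  have hδD : δ ≤ Real.exp (-(D:ℝ) ^ c) := by
    rw [hδΛ]; exact Real.exp_le_exp.mpr (by linarith)
  set Wd : Set F2 := {w : FreeGroup (Fin 2) | (FreeGroup.toWord w).length = n ∧
    matrixOpNorm ((φ w : Matrix (Fin d) (Fin d) ℂ) - 1) ≤ δ} with hWd
  let S2 : Set (MvPolynomial (VV d) ℤ) := {f | ∃ w ∈ Wd, ∃ i j, f = (wm d w.toWord - 1) i j}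
  obtain ⟨y, hy⟩ := hc D hD2 x (hD0 D hDD).2 ((S1 ∪ {q0}) ∪ S2) (by
    rintro f (hf | ⟨w, hw, i, j, rfl⟩)
    · obtain ⟨h1, h2⟩ := (hD0 D hDD).1 f hf
      refine ⟨h1, h2, ?_⟩
      have h0 : aeval x f = 0 := by
        rcases hf with ⟨⟨p, i, j⟩, rfl⟩ | hf
        · beta_reduce
          rw [wm_sub_aeval, hlm]
          simp only [List.map_cons, List.map_nil, List.prod_cons, List.prod_nil, mul_one]
          rw [lt_inv, ← map_mul, mul_inv_cancel, map_one, sub_self]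
          rfl
        · rw [Set.mem_singleton_iff] at hf
          rw [hf]
          simp only [q0, map_sub, map_mul, map_one, aeval_X]
          have h5 := wm_sub_aeval x g.toWord i0 j0
          rw [hxw] at h5
          simp only [Matrix.sub_apply, map_sub] at h5 ⊢
          rw [h5]
          change (((φ g : Matrix (Fin d) (Fin d) ℂ) - 1) i0 j0)⁻¹ * ((φ g : Matrix (Fin d) (Fin d) ℂ) - 1) i0 j0 - 1 = 0
          rw [inv_mul_cancel₀ hij, sub_self]
      rw [h0, norm_zero]
      positivity
    · have hl : w.toWord.length = n := hw.1
      obtain ⟨h1, h2⟩ := wm_sub_bound d hd w.toWord (by omega) i j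
      have hdn : d * n ≤ D := le_max_right _ _
      refine ⟨h1.trans ?_, h2.trans ?_, ?_⟩
      · rw [hl]; exact (Nat.le_mul_of_pos_left n hd).trans hdn
      · rw [hl]; exact Real.exp_le_exp.mpr (by exact_mod_cast hdn)
      · rw [wm_sub_aeval, hxw]
        exact ((entry_le _ i j).trans hw.2).trans hδD)
  have hrel : ∀ p : Fin 2 × Bool, lm y p * lm y (p.1, !p.2) = 1 := by
    intro p
    rw [← sub_eq_zero]
    ext i j
    have h1 := hy _ (Or.inl (Or.inl ⟨(p, i, j), rfl⟩))
    beta_reduce at h1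
    rw [wm_sub_aeval] at h1
    simpa using h1
  obtain ⟨ρ, hρ⟩ := exists_rep (lm y) hrel
  have hρg : ρ g ≠ 1 := by
    intro h1
    exact q0_aeval y g.toWord i0 j0 (hy q0 (Or.inl (Or.inr rfl))) ((hρ g).symm.trans h1)
  have hfin := hA ρ ⟨g, hg, hρg⟩ n hn
  refine le_trans ?_ hfin
  have hsub : Wd ⊆ {w : F2 | wl w = n ∧ ρ w = 1} := by
    intro w hw
    refine ⟨hw.1, ?_⟩
    rw [← sub_eq_zero]
    ext i j
    have h1 := hy _ (Or.inr ⟨w, hw, i, j, rfl⟩)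
    rw [wm_sub_aeval, ← hρ] at h1
    exact h1
  exact_mod_cast Set.ncard_le_ncard hsub ((wl_finite n).subset fun w hw => hw.1)
end
end WE

/-- **Weak equidistribution.** Given `d ≥ 1`, there are `τ, ε₁, C > 0` such that for every pair
`a, b ∈ GL_d(ℂ)` generating a non virtually solvable subgroup, there is `δ₀(a,b) > 0` such that
for every `δ ∈ (0, δ₀)` and every `n` with `1 ≤ n ≤ C·(log δ⁻¹)^{ε₁}`, the proportion of words
`w ∈ F₂` of length `n` with `‖w(a,b) − 1‖ ≤ δ` is at most `exp(−τn)`. -/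
theorem weak_equidistribution :
    ∀ d : ℕ, 1 ≤ d → ∃ τ ε₁ C : ℝ, 0 < τ ∧ 0 < ε₁ ∧ 0 < C ∧
      ∀ a b : GL (Fin d) ℂ,
        ¬(∃ H : Subgroup ↥(Subgroup.closure {a, b}), H.FiniteIndex ∧ IsSolvable ↥H) →
        ∃ δ₀ : ℝ, 0 < δ₀ ∧ ∀ δ : ℝ, 0 < δ → δ < δ₀ →
          ∀ n : ℕ, 1 ≤ n → (n : ℝ) ≤ C * Real.log δ⁻¹ ^ ε₁ →
            (({w : FreeGroup (Fin 2) | (FreeGroup.toWord w).length = n ∧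
                matrixOpNorm
                  (((FreeGroup.lift (fun i : Fin 2 => if i = 0 then a else b) w :
                      GL (Fin d) ℂ) : Matrix (Fin d) (Fin d) ℂ) -
                    (1 : Matrix (Fin d) (Fin d) ℂ)) ≤ δ}).ncard : ℝ) ≤
              Real.exp (-τ * n) *
                (({w : FreeGroup (Fin 2) | (FreeGroup.toWord w).length = n}).ncard : ℝ) := by
  intro d hd
  exact WE.final d hd
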